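/- Existence of a maximal Nash value: assume in addition that either (a) b and σ do not depend on the measure argument, or (c) O is an open interval, σ does not depend on the control argument a, and there exists c_σ > 0 with σ(t,x,m) ≥ c_σ for all (t,x,m). Let N⋆ denote the set of LP MFG Nash equilibria. Then there exists (μ⋆, m⋆) ∈ N⋆ such that Γ[μ,m](μ,m) ≤ Γ[μ⋆,m⋆](μ⋆,m⋆) for all (μ,m) ∈ N⋆. -/

import Mathlib

open MeasureTheory Filter Set Topology

noncomputable section

/-- Membership in `C_b^{1,2}([0,T] × closure O)`: `u` together with its partial
derivatives `ut = ∂_t u`, `ux = ∂_x u`, `uxx = ∂_xx u`, all continuous and bounded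
on `[0,T] × closure O`. -/
structure IsCb12 (T : ℝ) (O : Set ℝ) (u ut ux uxx : ℝ → ℝ → ℝ) : Prop where
  cont : ContinuousOn (fun p : ℝ × ℝ => u p.1 p.2) (Set.Icc 0 T ×ˢ closure O)
  cont_t : ContinuousOn (fun p : ℝ × ℝ => ut p.1 p.2) (Set.Icc 0 T ×ˢ closure O)
  cont_x : ContinuousOn (fun p : ℝ × ℝ => ux p.1 p.2) (Set.Icc 0 T ×ˢ closure O)
  cont_xx : ContinuousOn (fun p : ℝ × ℝ => uxx p.1 p.2) (Set.Icc 0 T ×ˢ closure O)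
  deriv_t : ∀ t ∈ Set.Icc (0:ℝ) T, ∀ x ∈ closure O,
    HasDerivWithinAt (fun s => u s x) (ut t x) (Set.Icc 0 T) t
  deriv_x : ∀ t ∈ Set.Icc (0:ℝ) T, ∀ x ∈ closure O,
    HasDerivWithinAt (fun y => u t y) (ux t x) (closure O) x
  deriv_xx : ∀ t ∈ Set.Icc (0:ℝ) T, ∀ x ∈ closure O,
    HasDerivWithinAt (fun y => ux t y) (uxx t x) (closure O) x
  bdd : ∃ C : ℝ, ∀ t ∈ Set.Icc (0:ℝ) T, ∀ x ∈ closure O,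
    |u t x| ≤ C ∧ |ut t x| ≤ C ∧ |ux t x| ≤ C ∧ |uxx t x| ≤ C

/-- Membership in `V`: a flow of finite positive Borel measures on
`closure O × A`, measurable in `t`, with integrable total mass on `[0,T]`. -/
def MemV (T : ℝ) (O A : Set ℝ) (m : ℝ → Measure (ℝ × ℝ)) : Prop :=
  (∀ t, m t Set.univ < ⊤) ∧
  (∀ t, m t ((closure O ×ˢ A)ᶜ) = 0) ∧
  (∀ B : Set (ℝ × ℝ), MeasurableSet B → Measurable fun t => m t B) ∧
  IntegrableOn (fun t => (m t Set.univ).toReal) (Set.Icc 0 T)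

/-- Weak convergence of (finite) measures on `[0,T] × closure O` (tested against
bounded continuous functions). -/
def WeakConv (μn : ℕ → Measure (ℝ × ℝ)) (μ : Measure (ℝ × ℝ)) : Prop :=
  ∀ h : ℝ × ℝ → ℝ, Continuous h → (∃ C : ℝ, ∀ p, |h p| ≤ C) →
    Tendsto (fun n => ∫ p, h p ∂(μn n)) atTop (nhds (∫ p, h p ∂μ))

/-- Convergence `mⁿ → m` in `V`: weak convergence of the associated finite
measures `m_tⁿ(dx,da)dt` on `[0,T] × closure O × A`. -/
def ConvV (T : ℝ) (mn : ℕ → ℝ → Measure (ℝ × ℝ)) (m : ℝ → Measure (ℝ × ℝ)) : Prop :=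
  ∀ h : ℝ → ℝ × ℝ → ℝ, Continuous (fun q : ℝ × ℝ × ℝ => h q.1 q.2) →
    (∃ C : ℝ, ∀ t p, |h t p| ≤ C) →
    Tendsto (fun n => ∫ t in Set.Icc 0 T, (∫ p, h t p ∂(mn n t))) atTop
      (nhds (∫ t in Set.Icc 0 T, (∫ p, h t p ∂(m t))))

/-- Mean-field structural assumptions on a coefficient
`c(t,x,m,a) = c̄(t, x, ∫ ĉ(t,y) m(dy,du), a)`: Lipschitz in `x` uniformly in the
other variables; `c̄` bounded, measurable and continuous in the variables other than
`t` for each fixed `t`; `ĉ` continuous and bounded on `[0,T] × closure O`. -/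
def MFCoeff (T : ℝ) (O A : Set ℝ) (d : ℕ)
    (c : ℝ → ℝ → Measure (ℝ × ℝ) → ℝ → ℝ)
    (cbar : ℝ → ℝ → (Fin d → ℝ) → ℝ → ℝ)
    (chat : ℝ → ℝ → Fin d → ℝ) : Prop :=
  (∃ K : ℝ, ∀ t (ν : Measure (ℝ × ℝ)) a x y, |c t x ν a - c t y ν a| ≤ K * |x - y|) ∧
  (∀ t x (ν : Measure (ℝ × ℝ)) a, c t x ν a = cbar t x (fun i => ∫ p, chat t p.1 i ∂ν) a) ∧
  (∃ C : ℝ, ∀ t x z a, |cbar t x z a| ≤ C) ∧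
  Measurable (fun q : ℝ × ℝ × (Fin d → ℝ) × ℝ => cbar q.1 q.2.1 q.2.2.1 q.2.2.2) ∧
  (∀ t, ContinuousOn (fun q : ℝ × (Fin d → ℝ) × ℝ => cbar t q.1 q.2.1 q.2.2)
      (Set.univ ×ˢ Set.univ ×ˢ A)) ∧
  ContinuousOn (fun p : ℝ × ℝ => chat p.1 p.2) (Set.Icc 0 T ×ˢ closure O) ∧
  (∃ C : ℝ, ∀ t x, ‖chat t x‖ ≤ C)

/-- Mean-field structural assumptions on the running reward
`f(t,x,m,a) = f̄(t, x, ∫ f̂(t,y) m(dy,du), a)` with `f̄` bounded, measurable,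
continuous in the variables other than `t` for each fixed `t`, and `f̂` continuous
and bounded. -/
def MFRunning (T : ℝ) (O A : Set ℝ) (d : ℕ)
    (f : ℝ → ℝ → Measure (ℝ × ℝ) → ℝ → ℝ)
    (fbar : ℝ → ℝ → (Fin d → ℝ) → ℝ → ℝ)
    (fhat : ℝ → ℝ → Fin d → ℝ) : Prop :=
  (∀ t x (ν : Measure (ℝ × ℝ)) a, f t x ν a = fbar t x (fun i => ∫ p, fhat t p.1 i ∂ν) a) ∧
  (∃ C : ℝ, ∀ t x z a, |fbar t x z a| ≤ C) ∧
  Measurable (fun q : ℝ × ℝ × (Fin d → ℝ) × ℝ => fbar q.1 q.2.1 q.2.2.1 q.2.2.2) ∧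
  (∀ t, ContinuousOn (fun q : ℝ × (Fin d → ℝ) × ℝ => fbar t q.1 q.2.1 q.2.2)
      (closure O ×ˢ Set.univ ×ˢ A)) ∧
  ContinuousOn (fun p : ℝ × ℝ => fhat p.1 p.2) (Set.Icc 0 T ×ˢ closure O) ∧
  (∃ C : ℝ, ∀ t x, ‖fhat t x‖ ≤ C)

/-- Mean-field structural assumptions on the terminal reward
`g(t,x,μ) = ḡ(t, x, ∫ ĝ(s,y) μ(ds,dy))` with `ḡ` and `ĝ` continuous and bounded. -/
def MFTerminal (T : ℝ) (O : Set ℝ) (d : ℕ)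
    (g : ℝ → ℝ → Measure (ℝ × ℝ) → ℝ)
    (gbar : ℝ → ℝ → (Fin d → ℝ) → ℝ)
    (ghat : ℝ → ℝ → Fin d → ℝ) : Prop :=
  (∀ t x (ν : Measure (ℝ × ℝ)), g t x ν = gbar t x (fun i => ∫ p, ghat p.1 p.2 i ∂ν)) ∧
  ContinuousOn (fun q : ℝ × ℝ × (Fin d → ℝ) => gbar q.1 q.2.1 q.2.2)
    (Set.Icc 0 T ×ˢ closure O ×ˢ Set.univ) ∧
  (∃ C : ℝ, ∀ t x z, |gbar t x z| ≤ C) ∧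
  ContinuousOn (fun p : ℝ × ℝ => ghat p.1 p.2) (Set.Icc 0 T ×ˢ closure O) ∧
  (∃ C : ℝ, ∀ t x, ‖ghat t x‖ ≤ C)

/-- Standing assumption on the initial measure in the mean-field setting: a
probability measure on `O` with `∫ |x|² dm₀* < ∞`. -/
def InitAssumption2 (O : Set ℝ) (m0 : Measure ℝ) : Prop :=
  IsProbabilityMeasure m0 ∧ m0 Oᶜ = 0 ∧ Integrable (fun x => x ^ 2) m0

/-- Membership in `R[m̄]`: the Fokker–Planck constraint with coefficients frozen
along the flow `m̄`. -/
def MemRm (T : ℝ) (O A : Set ℝ)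
    (b σ : ℝ → ℝ → Measure (ℝ × ℝ) → ℝ → ℝ) (m0 : Measure ℝ)
    (mbar : ℝ → Measure (ℝ × ℝ))
    (μ : Measure (ℝ × ℝ)) (m : ℝ → Measure (ℝ × ℝ)) : Prop :=
  IsProbabilityMeasure μ ∧ μ ((Set.Icc 0 T ×ˢ closure O)ᶜ) = 0 ∧ MemV T O A m ∧
  ∀ u ut ux uxx : ℝ → ℝ → ℝ, IsCb12 T O u ut ux uxx →
    ∫ p, u p.1 p.2 ∂μ
      = (∫ x, u 0 x ∂m0)
        + ∫ t in Set.Icc 0 T,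
            (∫ p, (ut t p.1 + (b t p.1 (mbar t) p.2 * ux t p.1
                + σ t p.1 (mbar t) p.2 ^ 2 / 2 * uxx t p.1)) ∂(m t))

/-- Membership in `R₀`: for every test function `u ∈ C_b^{1,2}` and every constant
`C` dominating `|L u|` uniformly over `[0,T] × closure O × M(Ō×A) × A`, the relaxed
Fokker–Planck inequality holds. -/
def MemR0 (T : ℝ) (O A : Set ℝ)
    (b σ : ℝ → ℝ → Measure (ℝ × ℝ) → ℝ → ℝ) (m0 : Measure ℝ)
    (μ : Measure (ℝ × ℝ)) (m : ℝ → Measure (ℝ × ℝ)) : Prop :=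
  IsProbabilityMeasure μ ∧ μ ((Set.Icc 0 T ×ˢ closure O)ᶜ) = 0 ∧ MemV T O A m ∧
  ∀ u ut ux uxx : ℝ → ℝ → ℝ, IsCb12 T O u ut ux uxx →
    ∀ C : ℝ,
      (∀ t ∈ Set.Icc (0:ℝ) T, ∀ x ∈ closure O, ∀ ν : Measure (ℝ × ℝ),
          ν Set.univ < ⊤ → ν ((closure O ×ˢ A)ᶜ) = 0 → ∀ a ∈ A,
          |b t x ν a * ux t x + σ t x ν a ^ 2 / 2 * uxx t x| ≤ C) →
      ∫ p, u p.1 p.2 ∂μ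
        ≤ (∫ x, u 0 x ∂m0)
          + (∫ t in Set.Icc 0 T, (∫ p, ut t p.1 ∂(m t)))
          + C * ∫ t in Set.Icc 0 T, ((m t) Set.univ).toReal

/-- The mean-field reward functional
`Γ[μ̄,m̄](μ,m) = ∫₀^T ∫ f(t,x,m̄_t,a) m_t(dx,da) dt + ∫ g(t,x,μ̄) μ(dt,dx)`. -/
def GammaMF (T : ℝ)
    (f : ℝ → ℝ → Measure (ℝ × ℝ) → ℝ → ℝ) (g : ℝ → ℝ → Measure (ℝ × ℝ) → ℝ)
    (μbar : Measure (ℝ × ℝ)) (mbar : ℝ → Measure (ℝ × ℝ))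
    (μ : Measure (ℝ × ℝ)) (m : ℝ → Measure (ℝ × ℝ)) : ℝ :=
  (∫ t in Set.Icc 0 T, ∫ p, f t p.1 (mbar t) p.2 ∂(m t)) + ∫ p, g p.1 p.2 μbar ∂μ

/-- `(μ⋆, m⋆)` is an LP MFG Nash equilibrium: `(μ⋆, m⋆) ∈ R[m⋆]` and it maximizes
`Γ[μ⋆, m⋆]` over `R[m⋆]`. -/
def IsLPNash (T : ℝ) (O A : Set ℝ)
    (b σ f : ℝ → ℝ → Measure (ℝ × ℝ) → ℝ → ℝ) (g : ℝ → ℝ → Measure (ℝ × ℝ) → ℝ)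
    (m0 : Measure ℝ)
    (μs : Measure (ℝ × ℝ)) (ms : ℝ → Measure (ℝ × ℝ)) : Prop :=
  MemRm T O A b σ m0 ms μs ms ∧
  ∀ (μ : Measure (ℝ × ℝ)) (m : ℝ → Measure (ℝ × ℝ)), MemRm T O A b σ m0 ms μ m →
    GammaMF T f g μs ms μ m ≤ GammaMF T f g μs ms μs ms

/-- The additional assumption (5)(a) or (5)(c): either `b` and `σ` do not depend on
the measure argument, or `O` is an open interval, `σ` does not depend on the control
argument and is uniformly bounded below by a positive constant. -/
def MeasIndepOrInterval (O : Set ℝ)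
    (b σ : ℝ → ℝ → Measure (ℝ × ℝ) → ℝ → ℝ) : Prop :=
  (∀ t x (ν ν' : Measure (ℝ × ℝ)) a, b t x ν a = b t x ν' a ∧ σ t x ν a = σ t x ν' a) ∨
  ((∃ c1 c2 : ℝ, c1 < c2 ∧ O = Set.Ioo c1 c2) ∧
   (∀ t x (ν : Measure (ℝ × ℝ)) a a', σ t x ν a = σ t x ν a') ∧
   (∃ cσ : ℝ, 0 < cσ ∧ ∀ t x (ν : Measure (ℝ × ℝ)) a, cσ ≤ σ t x ν a))

noncomputable section
namespace LPN
section Brouwer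
open scoped NNReal
variable {E : Type*} [NormedAddCommGroup E] [InnerProductSpace ℝ E] [FiniteDimensional ℝ E]

lemma det_poly (A : E →L[ℝ] E) : ∃ p : Polynomial ℝ,
    p.degree < (Finset.range (Module.finrank ℝ E + 1)).card ∧
    ∀ s : ℝ, p.eval s = (1 + s • A).det := by
  classical
  let b := Module.finBasis ℝ E
  let M := LinearMap.toMatrix b b (A : E →ₗ[ℝ] E)
  refine ⟨Matrix.det ((Polynomial.X : Polynomial ℝ) • M.map Polynomial.C
      + (1 : Matrix _ _ ℝ).map Polynomial.C), ?_, ?_⟩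
  · have := Polynomial.natDegree_det_X_add_C_le M (1 : Matrix _ _ ℝ)
    simp only [Fintype.card_fin] at this
    refine lt_of_le_of_lt Polynomial.degree_le_natDegree ?_
    simp only [Finset.card_range]
    exact_mod_cast Nat.lt_succ_of_le this
  · intro s
    rw [← Polynomial.coe_evalRingHom, RingHom.map_det]
    have : (1 + s • A).det = LinearMap.det ((1 + s • A : E →L[ℝ] E) : E →ₗ[ℝ] E) := rfl
    rw [this, ← LinearMap.det_toMatrix b]
    congr 1
    ext i j
    simp [M, Matrix.add_apply, LinearMap.toMatrix_apply,
      Matrix.one_apply, add_comm, Finsupp.single_apply, eq_comm]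
    split_ifs <;> simp [mul_comm]

lemma det_pos_of_small (A : E →L[ℝ] E) (s : ℝ) (hs : 0 ≤ s) (h : s * ‖A‖ < 1) :
    0 < (1 + s • A).det := by
  have hne : ∀ r ∈ Icc (0:ℝ) s, (1 + r • A).det ≠ 0 := by
    intro r hr hdet
    have hu : ¬ IsUnit ((1 + r • A).det) := by rw [hdet]; simp
    have h1 : ‖-(r • A)‖ < 1 := by
      rw [norm_neg, norm_smul, Real.norm_eq_abs, abs_of_nonneg hr.1]
      exact lt_of_le_of_lt (mul_le_mul_of_nonneg_right hr.2 (norm_nonneg _)) h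
    have h2 : IsUnit (1 - (-(r • A))) := isUnit_one_sub_of_norm_lt_one h1
    rw [sub_neg_eq_add] at h2
    apply hu
    have h3 := h2.map (ContinuousLinearMap.toLinearMapRingHom : (E →L[ℝ] E) →+* _)
    exact (LinearMap.isUnit_iff_isUnit_det _).1 h3
  have hc : ContinuousOn (fun r : ℝ => (1 + r • A).det) (Icc 0 s) := by
    apply Continuous.continuousOn
    apply ContinuousLinearMap.continuous_det.comp
    fun_prop
  by_contra hcon
  push Not at hcon
  have h0 : (1 + (0:ℝ) • A).det = 1 := by simp [ContinuousLinearMap.det]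
  have := intermediate_value_Icc' hs hc
  have h2 : (0:ℝ) ∈ Icc ((1 + s • A).det) ((1 + (0:ℝ) • A).det) := ⟨hcon, by rw [h0]; norm_num⟩
  obtain ⟨r, hr, hr0⟩ := this h2
  exact hne r hr hr0

lemma lagrange_det (v : ℕ → ℝ) (hv : Function.Injective v) : ∃ w : ℕ → ℝ,
    ∀ (A : E →L[ℝ] E), (1 + A).det =
      ∑ j ∈ Finset.range (Module.finrank ℝ E + 1), w j * (1 + v j • A).det := by
  refine ⟨fun j => (Lagrange.basis (Finset.range (Module.finrank ℝ E + 1)) v j).eval 1, ?_⟩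
  intro A
  obtain ⟨p, hp, hpe⟩ := det_poly A
  have h := Lagrange.eq_interpolate (s := Finset.range (Module.finrank ℝ E + 1)) (v := v)
    hv.injOn hp
  have h1 := hpe 1
  rw [one_smul] at h1
  rw [← h1]
  conv_lhs => rw [h]
  rw [Lagrange.interpolate_apply, Polynomial.eval_finsetSum]
  refine Finset.sum_congr rfl fun j hj => ?_
  simp [hpe, mul_comm]

variable [MeasurableSpace E] [BorelSpace E]

lemma no_retract (h : E → E) (K : ℝ≥0) (hK : LipschitzWith K h)
    (h0 : ∀ x, 1 ≤ ‖x‖ → h x = 0) (h' : E → E →L[ℝ] E)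
    (hd : ∀ x, ‖x‖ < 1 → HasFDerivAt h (h' x) x)
    (hr : ∀ x, ‖x‖ < 1 → ‖x + h x‖ = 1) : False := by
  set B : Set E := Metric.ball 0 1 with hB
  have hBm : MeasurableSet B := measurableSet_ball
  -- the small parameters
  have key : ∀ s : ℝ, 0 ≤ s → s * K < 1 →
      IntegrableOn (fun x => (1 + s • h' x).det) B ∧
      ∫ x in B, (1 + s • h' x).det = volume.real B := by
    intro s hs hsK
    set φ : E → E := fun x => x + s • h x with hφ
    have happ : ApproximatesLinearOn φ ((ContinuousLinearEquiv.refl ℝ E : E ≃L[ℝ] E) : E →L[ℝ] E)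
        univ (Real.toNNReal s * K) := by
      rw [ApproximatesLinearOn.approximatesLinearOn_iff_lipschitzOnWith, lipschitzOnWith_univ]
      have : (φ - ⇑((ContinuousLinearEquiv.refl ℝ E : E ≃L[ℝ] E) : E →L[ℝ] E)) = fun x => s • h x := by
        ext x; simp [hφ]
      rw [this]
      refine LipschitzWith.of_dist_le_mul fun x y => ?_
      rw [dist_smul₀, Real.norm_eq_abs, abs_of_nonneg hs]
      push_cast
      rw [Real.coe_toNNReal s hs, mul_assoc]
      exact mul_le_mul_of_nonneg_left (hK.dist_le_mul x y) hs
    have hc : Subsingleton E ∨ Real.toNNReal s * K <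
        ‖((ContinuousLinearEquiv.refl ℝ E).symm : E →L[ℝ] E)‖₊⁻¹ := by
      rcases subsingleton_or_nontrivial E with hE | hE
      · exact Or.inl hE
      · right
        have : ‖((ContinuousLinearEquiv.refl ℝ E).symm : E →L[ℝ] E)‖₊ = 1 := by
          have : ((ContinuousLinearEquiv.refl ℝ E).symm : E →L[ℝ] E) = ContinuousLinearMap.id ℝ E := rfl
          rw [this]; ext; simp
        rw [this, inv_one]
        have : ((Real.toNNReal s * K : ℝ≥0) : ℝ) < 1 := by
          push_cast; rw [Real.coe_toNNReal s hs]; exact hsK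
        exact_mod_cast this
    have hinj : Function.Injective φ := injOn_univ.1 (happ.injOn hc)
    have hsurj : Function.Surjective φ := happ.surjective hc
    have hout : ∀ x, 1 ≤ ‖x‖ → φ x = x := by intro x hx; simp [hφ, h0 x hx]
    have himg : φ '' B = B := by
      ext y
      constructor
      · rintro ⟨x, hx, rfl⟩
        by_contra hy
        have hy1 : 1 ≤ ‖φ x‖ := by simpa [hB] using hy
        have := hinj (hout _ hy1)
        rw [this] at hy1
        simp [hB] at hx
        linarith
      · intro hy
        obtain ⟨x, rfl⟩ := hsurj y
        refine ⟨x, ?_, rfl⟩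
        by_contra hx
        have hx1 : 1 ≤ ‖x‖ := by simpa [hB] using hx
        rw [hout x hx1] at hy
        exact hx hy
    have hder : ∀ x ∈ B, HasFDerivWithinAt φ (1 + s • h' x) B x := by
      intro x hx
      have hx1 : ‖x‖ < 1 := by simpa [hB] using hx
      exact ((hasFDerivAt_id x).add ((hd x hx1).const_smul s)).hasFDerivWithinAt
    have hnorm : ∀ x ∈ B, ‖h' x‖ ≤ K := by
      intro x hx
      exact (hd x (by simpa [hB] using hx)).le_of_lipschitz hK
    have hpos : ∀ x ∈ B, |(1 + s • h' x).det| = (1 + s • h' x).det := by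
      intro x hx
      apply abs_of_pos
      apply det_pos_of_small _ _ hs
      exact lt_of_le_of_lt (mul_le_mul_of_nonneg_left (hnorm x hx) hs) hsK
    have hI := integrableOn_image_iff_integrableOn_abs_det_fderiv_smul volume hBm hder
      hinj.injOn (fun _ => (1:ℝ))
    have hJ := integral_image_eq_integral_abs_det_fderiv_smul volume hBm hder
      hinj.injOn (fun _ => (1:ℝ))
    rw [himg] at hI hJ
    simp only [smul_eq_mul, mul_one] at hI hJ
    have hB1 : IntegrableOn (fun _ : E => (1:ℝ)) B := by
      exact integrableOn_const measure_ball_lt_top.ne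
    constructor
    · exact (hI.1 hB1).congr_fun hpos hBm
    · rw [← setIntegral_congr_fun hBm hpos, ← hJ]
      simp
  -- nodes
  let v : ℕ → ℝ := fun j => 1 / ((K:ℝ) + 1) * (1 / ((j:ℝ) + 1))
  have hK1 : (0:ℝ) < K + 1 := by positivity
  have hv : Function.Injective v := by
    intro i j hij
    simp only [v] at hij
    have h2 := mul_left_cancel₀ (by positivity) hij
    have h3 : ((i:ℝ) + 1) = j + 1 := by
      rw [one_div, one_div] at h2; exact inv_injective h2
    exact_mod_cast add_right_cancel h3
  have hv1 : ∀ j, 0 ≤ v j ∧ v j * K < 1 := by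
    intro j
    refine ⟨by positivity, ?_⟩
    have : v j ≤ 1 / ((K:ℝ) + 1) := by
      apply mul_le_of_le_one_right (by positivity)
      rw [div_le_one (by positivity)]
      linarith [(Nat.cast_nonneg j : (0:ℝ) ≤ j)]
    calc v j * K ≤ 1 / ((K:ℝ) + 1) * K := by gcongr
      _ < 1 := by rw [one_div, inv_mul_lt_iff₀ hK1]; linarith
  obtain ⟨w, hw⟩ := lagrange_det (E := E) v hv
  have hzero : ∀ x ∈ B, (1 + h' x).det = 0 := by
    intro x hx
    have hx1 : ‖x‖ < 1 := by simpa [hB] using hx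
    set r : E := x + h x
    have hrn : r ≠ 0 := by
      intro h; have := hr x hx1; simp only [r] at h; rw [h] at this; simp at this
    have hF : HasFDerivAt (fun y => y + h y) (1 + h' x) x := (hasFDerivAt_id x).add (hd x hx1)
    have hN := hF.norm_sq
    have hcst : (fun y => ‖y + h y‖ ^ 2) =ᶠ[𝓝 x] fun _ => (1:ℝ) := by
      have : B ∈ 𝓝 x := Metric.isOpen_ball.mem_nhds hx
      filter_upwards [this] with y hy
      rw [hr y (by simpa [hB] using hy)]; norm_num
    have h1 := (hN.congr_of_eventuallyEq hcst.symm).unique (hasFDerivAt_const (1:ℝ) x)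
    by_contra hne
    have hu : IsUnit (LinearMap.det ((1 + h' x : E →L[ℝ] E) : E →ₗ[ℝ] E)) := isUnit_iff_ne_zero.2 hne
    have hsur := ((Module.End.isUnit_iff _).1 ((LinearMap.isUnit_iff_isUnit_det _).2 hu)).2
    obtain ⟨y, hy⟩ := hsur r
    have h2 := congrArg (fun L => L y) h1
    have hy' : y + h' x y = r := by simpa using hy
    have h3 : (2:ℕ) • inner ℝ r (y + h' x y) = (0:ℝ) := h2
    rw [hy'] at h3
    simp only [nsmul_eq_mul, Nat.cast_ofNat, mul_eq_zero, OfNat.ofNat_ne_zero, false_or] at h3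
    exact hrn (inner_self_eq_zero.1 h3)
  have hsum : ∫ x in B, (1 + h' x).det = volume.real B *
      ∑ j ∈ Finset.range (Module.finrank ℝ E + 1), w j := by
    have : ∀ x, (1 + h' x).det = ∑ j ∈ Finset.range (Module.finrank ℝ E + 1), w j * (1 + v j • h' x).det :=
      fun x => hw (h' x)
    simp_rw [this]
    rw [integral_finsetSum]
    · rw [Finset.mul_sum]
      refine Finset.sum_congr rfl fun j _ => ?_
      rw [integral_const_mul, (key _ (hv1 j).1 (hv1 j).2).2, mul_comm]
    · intro j _
      exact (key _ (hv1 j).1 (hv1 j).2).1.const_mul _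
  have hw1 : ∑ j ∈ Finset.range (Module.finrank ℝ E + 1), w j = 1 := by
    have := hw 0
    simp [ContinuousLinearMap.det] at this
    exact this.symm
  rw [hw1, setIntegral_congr_fun hBm hzero] at hsum
  simp at hsum
  have : 0 < volume.real B := by
    rw [measureReal_def]
    apply ENNReal.toReal_pos
    · exact (Metric.measure_ball_pos _ _ one_pos).ne'
    · exact measure_ball_lt_top.ne
  linarith

lemma brouwer_smooth (f : E → E) (hf : ContDiff ℝ 1 f) (hb : ∀ x, ‖f x‖ ≤ 1) : ∃ x, f x = x := by
  by_contra hcon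
  push Not at hcon
  set u : E → E := fun x => x - f x with hu
  have hu0 : ∀ x, u x ≠ 0 := fun x h => hcon x (sub_eq_zero.1 h).symm
  have hun : ∀ x, 0 < ‖u x‖ ^ 2 := fun x => by have := norm_pos_iff.2 (hu0 x); positivity
  have huC : ContDiff ℝ 1 u := contDiff_id.sub hf
  set D : E → ℝ := fun x => (inner ℝ x (u x)) ^ 2 + ‖u x‖ ^ 2 * (1 - ‖x‖ ^ 2) with hD
  have hDC : ContDiff ℝ 1 D := by
    apply ContDiff.add
    · exact (contDiff_id.inner ℝ huC).pow 2
    · exact (huC.norm_sq ℝ).mul (contDiff_const.sub (contDiff_id.norm_sq ℝ))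
  have hsph : ∀ x, ‖x‖ = 1 → 0 < inner ℝ x (u x) := by
    intro x hx
    have h1 : inner ℝ x (u x) = 1 - inner ℝ x (f x) := by
      simp [hu, inner_sub_right, hx]
    have h2 : ‖u x‖ ^ 2 = 1 - 2 * inner ℝ x (f x) + ‖f x‖ ^ 2 := by
      simp only [hu]; rw [norm_sub_sq_real, hx]; norm_num
    have h3 : ‖f x‖ ^ 2 ≤ 1 := by have := hb x; have := norm_nonneg (f x); nlinarith
    have := hun x
    linarith
  have hDpos : ∀ x, ‖x‖ ≤ 1 → 0 < D x := by
    intro x hx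
    rcases hx.lt_or_eq with h | h
    · have h1 : 0 < 1 - ‖x‖ ^ 2 := by have := norm_nonneg x; nlinarith
      have := mul_pos (hun x) h1
      simp only [hD]; positivity
    · have := hsph x h
      simp only [hD, h]; norm_num; positivity
  set τ : E → ℝ := fun x => (-(inner ℝ x (u x)) + √(D x)) / ‖u x‖ ^ 2 with hτ
  set H : E → E := fun x => τ x • u x with hH
  have hHC : ∀ x, ‖x‖ ≤ 1 → ContDiffAt ℝ 1 H x := by
    intro x hx
    apply ContDiffAt.smul
    · apply ContDiffAt.div
      · apply ContDiffAt.add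
        · exact ((contDiff_id.inner ℝ huC).neg).contDiffAt
        · exact (hDC.contDiffAt).sqrt (hDpos x hx).ne'
      · exact (huC.norm_sq ℝ).contDiffAt
      · exact (hun x).ne'
    · exact huC.contDiffAt
  have hcpt : IsCompact (Metric.closedBall (0:E) 1) := isCompact_closedBall _ _
  obtain ⟨C, hC⟩ : ∃ C : ℝ, ∀ x ∈ Metric.closedBall (0:E) 1, ‖fderiv ℝ H x‖ ≤ C := by
    apply hcpt.exists_bound_of_continuousOn
    intro x hx
    have := (hHC x (by simpa using hx)).fderiv_right (m := 0) (by norm_num)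
    exact this.continuousAt.continuousWithinAt
  have hLip : LipschitzOnWith C.toNNReal H (Metric.closedBall 0 1) := by
    apply (convex_closedBall (0:E) 1).lipschitzOnWith_of_nnnorm_fderiv_le (𝕜 := ℝ)
    · intro x hx
      exact (hHC x (by simpa using hx)).differentiableAt (by norm_num)
    · intro x hx
      rw [← NNReal.coe_le_coe, coe_nnnorm]
      exact (hC x hx).trans (Real.le_coe_toNNReal C)
  have hHs : ∀ x, ‖x‖ = 1 → H x = 0 := by
    intro x hx
    have : D x = (inner ℝ x (u x)) ^ 2 := by simp [hD, hx]
    simp [hH, hτ, this, Real.sqrt_sq (hsph x hx).le]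
  set h : E → E := fun x => if ‖x‖ ≤ 1 then H x else 0 with hh
  have h0 : ∀ x, 1 ≤ ‖x‖ → h x = 0 := by
    intro x hx
    simp only [hh]
    split_ifs with h1
    · exact hHs x (le_antisymm h1 hx)
    · rfl
  have hin : ∀ x, ‖x‖ ≤ 1 → h x = H x := by
    intro x hx; simp [hh, hx]
  have hcross : ∀ x y, ‖x‖ ≤ 1 → 1 ≤ ‖y‖ → dist (h x) (h y) ≤ C.toNNReal * dist x y := by
    intro x y hx hy
    have hc : ContinuousOn (fun t : ℝ => ‖AffineMap.lineMap x y t‖) (Icc 0 1) := by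
      apply Continuous.continuousOn
      exact (AffineMap.lineMap_continuous).norm
    have hi := intermediate_value_Icc zero_le_one hc
    obtain ⟨t, ht, ht1⟩ := hi (show (1:ℝ) ∈ _ by simpa using ⟨hx, hy⟩)
    simp only at ht1
    rw [h0 y hy, hin x hx, ← hHs _ ht1]
    refine (hLip.dist_le_mul x (by simpa using hx) _ (by simp [ht1])).trans ?_
    gcongr
    rw [dist_left_lineMap, Real.norm_eq_abs, abs_of_nonneg ht.1]
    exact mul_le_of_le_one_left dist_nonneg ht.2
  have hlip : LipschitzWith C.toNNReal h := by
    refine LipschitzWith.of_dist_le_mul fun x y => ?_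
    rcases le_total ‖x‖ 1 with hx | hx <;> rcases le_total ‖y‖ 1 with hy | hy
    · rw [hin x hx, hin y hy]
      exact hLip.dist_le_mul x (by simpa using hx) y (by simpa using hy)
    · exact hcross x y hx hy
    · rw [dist_comm, dist_comm x]; exact hcross y x hy hx
    · rw [h0 x hx, h0 y hy, dist_self]; positivity
  refine no_retract h C.toNNReal hlip h0 (fun x => fderiv ℝ H x) ?_ ?_
  · intro x hx
    have h1 := ((hHC x hx.le).differentiableAt (by norm_num)).hasFDerivAt
    refine h1.congr_of_eventuallyEq ?_
    have : Metric.ball (0:E) 1 ∈ 𝓝 x := Metric.isOpen_ball.mem_nhds (by simpa using hx)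
    filter_upwards [this] with y hy
    exact hin y (by simpa using hy : ‖y‖ < 1).le
  · intro x hx
    rw [hin x hx.le]
    have h1 : ‖x + H x‖ ^ 2 = 1 := by
      have h3 : ‖x + H x‖ ^ 2 = ‖x‖ ^ 2 + 2 * (τ x * inner ℝ x (u x)) + τ x ^ 2 * ‖u x‖ ^ 2 := by
        rw [norm_add_sq_real]
        simp only [hH, inner_smul_right, norm_smul, mul_pow, Real.norm_eq_abs, sq_abs]
      rw [h3]
      have hs := Real.sq_sqrt (hDpos x hx.le).le
      have h4 : τ x * ‖u x‖ ^ 2 = -(inner ℝ x (u x)) + √(D x) := by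
        simp only [hτ]; rw [div_mul_cancel₀ _ (hun x).ne']
      have h5 : (‖x‖ ^ 2 + 2 * (τ x * inner ℝ x (u x)) + τ x ^ 2 * ‖u x‖ ^ 2 - 1) * ‖u x‖ ^ 2 = 0 := by
        have e1 : D x = (inner ℝ x (u x)) ^ 2 + ‖u x‖ ^ 2 * (1 - ‖x‖ ^ 2) := rfl
        rw [e1] at hs
        have : (‖x‖ ^ 2 + 2 * (τ x * inner ℝ x (u x)) + τ x ^ 2 * ‖u x‖ ^ 2 - 1) * ‖u x‖ ^ 2
          = (‖x‖ ^ 2 - 1) * ‖u x‖ ^ 2 + 2 * (τ x * ‖u x‖ ^ 2) * inner ℝ x (u x)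
            + (τ x * ‖u x‖ ^ 2) ^ 2 := by ring
        rw [this, h4, e1]
        linear_combination hs
      rcases mul_eq_zero.1 h5 with h6 | h6
      · linarith
      · exact absurd h6 (hun x).ne'
    have := norm_nonneg (x + H x)
    nlinarith

lemma brouwer_ball (f : E → E) (hf : Continuous f) (hb : ∀ x, ‖f x‖ ≤ 1) : ∃ x, f x = x := by
  by_contra hcon
  push Not at hcon
  have hcpt : IsCompact (Metric.closedBall (0:E) 1) := isCompact_closedBall _ _
  obtain ⟨x0, -, hx0⟩ := hcpt.exists_isMinOn ⟨0, by simp⟩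
    (f := fun x => ‖f x - x‖) (by fun_prop)
  set δ := ‖f x0 - x0‖
  have hδ : 0 < δ := norm_pos_iff.2 (sub_ne_zero.2 (hcon x0))
  set ε := δ / 4
  have hε : 0 < ε := by positivity
  obtain ⟨g, hg, hgf, -⟩ := hf.exists_contDiff_approx 1 (ε := fun _ => ε) (by fun_prop)
    (fun _ => hε)
  have hgn : ∀ x, ‖g x‖ ≤ 1 + ε := by
    intro x
    have h1 := hgf x
    rw [dist_eq_norm] at h1
    have := norm_le_norm_add_norm_sub' (g x) (f x)
    linarith [hb x]
  obtain ⟨x, hx⟩ := brouwer_smooth (fun x => (1 + ε)⁻¹ • g x) (hg.const_smul _) (by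
    intro x
    rw [norm_smul, Real.norm_eq_abs, abs_of_pos (by positivity)]
    rw [inv_mul_le_iff₀ (by positivity)]
    linarith [hgn x])
  have hxn : ‖x‖ ≤ 1 := by
    rw [← hx, norm_smul, Real.norm_eq_abs, abs_of_pos (by positivity)]
    rw [inv_mul_le_iff₀ (by positivity)]
    linarith [hgn x]
  have h1 : δ ≤ ‖f x - x‖ := hx0 (by simpa using hxn)
  have h2 : g x = (1 + ε) • x := by
    conv_rhs => rw [← hx]
    rw [smul_smul, mul_inv_cancel₀ (by positivity), one_smul]
  have h3 : ‖f x - x‖ ≤ ε + ε := by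
    have : f x - x = (f x - g x) + ε • x := by rw [h2, add_smul, one_smul]; abel
    rw [this]
    refine (norm_add_le _ _).trans (add_le_add ?_ ?_)
    · have := hgf x; rw [dist_comm, dist_eq_norm] at this; exact this.le
    · rw [norm_smul, Real.norm_eq_abs, abs_of_pos hε]
      exact mul_le_of_le_one_right hε.le hxn
  have : ε = δ / 4 := rfl
  linarith

end Brouwer

lemma approx_fixed {F : Type*} [NormedAddCommGroup F] [NormedSpace ℝ F] (C : Set F)
    (hC : Convex ℝ C) (htb : TotallyBounded C) (hne : C.Nonempty) (β : F → F)
    (hβ : ∀ x ∈ C, β x ∈ C) (ε : ℝ) (hε : 0 < ε) :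
    ∃ (ι : Type) (_ : Fintype ι) (x : ι → F) (w : ι → ℝ), (∀ i, x i ∈ C) ∧ (∀ i, 0 ≤ w i) ∧
      ∑ i, w i = 1 ∧ ∀ i, 0 < w i → ‖x i - ∑ j, w j • β (x j)‖ < ε := by
  classical
  obtain ⟨t, htC, htf, hcov⟩ := Metric.finite_approx_of_totallyBounded htb ε hε
  have : Fintype t := htf.fintype
  obtain ⟨n, ⟨e⟩⟩ := Finite.exists_equiv_fin t
  set ι := Fin n
  let x : ι → F := fun i => (e.symm i : F)
  have hxC : ∀ i, x i ∈ C := fun i => htC (e.symm i).2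
  have hcov' : ∀ p ∈ C, ∃ i, ‖x i - p‖ < ε := by
    intro p hp
    have := hcov hp
    simp only [mem_iUnion, Metric.mem_ball, exists_prop] at this
    obtain ⟨y, hy, hyp⟩ := this
    refine ⟨e ⟨y, hy⟩, ?_⟩
    simp only [x, Equiv.symm_apply_apply]
    rw [← dist_eq_norm, dist_comm]; exact hyp
  have hn : 0 < n := by
    obtain ⟨p, hp⟩ := hne
    obtain ⟨i, -⟩ := hcov' p hp
    exact i.pos
  have hnR : (0:ℝ) < n := by exact_mod_cast hn
  let E := EuclideanSpace ℝ ι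
  let S : E → ℝ := fun w => ∑ i, max (w i) 0
  let r : E → ι → ℝ := fun w i => (max (w i) 0 + max (1 - S w) 0 / n) / max (S w) 1
  have hco : ∀ i : ι, Continuous fun w : E => w i := fun i =>
    (continuous_apply i).comp (PiLp.continuous_ofLp 2 _)
  have hSc : Continuous S := by
    apply continuous_finsetSum; intro i _
    exact (hco i).max continuous_const
  have hmax : ∀ w, 0 < max (S w) 1 := fun w => lt_max_of_lt_right one_pos
  have hrc : ∀ i, Continuous fun w => r w i := by
    intro i
    apply Continuous.div _ (hSc.max continuous_const) (fun w => (hmax w).ne')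
    exact ((hco i).max continuous_const).add
      (((continuous_const.sub hSc).max continuous_const).div_const _)
  have hr0 : ∀ w i, 0 ≤ r w i := by
    intro w i; have := hmax w; positivity
  have hr1 : ∀ w, ∑ i, r w i = 1 := by
    intro w
    simp only [r]
    rw [← Finset.sum_div, Finset.sum_add_distrib, div_eq_one_iff_eq (hmax w).ne']
    simp only [Finset.sum_const, Finset.card_univ, nsmul_eq_mul, ι, Fintype.card_fin]
    rw [mul_div_cancel₀ _ hnR.ne']
    change S w + _ = _
    rcases le_total (S w) 1 with h | h
    · rw [max_eq_left (by linarith), max_eq_right h]; ring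
    · rw [max_eq_right (by linarith), max_eq_left h]; ring
  let p : E → F := fun w => ∑ j, r w j • β (x j)
  have hpc : Continuous p := by
    apply continuous_finsetSum; intro i _
    exact (hrc i).smul continuous_const
  have hpC : ∀ w, p w ∈ C := fun w =>
    hC.sum_mem (fun i _ => hr0 w i) (hr1 w) (fun i _ => hβ _ (hxC i))
  let l : E → ι → ℝ := fun w i => max (ε - ‖x i - p w‖) 0
  let L : E → ℝ := fun w => ∑ i, l w i
  have hl0 : ∀ w i, 0 ≤ l w i := fun w i => le_max_right _ _
  have hlc : ∀ i, Continuous fun w => l w i := fun i =>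
    (continuous_const.sub (continuous_const.sub hpc).norm).max continuous_const
  have hLc : Continuous L := continuous_finsetSum _ fun i _ => hlc i
  have hL : ∀ w, 0 < L w := by
    intro w
    obtain ⟨i, hi⟩ := hcov' _ (hpC w)
    refine Finset.sum_pos' (fun i _ => hl0 w i) ⟨i, Finset.mem_univ _, ?_⟩
    exact lt_max_of_lt_left (by linarith)
  let f : E → E := fun w => WithLp.toLp 2 (fun i => l w i / L w)
  have hfc : Continuous f := by
    apply (PiLp.continuous_toLp 2 _).comp
    apply continuous_pi; intro i
    exact (hlc i).div hLc (fun w => (hL w).ne')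
  have hfsum : ∀ w, ∑ i, l w i / L w = 1 := fun w => by
    rw [← Finset.sum_div]; exact div_self (hL w).ne'
  have hfb : ∀ w, ‖f w‖ ≤ 1 := by
    intro w
    have h1 : ‖f w‖ ^ 2 ≤ 1 := by
      rw [EuclideanSpace.norm_sq_eq]
      calc ∑ i, ‖f w i‖ ^ 2 ≤ ∑ i, l w i / L w := by
            refine Finset.sum_le_sum fun i _ => ?_
            have h2 : 0 ≤ l w i / L w := div_nonneg (hl0 w i) (hL w).le
            have h3 : l w i / L w ≤ 1 := by
              rw [div_le_one (hL w)]
              exact Finset.single_le_sum (f := l w) (fun i _ => hl0 w i) (Finset.mem_univ i)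
            change ‖l w i / L w‖ ^ 2 ≤ _
            rw [Real.norm_eq_abs, sq_abs]
            nlinarith
        _ = 1 := hfsum w
    have := norm_nonneg (f w)
    nlinarith
  obtain ⟨w, hw⟩ := brouwer_ball f hfc hfb
  have hwi : ∀ i, w i = l w i / L w := by
    intro i
    conv_lhs => rw [← hw]
  have hw0 : ∀ i, 0 ≤ w i := fun i => by rw [hwi]; exact div_nonneg (hl0 w i) (hL w).le
  have hw1 : ∑ i, w i = 1 := by simp_rw [hwi]; exact hfsum w
  have hSw : S w = 1 := by
    simp only [S]; rw [← hw1]; exact Finset.sum_congr rfl fun i _ => max_eq_left (hw0 i)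
  have hrw : ∀ i, r w i = w i := by
    intro i; simp [r, hSw, max_eq_left (hw0 i)]
  refine ⟨ι, inferInstance, x, fun i => w i, hxC, hw0, hw1, ?_⟩
  intro i hi
  have hp : ∑ j, w j • β (x j) = p w := by simp only [p, hrw]
  rw [hp]
  by_contra hcon
  push Not at hcon
  have : l w i = 0 := max_eq_right (by linarith)
  have hi' : 0 < w i := hi
  rw [hwi, this] at hi'
  simp at hi'
end LPN
end

noncomputable section
namespace LPN

lemma tietze_bdd {X : Type*} [TopologicalSpace X] [NormalSpace X] {s : Set X} (hs : IsClosed s)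
    (f : X → ℝ) (hf : ContinuousOn f s) (C : ℝ) (hC : 0 ≤ C) (hb : ∀ x ∈ s, |f x| ≤ C) :
    ∃ g : X → ℝ, Continuous g ∧ (∀ x, |g x| ≤ C) ∧ ∀ x ∈ s, g x = f x := by
  let f0 : C(s, ℝ) := ⟨s.restrict f, hf.restrict⟩
  have hmem : ∀ x, f0 x ∈ Icc (-C) C := fun x => abs_le.1 (hb x x.2)
  have : OrdConnected (Icc (-C) C) := ordConnected_Icc
  obtain ⟨g, hg, hgs⟩ := f0.exists_restrict_eq_forall_mem_of_closed hmem ⟨0, by simpa using hC⟩ hs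
  refine ⟨g, g.continuous, fun x => abs_le.2 (hg x), fun x hx => ?_⟩
  have := congrArg (fun h => h ⟨x, hx⟩) hgs
  exact this

/-- Caratheodory integrands. -/
structure Car (S : Set (ℝ × ℝ)) (F : ℝ → ℝ × ℝ → ℝ) : Prop where
  meas : Measurable (Function.uncurry F)
  cont : ∀ t, ContinuousOn (F t) S
  bdd : ∃ C, ∀ t p, |F t p| ≤ C

lemma Car.add {S : Set (ℝ × ℝ)} {F G : ℝ → ℝ × ℝ → ℝ} (hF : Car S F) (hG : Car S G) :
    Car S (fun t p => F t p + G t p) := by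
  refine ⟨hF.meas.add hG.meas, fun t => (hF.cont t).add (hG.cont t), ?_⟩
  obtain ⟨C, hC⟩ := hF.bdd
  obtain ⟨D, hD⟩ := hG.bdd
  exact ⟨C + D, fun t p => (abs_add_le _ _).trans (add_le_add (hC t p) (hD t p))⟩

lemma Car.mul {S : Set (ℝ × ℝ)} {F G : ℝ → ℝ × ℝ → ℝ} (hF : Car S F) (hG : Car S G) :
    Car S (fun t p => F t p * G t p) := by
  refine ⟨hF.meas.mul hG.meas, fun t => (hF.cont t).mul (hG.cont t), ?_⟩
  obtain ⟨C, hC⟩ := hF.bdd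
  obtain ⟨D, hD⟩ := hG.bdd
  refine ⟨C * D, fun t p => ?_⟩
  rw [abs_mul]
  exact mul_le_mul (hC t p) (hD t p) (abs_nonneg _) ((abs_nonneg _).trans (hC t p))

lemma Car.const {S : Set (ℝ × ℝ)} (c : ℝ) : Car S (fun _ _ => c) :=
  ⟨measurable_const, fun _ => continuousOn_const, ⟨|c|, fun _ _ => le_rfl⟩⟩

lemma Car.sub {S : Set (ℝ × ℝ)} {F G : ℝ → ℝ × ℝ → ℝ} (hF : Car S F) (hG : Car S G) :
    Car S (fun t p => F t p - G t p) := by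
  have := hF.add ((Car.const (S := S) (-1)).mul hG)
  simpa [sub_eq_add_neg] using this

lemma Car.mono {S S' : Set (ℝ × ℝ)} {F : ℝ → ℝ × ℝ → ℝ} (hF : Car S F) (h : S' ⊆ S) : Car S' F :=
  ⟨hF.meas, fun t => (hF.cont t).mono h, hF.bdd⟩

/-- cut-off of a function on `[0,T] × closure O`. -/
def cut (T : ℝ) (O : Set ℝ) (G : ℝ → ℝ → ℝ) : ℝ → ℝ × ℝ → ℝ := by
  classical
  exact fun t p => if t ∈ Icc 0 T ∧ p.1 ∈ closure O then G t p.1 else 0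

lemma cut_eq {T : ℝ} {O : Set ℝ} {G : ℝ → ℝ → ℝ} {t : ℝ} {p : ℝ × ℝ} (ht : t ∈ Icc 0 T)
    (hp : p.1 ∈ closure O) : cut T O G t p = G t p.1 := by
  simp only [cut]; rw [if_pos ⟨ht, hp⟩]

lemma measurable_cut2 {G : ℝ × ℝ → ℝ} (s : Set (ℝ × ℝ)) (hs : IsClosed s)
    (hG : ContinuousOn G s) : Measurable (s.indicator G) := by
  classical
  have h1 : Measurable (s.piecewise G 0) := by
    apply measurable_of_restrict_of_restrict_compl hs.measurableSet
    · rw [restrict_piecewise]; exact hG.restrict.measurable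
    · rw [restrict_piecewise_compl]; exact measurable_const
  rwa [Set.piecewise_eq_indicator] at h1

lemma cut_car {T : ℝ} {O A : Set ℝ} {G : ℝ → ℝ → ℝ}
    (hc : ContinuousOn (fun p : ℝ × ℝ => G p.1 p.2) (Icc 0 T ×ˢ closure O))
    (hb : ∃ C : ℝ, ∀ t ∈ Icc (0:ℝ) T, ∀ x ∈ closure O, |G t x| ≤ C) :
    Car (closure O ×ˢ A) (cut T O G) := by
  classical
  refine ⟨?_, ?_, ?_⟩
  · have h1 := measurable_cut2 (Icc 0 T ×ˢ closure O)
      (isClosed_Icc.prod isClosed_closure) hc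
    have h2 : Measurable fun q : ℝ × ℝ × ℝ => (q.1, q.2.1) := by fun_prop
    have h3 := h1.comp h2
    convert h3 using 1
    ext ⟨t, x, a⟩
    simp [cut, Function.uncurry, Set.indicator, mem_prod]
  · intro t
    by_cases ht : t ∈ Icc 0 T
    · have : ContinuousOn (fun p : ℝ × ℝ => G t p.1) (closure O ×ˢ A) := by
        have h1 : ContinuousOn (fun p : ℝ × ℝ => ((t, p.1) : ℝ × ℝ)) (closure O ×ˢ A) := by fun_prop
        exact hc.comp h1 (fun p hp => ⟨ht, hp.1⟩)
      exact this.congr fun p hp => cut_eq ht hp.1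
    · have : cut T O G t = fun _ => 0 := by
        ext p; simp only [cut]; rw [if_neg (fun h => ht h.1)]
      rw [this]; exact continuousOn_const
  · obtain ⟨C, hC⟩ := hb
    refine ⟨|C|, fun t p => ?_⟩
    simp only [cut]
    split_ifs with h
    · exact (hC t h.1 _ h.2).trans (le_abs_self C)
    · simp

/-- `C(K)`-valued version. -/
def cm (K : Set (ℝ × ℝ)) (F : ℝ → ℝ × ℝ → ℝ) : ℝ → C(K, ℝ) := by
  classical
  exact fun t => if h : ContinuousOn (F t) K then ⟨K.restrict (F t), h.restrict⟩ else 0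

lemma cm_apply {K : Set (ℝ × ℝ)} {F : ℝ → ℝ × ℝ → ℝ} (hF : Car K F) (t : ℝ) (p : K) :
    cm K F t p = F t p := by
  simp only [cm, dif_pos (hF.cont t)]
  rfl

lemma cm_meas {K : Set (ℝ × ℝ)} (hK : IsCompact K) {F : ℝ → ℝ × ℝ → ℝ} (hF : Car K F) :
    StronglyMeasurable (cm K F) := by
  have : CompactSpace K := isCompact_iff_compactSpace.1 hK
  rcases isEmpty_or_nonempty K with hE | hE
  · have : cm K F = fun _ => 0 := by ext t p; exact hE.elim p
    rw [this]; exact stronglyMeasurable_const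
  borelize C(K, ℝ)
  let q : ℕ → K := TopologicalSpace.denseSeq K
  let e : C(K, ℝ) → ℕ → ℝ := fun f n => f (q n)
  have hec : Continuous e := by
    apply continuous_pi; intro n; exact continuous_eval_const _
  have hei : Function.Injective e := by
    intro f g hfg
    ext x
    have : (f : K → ℝ) = g := by
      apply Continuous.ext_on (TopologicalSpace.denseRange_denseSeq K) f.continuous g.continuous
      rintro _ ⟨n, rfl⟩
      exact congrFun hfg n
    rw [this]
  have hem := hec.measurableEmbedding hei
  have : Measurable (cm K F) := by
    rw [← hem.measurable_comp_iff]
    apply measurable_pi_lambda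
    intro n
    have : (fun t => (e ∘ cm K F) t n) = fun t => F t (q n) := by
      ext t; exact cm_apply hF t (q n)
    rw [this]
    exact hF.meas.comp (by fun_prop : Measurable fun t : ℝ => (t, (q n : ℝ × ℝ)))
  exact this.stronglyMeasurable

lemma cm_bdd {K : Set (ℝ × ℝ)} (hK : IsCompact K) [CompactSpace K] {F : ℝ → ℝ × ℝ → ℝ} (hF : Car K F)
    {C : ℝ} (hC : ∀ t p, |F t p| ≤ C) (hC0 : 0 ≤ C) (t : ℝ) :
    ‖cm K F t‖ ≤ C := by
  rw [ContinuousMap.norm_le _ hC0]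
  intro p
  rw [cm_apply hF]; exact hC t p

/-- Approximation of a Caratheodory integrand by a jointly continuous one. -/
lemma car_approx {K : Set (ℝ × ℝ)} (hK : IsCompact K) {F : ℝ → ℝ × ℝ → ℝ} (hF : Car K F)
    (T ε : ℝ) (hε : 0 < ε) {C : ℝ} (hC : ∀ t p, |F t p| ≤ C) (hC0 : 0 ≤ C) :
    ∃ (H : ℝ × ℝ × ℝ → ℝ) (ψ : ℝ → ℝ) (D : ℝ), Continuous H ∧ (∀ q, |H q| ≤ D) ∧
      (∀ t, ∀ p ∈ K, |F t p - H (t, p)| ≤ ψ t) ∧ Measurable ψ ∧ (∀ t, 0 ≤ ψ t ∧ ψ t ≤ C + D) ∧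
      ∫ t in Icc 0 T, ψ t ≤ ε := by
  have hKs : CompactSpace K := isCompact_iff_compactSpace.1 hK
  have hm := cm_meas hK hF
  have hintg : Integrable (cm K F) (volume.restrict (Icc 0 T)) := by
    refine Measure.integrableOn_of_bounded (M := C) ?_ hm.aestronglyMeasurable
      (Eventually.of_forall fun t => cm_bdd hK hF hC hC0 t)
    simp
  obtain ⟨g, hg, hgi⟩ := hintg.exists_boundedContinuous_integral_sub_le hε
  have hgK : ContinuousOn (fun q : ℝ × ℝ × ℝ => (Function.extend (fun p : ℝ × K => (p.1, (p.2 : ℝ × ℝ)))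
      (fun p => g p.1 p.2) 0) q) (univ ×ˢ K) := by
    rw [continuousOn_iff_continuous_restrict]
    have h1 : Continuous fun p : ℝ × K => g p.1 p.2 := by
      have : Continuous fun p : ℝ × K => (g p.1, p.2) := by fun_prop
      exact continuous_eval.comp this
    have h2 : Continuous fun q : (univ ×ˢ K : Set (ℝ × ℝ × ℝ)) =>
        (((q : ℝ × ℝ × ℝ).1, (⟨(q : ℝ × ℝ × ℝ).2, q.2.2⟩ : K)) : ℝ × K) := by fun_prop
    have h3 := h1.comp h2
    convert h3 using 1
    ext q
    have hinj : Function.Injective (fun p : ℝ × K => (p.1, (p.2 : ℝ × ℝ))) := by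
      rintro ⟨a, b⟩ ⟨c, d⟩ h
      simp only [Prod.mk.injEq] at h
      exact Prod.ext h.1 (Subtype.ext h.2)
    obtain ⟨⟨t, p⟩, hq⟩ := q
    have := hinj.extend_apply (fun p : ℝ × K => g p.1 p.2) 0 ((t, (⟨p, hq.2⟩ : K)) : ℝ × K)
    simpa using this
  have hinj : Function.Injective (fun p : ℝ × K => (p.1, (p.2 : ℝ × ℝ))) := by
    rintro ⟨a, b⟩ ⟨c, d⟩ h
    simp only [Prod.mk.injEq] at h
    exact Prod.ext h.1 (Subtype.ext h.2)
  have hval : ∀ t, ∀ p (hp : p ∈ K), (Function.extend (fun p : ℝ × K => (p.1, (p.2 : ℝ × ℝ)))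
      (fun p => g p.1 p.2) 0) (t, p) = g t ⟨p, hp⟩ := by
    intro t p hp
    exact hinj.extend_apply _ _ ((t, ⟨p, hp⟩) : ℝ × K)
  obtain ⟨H, hH, hHb, hHe⟩ := tietze_bdd (isClosed_univ.prod hK.isClosed) _ hgK ‖g‖ (norm_nonneg _) (by
    rintro ⟨t, p⟩ ⟨-, hp⟩
    rw [hval t p hp]
    exact ((g t).norm_coe_le_norm ⟨p, hp⟩).trans (g.norm_coe_le_norm t))
  refine ⟨H, fun t => ‖cm K F t - g t‖, ‖g‖, hH, hHb, ?_, ?_, ?_, ?_⟩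
  · intro t p hp
    rw [hHe (t, p) ⟨mem_univ _, hp⟩, hval t p hp]
    have := (cm K F t - g t).norm_coe_le_norm ⟨p, hp⟩
    rw [ContinuousMap.sub_apply, cm_apply hF] at this
    exact this
  · exact (hm.sub g.continuous.stronglyMeasurable).norm.measurable
  · intro t
    exact ⟨norm_nonneg _, (norm_sub_le _ _).trans (add_le_add (cm_bdd hK hF hC hC0 t) (g.norm_coe_le_norm t))⟩
  · exact hg

end LPN
end

noncomputable section
namespace LPN

/-- bounded measurable integrands. -/
structure BM (F : ℝ → ℝ × ℝ → ℝ) : Prop where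
  meas : Measurable (Function.uncurry F)
  bdd : ∃ C, ∀ t p, |F t p| ≤ C

lemma Car.bm {S : Set (ℝ × ℝ)} {F : ℝ → ℝ × ℝ → ℝ} (h : Car S F) : BM F := ⟨h.meas, h.bdd⟩

lemma BM.add {F G : ℝ → ℝ × ℝ → ℝ} (hF : BM F) (hG : BM G) : BM (fun t p => F t p + G t p) := by
  refine ⟨hF.meas.add hG.meas, ?_⟩
  obtain ⟨C, hC⟩ := hF.bdd
  obtain ⟨D, hD⟩ := hG.bdd
  exact ⟨C + D, fun t p => (abs_add_le _ _).trans (add_le_add (hC t p) (hD t p))⟩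

lemma BM.mul {F G : ℝ → ℝ × ℝ → ℝ} (hF : BM F) (hG : BM G) : BM (fun t p => F t p * G t p) := by
  refine ⟨hF.meas.mul hG.meas, ?_⟩
  obtain ⟨C, hC⟩ := hF.bdd
  obtain ⟨D, hD⟩ := hG.bdd
  refine ⟨C * D, fun t p => ?_⟩
  rw [abs_mul]
  exact mul_le_mul (hC t p) (hD t p) (abs_nonneg _) ((abs_nonneg _).trans (hC t p))

lemma BM.const (c : ℝ) : BM (fun _ _ => c) := ⟨measurable_const, ⟨|c|, fun _ _ => le_rfl⟩⟩

lemma BM.cmul {G : ℝ → ℝ × ℝ → ℝ} (c : ℝ) (hG : BM G) : BM (fun t p => c * G t p) :=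
  (BM.const c).mul hG

lemma BM.sub {F G : ℝ → ℝ × ℝ → ℝ} (hF : BM F) (hG : BM G) : BM (fun t p => F t p - G t p) := by
  have := hF.add (hG.cmul (-1))
  simpa [sub_eq_add_neg] using this

lemma BM.abs {F : ℝ → ℝ × ℝ → ℝ} (hF : BM F) : BM (fun t p => |F t p|) := by
  obtain ⟨C, hC⟩ := hF.bdd
  exact ⟨hF.meas.abs, ⟨C, fun t p => by rw [abs_abs]; exact hC t p⟩⟩

lemma BM.time {ψ : ℝ → ℝ} (hψ : Measurable ψ) (hb : ∃ C, ∀ t, |ψ t| ≤ C) : BM (fun t _ => ψ t) :=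
  ⟨hψ.comp measurable_fst, hb.imp fun _ h t _ => h t⟩

lemma BM.cont {h : ℝ × ℝ → ℝ} (hh : Continuous h) (hb : ∃ C, ∀ p, |h p| ≤ C) :
    BM (fun t p => h (t, p.1)) :=
  ⟨(hh.comp (by fun_prop : Continuous fun q : ℝ × ℝ × ℝ => (q.1, q.2.1))).measurable,
    hb.imp fun _ h t p => h (t, p.1)⟩

/-- normalised flows. -/
structure Fl (O A : Set ℝ) (m : ℝ → Measure (ℝ × ℝ)) : Prop where
  meas : Measurable m
  mass : ∀ t, m t univ ≤ 1
  supp : ∀ t, m t (closure O ×ˢ A)ᶜ = 0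

/-- double integral. -/
def I2 (T : ℝ) (m : ℝ → Measure (ℝ × ℝ)) (F : ℝ → ℝ × ℝ → ℝ) : ℝ :=
  ∫ t in Icc 0 T, ∫ p, F t p ∂(m t)

section
variable {T : ℝ} {O A : Set ℝ} {m : ℝ → Measure (ℝ × ℝ)} {F G : ℝ → ℝ × ℝ → ℝ}

lemma Fl.fin (h : Fl O A m) (t : ℝ) : IsFiniteMeasure (m t) :=
  ⟨(h.mass t).trans_lt ENNReal.one_lt_top⟩

lemma Fl.ae (h : Fl O A m) (t : ℝ) : ∀ᵐ p ∂(m t), p ∈ closure O ×ˢ A := by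
  rw [ae_iff]; exact h.supp t

lemma Fl.real_le (h : Fl O A m) (t : ℝ) : (m t).real univ ≤ 1 := by
  rw [Measure.real]
  exact ENNReal.toReal_le_of_le_ofReal zero_le_one (by simpa using h.mass t)

lemma BM.meas' (hF : BM F) (t : ℝ) : Measurable (F t) :=
  hF.meas.comp (by fun_prop : Measurable fun p : ℝ × ℝ => (t, p))

lemma BM.int (hF : BM F) (ν : Measure (ℝ × ℝ)) [IsFiniteMeasure ν] (t : ℝ) : Integrable (F t) ν := by
  obtain ⟨C, hC⟩ := hF.bdd
  exact Integrable.of_bound (hF.meas' t).aestronglyMeasurable C (Eventually.of_forall (hC t))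

lemma Fl.inner_int (h : Fl O A m) (hF : BM F) (t : ℝ) : Integrable (F t) (m t) := by
  have := h.fin t
  exact hF.int _ t

lemma Fl.zmeas (h : Fl O A m) (hF : BM F) : Measurable fun t => ∫ p, F t p ∂(m t) := by
  let κ : ProbabilityTheory.Kernel ℝ (ℝ × ℝ) := ⟨m, h.meas⟩
  have hk : ProbabilityTheory.IsFiniteKernel κ := ⟨⟨1, ENNReal.one_lt_top, h.mass⟩⟩
  have := (hF.meas.stronglyMeasurable).integral_kernel_prod_right' (κ := κ)
  exact this.measurable

lemma Fl.zbd (h : Fl O A m) {C : ℝ} (hC : 0 ≤ C) (t : ℝ) (hb : ∀ p ∈ closure O ×ˢ A, |F t p| ≤ C) :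
    |∫ p, F t p ∂(m t)| ≤ C := by
  have := h.fin t
  have h1 := norm_integral_le_of_norm_le_const (μ := m t) (f := F t) (C := C)
    ((h.ae t).mono fun p hp => hb p hp)
  rw [Real.norm_eq_abs] at h1
  exact h1.trans (mul_le_of_le_one_right hC (h.real_le t))

lemma Fl.zint (h : Fl O A m) (hF : BM F) : Integrable (fun t => ∫ p, F t p ∂(m t))
    (volume.restrict (Icc 0 T)) := by
  obtain ⟨C, hC⟩ := hF.bdd
  have hC0 : 0 ≤ C := (abs_nonneg _).trans (hC 0 0)
  refine Measure.integrableOn_of_bounded (M := C) (by simp) (h.zmeas hF).aestronglyMeasurable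
    (Eventually.of_forall fun t => h.zbd hC0 t fun p _ => hC t p)

lemma Fl.I2_add (h : Fl O A m) (hF : BM F) (hG : BM G) :
    I2 T m (fun t p => F t p + G t p) = I2 T m F + I2 T m G := by
  unfold I2
  rw [← integral_add (h.zint hF) (h.zint hG)]
  congr 1; ext t
  exact integral_add (h.inner_int hF t) (h.inner_int hG t)

lemma I2_cmul (c : ℝ) : I2 T m (fun t p => c * G t p) = c * I2 T m G := by
  unfold I2
  rw [← integral_const_mul]
  congr 1; ext t
  exact integral_const_mul _ _

lemma Fl.I2_sub (h : Fl O A m) (hF : BM F) (hG : BM G) :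
    I2 T m (fun t p => F t p - G t p) = I2 T m F - I2 T m G := by
  have := h.I2_add (T := T) hF (hG.cmul (-1))
  rw [I2_cmul] at this
  simp only [neg_mul, one_mul, ← sub_eq_add_neg] at this
  exact this

lemma Fl.I2_congr (h : Fl O A m) (hFG : ∀ t ∈ Icc 0 T, ∀ p ∈ closure O ×ˢ A, F t p = G t p) :
    I2 T m F = I2 T m G := by
  unfold I2
  apply setIntegral_congr_fun measurableSet_Icc
  intro t ht
  exact integral_congr_ae ((h.ae t).mono fun p hp => hFG t ht p hp)

lemma Fl.I2_mono (h : Fl O A m) (hF : BM F) (hG : BM G)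
    (hFG : ∀ t ∈ Icc 0 T, ∀ p ∈ closure O ×ˢ A, F t p ≤ G t p) :
    I2 T m F ≤ I2 T m G := by
  unfold I2
  apply setIntegral_mono_on (h.zint hF) (h.zint hG) measurableSet_Icc
  intro t ht
  exact integral_mono_ae (h.inner_int hF t) (h.inner_int hG t) ((h.ae t).mono fun p hp => hFG t ht p hp)

lemma Fl.I2_le_time (h : Fl O A m) {ψ : ℝ → ℝ} (hψ : IntegrableOn ψ (Icc 0 T))
    (hF : BM F) (hp : ∀ t ∈ Icc 0 T, 0 ≤ ψ t)
    (hFψ : ∀ t ∈ Icc 0 T, ∀ p ∈ closure O ×ˢ A, F t p ≤ ψ t) :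
    I2 T m F ≤ ∫ t in Icc 0 T, ψ t := by
  unfold I2
  apply setIntegral_mono_on (h.zint hF) hψ measurableSet_Icc
  intro t ht
  have := h.fin t
  calc ∫ p, F t p ∂(m t) ≤ ∫ p, ψ t ∂(m t) :=
        integral_mono_ae (h.inner_int hF t) (integrable_const _) ((h.ae t).mono fun p hp => hFψ t ht p hp)
    _ = (m t).real univ * ψ t := by simp
    _ ≤ ψ t := mul_le_of_le_one_left (hp t ht) (h.real_le t)

lemma Fl.I2_abs_time (h : Fl O A m) {ψ : ℝ → ℝ} (hψ : IntegrableOn ψ (Icc 0 T))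
    (hF : BM F) (hp : ∀ t ∈ Icc 0 T, 0 ≤ ψ t)
    (hFψ : ∀ t ∈ Icc 0 T, ∀ p ∈ closure O ×ˢ A, |F t p| ≤ ψ t) :
    |I2 T m F| ≤ ∫ t in Icc 0 T, ψ t := by
  rw [abs_le]
  constructor
  · have := h.I2_le_time hψ (hF.cmul (-1)) hp
      (fun t ht p hp => by have := (abs_le.1 (hFψ t ht p hp)).1; linarith)
    rw [I2_cmul] at this
    linarith
  · exact h.I2_le_time hψ hF hp fun t ht p hp => (abs_le.1 (hFψ t ht p hp)).2

lemma Fl.I2_abs_le (h : Fl O A m) (hF : BM F) : |I2 T m F| ≤ I2 T m (fun t p => |F t p|) := by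
  rw [abs_le]
  constructor
  · have := h.I2_mono (T := T) (hF.cmul (-1)) hF.abs (fun t _ p _ => by
      have := neg_abs_le (F t p); linarith)
    rw [I2_cmul] at this
    linarith
  · exact h.I2_mono hF hF.abs fun t _ p _ => le_abs_self _

lemma Fl.I2_abs_const (h : Fl O A m) (hT : 0 ≤ T) {C : ℝ} (hC : 0 ≤ C) (hF : BM F)
    (hFψ : ∀ t ∈ Icc 0 T, ∀ p ∈ closure O ×ˢ A, |F t p| ≤ C) : |I2 T m F| ≤ C * T := by
  have := h.I2_abs_time (T := T) (ψ := fun _ => C) (by simp) hF (fun _ _ => hC) hFψ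
  simpa [Measure.real, hT, mul_comm] using this
end

end LPN
end

noncomputable section
namespace LPN

section
variable {T : ℝ} {O A : Set ℝ} {m0 : Measure ℝ} {B : ℝ}

/-- continuous extension. -/
lemma ext_cont {G : ℝ → ℝ → ℝ}
    (hc : ContinuousOn (fun p : ℝ × ℝ => G p.1 p.2) (Icc 0 T ×ˢ closure O)) {C : ℝ} (hC0 : 0 ≤ C)
    (hb : ∀ t ∈ Icc (0:ℝ) T, ∀ x ∈ closure O, |G t x| ≤ C) :
    ∃ h : ℝ × ℝ → ℝ, Continuous h ∧ (∀ p, |h p| ≤ C) ∧ ∀ t ∈ Icc 0 T, ∀ x ∈ closure O, h (t, x) = G t x := by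
  obtain ⟨h, h1, h2, h3⟩ := tietze_bdd (isClosed_Icc.prod isClosed_closure) _ hc C hC0
    (fun p hp => hb p.1 hp.1 p.2 hp.2)
  exact ⟨h, h1, h2, fun t ht x hx => h3 (t, x) ⟨ht, hx⟩⟩

/-- relaxed admissible pairs. -/
structure Reg (T : ℝ) (O A : Set ℝ) (m0 : Measure ℝ) (B : ℝ) (μ : Measure (ℝ × ℝ))
    (m : ℝ → Measure (ℝ × ℝ)) : Prop where
  prob : IsProbabilityMeasure μ
  supp : μ ((Icc 0 T ×ˢ closure O)ᶜ) = 0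
  fl : Fl O A m
  ineq : ∀ u ut ux uxx, IsCb12 T O u ut ux uxx → ∀ C, 0 ≤ C →
    (∀ t ∈ Icc (0:ℝ) T, ∀ x ∈ closure O, |ux t x| ≤ C ∧ |uxx t x| ≤ C) →
    |∫ p, u p.1 p.2 ∂μ - ∫ x, u 0 x ∂m0 - I2 T m (fun t p => ut t p.1)| ≤ B * C

lemma Reg.ae {μ m} (h : Reg T O A m0 B μ m) : ∀ᵐ p ∂μ, p ∈ Icc 0 T ×ˢ closure O := by
  rw [ae_iff]; exact h.supp

lemma cb12_tmul {h ht hx hxx : ℝ → ℝ → ℝ} (H : IsCb12 T O h ht hx hxx) {c c' : ℝ → ℝ}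
    (hc : ∀ t ∈ Icc 0 T, HasDerivWithinAt c (c' t) (Icc 0 T) t) (hc' : ContinuousOn c' (Icc 0 T)) :
    IsCb12 T O (fun t x => c t * h t x) (fun t x => c' t * h t x + c t * ht t x)
      (fun t x => c t * hx t x) (fun t x => c t * hxx t x) := by
  have hcc : ContinuousOn c (Icc 0 T) := fun t ht => (hc t ht).continuousWithinAt
  have k1 : ContinuousOn (fun p : ℝ × ℝ => c p.1) (Icc 0 T ×ˢ closure O) :=
    hcc.comp continuousOn_fst (fun p hp => hp.1)
  have k2 : ContinuousOn (fun p : ℝ × ℝ => c' p.1) (Icc 0 T ×ˢ closure O) :=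
    hc'.comp continuousOn_fst (fun p hp => hp.1)
  refine ⟨k1.mul H.cont, (k2.mul H.cont).add (k1.mul H.cont_t), k1.mul H.cont_x, k1.mul H.cont_xx,
    ?_, ?_, ?_, ?_⟩
  · intro t ht x hx
    exact (hc t ht).mul (H.deriv_t t ht x hx)
  · intro t ht x hx
    exact (H.deriv_x t ht x hx).const_mul _
  · intro t ht x hx
    exact (H.deriv_xx t ht x hx).const_mul _
  · obtain ⟨C, hC⟩ := H.bdd
    obtain ⟨D, hD⟩ := isCompact_Icc.exists_bound_of_continuousOn hcc
    obtain ⟨E, hE⟩ := isCompact_Icc.exists_bound_of_continuousOn hc'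
    refine ⟨E * C + D * C + D * C, fun t ht' x hx' => ?_⟩
    obtain ⟨a1, a2, a3, a4⟩ := hC t ht' x hx'
    have d1 : |c t| ≤ D := hD t ht'
    have d2 : |c' t| ≤ E := hE t ht'
    have hD0 := (abs_nonneg _).trans d1
    have hE0 := (abs_nonneg _).trans d2
    have hC0 := (abs_nonneg _).trans a1
    have e1 := mul_nonneg hD0 hC0
    have e2 := mul_nonneg hE0 hC0
    have b1 : |c t * h t x| ≤ D * C := by rw [abs_mul]; gcongr
    have b2 : |c' t * h t x| ≤ E * C := by rw [abs_mul]; gcongr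
    have b3 : |c t * ht t x| ≤ D * C := by rw [abs_mul]; exact mul_le_mul d1 a2 (abs_nonneg _) hD0
    have b4 : |c t * hx t x| ≤ D * C := by rw [abs_mul]; gcongr
    have b5 : |c t * hxx t x| ≤ D * C := by rw [abs_mul]; gcongr
    refine ⟨by linarith, (abs_add_le _ _).trans (by linarith), by linarith, by linarith⟩

lemma cb12_space {φ : ℝ → ℝ} (h : ContDiff ℝ 2 φ) {C : ℝ}
    (hC : ∀ x, |φ x| ≤ C ∧ |deriv φ x| ≤ C ∧ |deriv (deriv φ) x| ≤ C) (hC0 : 0 ≤ C) :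
    IsCb12 T O (fun _ x => φ x) (fun _ _ => 0) (fun _ x => deriv φ x) (fun _ x => deriv (deriv φ) x) := by
  have h1 : ContDiff ℝ 1 (deriv φ) := (contDiff_succ_iff_deriv (n := 1)).1 (by simpa [one_add_one_eq_two] using h) |>.2.2
  have hd1 : Differentiable ℝ φ := h.differentiable (by norm_num)
  have hd2 : Differentiable ℝ (deriv φ) := h1.differentiable (by norm_num)
  have hc2 : Continuous (deriv (deriv φ)) := h1.continuous_deriv (by norm_num)
  refine ⟨(hd1.continuous.comp continuous_snd).continuousOn, continuousOn_const,
    (hd2.continuous.comp continuous_snd).continuousOn, (hc2.comp continuous_snd).continuousOn, ?_, ?_, ?_, ?_⟩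
  · intro t ht x hx; exact hasDerivWithinAt_const _ _ _
  · intro t ht x hx; exact (hd1 x).hasDerivAt.hasDerivWithinAt
  · intro t ht x hx; exact (hd2 x).hasDerivAt.hasDerivWithinAt
  · exact ⟨C, fun t _ x _ => ⟨(hC x).1, by simpa using hC0, (hC x).2.1, (hC x).2.2⟩⟩

/-- cutoffs. -/
def chi (R : ℝ) (x : ℝ) : ℝ := Real.smoothTransition ((x / R) ^ 2 - 1)

lemma chi_nonneg (R x : ℝ) : 0 ≤ chi R x := Real.smoothTransition.nonneg _
lemma chi_le_one (R x : ℝ) : chi R x ≤ 1 := Real.smoothTransition.le_one _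
lemma chi_zero {R x : ℝ} (hR : 0 < R) (hx : |x| ≤ R) : chi R x = 0 := by
  apply Real.smoothTransition.zero_of_nonpos
  have : |x / R| ≤ 1 := by rw [abs_div, abs_of_pos hR]; exact (div_le_one hR).2 hx
  have := (sq_le_one_iff_abs_le_one _).2 this
  linarith
lemma chi_one {R x : ℝ} (hR : 0 < R) (hx : 2 * R ≤ |x|) : chi R x = 1 := by
  apply Real.smoothTransition.one_of_one_le
  have : 2 ≤ |x / R| := by rw [abs_div, abs_of_pos hR]; exact (le_div_iff₀ hR).2 hx
  have h2 : (2:ℝ) ^ 2 ≤ |x / R| ^ 2 := by gcongr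
  rw [sq_abs] at h2
  linarith
lemma chi_contDiff (R : ℝ) {n : ℕ∞} : ContDiff ℝ n (chi R) := by
  unfold chi
  exact Real.smoothTransition.contDiff.comp (by fun_prop)

lemma chi_scale (R x : ℝ) : chi R x = chi 1 (x / R) := by simp [chi]

lemma chi_bd : ∃ C, 0 ≤ C ∧ ∀ R, 1 ≤ R → ∀ x, |deriv (chi R) x| ≤ C / R ∧ |deriv (deriv (chi R)) x| ≤ C / R := by
  have h1 : ContDiff ℝ 2 (chi 1) := chi_contDiff 1 (n := 2)
  have h2 : ContDiff ℝ 1 (deriv (chi 1)) := (contDiff_succ_iff_deriv (n := 1)).1 (by simpa [one_add_one_eq_two] using h1) |>.2.2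
  have hd1 : Differentiable ℝ (chi 1) := h1.differentiable (by norm_num)
  have hd2 : Differentiable ℝ (deriv (chi 1)) := h2.differentiable (by norm_num)
  have hz : ∀ x, 2 < |x| → chi 1 =ᶠ[𝓝 x] fun _ => 1 := by
    intro x hx
    have : ∀ᶠ y in 𝓝 x, 2 < |y| := continuous_abs.continuousAt.eventually_const_lt hx
    exact this.mono fun y hy => chi_one one_pos (by linarith)
  have hz1 : ∀ x, 2 < |x| → deriv (chi 1) x = 0 := fun x hx => by rw [(hz x hx).deriv_eq]; simp
  have hz2 : ∀ x, 2 < |x| → deriv (deriv (chi 1)) x = 0 := fun x hx => by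
    rw [(hz x hx).deriv.deriv_eq]; simp
  obtain ⟨C1, hC1⟩ := (isCompact_Icc (a := (-2:ℝ)) (b := 2)).exists_bound_of_continuousOn
    (hd2.continuous.continuousOn (s := Icc (-2) 2))
  obtain ⟨C2, hC2⟩ := (isCompact_Icc (a := (-2:ℝ)) (b := 2)).exists_bound_of_continuousOn
    ((h2.continuous_deriv (by norm_num)).continuousOn (s := Icc (-2) 2))
  have h0 : (0:ℝ) ∈ Icc (-2:ℝ) 2 := by norm_num
  have hC10 := (norm_nonneg _).trans (hC1 0 h0)
  have hC20 := (norm_nonneg _).trans (hC2 0 h0)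
  have b1 : ∀ x, |deriv (chi 1) x| ≤ C1 + C2 := by
    intro x
    by_cases hx : 2 < |x|
    · rw [hz1 x hx]; simp; linarith
    · exact (hC1 x (abs_le.1 (not_lt.1 hx))).trans (by linarith)
  have b2 : ∀ x, |deriv (deriv (chi 1)) x| ≤ C1 + C2 := by
    intro x
    by_cases hx : 2 < |x|
    · rw [hz2 x hx]; simp; linarith
    · exact (hC2 x (abs_le.1 (not_lt.1 hx))).trans (by linarith)
  refine ⟨C1 + C2, by linarith, fun R hR x => ?_⟩
  have hR0 : 0 < R := by linarith
  have e1 : deriv (chi R) = fun x => deriv (chi 1) (x / R) * (1 / R) := by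
    ext x
    have : chi R = fun y => chi 1 (y / R) := by ext y; exact chi_scale R y
    rw [this]
    exact ((hd1 (x / R)).hasDerivAt.comp x ((hasDerivAt_id x).div_const R)).deriv
  have e2 : deriv (deriv (chi R)) x = deriv (deriv (chi 1)) (x / R) * (1 / R) * (1 / R) := by
    rw [e1]
    exact (((hd2 (x / R)).hasDerivAt.comp x ((hasDerivAt_id x).div_const R)).mul_const _).deriv
  have hinv : 0 < 1 / R := by positivity
  have hinv1 : 1 / R ≤ 1 := by rw [div_le_one hR0]; exact hR
  have e3 : (C1 + C2) / R = (C1 + C2) * (1 / R) := by ring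
  rw [e2, e1, e3]
  simp only [abs_mul, abs_of_pos hinv]
  refine ⟨by gcongr; exact b1 _, ?_⟩
  calc |deriv (deriv (chi 1)) (x / R)| * (1 / R) * (1 / R) ≤ (C1 + C2) * (1 / R) * 1 := by
        gcongr
        exact b2 _
    _ = _ := by ring

end
end LPN
end

noncomputable section
namespace LPN

section
variable {T : ℝ} {O A : Set ℝ} {m0 : Measure ℝ} {B : ℝ}

lemma chi_m0 [IsProbabilityMeasure m0] (ε : ℝ) (hε : 0 < ε) :
    ∀ᶠ n : ℕ in atTop, ∫ x, chi n x ∂m0 ≤ ε := by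
  have h : Tendsto (fun n : ℕ => ∫ x, chi n x ∂m0) atTop (𝓝 (∫ x, (0:ℝ) ∂m0)) := by
    apply tendsto_integral_of_dominated_convergence (fun _ => (1:ℝ))
    · intro n; exact (chi_contDiff n (n := 0)).continuous.aestronglyMeasurable
    · exact integrable_const _
    · intro n; exact Eventually.of_forall fun x => by
        rw [Real.norm_eq_abs, abs_of_nonneg (chi_nonneg _ _)]; exact chi_le_one _ _
    · refine Eventually.of_forall fun x => ?_
      apply tendsto_const_nhds.congr'
      filter_upwards [eventually_gt_atTop ⌈|x|⌉₊] with n hn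
      have h1 : |x| ≤ n := (Nat.le_ceil _).trans (by exact_mod_cast hn.le)
      have h2 : (0:ℝ) < n := by exact_mod_cast (Nat.zero_le _).trans_lt hn
      exact (chi_zero h2 h1).symm
  rw [integral_zero] at h
  exact (h.eventually_lt_const hε).mono fun n hn => hn.le

lemma bm_chi (R : ℝ) : BM (fun _ p => chi R p.1) :=
  ⟨((chi_contDiff R (n := 0)).continuous.comp (by fun_prop : Continuous fun q : ℝ × ℝ × ℝ => q.2.1)).measurable,
    ⟨1, fun t p => by rw [abs_of_nonneg (chi_nonneg _ _)]; exact chi_le_one _ _⟩⟩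

lemma reg_tight (hT : 0 < T) [IsProbabilityMeasure m0] (B : ℝ) (ε : ℝ) (hε : 0 < ε) :
    ∃ R, 1 ≤ R ∧ ∀ μ m, Reg T O A m0 B μ m →
      ∫ p, chi R p.2 ∂μ ≤ ε ∧ I2 T m (fun _ p => chi R p.1) ≤ ε := by
  obtain ⟨C, hC0, hC⟩ := chi_bd
  let ε' := ε / (2 * (1 + T))
  have hε' : 0 < ε' := by positivity
  have hlim : Tendsto (fun n : ℕ => |B| * (C / n)) atTop (𝓝 (|B| * 0)) :=
    (tendsto_const_div_atTop_nhds_zero_nat C).const_mul _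
  rw [mul_zero] at hlim
  obtain ⟨n, hn1, hn2, hn3⟩ := ((chi_m0 (m0 := m0) ε' hε').and
    ((hlim.eventually_lt_const hε').and (eventually_ge_atTop 1))).exists
  have hR : (1:ℝ) ≤ n := by exact_mod_cast hn3
  have hCn : 0 ≤ C / n := by positivity
  have hBB : ∀ x : ℝ, 0 ≤ x → B * x ≤ |B| * x := fun x hx => mul_le_mul_of_nonneg_right (le_abs_self B) hx
  refine ⟨n, hR, fun μ m h => ?_⟩
  have := h.prob
  have hcb : IsCb12 T O (fun _ x => chi n x) (fun _ _ => 0) (fun _ x => deriv (chi n) x)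
      (fun _ x => deriv (deriv (chi n)) x) := by
    apply cb12_space (C := 1 + C / n) (chi_contDiff n (n := 2)) _ (by positivity)
    intro x
    refine ⟨?_, ?_, ?_⟩
    · rw [abs_of_nonneg (chi_nonneg _ _)]; linarith [chi_le_one n x]
    · linarith [(hC n hR x).1]
    · linarith [(hC n hR x).2]
  have h1 := h.ineq _ _ _ _ hcb (C / n) hCn (fun t _ x _ => hC n hR x)
  have h2 := h.ineq _ _ _ _ (cb12_tmul hcb (c := fun t => T - t) (c' := fun _ => -1)
    (fun t _ => by simpa using (hasDerivWithinAt_id t (Icc 0 T)).const_sub T) continuousOn_const)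
    (T * (C / n)) (by positivity) (fun t ht x _ => by
      have : |T - t| ≤ T := by rw [abs_of_nonneg (by linarith [ht.2])]; linarith [ht.1]
      simp only [abs_mul]
      exact ⟨mul_le_mul this (hC n hR x).1 (abs_nonneg _) hT.le,
        mul_le_mul this (hC n hR x).2 (abs_nonneg _) hT.le⟩)
  have e0 : I2 T m (fun _ _ => 0) = 0 := by simp [I2]
  have e1 : I2 T m (fun t p => -1 * chi n p.1 + (T - t) * 0) = - I2 T m (fun _ p => chi n p.1) := by
    simp only [mul_zero, add_zero]
    rw [I2_cmul]; ring
  have e2 : 0 ≤ ∫ p : ℝ × ℝ, (T - p.1) * chi n p.2 ∂μ := by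
    apply integral_nonneg_of_ae
    filter_upwards [h.ae] with p hp
    exact mul_nonneg (by linarith [hp.1.2]) (chi_nonneg _ _)
  have e3 : ∫ x, (T - 0) * chi n x ∂m0 = T * ∫ x, chi n x ∂m0 := by
    rw [sub_zero, integral_const_mul]
  rw [e0] at h1
  rw [e1, e3] at h2
  have h1' := (abs_le.1 h1).2
  have h2' := (abs_le.1 h2).2
  have hb := hBB (C / n) hCn
  have hε2 : ε' * (2 * (1 + T)) = ε := div_mul_cancel₀ _ (by positivity)
  have hTε : 0 < T * ε' := by positivity
  constructor
  · nlinarith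
  · have : B * (T * (C / n)) ≤ T * ε' := by nlinarith
    have : T * ∫ x, chi n x ∂m0 ≤ T * ε' := by gcongr
    nlinarith

/-- Key estimate: time regularity in weak form. -/
lemma zker0 (hT : 0 < T) [IsProbabilityMeasure m0] {μ m} (H : Reg T O A m0 B μ m)
    (hm0 : m0 Oᶜ = 0) {h ht hx hxx : ℝ → ℝ → ℝ} (hc : IsCb12 T O h ht hx hxx)
    {C : ℝ} (hC : ∀ t ∈ Icc (0:ℝ) T, ∀ x ∈ closure O,
      |h t x| ≤ C ∧ |ht t x| ≤ C ∧ |hx t x| ≤ C ∧ |hxx t x| ≤ C) (hC0 : 0 ≤ C)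
    {g : ℝ → ℝ} (hg : Continuous g) {δ : ℝ} (hδ0 : 0 ≤ δ)
    (hδ : ∀ t ∈ Icc 0 T, |∫ s in t..T, g s| ≤ δ) :
    |∫ t in Icc 0 T, g t * ∫ p, cut T O h t p ∂(m t)| ≤ C * (2 + T + |B|) * δ := by
  have := H.prob
  let G : ℝ → ℝ := fun t => ∫ s in t..T, g s
  have hG : ∀ t, HasDerivAt G (- g t) t := fun t =>
    intervalIntegral.integral_hasDerivAt_left (hg.intervalIntegrable _ _)
      (hg.stronglyMeasurableAtFilter _ _) hg.continuousAt
  have hGc : Continuous G := continuous_iff_continuousAt.2 fun t => (hG t).continuousAt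
  have h1 := H.ineq _ _ _ _ (cb12_tmul hc (c := G) (c' := fun t => - g t)
    (fun t _ => (hG t).hasDerivWithinAt) hg.neg.continuousOn) (δ * C) (by positivity)
    (fun t ht x hx => by
      obtain ⟨_, _, a, b⟩ := hC t ht x hx
      simp only [abs_mul]
      exact ⟨mul_le_mul (hδ t ht) a (abs_nonneg _) hδ0, mul_le_mul (hδ t ht) b (abs_nonneg _) hδ0⟩)
  have k1 : |∫ p : ℝ × ℝ, G p.1 * h p.1 p.2 ∂μ| ≤ δ * C := by
    have := norm_integral_le_of_norm_le_const (μ := μ) (f := fun p : ℝ × ℝ => G p.1 * h p.1 p.2) (C := δ * C)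
      (H.ae.mono fun p hp => by
        rw [Real.norm_eq_abs, abs_mul]
        exact mul_le_mul (hδ _ hp.1) (hC _ hp.1 _ hp.2).1 (abs_nonneg _) hδ0)
    simpa using this
  have hm0ae : ∀ᵐ x ∂m0, x ∈ closure O := by
    have : ∀ᵐ x ∂m0, x ∈ O := by rw [ae_iff]; exact hm0
    exact this.mono fun x hx => subset_closure hx
  have h0T : (0:ℝ) ∈ Icc 0 T := ⟨le_rfl, hT.le⟩
  have k2 : |∫ x : ℝ, G 0 * h 0 x ∂m0| ≤ δ * C := by
    have := norm_integral_le_of_norm_le_const (μ := m0) (f := fun x : ℝ => G 0 * h 0 x) (C := δ * C)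
      (hm0ae.mono fun x hx => by
        rw [Real.norm_eq_abs, abs_mul]
        exact mul_le_mul (hδ _ h0T) (hC _ h0T _ hx).1 (abs_nonneg _) hδ0)
    simpa using this
  have bh : BM (cut T O h) := (cut_car (A := A) hc.cont ⟨C, fun t ht x hx => (hC t ht x hx).1⟩).bm
  have bht : BM (cut T O ht) := (cut_car (A := A) hc.cont_t ⟨C, fun t ht x hx => (hC t ht x hx).2.1⟩).bm
  obtain ⟨Dg, hDg⟩ := isCompact_Icc.exists_bound_of_continuousOn (hg.continuousOn (s := Icc 0 T))
  have bg : BM (fun t _ => (Icc 0 T).indicator g t) := BM.time (hg.measurable.indicator measurableSet_Icc)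
    ⟨|Dg|, fun t => by
      by_cases ht : t ∈ Icc 0 T
      · rw [indicator_of_mem ht]; exact (hDg t ht).trans (le_abs_self _)
      · rw [indicator_of_notMem ht]; simp⟩
  have bG : BM (fun t _ => (Icc 0 T).indicator G t) := BM.time (hGc.measurable.indicator measurableSet_Icc)
    ⟨δ, fun t => by
      by_cases ht : t ∈ Icc 0 T
      · rw [indicator_of_mem ht]; exact hδ t ht
      · rw [indicator_of_notMem ht]; simpa using hδ0⟩
  have e1 : I2 T m (fun t p => - g t * h t p.1 + G t * ht t p.1)
      = I2 T m (fun t p => (-1) * ((Icc 0 T).indicator g t * cut T O h t p) +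
        (Icc 0 T).indicator G t * cut T O ht t p) := by
    apply H.fl.I2_congr
    intro t ht p hp
    rw [indicator_of_mem ht, indicator_of_mem ht, cut_eq ht hp.1, cut_eq ht hp.1]; ring
  have e2 : I2 T m (fun t p => (Icc 0 T).indicator g t * cut T O h t p) =
      ∫ t in Icc 0 T, g t * ∫ p, cut T O h t p ∂(m t) := by
    unfold I2
    apply setIntegral_congr_fun measurableSet_Icc
    intro t ht
    simp only [indicator_of_mem ht]
    rw [integral_const_mul]
  have e3 : |I2 T m (fun t p => (Icc 0 T).indicator G t * cut T O ht t p)| ≤ δ * C * T := by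
    apply H.fl.I2_abs_const hT.le (by positivity) (bG.mul bht)
    intro t ht p hp
    rw [indicator_of_mem ht, cut_eq ht hp.1, abs_mul]
    exact mul_le_mul (hδ t ht) (hC t ht _ hp.1).2.1 (abs_nonneg _) hδ0
  rw [e1, H.fl.I2_add ((bg.mul bh).cmul _) (bG.mul bht), I2_cmul, e2] at h1
  have hB : B * (δ * C) ≤ |B| * (δ * C) := mul_le_mul_of_nonneg_right (le_abs_self B) (by positivity)
  rw [abs_le] at *
  constructor <;> nlinarith

lemma zker (hT : 0 < T) [IsProbabilityMeasure m0] {μ m} (H : Reg T O A m0 B μ m)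
    (hm0 : m0 Oᶜ = 0) {h ht hx hxx : ℝ → ℝ → ℝ} (hc : IsCb12 T O h ht hx hxx)
    {C : ℝ} (hC : ∀ t ∈ Icc (0:ℝ) T, ∀ x ∈ closure O,
      |h t x| ≤ C ∧ |ht t x| ≤ C ∧ |hx t x| ≤ C ∧ |hxx t x| ≤ C) (hC0 : 0 ≤ C)
    {g : ℝ → ℝ} (hg : Measurable g) (hgb : ∃ M, ∀ t, |g t| ≤ M) {δ : ℝ} (hδ0 : 0 ≤ δ)
    (hδ : ∀ t ∈ Icc 0 T, |∫ s in t..T, g s| ≤ δ) :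
    |∫ t in Icc 0 T, g t * ∫ p, cut T O h t p ∂(m t)| ≤ C * (2 + T + |B|) * δ := by
  obtain ⟨M, hM⟩ := hgb
  have bh : BM (cut T O h) := (cut_car (A := A) hc.cont ⟨C, fun t ht x hx => (hC t ht x hx).1⟩).bm
  have hgi : ∀ a b, IntervalIntegrable g volume a b := fun a b => by
    rw [intervalIntegrable_iff]
    exact Measure.integrableOn_of_bounded (M := M) (by simp) hg.aestronglyMeasurable
      (Eventually.of_forall hM)
  have hgI : IntegrableOn g (Icc 0 T) :=
    Measure.integrableOn_of_bounded (M := M) (by simp) hg.aestronglyMeasurable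
      (Eventually.of_forall hM)
  apply le_of_forall_pos_le_add
  intro ε hε
  let K := C * (2 + T + |B|) + C + 1
  have hK : 0 < K := by positivity
  obtain ⟨g', hg', -⟩ := hgI.exists_boundedContinuous_integral_sub_le (ε := ε / K) (by positivity)
  have hg'c := g'.continuous
  have hg'I : IntegrableOn g' (Icc 0 T) := hg'c.continuousOn.integrableOn_Icc
  have hdI : IntegrableOn (fun t => g t - g' t) (Icc 0 T) := hgI.sub hg'I
  have h1 := zker0 hT H hm0 hc hC hC0 hg'c (δ := δ + ε / K) (by positivity) (fun t ht => by
    have e : ∫ s in t..T, g' s = (∫ s in t..T, g s) - ∫ s in t..T, (g s - g' s) := by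
      rw [intervalIntegral.integral_sub (hgi _ _) (hg'c.intervalIntegrable _ _)]; ring
    have e2 : |∫ s in t..T, (g s - g' s)| ≤ ε / K := by
      rw [intervalIntegral.integral_of_le ht.2]
      calc |∫ s in Ioc t T, (g s - g' s)| ≤ ∫ s in Ioc t T, |g s - g' s| := abs_integral_le_integral_abs
        _ ≤ ∫ s in Icc 0 T, |g s - g' s| := setIntegral_mono_set hdI.abs
            (Eventually.of_forall fun _ => abs_nonneg _)
            (LE.le.eventuallyLE (fun s hs => ⟨ht.1.trans hs.1.le, hs.2⟩))
        _ ≤ ε / K := hg'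
    rw [e]
    exact (abs_sub _ _).trans (add_le_add (hδ t ht) e2))
  have hzb : ∀ t ∈ Icc 0 T, |∫ p, cut T O h t p ∂(m t)| ≤ C := fun t ht =>
    H.fl.zbd hC0 t fun p hp => by rw [cut_eq ht hp.1]; exact (hC t ht _ hp.1).1
  have hzm := H.fl.zmeas bh
  have i1 : IntegrableOn (fun t => g' t * ∫ p, cut T O h t p ∂(m t)) (Icc 0 T) := by
    apply Integrable.mul_bdd (c := C) hg'I hzm.aestronglyMeasurable
    exact (ae_restrict_mem measurableSet_Icc).mono hzb
  have i2 : IntegrableOn (fun t => (g t - g' t) * ∫ p, cut T O h t p ∂(m t)) (Icc 0 T) := by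
    apply Integrable.mul_bdd (c := C) hdI hzm.aestronglyMeasurable
    exact (ae_restrict_mem measurableSet_Icc).mono hzb
  have e3 : ∫ t in Icc 0 T, g t * ∫ p, cut T O h t p ∂(m t) =
      (∫ t in Icc 0 T, g' t * ∫ p, cut T O h t p ∂(m t)) +
      ∫ t in Icc 0 T, (g t - g' t) * ∫ p, cut T O h t p ∂(m t) := by
    rw [← integral_add i1 i2]
    congr 1; ext t; ring
  have e4 : |∫ t in Icc 0 T, (g t - g' t) * ∫ p, cut T O h t p ∂(m t)| ≤ C * (ε / K) := by
    calc _ ≤ ∫ t in Icc 0 T, |(g t - g' t) * ∫ p, cut T O h t p ∂(m t)| := abs_integral_le_integral_abs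
      _ ≤ ∫ t in Icc 0 T, C * |g t - g' t| := by
        apply setIntegral_mono_on i2.abs (hdI.abs.const_mul _) measurableSet_Icc
        intro t ht
        rw [abs_mul, mul_comm]
        exact mul_le_mul_of_nonneg_right (hzb t ht) (abs_nonneg _)
      _ ≤ C * (ε / K) := by
        rw [integral_const_mul]
        gcongr
        exact hg'
  rw [e3]
  refine (abs_add_le _ _).trans ?_
  have e5 : K * (ε / K) = ε := mul_div_cancel₀ _ hK.ne'
  have e6 : 0 < ε / K := by positivity
  have : C * (2 + T + |B|) * (ε / K) + C * (ε / K) ≤ K * (ε / K) := by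
    rw [← add_mul]; gcongr; simp [K]
  nlinarith
end
end LPN
end

noncomputable section
namespace LPN

/-- convergence of pairs -/
structure Cv (T : ℝ) (O A : Set ℝ) (μn : ℕ → Measure (ℝ × ℝ)) (mn : ℕ → ℝ → Measure (ℝ × ℝ))
    (μ : Measure (ℝ × ℝ)) (m : ℝ → Measure (ℝ × ℝ)) : Prop where
  c1 : ∀ h : ℝ × ℝ → ℝ, Continuous h → (∃ C, ∀ p, |h p| ≤ C) →
    Tendsto (fun n => ∫ p, h p ∂(μn n)) atTop (𝓝 (∫ p, h p ∂μ))
  c2 : ∀ F, Car (closure O ×ˢ A) F → Tendsto (fun n => I2 T (mn n) F) atTop (𝓝 (I2 T m F))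

/-- total boundedness of primitives. -/
lemma prim_net (T δ : ℝ) (hδ : 0 < δ) :
    ∃ (S : Set (ℝ → ℝ)), S.Finite ∧ (∀ s ∈ S, Measurable s ∧ ∀ t, |s t| ≤ 1) ∧
      ∀ g : ℝ → ℝ, Measurable g → (∀ t, |g t| ≤ 1) → ∃ s ∈ S, ∀ t ∈ Icc 0 T,
        |∫ r in t..T, (g r - s r)| ≤ δ := by
  let 𝒢 := {g : ℝ → ℝ // Measurable g ∧ ∀ t, |g t| ≤ 1}
  have hgi : ∀ g : 𝒢, ∀ a b, IntervalIntegrable g.1 volume a b := fun g a b => by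
    rw [intervalIntegrable_iff]
    exact Measure.integrableOn_of_bounded (M := 1) (by simp) g.2.1.aestronglyMeasurable
      (Eventually.of_forall g.2.2)
  have hlip : ∀ g : 𝒢, LipschitzWith 1 (fun t : Icc 0 T => ∫ r in (t:ℝ)..T, g.1 r) := by
    intro g
    apply LipschitzWith.of_dist_le_mul
    intro x y
    rw [Real.dist_eq, show (∫ r in (x:ℝ)..T, g.1 r) - ∫ r in (y:ℝ)..T, g.1 r = ∫ r in (x:ℝ)..y, g.1 r by
      rw [sub_eq_iff_eq_add, intervalIntegral.integral_add_adjacent_intervals (hgi g _ _) (hgi g _ _)]]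
    have := intervalIntegral.norm_integral_le_of_norm_le_const (f := g.1) (a := x) (b := y) (C := 1)
      (fun t _ => g.2.2 t)
    simp only [NNReal.coe_one, one_mul, Subtype.dist_eq]
    rw [Real.dist_eq, abs_sub_comm (x:ℝ)]
    simpa using this
  let Φ : 𝒢 → BoundedContinuousFunction (Icc 0 T) ℝ := fun g =>
    BoundedContinuousFunction.mkOfCompact ⟨_, (hlip g).continuous⟩
  have hcomp : IsCompact (closure (range Φ)) := by
    apply BoundedContinuousFunction.arzela_ascoli (Icc (-|T|) |T|) isCompact_Icc
    · rintro _ x ⟨g, rfl⟩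
      have := intervalIntegral.norm_integral_le_of_norm_le_const (f := g.1) (a := x) (b := T) (C := 1)
        (fun t _ => g.2.2 t)
      rw [one_mul, Real.norm_eq_abs] at this
      have h2 : |T - x| ≤ |T| := by
        rw [abs_of_nonneg (by linarith [x.2.2]), abs_of_nonneg (x.2.1.trans x.2.2)]; linarith [x.2.1]
      exact abs_le.1 (this.trans h2)
    · apply UniformEquicontinuous.equicontinuous
      refine LipschitzWith.uniformEquicontinuous _ 1 ?_
      rintro ⟨_, g, rfl⟩
      exact hlip g
  have htb : TotallyBounded (range Φ) := hcomp.totallyBounded.subset subset_closure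
  obtain ⟨t, hts, htf, htc⟩ := totallyBounded_iff_subset.1 htb _ (Metric.dist_mem_uniformity hδ)
  have : Nonempty 𝒢 := ⟨⟨fun _ => 0, measurable_const, by simp⟩⟩
  have hts' : ∀ y, y ∈ t → ∃ g : 𝒢, Φ g = y := fun y hy => hts hy
  choose! ψ hψ using hts'
  refine ⟨(fun f => (ψ f).1) '' t, htf.image _, ?_, ?_⟩
  · rintro _ ⟨f, hf, rfl⟩
    exact (ψ f).2
  · intro g hg hgb
    have : Φ ⟨g, hg, hgb⟩ ∈ ⋃ y ∈ t, {x | (x, y) ∈ {p : BoundedContinuousFunction (Icc 0 T) ℝ × BoundedContinuousFunction (Icc 0 T) ℝ | dist p.1 p.2 < δ}} := htc ⟨_, rfl⟩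
    simp only [mem_iUnion] at this
    obtain ⟨y, hy, hd⟩ := this
    refine ⟨_, ⟨y, hy, rfl⟩, fun r hr => ?_⟩
    have h1 : dist (Φ ⟨g, hg, hgb⟩) (Φ (ψ y)) < δ := by rw [hψ y hy]; exact hd
    have h2 := (BoundedContinuousFunction.dist_coe_le_dist (f := Φ ⟨g, hg, hgb⟩) (g := Φ (ψ y)) ⟨r, hr⟩).trans h1.le
    rw [intervalIntegral.integral_sub (hgi ⟨g, hg, hgb⟩ _ _) (hgi (ψ y) _ _)]
    exact h2

section
variable {T : ℝ} {O A : Set ℝ} {m0 : Measure ℝ} {B : ℝ}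

lemma z_L1_smooth (hT : 0 < T) [IsProbabilityMeasure m0] (hm0 : m0 Oᶜ = 0)
    {μn : ℕ → Measure (ℝ × ℝ)} {mn : ℕ → ℝ → Measure (ℝ × ℝ)} {μ m}
    (H : ∀ n, Reg T O A m0 B (μn n) (mn n)) (H0 : Reg T O A m0 B μ m) (hcv : Cv T O A μn mn μ m)
    {h ht hx hxx : ℝ → ℝ → ℝ} (hc : IsCb12 T O h ht hx hxx) :
    Tendsto (fun n => ∫ t in Icc 0 T, |∫ p, cut T O h t p ∂(mn n t) - ∫ p, cut T O h t p ∂(m t)|)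
      atTop (𝓝 0) := by
  obtain ⟨C', hC'⟩ := hc.bdd
  set C := |C'| with hCdef
  have hC0 : 0 ≤ C := abs_nonneg _
  have hC : ∀ t ∈ Icc (0:ℝ) T, ∀ x ∈ closure O,
      |h t x| ≤ C ∧ |ht t x| ≤ C ∧ |hx t x| ≤ C ∧ |hxx t x| ≤ C := fun t a x b => by
    obtain ⟨h1, h2, h3, h4⟩ := hC' t a x b
    have := le_abs_self C'
    exact ⟨by linarith, by linarith, by linarith, by linarith⟩
  have hcar : Car (closure O ×ˢ A) (cut T O h) := cut_car hc.cont ⟨C, fun t ht x hx => (hC t ht x hx).1⟩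
  have bh := hcar.bm
  rw [Metric.tendsto_atTop]
  intro ε hε
  let K := C * (2 + T + |B|) + 1
  have hK : 0 < K := by positivity
  obtain ⟨S, hSf, hS, hnet⟩ := prim_net T (ε / (4 * K)) (by positivity)
  -- convergence for the finitely many members of the net
  have hlim : ∀ s ∈ S, Tendsto (fun n => ∫ t in Icc 0 T, s t *
      (∫ p, cut T O h t p ∂(mn n t) - ∫ p, cut T O h t p ∂(m t))) atTop (𝓝 0) := by
    intro s hs
    have hcs : Car (closure O ×ˢ A) (fun t p => s t * cut T O h t p) :=
      Car.mul ⟨(hS s hs).1.comp measurable_fst, fun t => continuousOn_const, ⟨1, fun t p => (hS s hs).2 t⟩⟩ hcar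
    have h1 := hcv.c2 _ hcs
    have h2 : Tendsto (fun n => I2 T (mn n) (fun t p => s t * cut T O h t p) -
        I2 T m (fun t p => s t * cut T O h t p)) atTop (𝓝 0) := by
      simpa using h1.sub_const (I2 T m (fun t p => s t * cut T O h t p))
    refine h2.congr fun n => ?_
    unfold I2
    rw [← integral_sub ((H n).fl.zint hcs.bm) (H0.fl.zint hcs.bm)]
    congr 1; ext t
    rw [integral_const_mul, integral_const_mul]; ring
  have hev : ∀ᶠ n in atTop, ∀ s ∈ S, |∫ t in Icc 0 T, s t *
      (∫ p, cut T O h t p ∂(mn n t) - ∫ p, cut T O h t p ∂(m t))| < ε / 4 := by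
    rw [eventually_all_finite hSf]
    intro s hs
    have := (Metric.tendsto_nhds.1 (hlim s hs)) (ε / 4) (by positivity)
    simpa [Real.dist_eq] using this
  obtain ⟨N, hN⟩ := eventually_atTop.1 hev
  refine ⟨N, fun n hn => ?_⟩
  set E : ℝ → ℝ := fun t => ∫ p, cut T O h t p ∂(mn n t) - ∫ p, cut T O h t p ∂(m t) with hE
  have hEm : Measurable E := ((H n).fl.zmeas bh).sub (H0.fl.zmeas bh)
  have hEi : IntegrableOn E (Icc 0 T) := ((H n).fl.zint bh).sub (H0.fl.zint bh)
  let g : ℝ → ℝ := fun t => if 0 ≤ E t then 1 else -1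
  have hgm : Measurable g := Measurable.ite (measurableSet_le measurable_const hEm) measurable_const measurable_const
  have hgb : ∀ t, |g t| ≤ 1 := fun t => by simp only [g]; split_ifs <;> simp
  have hgE : ∀ t, g t * E t = |E t| := fun t => by
    simp only [g]; split_ifs with h
    · rw [abs_of_nonneg h, one_mul]
    · rw [abs_of_neg (not_le.1 h)]; ring
  obtain ⟨s, hs, hsd⟩ := hnet g hgm hgb
  have hdm : Measurable (fun t => g t - s t) := hgm.sub (hS s hs).1
  have hdb : ∃ M, ∀ t, |g t - s t| ≤ M := ⟨1 + 1, fun t => (abs_sub _ _).trans (add_le_add (hgb t) ((hS s hs).2 t))⟩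
  have k1 := zker hT (H n) hm0 hc hC hC0 hdm hdb (by positivity) hsd
  have k2 := zker hT H0 hm0 hc hC hC0 hdm hdb (by positivity) hsd
  have hs1 : IntegrableOn (fun t => s t * E t) (Icc 0 T) :=
    Integrable.bdd_mul (c := 1) hEi (hS s hs).1.aestronglyMeasurable (Eventually.of_forall (hS s hs).2)
  obtain ⟨M, hM⟩ := hdb
  have j1 : IntegrableOn (fun t => (g t - s t) * ∫ p, cut T O h t p ∂(mn n t)) (Icc 0 T) :=
    Integrable.bdd_mul (c := M) ((H n).fl.zint bh) hdm.aestronglyMeasurable (Eventually.of_forall hM)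
  have j2 : IntegrableOn (fun t => (g t - s t) * ∫ p, cut T O h t p ∂(m t)) (Icc 0 T) :=
    Integrable.bdd_mul (c := M) (H0.fl.zint bh) hdm.aestronglyMeasurable (Eventually.of_forall hM)
  have e1 : ∫ t in Icc 0 T, |E t| = (∫ t in Icc 0 T, s t * E t) +
      ((∫ t in Icc 0 T, (g t - s t) * ∫ p, cut T O h t p ∂(mn n t)) -
      ∫ t in Icc 0 T, (g t - s t) * ∫ p, cut T O h t p ∂(m t)) := by
    rw [← integral_sub' j1 j2, ← integral_add hs1 (j1.sub j2)]
    congr 1; ext t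
    rw [← hgE t]; simp only [hE, Pi.sub_apply]; ring
  have k3 := hN n hn s hs
  have k4 : C * (2 + T + |B|) * (ε / (4 * K)) ≤ ε / 4 := by
    have : K * (ε / (4 * K)) = ε / 4 := by field_simp
    rw [← this]
    have : 0 < ε / (4 * K) := by positivity
    gcongr
    simp [K]
  rw [Real.dist_eq, sub_zero, e1]
  have := abs_add_le (∫ t in Icc 0 T, s t * E t) ((∫ t in Icc 0 T, (g t - s t) * ∫ p, cut T O h t p ∂(mn n t)) -
      ∫ t in Icc 0 T, (g t - s t) * ∫ p, cut T O h t p ∂(m t))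
  have := abs_sub (∫ t in Icc 0 T, (g t - s t) * ∫ p, cut T O h t p ∂(mn n t))
      (∫ t in Icc 0 T, (g t - s t) * ∫ p, cut T O h t p ∂(m t))
  linarith
end
end LPN
end

noncomputable section
namespace LPN

section
variable {T : ℝ} {O A : Set ℝ} {m0 : Measure ℝ} {B : ℝ}

lemma cb12_smooth {g : ℝ × ℝ → ℝ} (hg : ContDiff ℝ 2 g) (R : ℝ)
    (hs : ∀ t x, R < |x| → g (t, x) = 0) :
    ∃ gt gx gxx, IsCb12 T O (fun t x => g (t, x)) gt gx gxx := by
  have hd : Differentiable ℝ g := hg.differentiable (by norm_num)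
  have h1 : ContDiff ℝ 1 (fderiv ℝ g) := hg.fderiv_right (by norm_num)
  let gx : ℝ × ℝ → ℝ := fun q => fderiv ℝ g q (0, 1)
  have hgx : ContDiff ℝ 1 gx := h1.clm_apply contDiff_const
  have hgxd : Differentiable ℝ gx := hgx.differentiable (by norm_num)
  let gt : ℝ × ℝ → ℝ := fun q => fderiv ℝ g q (1, 0)
  have hgt : Continuous gt := (h1.clm_apply contDiff_const).continuous
  let gxx : ℝ × ℝ → ℝ := fun q => fderiv ℝ gx q (0, 1)
  have hgxx : Continuous gxx := ((hgx.continuous_fderiv (by norm_num)).clm_apply continuous_const)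
  have dx : ∀ {k : ℝ × ℝ → ℝ}, Differentiable ℝ k → ∀ t x, HasDerivAt (fun y => k (t, y)) (fderiv ℝ k (t, x) (0, 1)) x := by
    intro k hk t x
    have : HasDerivAt (fun y : ℝ => (t, y)) ((0:ℝ), (1:ℝ)) x := (hasDerivAt_const x t).prodMk (hasDerivAt_id x)
    exact (hk (t, x)).hasFDerivAt.comp_hasDerivAt x this
  have dt : ∀ t x, HasDerivAt (fun s => g (s, x)) (gt (t, x)) t := by
    intro t x
    have : HasDerivAt (fun y : ℝ => (y, x)) ((1:ℝ), (0:ℝ)) t := (hasDerivAt_id t).prodMk (hasDerivAt_const t x)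
    exact (hd (t, x)).hasFDerivAt.comp_hasDerivAt t this
  refine ⟨fun t x => gt (t, x), fun t x => gx (t, x), fun t x => gxx (t, x),
    hg.continuous.continuousOn, hgt.continuousOn, hgx.continuous.continuousOn, hgxx.continuousOn,
    fun t _ x _ => (dt t x).hasDerivWithinAt, fun t _ x _ => (dx hd t x).hasDerivWithinAt,
    fun t _ x _ => (dx hgxd t x).hasDerivWithinAt, ?_⟩
  have hK : IsCompact (Icc 0 T ×ˢ Icc (-R) R) := isCompact_Icc.prod isCompact_Icc
  obtain ⟨C1, hC1⟩ := hK.exists_bound_of_continuousOn hg.continuous.continuousOn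
  obtain ⟨C2, hC2⟩ := hK.exists_bound_of_continuousOn hgt.continuousOn
  obtain ⟨C3, hC3⟩ := hK.exists_bound_of_continuousOn hgx.continuous.continuousOn
  obtain ⟨C4, hC4⟩ := hK.exists_bound_of_continuousOn hgxx.continuousOn
  refine ⟨|C1| + |C2| + |C3| + |C4|, fun t ht x _ => ?_⟩
  have n1 := abs_nonneg C1
  have n2 := abs_nonneg C2
  have n3 := abs_nonneg C3
  have n4 := abs_nonneg C4
  by_cases hx : R < |x|
  · have z0 : g =ᶠ[𝓝 (t, x)] fun _ => 0 := by
      have : ∀ᶠ q : ℝ × ℝ in 𝓝 (t, x), R < |q.2| :=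
        (continuous_abs.comp continuous_snd).continuousAt.eventually_const_lt hx
      exact this.mono fun q hq => hs q.1 q.2 hq
    have z1 : gx =ᶠ[𝓝 (t, x)] fun _ => 0 := by
      refine (z0.fderiv (𝕜 := ℝ)).mono fun q hq => ?_
      simp only [gx, hq]; simp
    have e0 := z0.eq_of_nhds
    have e1 := z1.eq_of_nhds
    have e2 : gt (t, x) = 0 := by simp only [gt, z0.fderiv_eq (𝕜 := ℝ)]; simp
    have e3 : gxx (t, x) = 0 := by simp only [gxx, z1.fderiv_eq (𝕜 := ℝ)]; simp
    rw [e0, e1, e2, e3]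
    simp; positivity
  · have hm : (t, x) ∈ Icc 0 T ×ˢ Icc (-R) R := ⟨ht, abs_le.1 (not_lt.1 hx)⟩
    have q1 := hC1 _ hm
    have q2 := hC2 _ hm
    have q3 := hC3 _ hm
    have q4 := hC4 _ hm
    rw [Real.norm_eq_abs] at q1 q2 q3 q4
    have := le_abs_self C1
    have := le_abs_self C2
    have := le_abs_self C3
    have := le_abs_self C4
    exact ⟨by linarith, by linarith, by linarith, by linarith⟩

lemma smooth_approx {h : ℝ → ℝ → ℝ}
    (hc : ContinuousOn (fun p : ℝ × ℝ => h p.1 p.2) (Icc 0 T ×ˢ closure O)) {C : ℝ} (hC0 : 0 ≤ C)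
    (hb : ∀ t ∈ Icc (0:ℝ) T, ∀ x ∈ closure O, |h t x| ≤ C) {R ε : ℝ} (hR : 1 ≤ R) (hε : 0 < ε) :
    ∃ g : ℝ × ℝ → ℝ, ContDiff ℝ 2 g ∧ (∃ gt gx gxx, IsCb12 T O (fun t x => g (t, x)) gt gx gxx) ∧
      (∀ p, |g p| ≤ C + ε) ∧
      ∀ t ∈ Icc (0:ℝ) T, ∀ x ∈ closure O, |h t x - g (t, x)| ≤ ε + C * chi R x := by
  obtain ⟨k, hk, hkb, hke⟩ := ext_cont hc hC0 hb
  have hchi : Continuous (chi R) := (chi_contDiff R (n := 0)).continuous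
  have hkc : Continuous (fun q : ℝ × ℝ => k q * (1 - chi R q.2)) := by fun_prop
  obtain ⟨g, hg, hgd, hgs⟩ := hkc.exists_contDiff_approx 2 (ε := fun _ => ε) continuous_const (fun _ => hε)
  have hk2 : ∀ q : ℝ × ℝ, |k q * (1 - chi R q.2)| ≤ C := fun q => by
    rw [abs_mul, abs_of_nonneg (by linarith [chi_le_one R q.2] : 0 ≤ 1 - chi R q.2)]
    calc _ ≤ C * 1 := by
          gcongr
          · linarith [chi_le_one R q.2]
          · exact hkb q
          · linarith [chi_nonneg R q.2]
      _ = C := mul_one _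
  refine ⟨g, hg, cb12_smooth hg (2 * R) ?_, ?_, ?_⟩
  · intro t x hx
    by_contra hne
    have := hgs (Function.mem_support.2 hne)
    rw [Function.mem_support] at this
    apply this
    rw [chi_one (by linarith) hx.le]; simp
  · intro p
    have h1 := hgd p
    rw [Real.dist_eq] at h1
    have h2 := hk2 p
    have := abs_add_le (g p - k p * (1 - chi R p.2)) (k p * (1 - chi R p.2))
    rw [sub_add_cancel] at this
    linarith
  · intro t ht x hx
    have h1 := hgd (t, x)
    rw [Real.dist_eq, hke t ht x hx, abs_sub_comm] at h1
    simp only at h1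
    have h2 : |h t x * chi R x| ≤ C * chi R x := by
      rw [abs_mul, abs_of_nonneg (chi_nonneg R x)]
      exact mul_le_mul_of_nonneg_right (hb t ht x hx) (chi_nonneg R x)
    have := abs_add_le (h t x * (1 - chi R x) - g (t, x)) (h t x * chi R x)
    have e : h t x * (1 - chi R x) - g (t, x) + h t x * chi R x = h t x - g (t, x) := by ring
    rw [e] at this
    linarith

lemma Fl.zdist {m} (h : Fl O A m) {F G : ℝ → ℝ × ℝ → ℝ} (hF : BM F) (hG : BM G) :
    ∫ t in Icc 0 T, |∫ p, F t p ∂(m t) - ∫ p, G t p ∂(m t)| ≤ I2 T m (fun t p => |F t p - G t p|) := by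
  unfold I2
  apply integral_mono ((h.zint hF).sub (h.zint hG)).abs (h.zint (hF.sub hG).abs)
  intro t
  simp only [Pi.sub_apply]
  rw [← integral_sub (h.inner_int hF t) (h.inner_int hG t)]
  exact abs_integral_le_integral_abs

lemma z_L1 (hT : 0 < T) [IsProbabilityMeasure m0] (hm0 : m0 Oᶜ = 0)
    {μn : ℕ → Measure (ℝ × ℝ)} {mn : ℕ → ℝ → Measure (ℝ × ℝ)} {μ m}
    (H : ∀ n, Reg T O A m0 B (μn n) (mn n)) (H0 : Reg T O A m0 B μ m) (hcv : Cv T O A μn mn μ m)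
    {h : ℝ → ℝ → ℝ}
    (hc : ContinuousOn (fun p : ℝ × ℝ => h p.1 p.2) (Icc 0 T ×ˢ closure O)) {C : ℝ}
    (hb : ∀ t ∈ Icc (0:ℝ) T, ∀ x ∈ closure O, |h t x| ≤ C) :
    Tendsto (fun n => ∫ t in Icc 0 T, |∫ p, cut T O h t p ∂(mn n t) - ∫ p, cut T O h t p ∂(m t)|)
      atTop (𝓝 0) := by
  wlog hC0 : 0 ≤ C
  · exact this hT hm0 H H0 hcv hc (C := |C|) (fun t ht x hx => (hb t ht x hx).trans (le_abs_self C)) (abs_nonneg _)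
  have bh : BM (cut T O h) := (cut_car (A := A) hc ⟨C, hb⟩).bm
  rw [Metric.tendsto_atTop]
  intro ε hε
  let K := T + C + 1
  have hK : 0 < K := by positivity
  obtain ⟨R, hR1, hR⟩ := reg_tight (O := O) (A := A) (m0 := m0) hT B (ε / (4 * K)) (by positivity)
  obtain ⟨g, -, ⟨gt, gx, gxx, hg⟩, -, hga⟩ := smooth_approx hc hC0 hb hR1 (ε := ε / (4 * K)) (by positivity)
  have bg : BM (cut T O fun t x => g (t, x)) := (cut_car (A := A) hg.cont (by
    obtain ⟨D, hD⟩ := hg.bdd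
    exact ⟨D, fun t ht x hx => (hD t ht x hx).1⟩)).bm
  have key : ∀ μ m, Reg T O A m0 B μ m →
      ∫ t in Icc 0 T, |∫ p, cut T O h t p ∂(m t) - ∫ p, cut T O (fun t x => g (t, x)) t p ∂(m t)| ≤ ε / 4 := by
    intro μ m H
    refine (H.fl.zdist bh bg).trans ?_
    have b2 : BM (fun _ p => ε / (4 * K) + C * chi R p.1) := (BM.const _).add ((bm_chi R).cmul C)
    calc _ ≤ I2 T m (fun _ p => ε / (4 * K) + C * chi R p.1) := by
          apply H.fl.I2_mono (bh.sub bg).abs b2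
          intro t ht p hp
          rw [cut_eq ht hp.1, cut_eq ht hp.1]
          exact hga t ht _ hp.1
      _ = I2 T m (fun _ p => ε / (4 * K)) + C * I2 T m (fun _ p => chi R p.1) := by
          rw [H.fl.I2_add (BM.const _) ((bm_chi R).cmul C), I2_cmul]
      _ ≤ ε / (4 * K) * T + C * (ε / (4 * K)) := by
          gcongr
          · exact (le_abs_self _).trans (H.fl.I2_abs_const hT.le (by positivity) (BM.const _)
              (fun t _ p _ => by rw [abs_of_pos (by positivity)]))
          · exact (hR μ m H).2
      _ ≤ K * (ε / (4 * K)) := by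
          have : 0 < ε / (4 * K) := by positivity
          simp only [K] at *; nlinarith
      _ = ε / 4 := by field_simp
  have hsm := z_L1_smooth hT hm0 H H0 hcv hg
  obtain ⟨N, hN⟩ := (Metric.tendsto_atTop.1 hsm) (ε / 4) (by positivity)
  refine ⟨N, fun n hn => ?_⟩
  have h1 := key _ _ (H n)
  have h2 := key _ _ H0
  have h3 := hN n hn
  rw [Real.dist_eq, sub_zero] at h3 ⊢
  rw [abs_of_nonneg (integral_nonneg fun _ => abs_nonneg _)] at h3 ⊢
  have i1 := (((H n).fl.zint (T := T) bh).sub ((H n).fl.zint bg)).abs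
  have i2 := (((H n).fl.zint (T := T) bg).sub (H0.fl.zint bg)).abs
  have i3 := ((H0.fl.zint (T := T) bh).sub (H0.fl.zint bg)).abs
  have i4 := (((H n).fl.zint (T := T) bh).sub (H0.fl.zint bh)).abs
  have := integral_mono i4 ((i1.add i2).add i3) (fun t => by
    simp only [Pi.add_apply]
    have a1 := abs_add_le (∫ p, cut T O h t p ∂(mn n t) - ∫ p, cut T O (fun t x => g (t, x)) t p ∂(mn n t))
      (∫ p, cut T O (fun t x => g (t, x)) t p ∂(mn n t) - ∫ p, cut T O (fun t x => g (t, x)) t p ∂(m t))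
    have a2 := abs_sub (∫ p, cut T O h t p ∂(mn n t) - ∫ p, cut T O (fun t x => g (t, x)) t p ∂(mn n t) +
      (∫ p, cut T O (fun t x => g (t, x)) t p ∂(mn n t) - ∫ p, cut T O (fun t x => g (t, x)) t p ∂(m t)))
      (∫ p, cut T O h t p ∂(m t) - ∫ p, cut T O (fun t x => g (t, x)) t p ∂(m t))
    simp only [Pi.sub_apply]
    refine le_trans (le_of_eq ?_) (a2.trans (add_le_add_left a1 _))
    congr 1; ring)
  rw [integral_add' (i1.add i2) i3, integral_add' i1 i2] at this
  refine this.trans_lt ?_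
  have e : ε / 4 + ε / 4 + ε / 4 < ε := by linarith
  refine lt_of_le_of_lt ?_ e
  exact add_le_add (add_le_add h1 h3.le) h2
end
end LPN
end

noncomputable section
namespace LPN

/-- normalised Lebesgue measure on the time interval. -/
def tau (T : ℝ) : Measure ℝ := (ENNReal.ofReal T)⁻¹ • volume.restrict (Icc 0 T)

lemma tau_prob {T : ℝ} (hT : 0 < T) : IsProbabilityMeasure (tau T) := by
  constructor
  simp only [tau, Measure.smul_apply, Measure.restrict_apply_univ, Real.volume_Icc, sub_zero, smul_eq_mul]
  exact ENNReal.inv_mul_cancel (by simpa using hT) ENNReal.ofReal_ne_top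

lemma integral_tau {T : ℝ} (hT : 0 < T) (f : ℝ → ℝ) : ∫ t, f t ∂(tau T) = T⁻¹ * ∫ t in Icc 0 T, f t := by
  simp [tau, integral_smul_measure, hT.le]

/-- extended measures with a cemetery point. -/
structure Hat (T : ℝ) (S : Set (ℝ × ℝ)) (e : ℝ × ℝ) (P : Measure (ℝ × ℝ × ℝ)) : Prop where
  prob : IsProbabilityMeasure P
  fst : P.fst = tau T
  supp : P (univ ×ˢ (S ∪ {e}))ᶜ = 0

lemma Hat.ae {T : ℝ} {S : Set (ℝ × ℝ)} {e : ℝ × ℝ} {P : Measure (ℝ × ℝ × ℝ)} (h : Hat T S e P) :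
    ∀ᵐ q ∂P, q.2 ∈ S ∪ {e} := by
  have : ∀ᵐ q ∂P, q ∈ (univ : Set ℝ) ×ˢ (S ∪ {e}) := by rw [ae_iff]; exact h.supp
  exact this.mono fun q hq => hq.2

lemma ind_bm {S : Set (ℝ × ℝ)} (hS : MeasurableSet S) {F : ℝ → ℝ × ℝ → ℝ} (hF : BM F) :
    BM (fun t => S.indicator (F t)) := by
  refine ⟨?_, ?_⟩
  · have : Measurable (((univ : Set ℝ) ×ˢ S).indicator (Function.uncurry F)) :=
      hF.meas.indicator (MeasurableSet.univ.prod hS)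
    convert this using 1
    ext ⟨t, p⟩
    by_cases h : p ∈ S <;> simp [Function.uncurry, h]
  · obtain ⟨C, hC⟩ := hF.bdd
    refine ⟨C, fun t p => ?_⟩
    by_cases h : p ∈ S
    · rw [indicator_of_mem h]; exact hC t p
    · rw [indicator_of_notMem h]; simpa using (abs_nonneg _).trans (hC t p)

lemma ind_car {S : Set (ℝ × ℝ)} (hS : IsClosed S) (e : ℝ × ℝ) {F : ℝ → ℝ × ℝ → ℝ}
    (hF : Car S F) : Car (S ∪ {e}) (fun t => S.indicator (F t)) := by
  have h := ind_bm hS.measurableSet hF.bm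
  refine ⟨h.meas, fun t => ?_, h.bdd⟩
  apply ContinuousOn.union_of_isClosed _ (continuousOn_singleton _ _) hS isClosed_singleton
  exact (hF.cont t).congr fun p hp => indicator_of_mem hp _

lemma int_of_bdd {X : Type*} [MeasurableSpace X] (P : Measure X) [IsFiniteMeasure P] {f : X → ℝ}
    (hf : Measurable f) {C : ℝ} (hC : ∀ x, |f x| ≤ C) : Integrable f P :=
  Integrable.of_bound hf.aestronglyMeasurable C (Eventually.of_forall hC)

lemma BM.intP {F : ℝ → ℝ × ℝ → ℝ} (hF : BM F) (P : Measure (ℝ × ℝ × ℝ)) [IsFiniteMeasure P] :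
    Integrable (fun q : ℝ × ℝ × ℝ => F q.1 q.2) P := by
  obtain ⟨C, hC⟩ := hF.bdd
  exact int_of_bdd P hF.meas (fun q => hC q.1 q.2)

lemma hat_approx {T : ℝ} (hT : 0 < T) {O A : Set ℝ} (hA : IsCompact A) {e : ℝ × ℝ}
    (he : e ∉ closure O ×ˢ A) {F : ℝ → ℝ × ℝ → ℝ} (hF : Car (closure O ×ˢ A) F) {C : ℝ}
    (hC : ∀ t p, |F t p| ≤ C) (R ε : ℝ) (hR : 0 < R) (hε : 0 < ε) :
    ∃ H : ℝ × ℝ × ℝ → ℝ, Continuous H ∧ (∀ q, |H q| ≤ C) ∧ ∀ P, Hat T (closure O ×ˢ A) e P →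
      |∫ q, (closure O ×ˢ A).indicator (F q.1) q.2 ∂P - ∫ q, H q ∂P| ≤ ε + 2 * C * ∫ q, chi R q.2.1 ∂P := by
  set S := closure O ×ˢ A with hSdef
  have hS : IsClosed S := isClosed_closure.prod hA.isClosed
  have hC0 : 0 ≤ C := (abs_nonneg _).trans (hC 0 0)
  let F' : ℝ → ℝ × ℝ → ℝ := fun t => S.indicator (F t)
  have hF' : Car (S ∪ {e}) F' := ind_car hS e hF
  have hC' : ∀ t p, |F' t p| ≤ C := fun t p => by
    by_cases h : p ∈ S
    · simp only [F', indicator_of_mem h]; exact hC t p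
    · simp only [F', indicator_of_notMem h]; simpa using hC0
  let K : Set (ℝ × ℝ) := (S ∪ {e}) ∩ (fun p : ℝ × ℝ => |p.1|) ⁻¹' (Iic (2 * R))
  have hK : IsCompact K := by
    have hcl : IsClosed K := (hS.union isClosed_singleton).inter (isClosed_Iic.preimage (by fun_prop))
    apply ((isCompact_Icc (a := -(2 * R)) (b := 2 * R)).prod (hA.union (isCompact_singleton (x := e.2)))).of_isClosed_subset hcl
    rintro p ⟨hp1, hp2⟩
    refine ⟨abs_le.1 hp2, ?_⟩
    rcases hp1 with h | h
    · exact Or.inl h.2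
    · right; rw [mem_singleton_iff] at h; rw [h]; rfl
  obtain ⟨H, ψ, D, hH, hHD, happ, hψm, hψ, hψi⟩ := car_approx hK (hF'.mono inter_subset_left) T (ε * T)
    (by positivity) hC' hC0
  let H' : ℝ × ℝ × ℝ → ℝ := fun q => max (-C) (min C (H q))
  have hH'c : Continuous H' := continuous_const.max (continuous_const.min hH)
  have hH'b : ∀ q, |H' q| ≤ C := fun q => abs_le.2 ⟨le_max_left _ _, max_le (by linarith) (min_le_left _ _)⟩
  have hcl : ∀ x y : ℝ, |x| ≤ C → |x - max (-C) (min C y)| ≤ |x - y| := by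
    intro x y hx
    obtain ⟨h1, h2⟩ := abs_le.1 hx
    rcases le_total C y with h | h
    · rw [min_eq_left h, max_eq_right (by linarith)]
      rw [abs_of_nonpos (by linarith), abs_of_nonpos (by linarith)]; linarith
    · rw [min_eq_right h]
      rcases le_total (-C) y with h' | h'
      · rw [max_eq_right h']
      · rw [max_eq_left h', abs_of_nonneg (by linarith), abs_of_nonneg (by linarith)]; linarith
  refine ⟨H', hH'c, hH'b, fun P hP => ?_⟩
  have := hP.prob
  have i1 : Integrable (fun q : ℝ × ℝ × ℝ => F' q.1 q.2) P := hF'.bm.intP P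
  have i2 : Integrable H' P := int_of_bdd P hH'c.measurable hH'b
  have cc := (chi_contDiff R (n := 0)).continuous
  have i3 : Integrable (fun q : ℝ × ℝ × ℝ => 2 * C * chi R q.2.1) P :=
    ((bm_chi R).intP P).const_mul _
  have i4 : Integrable (fun q : ℝ × ℝ × ℝ => ψ q.1) P := by
    refine int_of_bdd P (hψm.comp measurable_fst) (C := C + D) fun q => ?_
    rw [abs_of_nonneg (hψ _).1]; exact (hψ _).2
  have e4 : ∫ q : ℝ × ℝ × ℝ, ψ q.1 ∂P ≤ ε := by
    have : ∫ q : ℝ × ℝ × ℝ, ψ q.1 ∂P = ∫ t, ψ t ∂(P.fst) := by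
      rw [Measure.fst, integral_map measurable_fst.aemeasurable hψm.aestronglyMeasurable]
    rw [this, hP.fst, integral_tau hT]
    calc T⁻¹ * ∫ t in Icc 0 T, ψ t ≤ T⁻¹ * (ε * T) := by gcongr
      _ = ε := by field_simp
  rw [← integral_sub i1 i2]
  calc |∫ q, (F' q.1 q.2 - H' q) ∂P| ≤ ∫ q, |F' q.1 q.2 - H' q| ∂P := abs_integral_le_integral_abs
    _ ≤ ∫ q, (ψ q.1 + 2 * C * chi R q.2.1) ∂P := by
        apply integral_mono_ae (i1.sub i2).abs (i4.add i3)
        filter_upwards [hP.ae] with q hq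
        simp only [Pi.sub_apply, Pi.add_apply]
        by_cases hx : |q.2.1| ≤ 2 * R
        · have h1 := happ q.1 q.2 ⟨hq, hx⟩
          have h2 := hcl (F' q.1 q.2) (H q) (hC' _ _)
          have h3 := chi_nonneg R q.2.1
          have h4 : 0 ≤ 2 * C * chi R q.2.1 := by positivity
          have h5 : |F' q.1 q.2 - H' q| ≤ ψ q.1 := h2.trans h1
          linarith
        · rw [chi_one hR (by linarith)]
          have h2 := hC' q.1 q.2
          have h3 := hH'b q
          have h4 := (hψ q.1).1
          have h5 : |F' q.1 q.2 - H' q| ≤ |F' q.1 q.2| + |H' q| := by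
            simpa using abs_sub (F' q.1 q.2) (H' q)
          linarith
    _ = ∫ q, ψ q.1 ∂P + 2 * C * ∫ q, chi R q.2.1 ∂P := by
        rw [integral_add i4 i3, integral_const_mul]
    _ ≤ _ := by linarith

/-- decoding. -/
lemma hat_decode {T : ℝ} (hT : 0 < T) {O A : Set ℝ} (hA : IsCompact A) {e : ℝ × ℝ} {P : Measure (ℝ × ℝ × ℝ)}
    (hP : Hat T (closure O ×ˢ A) e P) :
    ∃ m, Fl O A m ∧ ∀ F, BM F → I2 T m F = T * ∫ q, (closure O ×ˢ A).indicator (F q.1) q.2 ∂P := by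
  have hS : MeasurableSet (closure O ×ˢ A) := (isClosed_closure.prod hA.isClosed).measurableSet
  have := hP.prob
  let κ := P.condKernel
  have hd : P.fst.compProd κ = P := P.disintegrate κ
  refine ⟨fun t => (κ t).restrict (closure O ×ˢ A), ⟨?_, ?_, ?_⟩, ?_⟩
  · have := (κ.restrict hS).measurable
    convert this using 1
    ext1 t; exact (ProbabilityTheory.Kernel.restrict_apply κ hS t).symm
  · intro t
    rw [Measure.restrict_apply_univ]
    exact prob_le_one
  · intro t
    rw [Measure.restrict_apply hS.compl]; simp
  · intro F hF
    have hF' := ind_bm hS hF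
    have h1 : ∫ q, (closure O ×ˢ A).indicator (F q.1) q.2 ∂P
        = ∫ t, ∫ p, (closure O ×ˢ A).indicator (F t) p ∂(κ t) ∂P.fst := by
      conv_lhs => rw [← hd]
      rw [Measure.integral_compProd]
      rw [hd]
      exact hF'.intP P
    rw [h1, hP.fst, integral_tau hT, ← mul_assoc, mul_inv_cancel₀ hT.ne', one_mul]
    unfold I2
    congr 1; ext t
    rw [integral_indicator hS]

/-- encoding. -/
lemma hat_encode {T : ℝ} (hT : 0 < T) {O A : Set ℝ} (hA : IsCompact A) {e : ℝ × ℝ}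
    (he : e ∉ closure O ×ˢ A) {m} (hm : Fl O A m) :
    ∃ P, Hat T (closure O ×ˢ A) e P ∧
      ∀ F, BM F → I2 T m F = T * ∫ q, (closure O ×ˢ A).indicator (F q.1) q.2 ∂P := by
  have hS : MeasurableSet (closure O ×ˢ A) := (isClosed_closure.prod hA.isClosed).measurableSet
  have hτ := tau_prob hT
  let k : ℝ → Measure (ℝ × ℝ) := fun t => m t + (1 - m t univ) • Measure.dirac e
  have hk : Measurable k := by
    have h1 : Measurable fun t => (1 - m t univ) :=
      measurable_const.sub ((Measure.measurable_coe MeasurableSet.univ).comp hm.meas)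
    have h2 : Measurable fun t => (1 - m t univ) • Measure.dirac e := h1.smul_measure _
    refine Measure.measurable_of_measurable_coe _ fun s hs => ?_
    exact ((Measure.measurable_coe hs).comp hm.meas).add ((Measure.measurable_coe hs).comp h2)
  let κ : ProbabilityTheory.Kernel ℝ (ℝ × ℝ) := ⟨k, hk⟩
  have hκ : ∀ t, κ t = m t + (1 - m t univ) • Measure.dirac e := fun t => rfl
  have hmk : ProbabilityTheory.IsMarkovKernel κ := by
    refine ⟨fun t => ⟨?_⟩⟩
    rw [hκ, Measure.add_apply, Measure.smul_apply, measure_univ (μ := Measure.dirac e), smul_eq_mul, mul_one]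
    exact add_tsub_cancel_of_le (hm.mass t)
  refine ⟨(tau T).compProd κ, ⟨inferInstance, Measure.fst_compProd _ _, ?_⟩, ?_⟩
  · have hSe : MeasurableSet (closure O ×ˢ A ∪ {e}) := hS.union (measurableSet_singleton e)
    rw [Measure.compProd_apply (MeasurableSet.univ.prod hSe).compl]
    rw [lintegral_eq_zero_iff' ?_]
    · refine Eventually.of_forall fun t => ?_
      have e1 : Prod.mk t ⁻¹' ((univ : Set ℝ) ×ˢ (closure O ×ˢ A ∪ {e}))ᶜ = (closure O ×ˢ A ∪ {e})ᶜ := by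
        ext p; simp
      simp only [Pi.zero_apply]
      rw [e1, hκ, Measure.add_apply, Measure.smul_apply]
      have a1 : m t (closure O ×ˢ A ∪ {e})ᶜ = 0 :=
        measure_mono_null (compl_subset_compl.2 subset_union_left) (hm.supp t)
      have a2 : Measure.dirac e (closure O ×ˢ A ∪ {e})ᶜ = 0 := by
        rw [Measure.dirac_apply' _ hSe.compl]; simp
      rw [a1, a2]; simp
    · exact (ProbabilityTheory.Kernel.measurable_kernel_prodMk_left (MeasurableSet.univ.prod hSe).compl).aemeasurable
  · intro F hF
    have hF' := ind_bm hS hF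
    rw [Measure.integral_compProd (hF'.intP _), integral_tau hT, ← mul_assoc, mul_inv_cancel₀ hT.ne', one_mul]
    unfold I2
    congr 1; ext t
    have := hm.fin t
    rw [hκ, integral_add_measure (hF'.int _ t), integral_smul_measure, integral_dirac,
      indicator_of_notMem he, smul_zero, add_zero, integral_indicator hS]
    · rw [Measure.restrict_eq_self_of_ae_mem (hm.ae t)]
    · exact (hF'.int _ t).smul_measure (by simp)

/-- a cemetery point. -/
lemma exists_cem {A : Set ℝ} (hA : IsCompact A) (O : Set ℝ) : ∃ e : ℝ × ℝ, e ∉ closure O ×ˢ A ∧ e.1 = 0 := by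
  obtain ⟨M, hM⟩ := hA.isBounded.exists_norm_le
  refine ⟨(0, |M| + 1), fun h => ?_, rfl⟩
  have := hM _ h.2
  rw [Real.norm_eq_abs, abs_of_nonneg (by positivity)] at this
  linarith [le_abs_self M]

lemma tight_lim {X : Type*} [MeasurableSpace X] [TopologicalSpace X] [OpensMeasurableSpace X] [HasOuterApproxClosed X]
    {ι : Type*} {l : Filter ι} [l.NeBot] {Pn : ι → ProbabilityMeasure X} {P : ProbabilityMeasure X}
    (h : Tendsto Pn l (𝓝 P)) {s : Set X} (hs : IsClosed s) (h0 : ∀ n, (Pn n : Measure X) sᶜ = 0) :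
    (P : Measure X) sᶜ = 0 := by
  have h2 := ProbabilityMeasure.le_liminf_measure_open_of_tendsto h hs.isOpen_compl
  simp only [h0] at h2
  simpa using h2

lemma pm_tendsto {X : Type*} [MeasurableSpace X] [TopologicalSpace X] [OpensMeasurableSpace X]
    {ι : Type*} {l : Filter ι} {Pn : ι → ProbabilityMeasure X} {P : ProbabilityMeasure X}
    (h : Tendsto Pn l (𝓝 P)) {H : X → ℝ} (hH : Continuous H) {C : ℝ} (hC : ∀ x, |H x| ≤ C) :
    Tendsto (fun n => ∫ x, H x ∂(Pn n : Measure X)) l (𝓝 (∫ x, H x ∂(P : Measure X))) := by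
  have := ProbabilityMeasure.tendsto_iff_forall_integral_tendsto.1 h
    (BoundedContinuousFunction.ofNormedAddCommGroup H hH C hC)
  simpa using this

lemma hat_lim {T : ℝ} (hT : 0 < T) {O A : Set ℝ} (hA : IsCompact A) {e : ℝ × ℝ} {ι : Type*} {l : Filter ι} [l.NeBot]
    {Pn : ι → ProbabilityMeasure (ℝ × ℝ × ℝ)} {P : ProbabilityMeasure (ℝ × ℝ × ℝ)}
    (h : Tendsto Pn l (𝓝 P)) (h0 : ∀ n, Hat T (closure O ×ˢ A) e (Pn n)) : Hat T (closure O ×ˢ A) e P := by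
  refine ⟨inferInstance, ?_, tight_lim h (isClosed_univ.prod ((isClosed_closure.prod hA.isClosed).union isClosed_singleton))
    fun n => (h0 n).supp⟩
  have h1 := ProbabilityMeasure.tendsto_map_of_tendsto_of_continuous Pn P h (continuous_fst (X := ℝ) (Y := ℝ × ℝ))
  have hτ := tau_prob hT
  have h2 : ∀ n, (Pn n).map continuous_fst.measurable.aemeasurable = (⟨tau T, hτ⟩ : ProbabilityMeasure ℝ) := fun n => by
    apply Subtype.ext
    exact (h0 n).fst
  simp only [h2] at h1
  have h3 := tendsto_nhds_unique h1 tendsto_const_nhds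
  exact congrArg Subtype.val h3

/-- continuity of Caratheodory integrals -/
lemma hat_tendsto {T : ℝ} (hT : 0 < T) {O A : Set ℝ} (hA : IsCompact A) {e : ℝ × ℝ}
    (he : e ∉ closure O ×ˢ A) {F : ℝ → ℝ × ℝ → ℝ} (hF : Car (closure O ×ˢ A) F)
    {ι : Type*} {l : Filter ι} [l.NeBot]
    {Pn : ι → ProbabilityMeasure (ℝ × ℝ × ℝ)} {P : ProbabilityMeasure (ℝ × ℝ × ℝ)}
    (h : Tendsto Pn l (𝓝 P)) (h0 : ∀ n, Hat T (closure O ×ˢ A) e (Pn n))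
    (ht : ∀ ε > 0, ∃ R > 0, ∀ n, ∫ q, chi R q.2.1 ∂(Pn n : Measure (ℝ × ℝ × ℝ)) ≤ ε) :
    Tendsto (fun n => ∫ q, (closure O ×ˢ A).indicator (F q.1) q.2 ∂(Pn n : Measure (ℝ × ℝ × ℝ))) l
      (𝓝 (∫ q, (closure O ×ˢ A).indicator (F q.1) q.2 ∂(P : Measure (ℝ × ℝ × ℝ)))) := by
  have hP := hat_lim hT hA h h0
  obtain ⟨C, hC⟩ := hF.bdd
  have hC0 : 0 ≤ C := (abs_nonneg _).trans (hC 0 0)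
  rw [Metric.tendsto_nhds]
  intro ε hε
  obtain ⟨R, hR, hRε⟩ := ht (ε / (8 * (C + 1))) (by positivity)
  have hRP : ∫ q, chi R q.2.1 ∂(P : Measure (ℝ × ℝ × ℝ)) ≤ ε / (8 * (C + 1)) := by
    have cc := (chi_contDiff R (n := 0)).continuous
    have := pm_tendsto h (H := fun q => chi R q.2.1) (by fun_prop) (C := 1) (fun q => by
      rw [abs_of_nonneg (chi_nonneg _ _)]; exact chi_le_one _ _)
    exact le_of_tendsto' this hRε
  obtain ⟨H, hHc, hHb, hH⟩ := hat_approx hT hA he hF hC R (ε / 8) hR (by positivity)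
  have h1 := pm_tendsto h hHc hHb
  rw [Metric.tendsto_nhds] at h1
  have hx : 2 * C * (ε / (8 * (C + 1))) ≤ ε / 4 := by
    rw [show 2 * C * (ε / (8 * (C + 1))) = (ε / 4) * (C / (C + 1)) by field_simp; ring]
    apply mul_le_of_le_one_right (by positivity)
    rw [div_le_one (by positivity)]; linarith
  filter_upwards [h1 (ε / 8) (by positivity)] with n hn
  have a1 := hH _ (h0 n)
  have a2 := hH _ hP
  have a3 : 2 * C * ∫ q, chi R q.2.1 ∂(Pn n : Measure (ℝ × ℝ × ℝ)) ≤ 2 * C * (ε / (8 * (C + 1))) := by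
    gcongr; exact hRε n
  have a4 : 2 * C * ∫ q, chi R q.2.1 ∂(P : Measure (ℝ × ℝ × ℝ)) ≤ 2 * C * (ε / (8 * (C + 1))) := by
    gcongr
  rw [Real.dist_eq] at hn ⊢
  rw [abs_lt] at hn ⊢
  rw [abs_le] at a1 a2
  constructor <;> linarith [a1.1, a1.2, a2.1, a2.2, hn.1, hn.2]

end LPN
end

noncomputable section
namespace LPN

section
variable {T : ℝ} {O A : Set ℝ} {m0 : Measure ℝ} {B : ℝ}

/-- Markov-type bound through the cutoffs. -/
lemma tail_le {X : Type*} [MeasurableSpace X] {P : Measure X} [IsProbabilityMeasure P] {s K : Set X}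
    (hK : MeasurableSet K)
    (hs : P sᶜ = 0) {χ : X → ℝ} (hχm : Measurable χ) (hχ0 : ∀ x, 0 ≤ χ x) (hχ1 : ∀ x, χ x ≤ 1)
    (hsK : ∀ x ∈ s, x ∉ K → χ x = 1) : P.real Kᶜ ≤ ∫ x, χ x ∂P := by
  have h1 : P.real Kᶜ = ∫ x, Kᶜ.indicator (fun _ => (1:ℝ)) x ∂P := by
    rw [integral_indicator hK.compl]; simp
  rw [h1]
  have hae : ∀ᵐ x ∂P, x ∈ s := by rw [ae_iff]; exact hs
  apply integral_mono_ae
  · exact (integrable_const _).indicator hK.compl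
  · exact int_of_bdd P hχm (C := 1) fun x => by rw [abs_of_nonneg (hχ0 x)]; exact hχ1 x
  · filter_upwards [hae] with x hx
    by_cases hxK : x ∈ K
    · rw [indicator_of_notMem (by simpa using hxK)]; exact hχ0 x
    · rw [indicator_of_mem (by simpa using hxK), hsK x hx hxK]

lemma tight_of_real {X : Type*} [MeasurableSpace X] [TopologicalSpace X] {S : Set (Measure X)}
    (hP : ∀ P ∈ S, IsProbabilityMeasure P)
    (h : ∀ ε : ℝ, 0 < ε → ∃ K, IsCompact K ∧ ∀ P ∈ S, P.real Kᶜ ≤ ε) : IsTightMeasureSet S := by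
  rw [isTightMeasureSet_iff_exists_isCompact_measure_compl_le]
  intro ε hε
  rcases eq_or_ne ε ⊤ with rfl | hε'
  · exact ⟨∅, isCompact_empty, fun _ _ => le_top⟩
  obtain ⟨K, hK, h⟩ := h ε.toReal (ENNReal.toReal_pos hε.ne' hε')
  refine ⟨K, hK, fun P hPS => ?_⟩
  have := hP P hPS
  have := h P hPS
  rw [Measure.real, ENNReal.toReal_le_toReal (measure_ne_top _ _) hε'] at this
  exact this

lemma reg_compact (hT : 0 < T) [IsProbabilityMeasure m0] (hA : IsCompact A)
    {μn : ℕ → Measure (ℝ × ℝ)} {mn : ℕ → ℝ → Measure (ℝ × ℝ)}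
    (H : ∀ n, Reg T O A m0 B (μn n) (mn n)) :
    ∃ μ m φ, StrictMono φ ∧ Reg T O A m0 B μ m ∧ Cv T O A (fun n => μn (φ n)) (fun n => mn (φ n)) μ m := by
  obtain ⟨e, he, he0⟩ := exists_cem hA O
  set S := closure O ×ˢ A with hSdef
  have hS : IsClosed S := isClosed_closure.prod hA.isClosed
  choose P hP hPI using fun n => hat_encode hT hA he (H n).fl
  have hchiI : ∀ n R, 0 < R → T * ∫ q, chi R q.2.1 ∂(P n) = I2 T (mn n) (fun _ p => chi R p.1) := by
    intro n R hR
    rw [hPI n _ (bm_chi R)]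
    congr 1
    apply integral_congr_ae
    filter_upwards [(hP n).ae] with q hq
    by_cases h : q.2 ∈ S
    · rw [indicator_of_mem h]
    · rw [indicator_of_notMem h]
      rcases hq with hq | hq
      · exact absurd hq h
      · rw [mem_singleton_iff] at hq
        rw [hq, he0]; exact chi_zero hR (by simpa using hR.le)
  have hti : ∀ ε : ℝ, 0 < ε → ∃ R, 1 ≤ R ∧ ∀ n, ∫ p, chi R p.2 ∂(μn n) ≤ ε ∧ ∫ q, chi R q.2.1 ∂(P n) ≤ ε := by
    intro ε hε
    obtain ⟨R, hR, h⟩ := reg_tight (O := O) (A := A) (m0 := m0) hT B (min ε (T * ε)) (by positivity)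
    refine ⟨R, hR, fun n => ⟨(h _ _ (H n)).1.trans (min_le_left _ _), ?_⟩⟩
    have h1 := (h _ _ (H n)).2.trans (min_le_right _ _)
    rw [← hchiI n R (by linarith)] at h1
    exact le_of_mul_le_mul_left h1 hT
  have hcc : ∀ R, Continuous (chi R) := fun R => (chi_contDiff R (n := 0)).continuous
  let pμ : ℕ → ProbabilityMeasure (ℝ × ℝ) := fun n => ⟨μn n, (H n).prob⟩
  let pP : ℕ → ProbabilityMeasure (ℝ × ℝ × ℝ) := fun n => ⟨P n, (hP n).prob⟩
  have t1 : IsCompact (closure (range pμ)) := by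
    apply isCompact_closure_of_isTightMeasureSet
    apply tight_of_real
    · rintro _ ⟨ν, _, rfl⟩; exact ν.2
    intro ε hε
    obtain ⟨R, hR, h⟩ := hti ε hε
    have hK : IsCompact (Icc 0 T ×ˢ Icc (-(2 * R)) (2 * R)) := isCompact_Icc.prod isCompact_Icc
    refine ⟨_, hK, ?_⟩
    rintro _ ⟨_, ⟨n, rfl⟩, rfl⟩
    have := (H n).prob
    refine (tail_le (P := μn n) hK.isClosed.measurableSet (H n).supp (χ := fun p => chi R p.2) ?_ (fun _ => chi_nonneg _ _)
      (fun _ => chi_le_one _ _) ?_).trans (h n).1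
    · exact ((hcc R).comp continuous_snd).measurable
    · intro x hx hxK
      apply chi_one (by linarith)
      by_contra hlt
      exact hxK ⟨hx.1, abs_le.1 (not_le.1 hlt).le⟩
  have t2 : IsCompact (closure (range pP)) := by
    apply isCompact_closure_of_isTightMeasureSet
    apply tight_of_real
    · rintro _ ⟨ν, _, rfl⟩; exact ν.2
    intro ε hε
    obtain ⟨R, hR, h⟩ := hti ε hε
    have hK : IsCompact (Icc 0 T ×ˢ (Icc (-(2 * R)) (2 * R) ×ˢ (A ∪ {e.2}))) :=
      isCompact_Icc.prod (isCompact_Icc.prod (hA.union isCompact_singleton))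
    refine ⟨_, hK, ?_⟩
    rintro _ ⟨_, ⟨n, rfl⟩, rfl⟩
    have := (hP n).prob
    have hsupp : P n ((Icc 0 T ×ˢ (S ∪ {e}))ᶜ) = 0 := by
      have a1 : P n (Prod.fst ⁻¹' (Icc 0 T)ᶜ) = 0 := by
        have := congrArg (fun ν => ν (Icc 0 T)ᶜ) (hP n).fst
        simp only [Measure.fst_apply measurableSet_Icc.compl] at this
        rw [this, tau, Measure.smul_apply, Measure.restrict_apply measurableSet_Icc.compl]
        simp
      refine measure_mono_null ?_ (measure_union_null a1 (hP n).supp)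
      intro q hq
      by_cases h1 : q.1 ∈ Icc 0 T
      · right; intro h2; exact hq ⟨h1, h2.2⟩
      · left; exact h1
    refine (tail_le (P := P n) hK.isClosed.measurableSet hsupp (χ := fun p => chi R p.2.1) ?_ (fun _ => chi_nonneg _ _)
      (fun _ => chi_le_one _ _) ?_).trans (h n).2
    · exact ((hcc R).comp (by fun_prop : Continuous fun q : ℝ × ℝ × ℝ => q.2.1)).measurable
    · intro x hx hxK
      apply chi_one (by linarith)
      by_contra hlt
      refine hxK ⟨hx.1, abs_le.1 (not_le.1 hlt).le, ?_⟩
      rcases hx.2 with h | h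
      · exact Or.inl h.2
      · right; rw [mem_singleton_iff] at h; rw [h]; rfl
  obtain ⟨μ, -, φ1, hφ1, l1⟩ := t1.tendsto_subseq (x := pμ) fun n => subset_closure ⟨n, rfl⟩
  obtain ⟨Q, -, φ2, hφ2, l2⟩ := t2.tendsto_subseq (x := fun n => pP (φ1 n)) fun n => subset_closure ⟨_, rfl⟩
  have l1' : Tendsto (fun n => pμ (φ1 (φ2 n))) atTop (𝓝 μ) := l1.comp hφ2.tendsto_atTop
  have l2' : Tendsto (fun n => pP (φ1 (φ2 n))) atTop (𝓝 Q) := l2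
  have hQ : Hat T S e Q := hat_lim hT hA l2' fun n => hP _
  obtain ⟨m, hm, hmI⟩ := hat_decode hT hA hQ
  have hcv : Cv T O A (fun n => μn (φ1 (φ2 n))) (fun n => mn (φ1 (φ2 n))) μ m := by
    refine ⟨fun h hc ⟨C, hC⟩ => pm_tendsto l1' hc hC, fun F hF => ?_⟩
    have := hat_tendsto hT hA he hF l2' (fun n => hP _) (fun ε hε => by
      obtain ⟨R, hR, h⟩ := hti ε hε
      exact ⟨R, by linarith, fun n => (h _).2⟩)
    have := this.const_mul T
    rw [hmI F hF.bm]
    refine this.congr fun n => ?_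
    rw [hPI _ F hF.bm]
    rfl
  have hsupp : (μ : Measure (ℝ × ℝ)) (Icc 0 T ×ˢ closure O)ᶜ = 0 :=
    tight_lim l1' (isClosed_Icc.prod isClosed_closure) fun n => (H _).supp
  have hae : ∀ᵐ p ∂(μ : Measure (ℝ × ℝ)), p ∈ Icc 0 T ×ˢ closure O := by rw [ae_iff]; exact hsupp
  refine ⟨μ, m, φ1 ∘ φ2, hφ1.comp hφ2, ⟨μ.2, hsupp, hm, ?_⟩, hcv⟩
  intro u ut ux uxx hu C hC hb
  obtain ⟨D, hD⟩ := hu.bdd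
  obtain ⟨h, hc, hhb, hh⟩ := ext_cont hu.cont (abs_nonneg D) (fun t ht x hx => (hD t ht x hx).1.trans (le_abs_self D))
  have hcut : Car S (cut T O ut) := cut_car hu.cont_t ⟨D, fun t ht x hx => (hD t ht x hx).2.1⟩
  have c1 := hcv.c1 h hc ⟨_, hhb⟩
  have c2 := hcv.c2 _ hcut
  have k1 : ∀ ν : Measure (ℝ × ℝ), (∀ᵐ p ∂ν, p ∈ Icc 0 T ×ˢ closure O) → ∫ p, u p.1 p.2 ∂ν = ∫ p, h p ∂ν := by
    intro ν hν
    apply integral_congr_ae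
    filter_upwards [hν] with p hp
    exact (hh p.1 hp.1 p.2 hp.2).symm
  have k2 : ∀ m', Fl O A m' → I2 T m' (fun t p => ut t p.1) = I2 T m' (cut T O ut) := fun m' hm' =>
    hm'.I2_congr fun t ht p hp => (cut_eq ht hp.1).symm
  rw [k1 _ hae, k2 m hm]
  refine le_of_tendsto' (((c1.sub_const _).sub c2).abs) fun n => ?_
  have := (H (φ1 (φ2 n))).ineq u ut ux uxx hu C hC hb
  rwa [k1 _ (H _).ae, k2 _ (H _).fl] at this

end
end LPN
end

noncomputable section
namespace LPN

section
variable {T : ℝ} {O A : Set ℝ} {m0 : Measure ℝ} {B : ℝ} {ι : Type} [Fintype ι]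

/-- parametrised Caratheodory functions. -/
structure CarZ (S : Set (ℝ × ℝ)) (Φ : ℝ → ℝ × ℝ → (ι → ℝ) → ℝ) : Prop where
  meas : Measurable (fun q : ℝ × (ℝ × ℝ) × (ι → ℝ) => Φ q.1 q.2.1 q.2.2)
  cont : ∀ t, ContinuousOn (fun q : (ℝ × ℝ) × (ι → ℝ) => Φ t q.1 q.2) (S ×ˢ univ)
  bdd : ∃ C, ∀ t p z, |Φ t p z| ≤ C

lemma CarZ.mono {S S' : Set (ℝ × ℝ)} {Φ : ℝ → ℝ × ℝ → (ι → ℝ) → ℝ} (h : CarZ S Φ) (hs : S' ⊆ S) : CarZ S' Φ :=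
  ⟨h.meas, fun t => (h.cont t).mono (prod_mono hs le_rfl), h.bdd⟩

lemma CarZ.car {S : Set (ℝ × ℝ)} {Φ : ℝ → ℝ × ℝ → (ι → ℝ) → ℝ} (h : CarZ S Φ) {z : ℝ → ι → ℝ} (hz : Measurable z) :
    Car S (fun t p => Φ t p (z t)) := by
  refine ⟨?_, fun t => ?_, ?_⟩
  · exact h.meas.comp (measurable_fst.prodMk (measurable_snd.prodMk (hz.comp measurable_fst)))
  · exact (h.cont t).comp (f := fun p : ℝ × ℝ => (p, z t)) (by fun_prop) (fun p hp => ⟨hp, mem_univ _⟩)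
  · obtain ⟨C, hC⟩ := h.bdd
    exact ⟨C, fun t p => hC t p _⟩

/-- uniform continuity of parametrised continuous functions over compacts -/
lemma unif_param {X Y : Type*} [TopologicalSpace X] [TopologicalSpace Y] {K : Set X} (hK : IsCompact K) {f : X → Y → ℝ}
    (hf : ContinuousOn (fun q : X × Y => f q.1 q.2) (K ×ˢ univ)) (y : Y) (ε : ℝ) (hε : 0 < ε) :
    ∀ᶠ y' in 𝓝 y, ∀ x ∈ K, |f x y' - f x y| < ε := by
  have : CompactSpace K := isCompact_iff_compactSpace.1 hK
  let g : C(Y × K, ℝ) := ⟨fun q => f q.2 q.1, by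
    have h1 : Continuous fun q : Y × K => ((q.2 : X), q.1) := by fun_prop
    exact hf.comp_continuous h1 fun q => ⟨q.2.2, mem_univ _⟩⟩
  have hc := g.curry.continuous.tendsto y
  rw [Metric.tendsto_nhds] at hc
  filter_upwards [hc ε hε] with y' hy' x hx
  have := (ContinuousMap.dist_lt_iff hε).1 hy' ⟨x, hx⟩
  simpa [Real.dist_eq, g] using this

lemma nem_unif {K : Set (ℝ × ℝ)} (hK : IsCompact K) [CompactSpace K] {Φ : ℝ → ℝ × ℝ → (ι → ℝ) → ℝ} (hΦ : CarZ K Φ)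
    (T : ℝ) {M : ℝ} {z : ℝ → ι → ℝ} (hz : Measurable z) (hzM : ∀ t, ‖z t‖ ≤ M) (ε : ℝ) (hε : 0 < ε) :
    ∃ δ > 0, ∀ z' : ℝ → ι → ℝ, Measurable z' → (∀ t, ‖z' t‖ ≤ M) → ∫ t in Icc 0 T, ‖z' t - z t‖ ≤ δ →
      ∫ t in Icc 0 T, ‖cm K (fun t p => Φ t p (z' t)) t - cm K (fun t p => Φ t p (z t)) t‖ ≤ ε := by
  by_contra hcon
  push Not at hcon
  have hpos : ∀ n : ℕ, (0:ℝ) < 1 / (n + 1) := fun n => by positivity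
  choose zn hzn hznM hzd hbad using fun n : ℕ => hcon (1 / (n + 1)) (hpos n)
  obtain ⟨C, hC⟩ := hΦ.bdd
  have hM0 : 0 ≤ M := (norm_nonneg _).trans (hzM 0)
  have hC0 : 0 ≤ |C| := abs_nonneg C
  have hintg : ∀ n, Integrable (fun t => zn n t - z t) (volume.restrict (Icc 0 T)) := fun n =>
    Measure.integrableOn_of_bounded (M := M + M) (by simp) ((hzn n).sub hz).aestronglyMeasurable
      (Eventually.of_forall fun t => (norm_sub_le _ _).trans (add_le_add (hznM n t) (hzM t)))
  have htim : TendstoInMeasure (volume.restrict (Icc 0 T)) (fun n t => zn n t) atTop z := by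
    apply tendstoInMeasure_of_tendsto_eLpNorm (p := 1) one_ne_zero
    · exact fun n => (hzn n).aestronglyMeasurable
    · exact hz.aestronglyMeasurable
    · have : ∀ n, eLpNorm ((fun t => zn n t) - z) 1 (volume.restrict (Icc 0 T)) = ENNReal.ofReal (∫ t in Icc 0 T, ‖zn n t - z t‖) := by
        intro n
        rw [eLpNorm_one_eq_lintegral_enorm, ofReal_integral_norm_eq_lintegral_enorm (hintg n)]
        rfl
      simp only [this]
      rw [← ENNReal.ofReal_zero]
      apply ENNReal.tendsto_ofReal
      exact squeeze_zero (fun n => integral_nonneg fun t => norm_nonneg _) hzd tendsto_one_div_add_atTop_nhds_zero_nat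
  obtain ⟨φ, hφ, hae⟩ := htim.exists_seq_tendsto_ae
  have key : Tendsto (fun n => ∫ t in Icc 0 T, ‖cm K (fun t p => Φ t p (zn (φ n) t)) t - cm K (fun t p => Φ t p (z t)) t‖)
      atTop (𝓝 (∫ t in Icc 0 T, (0:ℝ))) := by
    apply tendsto_integral_of_dominated_convergence (fun _ => |C| + |C|)
    · intro n
      exact ((cm_meas hK (hΦ.car (hzn _))).sub (cm_meas hK (hΦ.car hz))).norm.aestronglyMeasurable
    · simp
    · intro n
      refine Eventually.of_forall fun t => ?_
      rw [norm_norm]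
      refine (norm_sub_le _ _).trans (add_le_add ?_ ?_)
      · exact cm_bdd hK (hΦ.car (hzn _)) (fun t p => (hC t p _).trans (le_abs_self C)) hC0 t
      · exact cm_bdd hK (hΦ.car hz) (fun t p => (hC t p _).trans (le_abs_self C)) hC0 t
    · filter_upwards [hae] with t ht
      rw [Metric.tendsto_nhds]
      intro r hr
      filter_upwards [ht.eventually (unif_param hK (hΦ.cont t) (z t) r hr)] with n hn
      rw [Real.dist_eq, sub_zero, abs_of_nonneg (norm_nonneg _)]
      rw [ContinuousMap.norm_lt_iff _ hr]
      intro p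
      rw [ContinuousMap.sub_apply, cm_apply (hΦ.car (hzn _)), cm_apply (hΦ.car hz)]
      exact hn p p.2
  simp only [integral_zero] at key
  have := (key.eventually_lt_const hε).exists
  obtain ⟨n, hn⟩ := this
  exact absurd (hbad (φ n)) (not_lt.2 hn.le)

lemma nem_reg (hT : 0 < T) [IsProbabilityMeasure m0] (hA : IsCompact A) (B : ℝ) {Φ : ℝ → ℝ × ℝ → (ι → ℝ) → ℝ}
    (hΦ : CarZ (closure O ×ˢ A) Φ)
    {M : ℝ} {z : ℝ → ι → ℝ} (hz : Measurable z) (hzM : ∀ t, ‖z t‖ ≤ M) (ε : ℝ) (hε : 0 < ε) :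
    ∃ δ > 0, ∀ z' : ℝ → ι → ℝ, Measurable z' → (∀ t, ‖z' t‖ ≤ M) → ∫ t in Icc 0 T, ‖z' t - z t‖ ≤ δ →
      ∀ μ m, Reg T O A m0 B μ m → |I2 T m (fun t p => Φ t p (z' t)) - I2 T m (fun t p => Φ t p (z t))| ≤ ε := by
  obtain ⟨C, hC⟩ := hΦ.bdd
  have hC0 : 0 ≤ C := (abs_nonneg _).trans (hC 0 0 0)
  obtain ⟨R, hR, hRt⟩ := reg_tight (O := O) (A := A) (m0 := m0) hT B (ε / (4 * (C + 1))) (by positivity)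
  set S := closure O ×ˢ A with hSdef
  have hS : IsClosed S := isClosed_closure.prod hA.isClosed
  let K : Set (ℝ × ℝ) := S ∩ (fun p : ℝ × ℝ => |p.1|) ⁻¹' (Iic (2 * R))
  have hK : IsCompact K := by
    have hcl : IsClosed K := hS.inter (isClosed_Iic.preimage (by fun_prop))
    apply ((isCompact_Icc (a := -(2 * R)) (b := 2 * R)).prod hA).of_isClosed_subset hcl
    rintro p ⟨hp1, hp2⟩
    exact ⟨abs_le.1 hp2, hp1.2⟩
  have hKs : CompactSpace K := isCompact_iff_compactSpace.1 hK
  have hΦK : CarZ K Φ := hΦ.mono inter_subset_left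
  obtain ⟨δ, hδ, h⟩ := nem_unif hK hΦK T hz hzM (ε / 2) (by positivity)
  refine ⟨δ, hδ, fun z' hz' hzM' hd μ m hm => ?_⟩
  have h1 := h z' hz' hzM' hd
  set ψ : ℝ → ℝ := fun t => ‖cm K (fun t p => Φ t p (z' t)) t - cm K (fun t p => Φ t p (z t)) t‖ with hψ
  have hψm : Measurable ψ := ((cm_meas hK (hΦK.car hz')).sub (cm_meas hK (hΦK.car hz))).norm.measurable
  have hψ0 : ∀ t, 0 ≤ ψ t := fun t => norm_nonneg _
  have hψb : ∀ t, |ψ t| ≤ C + C := fun t => by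
    rw [abs_of_nonneg (hψ0 t)]
    refine (norm_sub_le _ _).trans (add_le_add ?_ ?_)
    · exact cm_bdd hK (hΦK.car hz') (fun t p => hC t p _) hC0 t
    · exact cm_bdd hK (hΦK.car hz) (fun t p => hC t p _) hC0 t
  have b1 := (hΦ.car hz').bm
  have b2 := (hΦ.car hz).bm
  have bψ : BM (fun t _ => ψ t) := BM.time hψm ⟨_, hψb⟩
  have hψi : IntegrableOn ψ (Icc 0 T) := Measure.integrableOn_of_bounded (M := C + C) (by simp) hψm.aestronglyMeasurable
    (Eventually.of_forall hψb)
  rw [← hm.fl.I2_sub b1 b2]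
  calc |I2 T m (fun t p => Φ t p (z' t) - Φ t p (z t))| ≤ I2 T m (fun t p => |Φ t p (z' t) - Φ t p (z t)|) :=
        hm.fl.I2_abs_le (b1.sub b2)
    _ ≤ I2 T m (fun t p => ψ t + 2 * C * chi R p.1) := by
        apply hm.fl.I2_mono (b1.sub b2).abs (bψ.add ((bm_chi R).cmul _))
        intro t ht p hp
        have h3 := chi_nonneg R p.1
        by_cases hx : |p.1| ≤ 2 * R
        · have := ContinuousMap.norm_coe_le_norm (cm K (fun t p => Φ t p (z' t)) t - cm K (fun t p => Φ t p (z t)) t) ⟨p, hp, hx⟩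
          rw [ContinuousMap.sub_apply, cm_apply (hΦK.car hz'), cm_apply (hΦK.car hz)] at this
          have h4 : 0 ≤ 2 * C * chi R p.1 := by positivity
          rw [Real.norm_eq_abs] at this
          change _ ≤ ψ t at this
          linarith
        · rw [chi_one (by linarith) (by linarith)]
          have := abs_sub (Φ t p (z' t)) (Φ t p (z t))
          linarith [hC t p (z' t), hC t p (z t), hψ0 t]
    _ = I2 T m (fun t _ => ψ t) + 2 * C * I2 T m (fun _ p => chi R p.1) := by
        rw [hm.fl.I2_add bψ ((bm_chi R).cmul _), I2_cmul]
    _ ≤ ε / 2 + 2 * C * (ε / (4 * (C + 1))) := by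
        gcongr
        · exact (hm.fl.I2_le_time hψi bψ (fun t _ => hψ0 t) (fun t _ p _ => le_rfl)).trans h1
        · exact (hRt μ m hm).2
    _ ≤ ε := by
        have : 2 * C * (ε / (4 * (C + 1))) = (ε / 2) * (C / (C + 1)) := by field_simp; ring
        have h5 : C / (C + 1) ≤ 1 := by rw [div_le_one (by positivity)]; linarith
        have : (ε / 2) * (C / (C + 1)) ≤ ε / 2 := mul_le_of_le_one_right (by positivity) h5
        linarith

lemma term_reg (hT : 0 < T) [IsProbabilityMeasure m0] (B : ℝ) {G : ℝ → ℝ → (ι → ℝ) → ℝ}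
    (hG : ContinuousOn (fun q : (ℝ × ℝ) × (ι → ℝ) => G q.1.1 q.1.2 q.2) ((Icc 0 T ×ˢ closure O) ×ˢ univ))
    {C : ℝ} (hC : ∀ t x w, |G t x w| ≤ C) (w : ι → ℝ) (ε : ℝ) (hε : 0 < ε) :
    ∃ δ > 0, ∀ w', ‖w' - w‖ ≤ δ → ∀ μ m, Reg T O A m0 B μ m →
      |∫ p, G p.1 p.2 w' ∂μ - ∫ p, G p.1 p.2 w ∂μ| ≤ ε := by
  have hC0 : 0 ≤ C := (abs_nonneg _).trans (hC 0 0 0)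
  obtain ⟨R, hR, hRt⟩ := reg_tight (O := O) (A := A) (m0 := m0) hT B (ε / (4 * (C + 1))) (by positivity)
  let K : Set (ℝ × ℝ) := Icc 0 T ×ˢ (closure O ∩ Icc (-(2 * R)) (2 * R))
  have hK : IsCompact K := isCompact_Icc.prod (isCompact_Icc.inter_left isClosed_closure)
  have hKs : K ⊆ Icc 0 T ×ˢ closure O := prod_mono le_rfl inter_subset_left
  have h1 := unif_param hK (f := fun p w => G p.1 p.2 w) (hG.mono (prod_mono hKs le_rfl)) w (ε / 2) (by positivity)
  rw [Metric.eventually_nhds_iff] at h1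
  obtain ⟨δ, hδ, h1⟩ := h1
  refine ⟨δ / 2, by positivity, fun w' hw' μ m hm => ?_⟩
  have := hm.prob
  have hw : dist w' w < δ := by rw [dist_eq_norm]; linarith
  have hI : ∀ v, Integrable (fun p : ℝ × ℝ => G p.1 p.2 v) μ := fun v => by
    refine Integrable.of_bound ?_ C (Eventually.of_forall fun p => hC _ _ _)
    have hc : ContinuousOn (fun p : ℝ × ℝ => G p.1 p.2 v) (Icc 0 T ×ˢ closure O) :=
      hG.comp (f := fun p : ℝ × ℝ => (p, v)) (by fun_prop) (fun p hp => ⟨hp, mem_univ _⟩)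
    have hcl : IsClosed (Icc 0 T ×ˢ closure O) := isClosed_Icc.prod isClosed_closure
    refine ⟨_, (measurable_cut2 _ hcl hc).stronglyMeasurable, ?_⟩
    filter_upwards [hm.ae] with p hp
    rw [indicator_of_mem hp]
  have cc := (chi_contDiff R (n := 0)).continuous
  have i3 : Integrable (fun p : ℝ × ℝ => 2 * C * chi R p.2) μ :=
    (int_of_bdd μ (cc.comp continuous_snd).measurable (C := 1) fun p => by
      simp only [Function.comp]
      rw [abs_of_nonneg (chi_nonneg _ _)]; exact chi_le_one _ _).const_mul _
  rw [← integral_sub (hI _) (hI _)]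
  calc |∫ p, (G p.1 p.2 w' - G p.1 p.2 w) ∂μ| ≤ ∫ p, |G p.1 p.2 w' - G p.1 p.2 w| ∂μ := abs_integral_le_integral_abs
    _ ≤ ∫ p, (ε / 2 + 2 * C * chi R p.2) ∂μ := by
        apply integral_mono_ae ((hI _).sub (hI _)).abs ((integrable_const _).add i3)
        filter_upwards [hm.ae] with p hp
        simp only [Pi.sub_apply, Pi.add_apply]
        have h3 := chi_nonneg R p.2
        have h4 : 0 ≤ 2 * C * chi R p.2 := by positivity
        by_cases hx : |p.2| ≤ 2 * R
        · have := h1 hw p ⟨hp.1, hp.2, abs_le.1 hx⟩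
          linarith
        · rw [chi_one (by linarith) (by linarith)]
          have := abs_sub (G p.1 p.2 w') (G p.1 p.2 w)
          linarith [hC p.1 p.2 w', hC p.1 p.2 w]
    _ = ε / 2 + 2 * C * ∫ p, chi R p.2 ∂μ := by
        rw [integral_add (integrable_const _) i3, integral_const_mul]; simp
    _ ≤ ε / 2 + 2 * C * (ε / (4 * (C + 1))) := by
        gcongr
        exact (hRt μ m hm).1
    _ ≤ ε := by
        have : 2 * C * (ε / (4 * (C + 1))) = (ε / 2) * (C / (C + 1)) := by field_simp; ring
        have h5 : C / (C + 1) ≤ 1 := by rw [div_le_one (by positivity)]; linarith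
        have : (ε / 2) * (C / (C + 1)) ≤ ε / 2 := mul_le_of_le_one_right (by positivity) h5
        linarith

end
end LPN
end

noncomputable section
namespace LPN

/-- abstract model -/
structure Mod (ι : Type) [Fintype ι] (T : ℝ) (O A : Set ℝ) where
  h : ι → ℝ → ℝ → ℝ
  gh : ι → ℝ → ℝ → ℝ
  b : ℝ → ℝ × ℝ → (ι → ℝ) → ℝ
  s : ℝ → ℝ × ℝ → (ι → ℝ) → ℝ
  f : ℝ → ℝ × ℝ → (ι → ℝ) → ℝ
  g : ℝ → ℝ → (ι → ℝ) → ℝ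
  Ch : ℝ
  Cb : ℝ
  Cg : ℝ
  h_cont : ∀ i, ContinuousOn (fun p : ℝ × ℝ => h i p.1 p.2) (Icc 0 T ×ˢ closure O)
  h_bd : ∀ i t x, |h i t x| ≤ Ch
  gh_cont : ∀ i, ContinuousOn (fun p : ℝ × ℝ => gh i p.1 p.2) (Icc 0 T ×ˢ closure O)
  gh_bd : ∀ i t x, |gh i t x| ≤ Ch
  Ch0 : 0 ≤ Ch
  b_car : CarZ (closure O ×ˢ A) b
  s_car : CarZ (closure O ×ˢ A) s
  f_car : CarZ (closure O ×ˢ A) f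
  b_bd : ∀ t p z, |b t p z| ≤ Cb
  s_bd : ∀ t p z, |s t p z ^ 2 / 2| ≤ Cb
  f_bd : ∀ t p z, |f t p z| ≤ Cg
  g_cont : ContinuousOn (fun q : (ℝ × ℝ) × (ι → ℝ) => g q.1.1 q.1.2 q.2) ((Icc 0 T ×ˢ closure O) ×ˢ univ)
  g_bd : ∀ t x w, |g t x w| ≤ Cg

/-- pairs -/
abbrev Y := Measure (ℝ × ℝ) × (ℝ → Measure (ℝ × ℝ))

section
variable {T : ℝ} {O A : Set ℝ} {m0 : Measure ℝ} {ι : Type} [Fintype ι] (M : Mod ι T O A)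

def Mod.zf (m : ℝ → Measure (ℝ × ℝ)) : ℝ → ι → ℝ := fun t i => ∫ p, cut T O (M.h i) t p ∂(m t)

def Mod.wf (μ : Measure (ℝ × ℝ)) : ι → ℝ := fun i => ∫ p, M.gh i p.1 p.2 ∂μ

/-- the operator with parameter -/
def Mod.L (ut ux uxx : ℝ → ℝ → ℝ) : ℝ → ℝ × ℝ → (ι → ℝ) → ℝ := fun t p z =>
  cut T O ut t p + (M.b t p z * cut T O ux t p + M.s t p z ^ 2 / 2 * cut T O uxx t p)

structure Mod.FP (m0 : Measure ℝ) (z : ℝ → ι → ℝ) (y : Y) : Prop where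
  prob : IsProbabilityMeasure y.1
  supp : y.1 ((Icc 0 T ×ˢ closure O)ᶜ) = 0
  fl : Fl O A y.2
  eq : ∀ u ut ux uxx, IsCb12 T O u ut ux uxx →
    ∫ p, u p.1 p.2 ∂y.1 = ∫ x, u 0 x ∂m0 + I2 T y.2 (fun t p => M.L ut ux uxx t p (z t))

def Mod.Gam (z : ℝ → ι → ℝ) (w : ι → ℝ) (y : Y) : ℝ :=
  I2 T y.2 (fun t p => M.f t p (z t)) + ∫ p, M.g p.1 p.2 w ∂y.1

def Mod.GamY (x y : Y) : ℝ := M.Gam (M.zf x.2) (M.wf x.1) y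

def Mod.RegP (m0 : Measure ℝ) (y : Y) : Prop := Reg T O A m0 (2 * M.Cb * T) y.1 y.2

lemma CarZ.add {S : Set (ℝ × ℝ)} {Φ Ψ : ℝ → ℝ × ℝ → (ι → ℝ) → ℝ} (h : CarZ S Φ) (k : CarZ S Ψ) :
    CarZ S (fun t p z => Φ t p z + Ψ t p z) := by
  refine ⟨h.meas.add k.meas, fun t => (h.cont t).add (k.cont t), ?_⟩
  obtain ⟨C, hC⟩ := h.bdd
  obtain ⟨D, hD⟩ := k.bdd
  exact ⟨C + D, fun t p z => (abs_add_le _ _).trans (add_le_add (hC t p z) (hD t p z))⟩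

lemma CarZ.mul {S : Set (ℝ × ℝ)} {Φ Ψ : ℝ → ℝ × ℝ → (ι → ℝ) → ℝ} (h : CarZ S Φ) (k : CarZ S Ψ) :
    CarZ S (fun t p z => Φ t p z * Ψ t p z) := by
  refine ⟨h.meas.mul k.meas, fun t => (h.cont t).mul (k.cont t), ?_⟩
  obtain ⟨C, hC⟩ := h.bdd
  obtain ⟨D, hD⟩ := k.bdd
  refine ⟨C * D, fun t p z => ?_⟩
  rw [abs_mul]
  exact mul_le_mul (hC t p z) (hD t p z) (abs_nonneg _) ((abs_nonneg _).trans (hC t p z))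

lemma Car.toZ {S : Set (ℝ × ℝ)} {F : ℝ → ℝ × ℝ → ℝ} (h : Car S F) : CarZ S (fun t p (_ : ι → ℝ) => F t p) := by
  refine ⟨?_, fun t => ?_, ?_⟩
  · exact h.meas.comp (measurable_fst.prodMk (measurable_snd.fst))
  · exact (h.cont t).comp continuousOn_fst (fun q hq => hq.1)
  · obtain ⟨C, hC⟩ := h.bdd
    exact ⟨C, fun t p _ => hC t p⟩

lemma Mod.L_car {u ut ux uxx : ℝ → ℝ → ℝ} (hu : IsCb12 T O u ut ux uxx) :
    CarZ (closure O ×ˢ A) (M.L ut ux uxx) := by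
  obtain ⟨C, hC⟩ := hu.bdd
  have c1 : Car (closure O ×ˢ A) (cut T O ut) := cut_car hu.cont_t ⟨C, fun t ht x hx => (hC t ht x hx).2.1⟩
  have c2 : Car (closure O ×ˢ A) (cut T O ux) := cut_car hu.cont_x ⟨C, fun t ht x hx => (hC t ht x hx).2.2.1⟩
  have c3 : Car (closure O ×ˢ A) (cut T O uxx) := cut_car hu.cont_xx ⟨C, fun t ht x hx => (hC t ht x hx).2.2.2⟩
  have hs : CarZ (closure O ×ˢ A) (fun t p z => M.s t p z ^ 2 / 2) := by
    have := (M.s_car.mul M.s_car).mul ((Car.const (S := closure O ×ˢ A) (1/2:ℝ)).toZ (ι := ι))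
    convert this using 4
    ring
  exact c1.toZ.add ((M.b_car.mul c2.toZ).add (hs.mul c3.toZ))

lemma Mod.h_bm (i : ι) : BM (cut T O (M.h i)) :=
  (cut_car (A := A) (M.h_cont i) ⟨M.Ch, fun t _ x _ => M.h_bd i t x⟩).bm

lemma cut_bd {G : ℝ → ℝ → ℝ} {C : ℝ} (hC : ∀ t x, |G t x| ≤ C) (t : ℝ) (p : ℝ × ℝ) : |cut T O G t p| ≤ C := by
  simp only [cut]
  split_ifs
  · exact hC _ _
  · simpa using (abs_nonneg _).trans (hC 0 0)

lemma Mod.zf_meas {m} (hm : Fl O A m) : Measurable (M.zf m) :=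
  measurable_pi_lambda _ fun i => hm.zmeas (M.h_bm i)

lemma Mod.zf_bd {m} (hm : Fl O A m) (t : ℝ) : ‖M.zf m t‖ ≤ M.Ch := by
  rw [pi_norm_le_iff_of_nonneg M.Ch0]
  intro i
  exact hm.zbd M.Ch0 t fun p _ => cut_bd (M.h_bd i) t p

lemma Mod.Cb0 : 0 ≤ M.Cb := (abs_nonneg _).trans (M.b_bd 0 0 0)

/-- admissible implies relaxed admissible -/
lemma Mod.FP.reg (hT : 0 < T) {z : ℝ → ι → ℝ} (hz : Measurable z) {y : Y} (h : M.FP m0 z y) : M.RegP m0 y := by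
  refine ⟨h.prob, h.supp, h.fl, ?_⟩
  intro u ut ux uxx hu C hC hb
  obtain ⟨D, hD⟩ := hu.bdd
  have c1 : Car (closure O ×ˢ A) (cut T O ut) := cut_car hu.cont_t ⟨D, fun t ht x hx => (hD t ht x hx).2.1⟩
  have e1 : I2 T y.2 (fun t p => ut t p.1) = I2 T y.2 (cut T O ut) :=
    h.fl.I2_congr fun t ht p hp => (cut_eq ht hp.1).symm
  have cL := (M.L_car hu).car hz
  rw [h.eq u ut ux uxx hu, e1]
  have e2 : ∫ x, u 0 x ∂m0 + I2 T y.2 (fun t p => M.L ut ux uxx t p (z t)) - ∫ x, u 0 x ∂m0 - I2 T y.2 (cut T O ut)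
      = I2 T y.2 (fun t p => M.L ut ux uxx t p (z t) - cut T O ut t p) := by
    rw [h.fl.I2_sub cL.bm c1.bm]; ring
  rw [e2]
  have hCb := M.Cb0
  have := h.fl.I2_abs_const hT.le (C := 2 * M.Cb * C) (by positivity) (cL.bm.sub c1.bm) (fun t ht p hp => by
    simp only [Mod.L]
    rw [cut_eq ht hp.1, cut_eq ht hp.1, cut_eq ht hp.1, add_sub_cancel_left]
    obtain ⟨b1, b2⟩ := hb t ht p.1 hp.1
    refine (abs_add_le _ _).trans ?_
    rw [abs_mul, abs_mul]
    have a1 := mul_le_mul (M.b_bd t p (z t)) b1 (abs_nonneg _) hCb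
    have a2 := mul_le_mul (M.s_bd t p (z t)) b2 (abs_nonneg _) hCb
    linarith)
  linarith

lemma Mod.g_ext (w : ι → ℝ) : ∃ k : ℝ × ℝ → ℝ, Continuous k ∧ (∀ p, |k p| ≤ M.Cg) ∧
    ∀ t ∈ Icc 0 T, ∀ x ∈ closure O, k (t, x) = M.g t x w := by
  have hc : ContinuousOn (fun p : ℝ × ℝ => M.g p.1 p.2 w) (Icc 0 T ×ˢ closure O) :=
    M.g_cont.comp (f := fun p : ℝ × ℝ => (p, w)) (by fun_prop) (fun p hp => ⟨hp, mem_univ _⟩)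
  exact ext_cont hc ((abs_nonneg _).trans (M.g_bd 0 0 w)) fun t _ x _ => M.g_bd t x w

lemma Reg.int_congr {B : ℝ} {μ m} (H : Reg T O A m0 B μ m) {u : ℝ → ℝ → ℝ} {k : ℝ × ℝ → ℝ}
    (hk : ∀ t ∈ Icc 0 T, ∀ x ∈ closure O, k (t, x) = u t x) : ∫ p, u p.1 p.2 ∂μ = ∫ p, k p ∂μ := by
  apply integral_congr_ae
  filter_upwards [H.ae] with p hp
  exact (hk p.1 hp.1 p.2 hp.2).symm

lemma Mod.Gam_bd (hT : 0 < T) {z : ℝ → ι → ℝ} (hz : Measurable z) (w : ι → ℝ) {y : Y} (h : M.RegP m0 y) :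
    |M.Gam z w y| ≤ M.Cg * T + M.Cg := by
  have hp := h.prob
  have h1 := h.fl.I2_abs_const hT.le ((abs_nonneg _).trans (M.f_bd 0 0 0)) (M.f_car.car hz).bm
    (fun t _ p _ => M.f_bd t p (z t))
  have h2 := norm_integral_le_of_norm_le_const (μ := y.1) (f := fun p : ℝ × ℝ => M.g p.1 p.2 w) (C := M.Cg)
    (Eventually.of_forall fun p => M.g_bd _ _ _)
  rw [Real.norm_eq_abs] at h2
  simp at h2
  exact (abs_add_le _ _).trans (add_le_add h1 h2)

/-- uniform continuity in the parameter. -/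
lemma Mod.Gam_unif (hT : 0 < T) (hA : IsCompact A) [IsProbabilityMeasure m0] {x : Y} (hx : M.RegP m0 x) (ε : ℝ) (hε : 0 < ε) :
    ∃ δ > 0, ∀ x', M.RegP m0 x' → ∫ t in Icc 0 T, ‖M.zf x'.2 t - M.zf x.2 t‖ ≤ δ → ‖M.wf x'.1 - M.wf x.1‖ ≤ δ →
      ∀ y, M.RegP m0 y → |M.GamY x' y - M.GamY x y| ≤ ε := by
  obtain ⟨δ1, hδ1, h1⟩ := nem_reg (m0 := m0) hT hA (2 * M.Cb * T) M.f_car (M.zf_meas hx.fl) (M.zf_bd hx.fl) (ε / 2) (by positivity)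
  obtain ⟨δ2, hδ2, h2⟩ := term_reg (A := A) (m0 := m0) hT (2 * M.Cb * T) M.g_cont M.g_bd (M.wf x.1) (ε / 2) (by positivity)
  refine ⟨min δ1 δ2, lt_min hδ1 hδ2, fun x' hx' a1 a2 y hy => ?_⟩
  have b1 := h1 _ (M.zf_meas hx'.fl) (M.zf_bd hx'.fl) (a1.trans (min_le_left _ _)) _ _ hy
  have b2 := h2 _ (a2.trans (min_le_right _ _)) _ _ hy
  unfold Mod.GamY Mod.Gam
  rw [abs_le] at b1 b2 ⊢
  constructor <;> linarith [b1.1, b1.2, b2.1, b2.2]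

lemma Mod.L_unif (hT : 0 < T) (hA : IsCompact A) [IsProbabilityMeasure m0] {x : Y} (hx : M.RegP m0 x) {u ut ux uxx : ℝ → ℝ → ℝ}
    (hu : IsCb12 T O u ut ux uxx) (ε : ℝ) (hε : 0 < ε) :
    ∃ δ > 0, ∀ x', M.RegP m0 x' → ∫ t in Icc 0 T, ‖M.zf x'.2 t - M.zf x.2 t‖ ≤ δ →
      ∀ y, M.RegP m0 y → |I2 T y.2 (fun t p => M.L ut ux uxx t p (M.zf x'.2 t)) -
        I2 T y.2 (fun t p => M.L ut ux uxx t p (M.zf x.2 t))| ≤ ε := by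
  obtain ⟨δ1, hδ1, h1⟩ := nem_reg (m0 := m0) hT hA (2 * M.Cb * T) (M.L_car hu) (M.zf_meas hx.fl) (M.zf_bd hx.fl) ε hε
  exact ⟨δ1, hδ1, fun x' hx' a1 y hy => h1 _ (M.zf_meas hx'.fl) (M.zf_bd hx'.fl) a1 _ _ hy⟩

/-- convergence gives closeness -/
lemma Mod.cv_close (hT : 0 < T) [IsProbabilityMeasure m0] (hm0 : m0 Oᶜ = 0) {xn : ℕ → Y} {x : Y}
    (H : ∀ n, M.RegP m0 (xn n)) (H0 : M.RegP m0 x) (hcv : Cv T O A (fun n => (xn n).1) (fun n => (xn n).2) x.1 x.2)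
    (δ : ℝ) (hδ : 0 < δ) :
    ∀ᶠ n in atTop, ∫ t in Icc 0 T, ‖M.zf (xn n).2 t - M.zf x.2 t‖ ≤ δ ∧ ‖M.wf (xn n).1 - M.wf x.1‖ ≤ δ := by
  have h1 : Tendsto (fun n => ∑ i, ∫ t in Icc 0 T, |M.zf (xn n).2 t i - M.zf x.2 t i|) atTop (𝓝 (∑ i : ι, (0:ℝ))) :=
    tendsto_finsetSum _ fun i _ => z_L1 hT hm0 H H0 hcv (M.h_cont i) (fun t _ x _ => M.h_bd i t x)
  have h2 : Tendsto (fun n => M.wf (xn n).1) atTop (𝓝 (M.wf x.1)) := by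
    rw [tendsto_pi_nhds]
    intro i
    obtain ⟨k, kc, kb, hk⟩ := ext_cont (M.gh_cont i) M.Ch0 (fun t _ x _ => M.gh_bd i t x)
    have := hcv.c1 k kc ⟨_, kb⟩
    unfold Mod.wf
    rw [H0.int_congr hk]
    exact this.congr fun n => ((H n).int_congr hk).symm
  rw [Metric.tendsto_nhds] at h2
  simp only [Finset.sum_const_zero] at h1
  filter_upwards [h1.eventually_lt_const hδ, h2 δ hδ] with n hn1 hn2
  refine ⟨?_, by rw [dist_eq_norm] at hn2; exact hn2.le⟩
  refine le_trans ?_ hn1.le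
  have hi : ∀ i, Integrable (fun t => |M.zf (xn n).2 t i - M.zf x.2 t i|) (volume.restrict (Icc 0 T)) := fun i =>
    (((H n).fl.zint (M.h_bm i)).sub (H0.fl.zint (M.h_bm i))).abs
  rw [← integral_finset_sum _ fun i _ => hi i]
  apply integral_mono_of_nonneg (Eventually.of_forall fun t => norm_nonneg _) (integrable_finset_sum _ fun i _ => hi i)
  refine Eventually.of_forall fun t => ?_
  refine (pi_norm_le_iff_of_nonneg (Finset.sum_nonneg fun i _ => abs_nonneg _)).2 fun i => ?_
  exact Finset.single_le_sum (f := fun i => |M.zf (xn n).2 t i - M.zf x.2 t i|) (fun j _ => abs_nonneg _) (Finset.mem_univ i)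

lemma Mod.Gam_cv {xn : ℕ → Y} {x : Y}
    (H : ∀ n, M.RegP m0 (xn n)) (H0 : M.RegP m0 x) (hcv : Cv T O A (fun n => (xn n).1) (fun n => (xn n).2) x.1 x.2)
    {z : ℝ → ι → ℝ} (hz : Measurable z) (w : ι → ℝ) :
    Tendsto (fun n => M.Gam z w (xn n)) atTop (𝓝 (M.Gam z w x)) := by
  obtain ⟨k, kc, kb, hk⟩ := M.g_ext w
  have := (hcv.c2 _ (M.f_car.car hz)).add (hcv.c1 k kc ⟨_, kb⟩)
  unfold Mod.Gam
  rw [H0.int_congr (u := fun t x => M.g t x w) hk]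
  refine this.congr fun n => ?_
  rw [(H n).int_congr (u := fun t x => M.g t x w) hk]

end
end LPN
end

noncomputable section
namespace LPN

section
variable {T : ℝ} {O A : Set ℝ} {m0 : Measure ℝ} {ι : Type} [Fintype ι] (M : Mod ι T O A)

/-- x is the mixture of the ys -/
structure Mix (T : ℝ) {κ : Type} [Fintype κ] (l : κ → ℝ) (ys : κ → Y) (x : Y) : Prop where
  i2 : ∀ F, BM F → I2 T x.2 F = ∑ i, l i * I2 T (ys i).2 F
  int : ∀ h : ℝ × ℝ → ℝ, (∀ i, Integrable h (ys i).1) → ∫ p, h p ∂x.1 = ∑ i, l i * ∫ p, h p ∂(ys i).1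

def mix {κ : Type} [Fintype κ] (l : κ → ℝ) (ys : κ → Y) : Y :=
  (∑ i, ENNReal.ofReal (l i) • (ys i).1, fun t => ∑ i, ENNReal.ofReal (l i) • (ys i).2 t)

lemma int_mix {α : Type} [MeasurableSpace α] {κ : Type} [Fintype κ] {l : κ → ℝ} (hl : ∀ i, 0 ≤ l i) {ν : κ → Measure α}
    {h : α → ℝ} (hi : ∀ i, Integrable h (ν i)) :
    ∫ p, h p ∂(∑ i, ENNReal.ofReal (l i) • ν i) = ∑ i, l i * ∫ p, h p ∂(ν i) := by
  rw [integral_finsetSum_measure (fun i _ => (hi i).smul_measure ENNReal.ofReal_ne_top)]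
  refine Finset.sum_congr rfl fun i _ => ?_
  rw [integral_smul_measure, ENNReal.toReal_ofReal (hl i), smul_eq_mul]

lemma int_u {B : ℝ} {μ m} (H : Reg T O A m0 B μ m) {u ut ux uxx : ℝ → ℝ → ℝ} (hu : IsCb12 T O u ut ux uxx) :
    Integrable (fun p : ℝ × ℝ => u p.1 p.2) μ := by
  obtain ⟨C, hC⟩ := hu.bdd
  have hc := H.prob
  by_cases h0 : ∃ t ∈ Icc 0 T, ∃ x ∈ closure O, True
  · obtain ⟨t0, ht0, x0, hx0, -⟩ := h0
    obtain ⟨k, kc, kb, hk⟩ := ext_cont hu.cont ((abs_nonneg _).trans (hC t0 ht0 x0 hx0).1) (fun t ht x hx => (hC t ht x hx).1)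
    have : Integrable k μ := Integrable.of_bound kc.aestronglyMeasurable C (Eventually.of_forall kb)
    refine this.congr ?_
    filter_upwards [H.ae] with p hp
    exact hk p.1 hp.1 p.2 hp.2
  · exfalso
    obtain ⟨p, hp⟩ := H.ae.exists
    exact h0 ⟨p.1, hp.1, p.2, hp.2, trivial⟩

lemma Mod.g_int {y : Y} (H : M.RegP m0 y) (w : ι → ℝ) : Integrable (fun p : ℝ × ℝ => M.g p.1 p.2 w) y.1 := by
  have hc := H.prob
  obtain ⟨k, kc, kb, hk⟩ := M.g_ext w
  have : Integrable k y.1 := Integrable.of_bound kc.aestronglyMeasurable _ (Eventually.of_forall kb)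
  refine this.congr ?_
  filter_upwards [H.ae] with p hp
  exact hk p.1 hp.1 p.2 hp.2

lemma Mod.gh_int {y : Y} (H : M.RegP m0 y) (i : ι) : Integrable (fun p : ℝ × ℝ => M.gh i p.1 p.2) y.1 := by
  have hc := H.prob
  obtain ⟨k, kc, kb, hk⟩ := ext_cont (M.gh_cont i) M.Ch0 (fun t _ x _ => M.gh_bd i t x)
  have : Integrable k y.1 := Integrable.of_bound kc.aestronglyMeasurable _ (Eventually.of_forall kb)
  refine this.congr ?_
  filter_upwards [H.ae] with p hp
  exact hk p.1 hp.1 p.2 hp.2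

lemma cut_bm_of {u ut ux uxx : ℝ → ℝ → ℝ} (hu : IsCb12 T O u ut ux uxx) : BM (cut T O ut) := by
  obtain ⟨D, hD⟩ := hu.bdd
  exact (cut_car (A := univ) hu.cont_t ⟨D, fun t ht x hx => (hD t ht x hx).2.1⟩).bm

lemma mix_fl {κ : Type} [Fintype κ] {l : κ → ℝ} (hl : ∀ i, 0 ≤ l i) (hs : ∑ i, l i = 1) {ys : κ → Y}
    (hy : ∀ i, Fl O A (ys i).2) : Fl O A (mix l ys).2 := by
  refine ⟨?_, fun t => ?_, fun t => ?_⟩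
  · refine Measure.measurable_of_measurable_coe _ fun s hs => ?_
    simp only [mix, Measure.finsetSum_apply, Measure.smul_apply, smul_eq_mul]
    refine Finset.measurable_sum _ fun i _ => ?_
    exact ((Measure.measurable_coe hs).comp (hy i).meas).const_mul _
  · simp only [mix, Measure.finsetSum_apply, Measure.smul_apply, smul_eq_mul]
    calc _ ≤ ∑ i, ENNReal.ofReal (l i) := Finset.sum_le_sum fun i _ => by
            simpa using mul_le_mul_right ((hy i).mass t) _
      _ = 1 := by rw [← ENNReal.ofReal_sum_of_nonneg (fun i _ => hl i), hs]; simp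
  · simp only [mix, Measure.finsetSum_apply, Measure.smul_apply, smul_eq_mul]
    simp [(hy _).supp]

lemma mix_mix {κ : Type} [Fintype κ] {l : κ → ℝ} (hl : ∀ i, 0 ≤ l i) {ys : κ → Y}
    (hy : ∀ i, Fl O A (ys i).2) : Mix T l ys (mix l ys) := by
  refine ⟨fun F hF => ?_, fun h hi => int_mix hl hi⟩
  unfold I2
  simp only [mix]
  calc _ = ∫ t in Icc 0 T, ∑ i, l i * ∫ p, F t p ∂((ys i).2 t) := by
        congr 1; ext t
        exact int_mix hl fun i => (hy i).inner_int hF t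
    _ = _ := by
        rw [integral_finsetSum _ fun i _ => ((hy i).zint hF).const_mul _]
        simp_rw [integral_const_mul]

lemma mix_reg {κ : Type} [Fintype κ] {l : κ → ℝ} (hl : ∀ i, 0 ≤ l i) (hs : ∑ i, l i = 1) {ys : κ → Y}
    {B : ℝ} (hy : ∀ i, Reg T O A m0 B (ys i).1 (ys i).2) : Reg T O A m0 B (mix l ys).1 (mix l ys).2 := by
  have hmm := mix_mix (T := T) hl fun i => (hy i).fl
  have hfl := mix_fl hl hs fun i => (hy i).fl
  refine ⟨⟨?_⟩, ?_, hfl, ?_⟩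
  · simp only [mix, Measure.finsetSum_apply, Measure.smul_apply, smul_eq_mul]
    have := fun i => (hy i).prob.measure_univ
    simp only [this, mul_one]
    rw [← ENNReal.ofReal_sum_of_nonneg (fun i _ => hl i), hs]; simp
  · simp only [mix, Measure.finsetSum_apply, Measure.smul_apply, smul_eq_mul]
    simp [(hy _).supp]
  · intro u ut ux uxx hu C hC hb
    have e1 : ∀ {m}, Fl O A m → I2 T m (fun t p => ut t p.1) = I2 T m (cut T O ut) := fun h =>
      h.I2_congr fun t ht p hp => (cut_eq ht hp.1).symm
    rw [e1 hfl, hmm.i2 _ (cut_bm_of hu), hmm.int _ (fun i => int_u (hy i) hu)]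
    have e2 : ∫ x, u 0 x ∂m0 = ∑ i, l i * ∫ x, u 0 x ∂m0 := by rw [← Finset.sum_mul, hs, one_mul]
    rw [e2, ← Finset.sum_sub_distrib, ← Finset.sum_sub_distrib]
    refine (Finset.abs_sum_le_sum_abs _ _).trans ?_
    calc _ ≤ ∑ i, l i * (B * C) := Finset.sum_le_sum fun i _ => by
            have := (hy i).ineq u ut ux uxx hu C hC hb
            rw [e1 (hy i).fl] at this
            rw [← mul_sub, ← mul_sub, abs_mul, abs_of_nonneg (hl i)]
            exact mul_le_mul_of_nonneg_left this (hl i)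
      _ = B * C := by rw [← Finset.sum_mul, hs, one_mul]

lemma Mod.Gam_mix {κ : Type} [Fintype κ] {l : κ → ℝ} {ys : κ → Y} {x : Y} (hx : Mix T l ys x)
    (hy : ∀ i, M.RegP m0 (ys i)) {z : ℝ → ι → ℝ} (hz : Measurable z) (w : ι → ℝ) :
    M.Gam z w x = ∑ i, l i * M.Gam z w (ys i) := by
  unfold Mod.Gam
  rw [hx.i2 _ (M.f_car.car hz).bm, hx.int _ (fun i => M.g_int (hy i) w), ← Finset.sum_add_distrib]
  refine Finset.sum_congr rfl fun i _ => by ring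

/-- lower semicontinuity of best responses -/
def Mod.LSC (m0 : Measure ℝ) : Prop := ∀ x, M.RegP m0 x → ∀ y, M.FP m0 (M.zf x.2) y → ∀ ε > 0, ∃ δ > 0, ∀ x', M.RegP m0 x' →
  ∫ t in Icc 0 T, ‖M.zf x'.2 t - M.zf x.2 t‖ ≤ δ → ‖M.wf x'.1 - M.wf x.1‖ ≤ δ →
  ∃ y', M.FP m0 (M.zf x'.2) y' ∧ M.GamY x y - ε ≤ M.GamY x' y'

def Mod.Close (δ : ℝ) (x' x : Y) : Prop :=
  ∫ t in Icc 0 T, ‖M.zf x'.2 t - M.zf x.2 t‖ ≤ δ ∧ ‖M.wf x'.1 - M.wf x.1‖ ≤ δ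

def Mod.Nash (m0 : Measure ℝ) (x : Y) : Prop :=
  M.FP m0 (M.zf x.2) x ∧ ∀ y, M.FP m0 (M.zf x.2) y → M.GamY x y ≤ M.GamY x x

/-- approximate Nash: a mixture of eps-best responses to nearby points -/
def Mod.AN (m0 : Measure ℝ) (ε : ℝ) (x : Y) : Prop :=
  ∃ (κ : Type) (_ : Fintype κ) (l : κ → ℝ) (xs ys : κ → Y), (∀ i, 0 ≤ l i) ∧ ∑ i, l i = 1 ∧
    (∀ i, M.RegP m0 (xs i)) ∧ (∀ i, M.FP m0 (M.zf (xs i).2) (ys i)) ∧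
    (∀ i y, M.FP m0 (M.zf (xs i).2) y → M.GamY (xs i) y ≤ M.GamY (xs i) (ys i) + ε) ∧
    (∀ i, 0 < l i → M.Close ε (xs i) x) ∧ Mix T l ys x

lemma Mod.z_int {x : Y} (hx : Fl O A x.2) : Integrable (M.zf x.2) (volume.restrict (Icc 0 T)) :=
  Measure.integrableOn_of_bounded (M := M.Ch) (by simp) (M.zf_meas hx).aestronglyMeasurable
    (Eventually.of_forall fun t => M.zf_bd hx t)

lemma Mod.Close.trans {δ δ' : ℝ} {a b c : Y} (ha : Fl O A a.2) (hb : Fl O A b.2) (hc : Fl O A c.2)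
    (h1 : M.Close δ a b) (h2 : M.Close δ' b c) : M.Close (δ + δ') a c := by
  constructor
  · have i1 := (M.z_int ha).sub (M.z_int hb)
    have i2 := (M.z_int hb).sub (M.z_int hc)
    have i3 := (M.z_int ha).sub (M.z_int hc)
    have : ∫ t in Icc 0 T, ‖M.zf a.2 t - M.zf c.2 t‖ ≤ ∫ t in Icc 0 T, (‖M.zf a.2 t - M.zf b.2 t‖ + ‖M.zf b.2 t - M.zf c.2 t‖) :=
      integral_mono i3.norm (i1.norm.add i2.norm) fun t => by
        simpa using norm_sub_le_norm_sub_add_norm_sub (M.zf a.2 t) (M.zf b.2 t) (M.zf c.2 t)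
    have h3 : ∫ t in Icc 0 T, (‖M.zf a.2 t - M.zf b.2 t‖ + ‖M.zf b.2 t - M.zf c.2 t‖) =
      (∫ t in Icc 0 T, ‖M.zf a.2 t - M.zf b.2 t‖) + ∫ t in Icc 0 T, ‖M.zf b.2 t - M.zf c.2 t‖ := integral_add i1.norm i2.norm
    linarith [h1.1, h2.1]
  · have := norm_sub_le_norm_sub_add_norm_sub (M.wf a.1) (M.wf b.1) (M.wf c.1)
    linarith [h1.2, h2.2]

lemma wsum_le {κ : Type} [Fintype κ] {l a : κ → ℝ} {c : ℝ} (hl : ∀ i, 0 ≤ l i) (hs : ∑ i, l i = 1)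
    (h : ∀ i, 0 < l i → a i ≤ c) : ∑ i, l i * a i ≤ c := by
  calc _ ≤ ∑ i, l i * c := Finset.sum_le_sum fun i _ => by
        rcases (hl i).eq_or_lt with h0 | h0
        · rw [← h0]; simp
        · exact mul_le_mul_of_nonneg_left (h i h0) h0.le
    _ = c := by rw [← Finset.sum_mul, hs, one_mul]

lemma le_wsum {κ : Type} [Fintype κ] {l a : κ → ℝ} {c : ℝ} (hl : ∀ i, 0 ≤ l i) (hs : ∑ i, l i = 1)
    (h : ∀ i, 0 < l i → c ≤ a i) : c ≤ ∑ i, l i * a i := by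
  have := wsum_le (a := fun i => - a i) (c := -c) hl hs (fun i hi => neg_le_neg (h i hi))
  simp only [mul_neg, Finset.sum_neg_distrib] at this
  linarith

/-- limits of approximate Nash are Nash -/
lemma Mod.limit (hT : 0 < T) (hA : IsCompact A) [IsProbabilityMeasure m0] (hm0 : m0 Oᶜ = 0) (hL : M.LSC m0)
    {xn : ℕ → Y} {x : Y} {en : ℕ → ℝ} (he : Tendsto en atTop (𝓝 0))
    (H : ∀ n, M.RegP m0 (xn n)) (HA : ∀ n, M.AN m0 (en n) (xn n)) (H0 : M.RegP m0 x)
    (hcv : Cv T O A (fun n => (xn n).1) (fun n => (xn n).2) x.1 x.2) : M.Nash m0 x := by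
  have near : ∀ δ > 0, ∀ᶠ n in atTop, M.Close (δ / 2) (xn n) x ∧ en n ≤ δ / 2 := fun δ hδ => by
    have h1 := M.cv_close hT hm0 H H0 hcv (δ / 2) (by positivity)
    have h2 := he.eventually_le_const (show (0:ℝ) < δ / 2 by positivity)
    filter_upwards [h1, h2] with n a b
    exact ⟨a, b⟩
  have zm := M.zf_meas H0.fl
  constructor
  · refine ⟨H0.prob, H0.supp, H0.fl, fun u ut ux uxx hu => ?_⟩
    have cL := (M.L_car hu).car zm
    set d := ∫ p, u p.1 p.2 ∂x.1 - ∫ x, u 0 x ∂m0 - I2 T x.2 (fun t p => M.L ut ux uxx t p (M.zf x.2 t)) with hd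
    have hdl : Tendsto (fun n => ∫ p, u p.1 p.2 ∂(xn n).1 - ∫ x, u 0 x ∂m0 - I2 T (xn n).2 (fun t p => M.L ut ux uxx t p (M.zf x.2 t)))
        atTop (𝓝 d) := by
      obtain ⟨C, hC⟩ := hu.bdd
      have hpr := H0.prob
      obtain ⟨p, hp⟩ := H0.ae.exists
      obtain ⟨k, kc, kb, hk⟩ := ext_cont hu.cont ((abs_nonneg _).trans (hC p.1 hp.1 p.2 hp.2).1) (fun t ht x hx => (hC t ht x hx).1)
      have h1 := hcv.c1 k kc ⟨_, kb⟩
      rw [hd, H0.int_congr hk]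
      refine ((h1.sub_const _).sub (hcv.c2 _ cL)).congr fun n => ?_
      rw [(H n).int_congr hk]
    have : |d| ≤ 0 := by
      refine le_of_forall_pos_le_add fun ε hε => ?_
      obtain ⟨δ, hδ, hh⟩ := M.L_unif hT hA H0 hu ε hε
      refine le_of_tendsto hdl.abs ?_
      filter_upwards [near δ hδ] with n ⟨hn, hen⟩
      obtain ⟨κ, _, l, xs, ys, hl, hs, hxs, hys, -, hc, hmix⟩ := HA n
      have hyr : ∀ i, M.RegP m0 (ys i) := fun i => (hys i).reg M hT (M.zf_meas (hxs i).fl)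
      rw [hmix.i2 _ cL.bm, hmix.int _ (fun i => int_u (hyr i) hu)]
      have e2 : ∫ x, u 0 x ∂m0 = ∑ i, l i * ∫ x, u 0 x ∂m0 := by rw [← Finset.sum_mul, hs, one_mul]
      rw [e2, ← Finset.sum_sub_distrib, ← Finset.sum_sub_distrib]
      have key : ∀ i, 0 < l i → |∫ p, u p.1 p.2 ∂(ys i).1 - ∫ x, u 0 x ∂m0 - I2 T (ys i).2 (fun t p => M.L ut ux uxx t p (M.zf x.2 t))| ≤ ε := by
        intro i hi
        have hcl := (hc i hi).trans M (hxs i).fl (H n).fl H0.fl hn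
        have := hh _ (hxs i) (hcl.1.trans (by linarith)) _ (hyr i)
        rw [(hys i).eq u ut ux uxx hu]
        convert this using 2
        ring
      have k1 := wsum_le hl hs (fun i hi => (abs_le.1 (key i hi)).2)
      have k2 := le_wsum hl hs (fun i hi => (abs_le.1 (key i hi)).1)
      rw [abs_le]
      constructor
      · refine le_trans (by linarith) (k2.trans (le_of_eq (Finset.sum_congr rfl fun i _ => by ring)))
      · refine le_trans (le_of_eq (Finset.sum_congr rfl fun i _ => by ring)) (k1.trans (by linarith))
    have hd0 : d = 0 := abs_nonpos_iff.1 this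
    linarith
  · intro y hy
    refine le_of_forall_pos_le_add fun ε hε => ?_
    obtain ⟨δ1, hδ1, h1⟩ := hL x H0 y hy (ε / 3) (by positivity)
    obtain ⟨δ2, hδ2, h2⟩ := M.Gam_unif hT hA H0 (ε / 3) (by positivity)
    set δ := min (min δ1 δ2) (ε / 3)
    have hδ : 0 < δ := lt_min (lt_min hδ1 hδ2) (by positivity)
    have g1 : δ ≤ δ1 := (min_le_left _ _).trans (min_le_left _ _)
    have g2 : δ ≤ δ2 := (min_le_left _ _).trans (min_le_right _ _)
    have g3 : δ ≤ ε / 3 := min_le_right _ _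
    have hlim := (M.Gam_cv H H0 hcv zm (M.wf x.1))
    suffices M.GamY x y - ε ≤ M.GamY x x by linarith
    refine ge_of_tendsto hlim ?_
    filter_upwards [near δ hδ] with n ⟨hn, hen⟩
    obtain ⟨κ, _, l, xs, ys, hl, hs, hxs, hys, hopt, hc, hmix⟩ := HA n
    have hyr : ∀ i, M.RegP m0 (ys i) := fun i => (hys i).reg M hT (M.zf_meas (hxs i).fl)
    rw [M.Gam_mix hmix hyr zm]
    refine le_wsum hl hs fun i hi => ?_
    have hcl := (hc i hi).trans M (hxs i).fl (H n).fl H0.fl hn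
    obtain ⟨y', hy', hyy⟩ := h1 _ (hxs i) (hcl.1.trans (by linarith)) (hcl.2.trans (by linarith))
    have := hopt i y' hy'
    have h3 := abs_le.1 (h2 _ (hxs i) (hcl.1.trans (by linarith)) (hcl.2.trans (by linarith)) _ (hyr i))
    have h4 := h3.2
    have h5 : M.GamY x (ys i) = M.Gam (M.zf x.2) (M.wf x.1) (ys i) := rfl
    linarith
end
end LPN
end

noncomputable section
namespace LPN

section
variable {T : ℝ} {O A : Set ℝ} {m0 : Measure ℝ} {ι : Type} [Fintype ι] (M : Mod ι T O A)

/-- the trivial pair: exit at time zero -/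
def y0 (m0 : Measure ℝ) : Y := (m0.map (fun x => ((0:ℝ), x)), fun _ => 0)

lemma Mod.FP_y0 (hT : 0 < T) [IsProbabilityMeasure m0] (hm0 : m0 Oᶜ = 0) (z : ℝ → ι → ℝ) : M.FP m0 z (y0 m0) := by
  have hme : MeasurableEmbedding (fun x : ℝ => ((0:ℝ), x)) := measurableEmbedding_prodMk_left 0
  refine ⟨Measure.isProbabilityMeasure_map hme.measurable.aemeasurable, ?_, ?_, ?_⟩
  · simp only [y0]
    rw [hme.map_apply]
    refine measure_mono_null (fun x hx => ?_) hm0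
    intro hxO
    exact hx ⟨⟨le_rfl, hT.le⟩, subset_closure hxO⟩
  · exact ⟨measurable_const, fun t => by simp [y0], fun t => by simp [y0]⟩
  · intro u ut ux uxx hu
    simp only [y0]
    rw [hme.integral_map]
    simp [I2]

def Mod.img (x : Y) : (ℝ →₁[volume.restrict (Icc 0 T)] (ι → ℝ)) × (ι → ℝ) := by
  classical
  exact (if h : Integrable (M.zf x.2) (volume.restrict (Icc 0 T)) then h.toL1 _ else 0, M.wf x.1)

lemma Mod.img_eq {x : Y} (hx : Fl O A x.2) : M.img x = ((M.z_int hx).toL1 _, M.wf x.1) := by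
  simp only [Mod.img]
  rw [dif_pos (M.z_int hx)]

lemma Mod.norm_img {x x' : Y} (hx : Fl O A x.2) (hx' : Fl O A x'.2) :
    ‖M.img x - M.img x'‖ = max (∫ t in Icc 0 T, ‖M.zf x.2 t - M.zf x'.2 t‖) ‖M.wf x.1 - M.wf x'.1‖ := by
  rw [M.img_eq hx, M.img_eq hx', Prod.mk_sub_mk, Prod.norm_mk, ← Integrable.toL1_sub, L1.norm_of_fun_eq_integral_norm]
  rfl

lemma Mod.img_mix {κ : Type} [Fintype κ] {l : κ → ℝ} (hl : ∀ i, 0 ≤ l i) (hs : ∑ i, l i = 1) {ys : κ → Y}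
    (hy : ∀ i, M.RegP m0 (ys i)) : M.img (mix l ys) = ∑ i, l i • M.img (ys i) := by
  have hfl := mix_fl hl hs fun i => (hy i).fl
  have hm := mix_mix (T := T) hl fun i => (hy i).fl
  rw [M.img_eq hfl]
  have : ∑ i, l i • M.img (ys i) = (∑ i, l i • (M.z_int (hy i).fl).toL1 _, ∑ i, l i • M.wf (ys i).1) := by
    ext1
    · rw [Prod.fst_sum]
      refine Finset.sum_congr rfl fun i _ => ?_
      rw [M.img_eq (hy i).fl]
      rfl
    · rw [Prod.snd_sum]
      refine Finset.sum_congr rfl fun i _ => ?_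
      rw [M.img_eq (hy i).fl]
      rfl
  rw [this]
  ext1
  · simp only
    apply Lp.ext
    have h1 := Lp.coeFn_fun_finsetSum (p := 1) (μ := volume.restrict (Icc 0 T)) Finset.univ (fun i => l i • (M.z_int (hy i).fl).toL1 _)
    have h2 : ∀ i, ∀ᵐ t ∂(volume.restrict (Icc 0 T)), (l i • (M.z_int (hy i).fl).toL1 _ : ℝ →₁[volume.restrict (Icc 0 T)] (ι → ℝ)) t = l i • M.zf (ys i).2 t := by
      intro i
      filter_upwards [Lp.coeFn_smul (l i) ((M.z_int (hy i).fl).toL1 _), (M.z_int (hy i).fl).coeFn_toL1] with t a1 a2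
      rw [a1, Pi.smul_apply, a2]
    filter_upwards [h1, (M.z_int hfl).coeFn_toL1, ae_all_iff.2 h2] with t a1 a2 a3
    rw [a1, a2]
    simp_rw [a3]
    ext j
    simp only [Mod.zf, mix, Finset.sum_apply, Pi.smul_apply, smul_eq_mul]
    exact int_mix hl fun i => (hy i).fl.inner_int (M.h_bm j) t
  · simp only
    ext j
    simp only [Mod.wf, Finset.sum_apply, Pi.smul_apply, smul_eq_mul]
    exact hm.int _ fun i => M.gh_int (hy i) j

lemma Mod.exists_opt (hT : 0 < T) [IsProbabilityMeasure m0] (hm0 : m0 Oᶜ = 0) {x : Y} (hx : M.RegP m0 x) {ε : ℝ} (hε : 0 < ε) :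
    ∃ y, M.FP m0 (M.zf x.2) y ∧ ∀ y', M.FP m0 (M.zf x.2) y' → M.GamY x y' ≤ M.GamY x y + ε := by
  set S := (fun y => M.GamY x y) '' {y | M.FP m0 (M.zf x.2) y}
  have hne : S.Nonempty := ⟨_, _, M.FP_y0 hT hm0 _, rfl⟩
  have hbd : BddAbove S := by
    refine ⟨M.Cg * T + M.Cg, ?_⟩
    rintro _ ⟨y, hy, rfl⟩
    exact (le_abs_self _).trans (M.Gam_bd hT (M.zf_meas hx.fl) _ (hy.reg M hT (M.zf_meas hx.fl)))
  obtain ⟨_, ⟨y, hy, rfl⟩, h⟩ := exists_lt_of_lt_csSup hne (show sSup S - ε < sSup S by linarith)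
  refine ⟨y, hy, fun y' hy' => ?_⟩
  have := le_csSup hbd ⟨y', hy', rfl⟩
  simp only at h this
  linarith

lemma Mod.exists_AN (hT : 0 < T) (hA : IsCompact A) [IsProbabilityMeasure m0] (hm0 : m0 Oᶜ = 0) {ε : ℝ} (hε : 0 < ε) :
    ∃ x, M.RegP m0 x ∧ M.AN m0 ε x := by
  classical
  set C := M.img '' {x | M.RegP m0 x} with hCdef
  have hreg0 : M.RegP m0 (y0 m0) := (M.FP_y0 hT hm0 (fun _ => 0)).reg M hT measurable_const
  have hne : C.Nonempty := ⟨_, _, hreg0, rfl⟩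
  have hconv : Convex ℝ C := by
    rintro _ ⟨x, hx, rfl⟩ _ ⟨y, hy, rfl⟩ a b ha hb hab
    let l : Bool → ℝ := fun i => if i then a else b
    let ys : Bool → Y := fun i => if i then x else y
    have hl : ∀ i, 0 ≤ l i := by intro i; cases i <;> simp [l, ha, hb]
    have hs : ∑ i, l i = 1 := by simp [l, hab]
    have hr : ∀ i, M.RegP m0 (ys i) := by
      intro i; cases i
      · exact hy
      · exact hx
    refine ⟨mix l ys, mix_reg hl hs hr, ?_⟩
    rw [M.img_mix hl hs hr]
    simp [l, ys]
  have hseq : IsSeqCompact C := by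
    intro c hc
    choose x hx hxc using hc
    obtain ⟨μ, m, φ, hφ, hr, hcv⟩ := reg_compact hT hA hx
    refine ⟨M.img (μ, m), ⟨_, hr, rfl⟩, φ, hφ, ?_⟩
    rw [Metric.tendsto_nhds]
    intro δ hδ
    filter_upwards [M.cv_close (xn := fun n => x (φ n)) (x := (μ, m)) hT hm0 (fun n => hx _) hr hcv (δ / 2) (by positivity)] with n hn
    rw [Function.comp_apply, ← hxc, dist_eq_norm, M.norm_img (hx _).fl hr.fl]
    exact (max_le hn.1 hn.2).trans_lt (by linarith)
  have hrep : ∀ p ∈ C, ∃ x, M.RegP m0 x ∧ M.img x = p := fun p hp => hp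
  choose! rep hrep1 hrep2 using hrep
  have hopt : ∀ x, M.RegP m0 x → ∃ y, M.FP m0 (M.zf x.2) y ∧ ∀ y', M.FP m0 (M.zf x.2) y' → M.GamY x y' ≤ M.GamY x y + ε :=
    fun x hx => M.exists_opt hT hm0 hx hε
  choose! opt ho1 ho2 using hopt
  have hor : ∀ x, M.RegP m0 x → M.RegP m0 (opt x) := fun x hx => (ho1 x hx).reg M hT (M.zf_meas hx.fl)
  obtain ⟨κ, _, p, w, hp, hw, hws, hcl⟩ := approx_fixed C hconv hseq.totallyBounded hne (fun p => M.img (opt (rep p)))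
    (fun p hp => ⟨_, hor _ (hrep1 p hp), rfl⟩) ε hε
  have hyr : ∀ i, M.RegP m0 (opt (rep (p i))) := fun i => hor _ (hrep1 _ (hp i))
  have hmr : M.RegP m0 (mix w fun i => opt (rep (p i))) := mix_reg hw hws hyr
  refine ⟨mix w fun i => opt (rep (p i)), hmr, κ, _, w, fun i => rep (p i), fun i => opt (rep (p i)),
    hw, hws, fun i => hrep1 _ (hp i), fun i => ho1 _ (hrep1 _ (hp i)), fun i => ho2 _ (hrep1 _ (hp i)), ?_, mix_mix hw fun i => (hyr i).fl⟩
  intro i hi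
  have := hcl i hi
  rw [← M.img_mix hw hws hyr, ← hrep2 _ (hp i), M.norm_img (hrep1 _ (hp i)).fl hmr.fl] at this
  exact ⟨(le_max_left _ _).trans this.le, (le_max_right _ _).trans this.le⟩

lemma Mod.Nash.AN (hT : 0 < T) {x : Y} (hx : M.RegP m0 x) (h : M.Nash m0 x) {ε : ℝ} (hε : 0 ≤ ε) : M.AN m0 ε x := by
  refine ⟨Unit, inferInstance, fun _ => 1, fun _ => x, fun _ => x, by simp, by simp, fun _ => hx, fun _ => h.1, fun _ y hy => ?_, fun _ _ => ?_, ?_⟩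
  · have := h.2 y hy; linarith
  · constructor <;> simpa using hε
  · constructor <;> intros <;> simp

/-- main abstract theorem -/
lemma Mod.exists_max (hT : 0 < T) (hA : IsCompact A) [IsProbabilityMeasure m0] (hm0 : m0 Oᶜ = 0) (hL : M.LSC m0) :
    ∃ x, M.RegP m0 x ∧ M.Nash m0 x ∧ ∀ y, M.RegP m0 y → M.Nash m0 y → M.GamY y y ≤ M.GamY x x := by
  have hlim := tendsto_one_div_add_atTop_nhds_zero_nat (𝕜 := ℝ)
  have hne : ∃ x, M.RegP m0 x ∧ M.Nash m0 x := by
    have : ∀ n : ℕ, ∃ x, M.RegP m0 x ∧ M.AN m0 (1 / ((n:ℝ) + 1)) x := fun n => M.exists_AN hT hA hm0 (by positivity)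
    choose x hx hAN using this
    obtain ⟨μ, m, φ, hφ, hr, hcv⟩ := reg_compact hT hA hx
    exact ⟨(μ, m), hr, M.limit (xn := fun n => x (φ n)) (x := (μ, m)) hT hA hm0 hL (hlim.comp hφ.tendsto_atTop) (fun n => hx _) (fun n => hAN _) hr hcv⟩
  set S := (fun y => M.GamY y y) '' {y | M.RegP m0 y ∧ M.Nash m0 y} with hS
  have hSne : S.Nonempty := by
    obtain ⟨x, hx⟩ := hne
    exact ⟨_, x, hx, rfl⟩
  have hbd : BddAbove S := by
    refine ⟨M.Cg * T + M.Cg, ?_⟩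
    rintro _ ⟨y, hy, rfl⟩
    exact (le_abs_self _).trans (M.Gam_bd hT (M.zf_meas hy.1.fl) _ hy.1)
  have : ∀ n : ℕ, ∃ y, (M.RegP m0 y ∧ M.Nash m0 y) ∧ sSup S - 1 / ((n:ℝ) + 1) < M.GamY y y := fun n => by
    have hp : (0:ℝ) < 1 / ((n:ℝ) + 1) := by positivity
    obtain ⟨_, ⟨y, hy, rfl⟩, h⟩ := exists_lt_of_lt_csSup hSne (show sSup S - 1 / ((n:ℝ) + 1) < sSup S by linarith)
    exact ⟨y, hy, h⟩
  choose x hx hval using this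
  obtain ⟨μ, m, φ, hφ, hr, hcv⟩ := reg_compact hT hA (fun n => (hx n).1)
  have hN : M.Nash m0 (μ, m) := M.limit (xn := fun n => x (φ n)) (x := (μ, m)) (en := fun _ => 0) hT hA hm0 hL tendsto_const_nhds (fun n => (hx _).1)
    (fun n => (hx _).2.AN M hT (hx _).1 le_rfl) hr hcv
  refine ⟨(μ, m), hr, hN, fun y hy hyN => ?_⟩
  refine (le_csSup hbd ⟨y, ⟨hy, hyN⟩, rfl⟩).trans ?_
  refine le_of_forall_pos_le_add fun ε hε => ?_
  obtain ⟨δ, hδ, h2⟩ := M.Gam_unif (x := (μ, m)) hT hA hr ε hε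
  have l1 := M.Gam_cv (xn := fun n => x (φ n)) (x := (μ, m)) (fun n => (hx _).1) hr hcv (M.zf_meas hr.fl) (M.wf μ)
  have l2 : Tendsto (fun n => sSup S - 1 / ((φ n : ℝ) + 1) - ε) atTop (𝓝 (sSup S - 0 - ε)) :=
    ((hlim.comp hφ.tendsto_atTop).const_sub _).sub_const _
  have : sSup S - 0 - ε ≤ M.Gam (M.zf m) (M.wf μ) (μ, m) := by
    refine le_of_tendsto_of_tendsto l2 l1 ?_
    filter_upwards [M.cv_close (xn := fun n => x (φ n)) (x := (μ, m)) hT hm0 (fun n => (hx _).1) hr hcv δ hδ] with n hn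
    have h3 := (abs_le.1 (h2 _ (hx (φ n)).1 hn.1 hn.2 _ (hx (φ n)).1)).2
    have h4 := hval (φ n)
    have h5 : M.GamY (μ, m) (x (φ n)) = M.Gam (M.zf m) (M.wf μ) (x (φ n)) := rfl
    linarith
  have h5 : M.GamY (μ, m) (μ, m) = M.Gam (M.zf m) (M.wf μ) (μ, m) := rfl
  linarith

/-- case (a) -/
lemma Mod.LSC_a (hT : 0 < T) (hA : IsCompact A) [IsProbabilityMeasure m0]
    (hind : ∀ t p z z', M.b t p z = M.b t p z' ∧ M.s t p z = M.s t p z') : M.LSC m0 := by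
  intro x hx y hy ε hε
  obtain ⟨δ, hδ, h⟩ := M.Gam_unif hT hA hx ε hε
  refine ⟨δ, hδ, fun x' hx' h1 h2 => ⟨y, ⟨hy.prob, hy.supp, hy.fl, fun u ut ux uxx hu => ?_⟩, ?_⟩⟩
  · rw [hy.eq u ut ux uxx hu]
    congr 2
    ext t p
    simp only [Mod.L]
    rw [(hind t p (M.zf x.2 t) (M.zf x'.2 t)).1, (hind t p (M.zf x.2 t) (M.zf x'.2 t)).2]
  · have := (abs_le.1 (h x' hx' h1 h2 y (hy.reg M hT (M.zf_meas hx.fl)))).1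
    linarith
end
end LPN
end

noncomputable section
namespace LPN

section
variable {T : ℝ} {O A : Set ℝ} {m0 : Measure ℝ}

/-- truncated flow -/
def hatm (m : ℝ → Measure (ℝ × ℝ)) : ℝ → Measure (ℝ × ℝ) := by
  classical
  exact fun t => if m t univ ≤ 1 then m t else 0

lemma hatm_fl {m} (h : MemV T O A m) : Fl O A (hatm m) := by
  have hm : Measurable m := Measure.measurable_of_measurable_coe _ h.2.2.1
  refine ⟨?_, fun t => ?_, fun t => ?_⟩
  · exact Measurable.ite (measurableSet_le (h.2.2.1 _ MeasurableSet.univ) measurable_const) hm measurable_const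
  · simp only [hatm]; split_ifs with h1
    · exact h1
    · simp
  · simp only [hatm]; split_ifs with h1
    · exact h.2.1 t
    · simp

lemma Fl.memV {m} (h : Fl O A m) : MemV T O A m := by
  refine ⟨fun t => (h.mass t).trans_lt ENNReal.one_lt_top, h.supp, fun B hB => (Measure.measurable_coe hB).comp h.meas, ?_⟩
  refine Measure.integrableOn_of_bounded (M := 1) (by simp) ?_ (Eventually.of_forall fun t => ?_)
  · exact ((Measure.measurable_coe MeasurableSet.univ).comp h.meas).ennreal_toReal.aestronglyMeasurable
  · have := h.real_le t
    rw [Real.norm_of_nonneg ENNReal.toReal_nonneg]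
    exact this

/-- mass bound -/
lemma mass_le (hT : 0 < T) [IsProbabilityMeasure m0] {μ : Measure (ℝ × ℝ)} [IsProbabilityMeasure μ] {m : ℝ → Measure (ℝ × ℝ)} (hm : MemV T O A m)
    (hμ : μ ((Icc 0 T ×ˢ closure O)ᶜ) = 0)
    (h : ∀ u ut : ℝ → ℝ, (∀ t ∈ Icc 0 T, HasDerivWithinAt u (ut t) (Icc 0 T) t) → ContinuousOn ut (Icc 0 T) →
      ∫ p, u p.1 ∂μ = u 0 + ∫ t in Icc 0 T, ut t * (m t univ).toReal) :
    ∀ᵐ t ∂(volume.restrict (Icc 0 T)), m t univ ≤ 1 := by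
  have hintg := hm.2.2.2
  have hmeas := hm.2.2.1 _ MeasurableSet.univ
  have hae : ∀ᵐ p ∂μ, p ∈ Icc 0 T ×ˢ closure O := by rw [ae_iff]; exact hμ
  -- continuous test
  have step1 : ∀ g : ℝ → ℝ, Continuous g → (∀ t, 0 ≤ g t) → (∀ t, g t ≤ 1) → ∫ t in Icc 0 T, g t * ((m t univ).toReal - 1) ≤ 0 := by
    intro g hg hg0 hg1
    have hd : ∀ t, HasDerivAt (fun t => ∫ s in t..T, g s) (- g t) t := fun t =>
      intervalIntegral.integral_hasDerivAt_left (hg.intervalIntegrable _ _) hg.stronglyMeasurable.stronglyMeasurableAtFilter hg.continuousAt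
    have := h (fun t => ∫ s in t..T, g s) (fun t => - g t) (fun t _ => (hd t).hasDerivWithinAt) hg.neg.continuousOn
    have h0 : 0 ≤ ∫ p, (∫ s in p.1..T, g s) ∂μ := by
      apply integral_nonneg_of_ae
      filter_upwards [hae] with p hp
      exact intervalIntegral.integral_nonneg hp.1.2 fun s _ => hg0 s
    have h1 : ∫ s in (0:ℝ)..T, g s = ∫ s in Icc 0 T, g s := by
      rw [intervalIntegral.integral_of_le hT.le, integral_Icc_eq_integral_Ioc]
    have gi : IntegrableOn g (Icc 0 T) := hg.continuousOn.integrableOn_compact isCompact_Icc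
    have gmi : IntegrableOn (fun t => g t * (m t univ).toReal) (Icc 0 T) := by
      refine hintg.bdd_mul (c := 1) hg.aestronglyMeasurable (Eventually.of_forall fun t => ?_)
      rw [Real.norm_of_nonneg (hg0 t)]; exact hg1 t
    have e : ∫ t in Icc 0 T, g t * ((m t univ).toReal - 1) = (∫ t in Icc 0 T, g t * (m t univ).toReal) - ∫ t in Icc 0 T, g t := by
      rw [← integral_sub gmi gi]
      congr 1; ext t; ring
    have e2 : ∫ t in Icc 0 T, -g t * (m t univ).toReal = - ∫ t in Icc 0 T, g t * (m t univ).toReal := by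
      rw [← integral_neg]; congr 1; ext t; ring
    rw [e2] at this
    linarith
  have hint1 : IntegrableOn (fun t => (m t univ).toReal - 1) (Icc 0 T) := hintg.sub (by simp)
  have step2 : ∀ K, IsCompact K → K ⊆ Icc 0 T → ∫ t in K, ((m t univ).toReal - 1) ≤ 0 := by
    intro K hK hKs
    let g : ℕ → ℝ → ℝ := fun n t => (thickenedIndicator (δ := 1 / ((n:ℝ) + 1)) (by positivity) K t : ℝ)
    have hgc : ∀ n, Continuous (g n) := fun n => NNReal.continuous_coe.comp (thickenedIndicator _ K).continuous
    have hg1 : ∀ n t, g n t ≤ 1 := fun n t => by exact_mod_cast thickenedIndicator_le_one _ K t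
    have hg0 : ∀ n t, 0 ≤ g n t := fun n t => NNReal.coe_nonneg _
    have hlim : Tendsto (fun n => ∫ t in Icc 0 T, g n t * ((m t univ).toReal - 1)) atTop (𝓝 (∫ t in Icc 0 T, K.indicator 1 t * ((m t univ).toReal - 1))) := by
      refine tendsto_integral_of_dominated_convergence (fun t => |(m t univ).toReal - 1|) (fun n => ?_) hint1.abs (fun n => Eventually.of_forall fun t => ?_) (Eventually.of_forall fun t => ?_)
      · exact (hgc n).aestronglyMeasurable.mul hint1.aestronglyMeasurable
      · rw [norm_mul, Real.norm_of_nonneg (hg0 n t), Real.norm_eq_abs]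
        exact mul_le_of_le_one_left (abs_nonneg _) (hg1 n t)
      · refine Tendsto.mul_const _ ?_
        have := thickenedIndicator_tendsto_indicator_closure (δseq := fun n : ℕ => 1 / ((n:ℝ) + 1)) (fun n => by positivity) tendsto_one_div_add_atTop_nhds_zero_nat K
        rw [tendsto_pi_nhds] at this
        have h2 := (NNReal.continuous_coe.tendsto _).comp (this t)
        rw [hK.isClosed.closure_eq] at h2
        have e : (K.indicator 1 t : ℝ) = ((K.indicator (fun _ => 1) t : NNReal) : ℝ) := by
          by_cases ht : t ∈ K <;> simp [ht]
        rw [e]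
        exact h2
    have hle := le_of_tendsto' hlim fun n => step1 _ (hgc n) (hg0 n) (hg1 n)
    refine le_trans (le_of_eq ?_) hle
    have : ∀ t, K.indicator 1 t * ((m t univ).toReal - 1) = K.indicator (fun t => (m t univ).toReal - 1) t := fun t => by
      by_cases ht : t ∈ K <;> simp [ht]
    simp_rw [this]
    rw [setIntegral_indicator hK.measurableSet, inter_eq_right.2 hKs]
  set S := {t | ¬ (m t univ ≤ 1)} ∩ Icc 0 T with hS
  have hSm : MeasurableSet S := (measurableSet_le hmeas measurable_const).compl.inter measurableSet_Icc
  suffices volume S = 0 by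
    have hms : MeasurableSet {a | ¬ (m a univ ≤ 1)} := (measurableSet_le hmeas measurable_const).compl
    rw [ae_iff, Measure.restrict_apply hms]
    exact this
  by_contra hne
  obtain ⟨K, hKS, hK, hKp⟩ := hSm.exists_lt_isCompact (pos_iff_ne_zero.2 hne)
  have h2 := step2 K hK (hKS.trans inter_subset_right)
  have hpos : ∀ t ∈ K, 0 < (m t univ).toReal - 1 := fun t ht => by
    have h1 : ¬ (m t univ ≤ 1) := (hKS ht).1
    have : (1:ℝ) < (m t univ).toReal := by
      rw [← ENNReal.toReal_one]
      exact (ENNReal.toReal_lt_toReal (by simp) (hm.1 t).ne).2 (not_le.1 h1)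
    linarith
  have h3 := (setIntegral_pos_iff_support_of_nonneg_ae (μ := volume) (s := K) (f := fun t => (m t univ).toReal - 1)
    ((ae_restrict_iff' hK.measurableSet).2 (Eventually.of_forall fun t ht => (hpos t ht).le)) (hint1.mono_set (hKS.trans inter_subset_right))).2
  have h4 : Function.support (fun t => (m t univ).toReal - 1) ∩ K = K := by
    rw [inter_eq_right]
    intro t ht
    exact (hpos t ht).ne'
  rw [h4] at h3
  exact absurd (h3 hKp) (not_lt.2 h2)
end

section
variable {T : ℝ} {O A : Set ℝ} {m0 : Measure ℝ} {d : ℕ}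
    {b σ f : ℝ → ℝ → Measure (ℝ × ℝ) → ℝ → ℝ} {g : ℝ → ℝ → Measure (ℝ × ℝ) → ℝ}
    {bbar σbar fbar : ℝ → ℝ → (Fin d → ℝ) → ℝ → ℝ}
    {bhat σhat fhat ghat : ℝ → ℝ → Fin d → ℝ}
    {gbar : ℝ → ℝ → (Fin d → ℝ) → ℝ}

def hh (bhat σhat fhat : ℝ → ℝ → Fin d → ℝ) : Fin 3 × Fin d → ℝ → ℝ → ℝ := fun i t x => (![bhat, σhat, fhat] i.1) t x i.2

def cc (k : Fin 3) (c : ℝ → ℝ → (Fin d → ℝ) → ℝ → ℝ) : ℝ → ℝ × ℝ → (Fin 3 × Fin d → ℝ) → ℝ :=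
  fun t p z => c t p.1 (fun j => z (k, j)) p.2

lemma cc_car (k : Fin 3) {c : ℝ → ℝ → (Fin d → ℝ) → ℝ → ℝ}
    (hm : Measurable (fun q : ℝ × ℝ × (Fin d → ℝ) × ℝ => c q.1 q.2.1 q.2.2.1 q.2.2.2))
    (hc : ∀ t, ContinuousOn (fun q : ℝ × (Fin d → ℝ) × ℝ => c t q.1 q.2.1 q.2.2) (closure O ×ˢ Set.univ ×ˢ A))
    (hb : ∃ C : ℝ, ∀ t x z a, |c t x z a| ≤ C) : CarZ (closure O ×ˢ A) (cc k c) := by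
  refine ⟨?_, fun t => ?_, ?_⟩
  · refine hm.comp (g := fun q : ℝ × ℝ × (Fin d → ℝ) × ℝ => c q.1 q.2.1 q.2.2.1 q.2.2.2)
      (f := fun q : ℝ × (ℝ × ℝ) × (Fin 3 × Fin d → ℝ) => (q.1, q.2.1.1, (fun j => q.2.2 (k, j)), q.2.1.2)) ?_
    refine measurable_fst.prodMk (measurable_snd.fst.fst.prodMk (Measurable.prodMk ?_ measurable_snd.fst.snd))
    exact measurable_pi_lambda _ fun j => (measurable_pi_apply _).comp measurable_snd.snd
  · refine (hc t).comp (f := fun q : (ℝ × ℝ) × (Fin 3 × Fin d → ℝ) => (q.1.1, (fun j => q.2 (k, j)), q.1.2)) ?_ ?_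
    · exact Continuous.continuousOn (by fun_prop)
    · rintro q ⟨⟨h1, h2⟩, -⟩
      exact ⟨h1, mem_univ _, h2⟩
  · obtain ⟨C, hC⟩ := hb
    exact ⟨C, fun t p z => hC _ _ _ _⟩

lemma exists_mod (hb : MFCoeff T O A d b bbar bhat) (hσ : MFCoeff T O A d σ σbar σhat)
    (hf : MFRunning T O A d f fbar fhat) (hg : MFTerminal T O d g gbar ghat) :
    ∃ M : Mod (Fin 3 × Fin d) T O A, M.h = hh bhat σhat fhat ∧ (M.gh = fun i t x => ghat t x i.2) ∧ M.b = cc 0 bbar ∧ M.s = cc 1 σbar ∧ M.f = cc 2 fbar ∧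
      M.g = fun t x w => gbar t x (fun j => w (0, j)) := by
  obtain ⟨-, -, ⟨C1, hC1⟩, b1, b2, b3, ⟨D1, hD1⟩⟩ := hb
  obtain ⟨-, -, ⟨C2, hC2⟩, s1, s2, s3, ⟨D2, hD2⟩⟩ := hσ
  obtain ⟨-, ⟨C3, hC3⟩, f1, f2, f3, ⟨D3, hD3⟩⟩ := hf
  obtain ⟨-, g1, ⟨C4, hC4⟩, g3, ⟨D4, hD4⟩⟩ := hg
  have n1 : 0 ≤ D1 := (norm_nonneg _).trans (hD1 0 0)
  have n2 : 0 ≤ D2 := (norm_nonneg _).trans (hD2 0 0)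
  have n3 : 0 ≤ D3 := (norm_nonneg _).trans (hD3 0 0)
  have n4 : 0 ≤ D4 := (norm_nonneg _).trans (hD4 0 0)
  have m1 : 0 ≤ C1 := (abs_nonneg _).trans (hC1 0 0 0 0)
  have m2 : 0 ≤ C2 := (abs_nonneg _).trans (hC2 0 0 0 0)
  have m3 : 0 ≤ C3 := (abs_nonneg _).trans (hC3 0 0 0 0)
  have m4 : 0 ≤ C4 := (abs_nonneg _).trans (hC4 0 0 0)
  have ev : ∀ {c : ℝ → ℝ → Fin d → ℝ} {D : ℝ}, (∀ t x, ‖c t x‖ ≤ D) → ∀ t x i, |c t x i| ≤ D := fun h t x i =>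
    (norm_le_pi_norm _ i).trans (h t x)
  have cv : ∀ {c : ℝ → ℝ → Fin d → ℝ}, ContinuousOn (fun p : ℝ × ℝ => c p.1 p.2) (Icc 0 T ×ˢ closure O) → ∀ i,
      ContinuousOn (fun p : ℝ × ℝ => c p.1 p.2 i) (Icc 0 T ×ˢ closure O) := fun h i => continuousOn_pi.1 h i
  refine ⟨{ h := hh bhat σhat fhat, gh := fun i t x => ghat t x i.2, b := cc 0 bbar, s := cc 1 σbar, f := cc 2 fbar,
            g := fun t x w => gbar t x (fun j => w (0, j)), Ch := D1 + D2 + D3 + D4, Cb := C1 + C2 ^ 2 / 2, Cg := C3 + C4,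
            h_cont := ?_, h_bd := ?_, gh_cont := fun i => cv g3 _, gh_bd := ?_, Ch0 := by positivity,
            b_car := cc_car 0 b1 (fun t => (b2 t).mono (prod_mono (subset_univ _) le_rfl)) ⟨_, hC1⟩
            s_car := cc_car 1 s1 (fun t => (s2 t).mono (prod_mono (subset_univ _) le_rfl)) ⟨_, hC2⟩
            f_car := cc_car 2 f1 f2 ⟨_, hC3⟩
            b_bd := ?_, s_bd := ?_, f_bd := ?_, g_cont := ?_, g_bd := ?_ }, rfl, rfl, rfl, rfl, rfl, rfl⟩
  · rintro ⟨k, j⟩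
    fin_cases k
    · exact cv b3 j
    · exact cv s3 j
    · exact cv f3 j
  · rintro ⟨k, j⟩ t x
    fin_cases k
    · exact (ev hD1 t x j).trans (by linarith)
    · exact (ev hD2 t x j).trans (by linarith)
    · exact (ev hD3 t x j).trans (by linarith)
  · intro i t x
    exact (ev hD4 t x i.2).trans (by linarith)
  · intro t p z
    exact (hC1 _ _ _ _).trans (by nlinarith)
  · intro t p z
    have h1 := hC2 t p.1 (fun j => z (1, j)) p.2
    have h2 : (cc 1 σbar t p z) ^ 2 ≤ C2 ^ 2 := sq_le_sq' (abs_le.1 h1).1 (abs_le.1 h1).2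
    rw [abs_of_nonneg (by positivity)]
    linarith
  · intro t p z
    exact (hC3 _ _ _ _).trans (by linarith)
  · refine g1.comp (f := fun q : (ℝ × ℝ) × (Fin 3 × Fin d → ℝ) => (q.1.1, q.1.2, fun j => q.2 (0, j))) ?_ ?_
    · exact Continuous.continuousOn (by fun_prop)
    · rintro q ⟨⟨h1, h2⟩, -⟩
      exact ⟨h1, h2, mem_univ _⟩
  · intro t x w
    exact (hC4 _ _ _).trans (by linarith)

lemma zf_eq {M : Mod (Fin 3 × Fin d) T O A} (hM : M.h = hh bhat σhat fhat) {m} (hm : Fl O A m) {t : ℝ} (ht : t ∈ Icc 0 T) (k : Fin 3) :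
    (fun j => M.zf m t (k, j)) = fun j => ∫ p, (![bhat, σhat, fhat] k) t p.1 j ∂(m t) := by
  ext j
  simp only [Mod.zf]
  apply integral_congr_ae
  filter_upwards [hm.ae t] with p hp
  rw [cut_eq ht hp.1, hM]
  rfl

end
end LPN
end

noncomputable section
namespace LPN

section
variable {T : ℝ} {O A : Set ℝ} {m0 : Measure ℝ} {d : ℕ}
    {b σ f : ℝ → ℝ → Measure (ℝ × ℝ) → ℝ → ℝ} {g : ℝ → ℝ → Measure (ℝ × ℝ) → ℝ}
    {bbar σbar fbar : ℝ → ℝ → (Fin d → ℝ) → ℝ → ℝ}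
    {bhat σhat fhat ghat : ℝ → ℝ → Fin d → ℝ}
    {gbar : ℝ → ℝ → (Fin d → ℝ) → ℝ}

/-- compatibility of coefficients -/
structure Compat (M : Mod (Fin 3 × Fin d) T O A) (b σ f : ℝ → ℝ → Measure (ℝ × ℝ) → ℝ → ℝ) (g : ℝ → ℝ → Measure (ℝ × ℝ) → ℝ) : Prop where
  hb : ∀ m, Fl O A m → ∀ t ∈ Icc 0 T, ∀ p : ℝ × ℝ, M.b t p (M.zf m t) = b t p.1 (m t) p.2
  hs : ∀ m, Fl O A m → ∀ t ∈ Icc 0 T, ∀ p : ℝ × ℝ, M.s t p (M.zf m t) = σ t p.1 (m t) p.2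
  hf : ∀ m, Fl O A m → ∀ t ∈ Icc 0 T, ∀ p : ℝ × ℝ, M.f t p (M.zf m t) = f t p.1 (m t) p.2
  hg : ∀ μ t x, M.g t x (M.wf μ) = g t x μ

def AeEq (T : ℝ) (m m' : ℝ → Measure (ℝ × ℝ)) : Prop := ∀ᵐ t ∂(volume.restrict (Icc 0 T)), m t = m' t

lemma Compat.eqL {M : Mod (Fin 3 × Fin d) T O A} (H : Compat M b σ f g) {m m' k k'} (e1 : AeEq T m m') (e2 : AeEq T k k')
    (hm : Fl O A m') (hk : Fl O A k') (ut ux uxx : ℝ → ℝ → ℝ) :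
    ∫ t in Icc 0 T, (∫ p, (ut t p.1 + (b t p.1 (k t) p.2 * ux t p.1
                + σ t p.1 (k t) p.2 ^ 2 / 2 * uxx t p.1)) ∂(m t)) = I2 T m' (fun t p => M.L ut ux uxx t p (M.zf k' t)) := by
  unfold I2
  apply integral_congr_ae
  filter_upwards [e1, e2, ae_restrict_mem measurableSet_Icc] with t h1 h2 ht
  rw [h1, h2]
  apply integral_congr_ae
  filter_upwards [hm.ae t] with p hp
  simp only [Mod.L]
  rw [cut_eq ht hp.1, cut_eq ht hp.1, cut_eq ht hp.1, H.hb k' hk t ht, H.hs k' hk t ht]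

lemma Compat.eqG {M : Mod (Fin 3 × Fin d) T O A} (H : Compat M b σ f g) {m m' k k'} (e1 : AeEq T m m') (e2 : AeEq T k k')
    (hk : Fl O A k') (μ ν : Measure (ℝ × ℝ)) :
    GammaMF T f g μ k ν m = M.GamY (μ, k') (ν, m') := by
  unfold GammaMF Mod.GamY Mod.Gam I2
  simp only
  congr 1
  · apply integral_congr_ae
    filter_upwards [e1, e2, ae_restrict_mem measurableSet_Icc] with t h1 h2 ht
    rw [h1, h2]
    congr 1; ext p
    rw [H.hf k' hk t ht]
  · simp_rw [H.hg]

lemma memRm_mass (hT : 0 < T) [IsProbabilityMeasure m0] {k μ m} (h : MemRm T O A b σ m0 k μ m) : AeEq T m (hatm m) := by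
  have := h.1
  have := mass_le (m0 := m0) hT h.2.2.1 h.2.1 (fun u ut hu hut => by
    have hc : IsCb12 T O (fun t _ => u t) (fun t _ => ut t) (fun _ _ => 0) (fun _ _ => 0) := by
      have h1 : IsCb12 T O (fun _ _ => (1:ℝ)) (fun _ _ => 0) (fun _ _ => 0) (fun _ _ => 0) := by
        refine ⟨continuousOn_const, continuousOn_const, continuousOn_const, continuousOn_const, ?_, ?_, ?_, 1, ?_⟩
        · intro t _ x _; exact hasDerivWithinAt_const _ _ _
        · intro t _ x _; exact hasDerivWithinAt_const _ _ _
        · intro t _ x _; exact hasDerivWithinAt_const _ _ _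
        · intro t _ x _; simp
      have := cb12_tmul h1 hu hut
      simpa using this
    have := h.2.2.2 _ _ _ _ hc
    simp only [mul_zero, add_zero, integral_const, smul_eq_mul] at this
    rw [this]
    simp [Measure.real, mul_comm])
  filter_upwards [this] with t ht
  simp only [hatm]
  rw [if_pos ht]

lemma AeEq.refl {T : ℝ} (m) : AeEq T m m := Eventually.of_forall fun _ => rfl

lemma Compat.toFP {M : Mod (Fin 3 × Fin d) T O A} (H : Compat M b σ f g) (hT : 0 < T) [IsProbabilityMeasure m0] {k k' μ m} (e2 : AeEq T k k')
    (hk : Fl O A k') (h : MemRm T O A b σ m0 k μ m) : M.FP m0 (M.zf k') (μ, hatm m) := by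
  have hfl := hatm_fl h.2.2.1
  refine ⟨h.1, h.2.1, hfl, fun u ut ux uxx hu => ?_⟩
  rw [← H.eqL (memRm_mass hT h) e2 hfl hk]
  exact h.2.2.2 u ut ux uxx hu

lemma Compat.ofFP {M : Mod (Fin 3 × Fin d) T O A} (H : Compat M b σ f g) {k μ m}
    (hk : Fl O A k) (h : M.FP m0 (M.zf k) (μ, m)) : MemRm T O A b σ m0 k μ m := by
  have hfl := h.fl
  refine ⟨h.prob, h.supp, hfl.memV, fun u ut ux uxx hu => ?_⟩
  rw [H.eqL (AeEq.refl _) (AeEq.refl _) hfl hk]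
  exact h.eq u ut ux uxx hu

lemma Compat.main {M : Mod (Fin 3 × Fin d) T O A} (H : Compat M b σ f g) (hT : 0 < T) (hA : IsCompact A) [IsProbabilityMeasure m0] (hm0 : m0 Oᶜ = 0)
    (hL : M.LSC m0) : ∃ (μs : Measure (ℝ × ℝ)) (ms : ℝ → Measure (ℝ × ℝ)),
      IsLPNash T O A b σ f g m0 μs ms ∧
      ∀ (μ : Measure (ℝ × ℝ)) (m : ℝ → Measure (ℝ × ℝ)),
        IsLPNash T O A b σ f g m0 μ m →
        GammaMF T f g μ m μ m ≤ GammaMF T f g μs ms μs ms := by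
  obtain ⟨⟨μs, ms⟩, hr, hN, hmax⟩ := M.exists_max hT hA hm0 hL
  refine ⟨μs, ms, ⟨H.ofFP hr.fl hN.1, fun μ m h => ?_⟩, fun μ m h => ?_⟩
  · rw [H.eqG (memRm_mass hT h) (AeEq.refl _) hr.fl, H.eqG (AeEq.refl _) (AeEq.refl _) hr.fl]
    exact hN.2 _ (H.toFP hT (AeEq.refl _) hr.fl h)
  · have e := memRm_mass hT h.1
    have hfl := hatm_fl h.1.2.2.1
    have hFP := H.toFP hT e hfl h.1
    rw [H.eqG e e hfl, H.eqG (AeEq.refl _) (AeEq.refl _) hr.fl]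
    refine hmax (μ, hatm m) (hFP.reg M hT (M.zf_meas hfl)) ⟨hFP, ?_⟩
    rintro ⟨ν, n⟩ hn
    -- competitor against the untruncated flow
    have hn' : MemRm T O A b σ m0 m ν n := by
      refine ⟨hn.prob, hn.supp, hn.fl.memV, fun u ut ux uxx hu => ?_⟩
      rw [H.eqL (AeEq.refl _) e hn.fl hfl]
      exact hn.eq u ut ux uxx hu
    have := h.2 ν n hn'
    rwa [H.eqG (AeEq.refl _) e hfl, H.eqG e e hfl] at this

/-- hypotheses for case (c) -/
structure Mod.HypC {ι : Type} [Fintype ι] (M : Mod ι T O A) (c1 c2 K cs : ℝ) : Prop where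
  c12 : c1 < c2
  hO : O = Ioo c1 c2
  cs0 : 0 < cs
  lb : ∀ m, Fl O A m → ∀ t ∈ Icc 0 T, ∀ x y a, |M.b t (x, a) (M.zf m t) - M.b t (y, a) (M.zf m t)| ≤ K * |x - y|
  ls : ∀ m, Fl O A m → ∀ t ∈ Icc 0 T, ∀ x y a, |M.s t (x, a) (M.zf m t) - M.s t (y, a) (M.zf m t)| ≤ K * |x - y|
  sa : ∀ m, Fl O A m → ∀ t ∈ Icc 0 T, ∀ x a a', M.s t (x, a) (M.zf m t) = M.s t (x, a') (M.zf m t)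
  sc : ∀ m, Fl O A m → ∀ t ∈ Icc 0 T, ∀ x a, cs ≤ M.s t (x, a) (M.zf m t)

lemma final (hC : ∀ (M : Mod (Fin 3 × Fin d) T O A) (c1 c2 K cs : ℝ), M.HypC c1 c2 K cs → M.LSC m0)
    (hT : 0 < T) (hA : IsCompact A)
    (hb : MFCoeff T O A d b bbar bhat) (hσ : MFCoeff T O A d σ σbar σhat)
    (hf : MFRunning T O A d f fbar fhat) (hg : MFTerminal T O d g gbar ghat)
    (halt : MeasIndepOrInterval O b σ) (hm0 : InitAssumption2 O m0) :
    ∃ (μs : Measure (ℝ × ℝ)) (ms : ℝ → Measure (ℝ × ℝ)),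
      IsLPNash T O A b σ f g m0 μs ms ∧
      ∀ (μ : Measure (ℝ × ℝ)) (m : ℝ → Measure (ℝ × ℝ)),
        IsLPNash T O A b σ f g m0 μ m →
        GammaMF T f g μ m μ m ≤ GammaMF T f g μs ms μs ms := by
  obtain ⟨M, e1, e2, e3, e4, e5, e6⟩ := exists_mod hb hσ hf hg
  have hpr := hm0.1
  have H : Compat M b σ f g := by
    refine ⟨fun m hm t ht p => ?_, fun m hm t ht p => ?_, fun m hm t ht p => ?_, fun μ t x => ?_⟩
    · rw [e3, hb.2.1]; simp only [cc]; rw [zf_eq e1 hm ht]; rfl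
    · rw [e4, hσ.2.1]; simp only [cc]; rw [zf_eq e1 hm ht]; rfl
    · rw [e5, hf.1]; simp only [cc]; rw [zf_eq e1 hm ht]; rfl
    · rw [e6, hg.1]; simp only [Mod.wf]; rw [e2]
  refine H.main hT hA hm0.2.1 ?_
  rcases halt with h | ⟨⟨c1, c2, h12, hO⟩, hsa, cs, hcs, hsc⟩
  · intro x hx y hy ε hε
    obtain ⟨δ, hδ, hh⟩ := M.Gam_unif hT hA hx ε hε
    refine ⟨δ, hδ, fun x' hx' h1 h2 => ⟨y, ⟨hy.prob, hy.supp, hy.fl, fun u ut ux uxx hu => ?_⟩, ?_⟩⟩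
    · rw [hy.eq u ut ux uxx hu]
      congr 1
      refine hy.fl.I2_congr fun t ht p hp => ?_
      simp only [Mod.L]
      rw [H.hb _ hx.fl t ht, H.hb _ hx'.fl t ht, H.hs _ hx.fl t ht, H.hs _ hx'.fl t ht,
        (h t p.1 (x.2 t) (x'.2 t) p.2).1, (h t p.1 (x.2 t) (x'.2 t) p.2).2]
    · have := (abs_le.1 (hh x' hx' h1 h2 y (hy.reg M hT (M.zf_meas hx.fl)))).1
      linarith
  · obtain ⟨K1, hK1⟩ := hb.1
    obtain ⟨K2, hK2⟩ := hσ.1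
    refine hC M c1 c2 (max K1 K2) cs ⟨h12, hO, hcs, ?_, ?_, ?_, ?_⟩
    · intro m hm t ht x y a
      rw [H.hb m hm t ht, H.hb m hm t ht]
      exact (hK1 _ _ _ _ _).trans (mul_le_mul_of_nonneg_right (le_max_left _ _) (abs_nonneg _))
    · intro m hm t ht x y a
      rw [H.hs m hm t ht, H.hs m hm t ht]
      exact (hK2 _ _ _ _ _).trans (mul_le_mul_of_nonneg_right (le_max_right _ _) (abs_nonneg _))
    · intro m hm t ht x a a'
      rw [H.hs m hm t ht, H.hs m hm t ht]
      exact hsa _ _ _ _ _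
    · intro m hm t ht x a
      rw [H.hs m hm t ht]
      exact hsc _ _ _ _
end
end LPN
end

noncomputable section
namespace LPN

lemma dual_abs {X : Type*} [TopologicalSpace X] {Q : Set X} (hQ : IsCompact Q) {I : Type*} {Φ : I → X → ℝ} {Γ : X → ℝ}
    (hΦ : ∀ i, ContinuousOn (Φ i) Q) (hΓ : ContinuousOn Γ Q)
    (hconv : ∀ q ∈ Q, ∀ q' ∈ Q, ∀ s t : ℝ, 0 ≤ s → 0 ≤ t → s + t = 1 →
      ∃ r ∈ Q, (∀ i, Φ i r = s * Φ i q + t * Φ i q') ∧ Γ r = s * Γ q + t * Γ q')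
    (h0 : ∃ q ∈ Q, ∀ i, Φ i q = 0) {c : ℝ} (h : ∀ q ∈ Q, (∀ i, Φ i q = 0) → Γ q < c) :
    ∃ (J : Finset I) (k : I → ℝ), ∀ q ∈ Q, Γ q + ∑ i ∈ J, k i * Φ i q < c := by
  classical
  have hQc : CompactSpace Q := isCompact_iff_compactSpace.1 hQ
  let Φ' : I → Q → ℝ := fun i q => Φ i q
  let Γ' : Q → ℝ := fun q => Γ q
  have hΦ' : ∀ i, Continuous (Φ' i) := fun i => continuousOn_iff_continuous_domRestrict.1 (hΦ i)
  have hΓ' : Continuous Γ' := continuousOn_iff_continuous_domRestrict.1 hΓ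
  obtain ⟨J, hJ⟩ : ∃ J : Finset I, ∀ q : Q, (∀ i ∈ J, Φ' i q = 0) → Γ' q < c := by
    have hcl : IsCompact {q : Q | c ≤ Γ' q} := (isClosed_le continuous_const hΓ').isCompact
    obtain ⟨J, hJ⟩ := hcl.elim_finite_subfamily_closed (fun i => {q | Φ' i q = 0})
      (fun i => isClosed_eq (hΦ' i) continuous_const) (by
        ext q
        simp only [mem_inter_iff, mem_ofPred_eq, mem_iInter, mem_empty_iff_false, iff_false, not_and]
        intro h1 h2
        exact absurd (h q q.2 h2) (not_lt.2 h1))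
    refine ⟨J, fun q hq => ?_⟩
    by_contra hcon
    have : q ∈ {q : Q | c ≤ Γ' q} ∩ ⋂ i ∈ J, {q | Φ' i q = 0} := ⟨not_lt.1 hcon, by simpa using hq⟩
    rw [hJ] at this
    exact this
  let Θ : Q → (J → ℝ) × ℝ := fun q => (fun i => Φ' i q, Γ' q)
  have hΘ : Continuous Θ := (continuous_pi fun i : J => hΦ' (i : I)).prodMk hΓ'
  have hS : IsCompact (range Θ) := isCompact_range hΘ
  have hSc : Convex ℝ (range Θ) := by
    rintro _ ⟨q, rfl⟩ _ ⟨q', rfl⟩ s t hs ht hst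
    obtain ⟨r, hr, h1, h2⟩ := hconv q q.2 q' q'.2 s t hs ht hst
    refine ⟨⟨r, hr⟩, ?_⟩
    refine Prod.ext ?_ ?_
    · ext i; simp [Θ, Φ', h1]
    · simp [Θ, Γ', h2]
  let t : Set ((J → ℝ) × ℝ) := {0} ×ˢ Ici c
  have ht : IsClosed t := isClosed_singleton.prod isClosed_Ici
  have htc : Convex ℝ t := (convex_singleton _).prod (convex_Ici _)
  have hd : Disjoint (range Θ) t := by
    rw [Set.disjoint_left]
    rintro _ ⟨q, rfl⟩ ⟨h1, h2⟩
    have := hJ q (fun i hi => congrFun h1 ⟨i, hi⟩)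
    exact absurd this (not_lt.2 h2)
  obtain ⟨f, u, v, hu, huv, hv⟩ := geometric_hahn_banach_compact_closed hSc hS htc ht hd
  have hvc := hv (0, c) ⟨rfl, mem_Ici.2 le_rfl⟩
  have key : ∀ q : Q, f (Θ q) = ∑ i : J, Φ' i q * f (Pi.single i 1, 0) + Γ' q * f (0, 1) := by
    intro q
    have : Θ q = ∑ i : J, Φ' i q • ((Pi.single i 1, 0) : (J → ℝ) × ℝ) + Γ' q • ((0, 1) : (J → ℝ) × ℝ) := by
      refine Prod.ext ?_ ?_
      · ext j
        simp [Θ, Prod.fst_sum, Finset.sum_apply, Pi.single_apply]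
      · simp [Θ, Prod.snd_sum]
    rw [this]
    simp only [map_add, map_sum, map_smul, smul_eq_mul]
  have key2 : f ((0 : J → ℝ), c) = c * f (0, 1) := by
    have : ((0 : J → ℝ), c) = c • ((0 : J → ℝ), (1:ℝ)) := by simp
    rw [this, map_smul, smul_eq_mul]
  obtain ⟨q0, hq0, h00⟩ := h0
  have h1 := hu _ ⟨⟨q0, hq0⟩, rfl⟩
  rw [key] at h1
  simp only [Φ', h00, zero_mul, Finset.sum_const_zero, zero_add, Γ'] at h1
  rw [key2] at hvc
  have hlt := h q0 hq0 h00
  have hf : 0 < f ((0 : J → ℝ), (1:ℝ)) := by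
    by_contra hcon
    nlinarith
  refine ⟨J, fun i => if hi : i ∈ J then f (Pi.single ⟨i, hi⟩ 1, 0) / f (0, 1) else 0, fun q hq => ?_⟩
  have h2 := hu _ ⟨⟨q, hq⟩, rfl⟩
  rw [key] at h2
  have e : ∑ i ∈ J, (if hi : i ∈ J then f (Pi.single ⟨i, hi⟩ 1, 0) / f (0, 1) else 0) * Φ i q
      = (∑ i : J, Φ' i ⟨q, hq⟩ * f (Pi.single i 1, 0)) / f (0, 1) := by
    rw [← Finset.sum_coe_sort, Finset.sum_div]
    refine Finset.sum_congr rfl fun i _ => ?_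
    simp only [Finset.coe_mem, dite_true, Φ']
    ring
  rw [e]
  have h3 : ∑ i : J, Φ' i ⟨q, hq⟩ * f (Pi.single i 1, 0) + Γ q * f (0, 1) < c * f (0, 1) := by
    simp only [Γ'] at h2; linarith
  rw [← lt_sub_iff_add_lt', div_lt_iff₀ hf]
  linarith

lemma cb12_comb {T : ℝ} {O : Set ℝ} {u ut ux uxx v vt vx vxx : ℝ → ℝ → ℝ} (hu : IsCb12 T O u ut ux uxx)
    (hv : IsCb12 T O v vt vx vxx) (k : ℝ) :
    IsCb12 T O (fun t x => u t x + k * v t x) (fun t x => ut t x + k * vt t x) (fun t x => ux t x + k * vx t x)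
      (fun t x => uxx t x + k * vxx t x) := by
  obtain ⟨C, hC⟩ := hu.bdd
  obtain ⟨D, hD⟩ := hv.bdd
  refine ⟨hu.cont.add (hv.cont.const_smul k), hu.cont_t.add (hv.cont_t.const_smul k), hu.cont_x.add (hv.cont_x.const_smul k),
    hu.cont_xx.add (hv.cont_xx.const_smul k), fun t ht x hx => (hu.deriv_t t ht x hx).add ((hv.deriv_t t ht x hx).const_mul k),
    fun t ht x hx => (hu.deriv_x t ht x hx).add ((hv.deriv_x t ht x hx).const_mul k),
    fun t ht x hx => (hu.deriv_xx t ht x hx).add ((hv.deriv_xx t ht x hx).const_mul k), C + |k| * D, ?_⟩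
  intro t ht x hx
  obtain ⟨a1, a2, a3, a4⟩ := hC t ht x hx
  obtain ⟨b1, b2, b3, b4⟩ := hD t ht x hx
  have key : ∀ a b : ℝ, |a| ≤ C → |b| ≤ D → |a + k * b| ≤ C + |k| * D := fun a b ha hb =>
    (abs_add_le _ _).trans (add_le_add ha (by rw [abs_mul]; exact mul_le_mul_of_nonneg_left hb (abs_nonneg _)))
  exact ⟨key _ _ a1 b1, key _ _ a2 b2, key _ _ a3 b3, key _ _ a4 b4⟩

lemma cb12_const (T : ℝ) (O : Set ℝ) (k : ℝ) : IsCb12 T O (fun _ _ => k) (fun _ _ => 0) (fun _ _ => 0) (fun _ _ => 0) :=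
  ⟨continuousOn_const, continuousOn_const, continuousOn_const, continuousOn_const,
    fun _ _ _ _ => hasDerivWithinAt_const _ _ _, fun _ _ _ _ => hasDerivWithinAt_const _ _ _,
    fun _ _ _ _ => hasDerivWithinAt_const _ _ _, ⟨|k|, fun _ _ _ _ => by simp⟩⟩

def maxseq (a : ℕ → ℝ) : ℕ → ℝ
  | 0 => 0
  | n + 1 => max (maxseq a n) (a n)

/-- measurable selection -/
lemma exists_sel {T : ℝ} {O A : Set ℝ} (hA : IsCompact A) (hO : Bornology.IsBounded O) {H : ℝ → ℝ × ℝ → ℝ}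
    (hH : Car (closure O ×ˢ A) H) {R : ℝ} (h : ∀ m, Fl O A m → I2 T m H ≤ R) :
    ∃ ψ : ℝ → ℝ, Measurable ψ ∧ (∃ C, ∀ t, |ψ t| ≤ C) ∧ (∀ t, 0 ≤ ψ t) ∧
      (∀ t, ∀ p ∈ closure O ×ˢ A, H t p ≤ ψ t) ∧ ∫ t in Icc 0 T, ψ t ≤ R := by
  have hK : IsCompact (closure O ×ˢ A) := hO.isCompact_closure.prod hA
  obtain ⟨C, hC⟩ := hH.bdd
  have hC0 : 0 ≤ C := (abs_nonneg _).trans (hC 0 0)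
  have hz : Fl O A (fun _ => 0) := ⟨measurable_const, fun _ => by simp, fun _ => by simp⟩
  rcases (closure O ×ˢ A).eq_empty_or_nonempty with hE | hne
  · refine ⟨fun _ => 0, measurable_const, ⟨0, by simp⟩, fun _ => le_rfl, fun t p hp => ?_, ?_⟩
    · rw [hE] at hp; exact hp.elim
    · have := h _ hz
      simpa [I2] using this
  have : Nonempty (closure O ×ˢ A : Set (ℝ × ℝ)) := hne.to_subtype
  let q : ℕ → (closure O ×ˢ A : Set (ℝ × ℝ)) := TopologicalSpace.denseSeq _
  have hq : DenseRange q := TopologicalSpace.denseRange_denseSeq _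
  let ψn : ℕ → ℝ → ℝ := fun n t => maxseq (fun k => H t (q k)) n
  have ψ0 : ∀ t, ψn 0 t = 0 := fun t => rfl
  have ψs : ∀ n t, ψn (n + 1) t = max (ψn n t) (H t (q n)) := fun n t => rfl
  have hHm : ∀ p : ℝ × ℝ, Measurable fun t => H t p := fun p => hH.meas.comp (measurable_id.prodMk measurable_const)
  have ψm : ∀ n, Measurable (ψn n) := by
    intro n
    induction n with
    | zero => exact measurable_const
    | succ k ih => exact ih.max (hHm _)
  have ψmono : ∀ t, Monotone fun n => ψn n t := fun t => monotone_nat_of_le_succ fun n => by rw [ψs]; exact le_max_left _ _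
  have ψb : ∀ n t, 0 ≤ ψn n t ∧ ψn n t ≤ C := by
    intro n t
    refine ⟨ψmono t (Nat.zero_le n), ?_⟩
    induction n with
    | zero => exact hC0
    | succ k ih => rw [ψs]; exact max_le ih ((le_abs_self _).trans (hC _ _))
  have hsel : ∀ n, ∃ m, Fl O A m ∧ ∀ t, ∫ p, H t p ∂(m t) = ψn n t := by
    intro n
    induction n with
    | zero => exact ⟨_, hz, fun t => by simp [ψ0]⟩
    | succ k ih =>
      classical
      obtain ⟨m, hm, hmi⟩ := ih
      have hs : MeasurableSet {t | ψn k t < H t (q k)} := measurableSet_lt (ψm k) (hHm _)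
      let m' : ℝ → Measure (ℝ × ℝ) := fun t => if ψn k t < H t (q k) then Measure.dirac (q k : ℝ × ℝ) else m t
      refine ⟨m', ⟨?_, ?_, ?_⟩, ?_⟩
      · exact Measurable.ite (p := fun t => ψn k t < H t (q k)) hs measurable_const hm.meas
      · intro t
        dsimp only [m']
        split_ifs
        · simp
        · exact hm.mass t
      · intro t
        dsimp only [m']
        split_ifs
        · rw [Measure.dirac_apply' _ hK.isClosed.measurableSet.compl]
          simp [(q k).2]
        · exact hm.supp t
      · intro t
        dsimp only [m']
        rw [ψs]
        split_ifs with hh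
        · rw [integral_dirac' _ _ (hH.bm.meas' t).stronglyMeasurable, max_eq_right (le_of_lt hh)]
        · rw [hmi, max_eq_left (not_lt.1 hh)]
  let ψ : ℝ → ℝ := fun t => ⨆ n, ψn n t
  have hbdd : ∀ t, BddAbove (range fun n => ψn n t) := fun t => ⟨C, by rintro _ ⟨n, rfl⟩; exact (ψb n t).2⟩
  have hlim : ∀ t, Tendsto (fun n => ψn n t) atTop (𝓝 (ψ t)) := fun t => tendsto_atTop_ciSup (ψmono t) (hbdd t)
  have hψm : Measurable ψ := measurable_of_tendsto_metrizable ψm (tendsto_pi_nhds.2 hlim)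
  have hψb : ∀ t, 0 ≤ ψ t ∧ ψ t ≤ C := fun t =>
    ⟨ge_of_tendsto' (hlim t) fun n => (ψb n t).1, le_of_tendsto' (hlim t) fun n => (ψb n t).2⟩
  refine ⟨ψ, hψm, ⟨C, fun t => by rw [abs_of_nonneg (hψb t).1]; exact (hψb t).2⟩, fun t => (hψb t).1, ?_, ?_⟩
  · intro t p hp
    have hc : IsClosed {p : (closure O ×ˢ A : Set (ℝ × ℝ)) | H t p ≤ ψ t} :=
      isClosed_le (continuousOn_iff_continuous_domRestrict.1 (hH.cont t)) continuous_const
    have : ∀ p : (closure O ×ˢ A : Set (ℝ × ℝ)), p ∈ {p : (closure O ×ˢ A : Set (ℝ × ℝ)) | H t p ≤ ψ t} := by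
      intro p
      refine hq.induction_on (p := fun p => p ∈ {p : (closure O ×ˢ A : Set (ℝ × ℝ)) | H t p ≤ ψ t}) p hc fun n => ?_
      have h1 : ψn (n + 1) t ≤ ψ t := le_ciSup (hbdd t) (n + 1)
      rw [ψs] at h1
      exact (le_max_right _ _).trans h1
    exact this ⟨p, hp⟩
  · have hl : Tendsto (fun n => ∫ t in Icc 0 T, ψn n t) atTop (𝓝 (∫ t in Icc 0 T, ψ t)) := by
      refine tendsto_integral_of_dominated_convergence (fun _ => C) (fun n => (ψm n).aestronglyMeasurable)
        (integrable_const _) (fun n => Eventually.of_forall fun t => ?_) (Eventually.of_forall hlim)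
      rw [Real.norm_eq_abs, abs_of_nonneg (ψb n t).1]; exact (ψb n t).2
    refine le_of_tendsto' hl fun n => ?_
    obtain ⟨m, hm, hmi⟩ := hsel n
    have := h m hm
    unfold I2 at this
    simpa only [hmi] using this

end LPN
end

noncomputable section
namespace LPN

lemma pm_compact {E : Type*} [MeasurableSpace E] [MetricSpace E] [BorelSpace E]
    [SecondCountableTopology E] [CompleteSpace E] {K : Set E} (hK : IsCompact K) {S : Set (ProbabilityMeasure E)}
    (hS : ∀ μ ∈ S, (μ : Measure E) Kᶜ = 0) (hc : IsClosed S) : IsCompact S := by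
  have := isCompact_closure_of_isTightMeasureSet (S := S) (by
    rw [isTightMeasureSet_iff_exists_isCompact_measure_compl_le]
    intro ε _
    refine ⟨K, hK, ?_⟩
    rintro _ ⟨μ, hμ, rfl⟩
    rw [hS μ hμ]; exact bot_le)
  rwa [hc.closure_eq] at this

lemma pm_closed {E : Type*} [TopologicalSpace E] {S : Set E}
    (h : ∀ q : E, ∀ l : Filter S, l.NeBot → Tendsto (fun s : S => (s : E)) l (𝓝 q) → q ∈ S) : IsClosed S := by
  rw [← closure_subset_iff_isClosed]
  intro q hq
  exact h q _ (mem_closure_iff_comap_neBot.1 hq) tendsto_comap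

section
variable {T : ℝ} {O A : Set ℝ} {m0 : Measure ℝ} {ι : Type} [Fintype ι] (M : Mod ι T O A)

lemma hat_cpt (hT : 0 < T) (hA : IsCompact A) (hO : Bornology.IsBounded O) (e : ℝ × ℝ) :
    IsCompact {P : ProbabilityMeasure (ℝ × ℝ × ℝ) | Hat T (closure O ×ˢ A) e P} := by
  have hK : IsCompact (closure O ×ˢ A ∪ {e}) := (hO.isCompact_closure.prod hA).union isCompact_singleton
  refine pm_compact (K := Icc 0 T ×ˢ (closure O ×ˢ A ∪ {e})) (isCompact_Icc.prod hK) ?_ ?_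
  · intro P hP
    have h1 : (P : Measure (ℝ × ℝ × ℝ)) (Prod.fst ⁻¹' (Icc 0 T)ᶜ) = 0 := by
      rw [← Measure.fst_apply measurableSet_Icc.compl, hP.fst]
      simp [tau, Measure.restrict_apply measurableSet_Icc.compl]
    refine measure_mono_null ?_ (measure_union_null h1 hP.supp)
    rintro ⟨t, p⟩ hq
    by_cases ht : t ∈ Icc 0 T
    · right
      intro h2
      exact hq ⟨ht, h2.2⟩
    · left; exact ht
  · refine pm_closed fun q l hl h => ?_
    exact hat_lim hT hA h fun n => n.2

lemma mu_cpt (hO : Bornology.IsBounded O) :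
    IsCompact {μ : ProbabilityMeasure (ℝ × ℝ) | (μ : Measure (ℝ × ℝ)) (Icc 0 T ×ˢ closure O)ᶜ = 0} := by
  refine pm_compact (K := Icc 0 T ×ˢ closure O) (isCompact_Icc.prod hO.isCompact_closure) (fun μ h => h) ?_
  refine pm_closed fun q l hl h => ?_
  exact tight_lim h (isClosed_Icc.prod isClosed_closure) fun n => n.2

lemma continuousOn_of_filt {E : Type*} [TopologicalSpace E] {S : Set E} {f : E → ℝ}
    (h : ∀ q ∈ S, ∀ l : Filter S, l.NeBot → Tendsto (fun s : S => (s : E)) l (𝓝 q) → Tendsto (fun s : S => f s) l (𝓝 (f q))) :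
    ContinuousOn f S := by
  rw [continuousOn_iff_continuous_domRestrict, continuous_iff_continuousAt]
  intro q
  have := h q q.2 (𝓝 q) inferInstance (continuous_subtype_val.tendsto q)
  exact this

/-- duality -/
lemma Mod.dual (hT : 0 < T) (hA : IsCompact A) (hO : Bornology.IsBounded O) [IsProbabilityMeasure m0] (hm0 : m0 Oᶜ = 0)
    {z : ℝ → ι → ℝ} (hz : Measurable z) {F : ℝ → ℝ × ℝ → ℝ} (hF : Car (closure O ×ˢ A) F) {G : ℝ → ℝ → ℝ}
    (hG : ContinuousOn (fun p : ℝ × ℝ => G p.1 p.2) (Icc 0 T ×ˢ closure O)) {c : ℝ}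
    (h : ∀ y, M.FP m0 z y → I2 T y.2 F + ∫ p, G p.1 p.2 ∂y.1 < c) :
    ∃ u ut ux uxx ψ, IsCb12 T O u ut ux uxx ∧ Measurable ψ ∧ (∃ C, ∀ t, |ψ t| ≤ C) ∧ (∀ t, 0 ≤ ψ t) ∧
      (∀ t ∈ Icc 0 T, ∀ x ∈ closure O, G t x ≤ u t x) ∧
      (∀ t, ∀ p ∈ closure O ×ˢ A, F t p + M.L ut ux uxx t p (z t) ≤ ψ t) ∧
      ∫ x, u 0 x ∂m0 + ∫ t in Icc 0 T, ψ t ≤ c := by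
  classical
  obtain ⟨e, he, -⟩ := exists_cem hA O
  have hKc : IsCompact (Icc 0 T ×ˢ closure O) := isCompact_Icc.prod hO.isCompact_closure
  let Qμ : Set (ProbabilityMeasure (ℝ × ℝ)) := {μ | (μ : Measure (ℝ × ℝ)) (Icc 0 T ×ˢ closure O)ᶜ = 0}
  let QP : Set (ProbabilityMeasure (ℝ × ℝ × ℝ)) := {P | Hat T (closure O ×ˢ A) e P}
  have hQ : IsCompact (Qμ ×ˢ QP) := (mu_cpt hO).prod (hat_cpt hT hA hO e)
  let I := {q : (ℝ → ℝ → ℝ) × (ℝ → ℝ → ℝ) × (ℝ → ℝ → ℝ) × (ℝ → ℝ → ℝ) // IsCb12 T O q.1 q.2.1 q.2.2.1 q.2.2.2}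
  let J : (ℝ → ℝ × ℝ → ℝ) → ProbabilityMeasure (ℝ × ℝ × ℝ) → ℝ := fun F P =>
    T * ∫ q, (closure O ×ˢ A).indicator (F q.1) q.2 ∂(P : Measure (ℝ × ℝ × ℝ))
  let Lz : I → ℝ → ℝ × ℝ → ℝ := fun i t p => M.L i.1.2.1 i.1.2.2.1 i.1.2.2.2 t p (z t)
  let Φ : I → ProbabilityMeasure (ℝ × ℝ) × ProbabilityMeasure (ℝ × ℝ × ℝ) → ℝ := fun i q =>
    ∫ x, i.1.1 0 x ∂m0 + J (Lz i) q.2 - ∫ p, i.1.1 p.1 p.2 ∂(q.1 : Measure (ℝ × ℝ))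
  let Γ : ProbabilityMeasure (ℝ × ℝ) × ProbabilityMeasure (ℝ × ℝ × ℝ) → ℝ := fun q =>
    J F q.2 + ∫ p, G p.1 p.2 ∂(q.1 : Measure (ℝ × ℝ))
  have hLz : ∀ i, Car (closure O ×ˢ A) (Lz i) := fun i => (M.L_car i.2).car hz
  obtain ⟨Rb, hRb⟩ := hO.closure.exists_norm_le
  have hJc : ∀ {F}, Car (closure O ×ˢ A) F → ContinuousOn (fun q => J F q.2) (Qμ ×ˢ QP) := by
    intro F hF
    have h1 : ContinuousOn (J F) QP := by
      refine continuousOn_of_filt fun q hq l hl h => ?_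
      refine Tendsto.const_mul _ (hat_tendsto hT hA he hF h (fun n => n.2) fun ε hε => ?_)
      refine ⟨|Rb| + |e.1| + 1, by positivity, fun n => ?_⟩
      refine le_trans (le_of_eq ?_) hε.le
      apply integral_eq_zero_of_ae
      filter_upwards [n.2.ae] with q hq
      apply chi_zero (by positivity)
      rcases hq with hq | hq
      · have := hRb _ hq.1
        rw [Real.norm_eq_abs] at this
        have := le_abs_self Rb
        have := abs_nonneg e.1
        linarith
      · rw [mem_singleton_iff] at hq
        rw [hq]
        have := abs_nonneg Rb
        linarith
    exact h1.comp continuousOn_snd (fun q hq => hq.2)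
  have hbd : ∀ {u : ℝ → ℝ → ℝ}, ContinuousOn (fun p : ℝ × ℝ => u p.1 p.2) (Icc 0 T ×ˢ closure O) →
      ∃ C, 0 ≤ C ∧ ∀ t ∈ Icc (0:ℝ) T, ∀ x ∈ closure O, |u t x| ≤ C := by
    intro u hu
    obtain ⟨C, hC⟩ := hKc.exists_bound_of_continuousOn hu
    exact ⟨|C|, abs_nonneg _, fun t ht x hx => (hC (t, x) ⟨ht, hx⟩).trans (le_abs_self _)⟩
  have hae : ∀ μ ∈ Qμ, ∀ᵐ p ∂(μ : Measure (ℝ × ℝ)), p ∈ Icc 0 T ×ˢ closure O := fun μ hμ => by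
    rw [ae_iff]; exact hμ
  have hμc : ∀ {u : ℝ → ℝ → ℝ}, ContinuousOn (fun p : ℝ × ℝ => u p.1 p.2) (Icc 0 T ×ˢ closure O) →
      ContinuousOn (fun q : ProbabilityMeasure (ℝ × ℝ) × ProbabilityMeasure (ℝ × ℝ × ℝ) =>
        ∫ p, u p.1 p.2 ∂(q.1 : Measure (ℝ × ℝ))) (Qμ ×ˢ QP) := by
    intro u hu
    obtain ⟨C, hC0, hC⟩ := hbd hu
    obtain ⟨k, hk, hkb, hke⟩ := ext_cont hu hC0 hC
    have h1 : ContinuousOn (fun μ : ProbabilityMeasure (ℝ × ℝ) => ∫ p, k p ∂(μ : Measure (ℝ × ℝ))) Qμ :=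
      continuousOn_of_filt fun q hq l hl h => pm_tendsto h hk hkb
    have h2 : ContinuousOn (fun μ : ProbabilityMeasure (ℝ × ℝ) => ∫ p, u p.1 p.2 ∂(μ : Measure (ℝ × ℝ))) Qμ := by
      refine h1.congr fun μ hμ => integral_congr_ae ?_
      filter_upwards [hae μ hμ] with p hp
      exact (hke p.1 hp.1 p.2 hp.2).symm
    exact h2.comp continuousOn_fst (fun q hq => hq.1)
  have hintg : ∀ {u : ℝ → ℝ → ℝ}, ContinuousOn (fun p : ℝ × ℝ => u p.1 p.2) (Icc 0 T ×ˢ closure O) →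
      ∀ μ ∈ Qμ, Integrable (fun p : ℝ × ℝ => u p.1 p.2) (μ : Measure (ℝ × ℝ)) := by
    intro u hu μ hμ
    obtain ⟨C, hC0, hC⟩ := hbd hu
    obtain ⟨k, hk, hkb, hke⟩ := ext_cont hu hC0 hC
    refine (int_of_bdd _ hk.measurable hkb).congr ?_
    filter_upwards [hae μ hμ] with p hp
    exact hke p.1 hp.1 p.2 hp.2
  have hu0 : ∀ i : I, Integrable (fun x => i.1.1 0 x) m0 := by
    intro i
    obtain ⟨C, hC0, hC⟩ := hbd i.2.cont
    obtain ⟨k, hk, hkb, hke⟩ := ext_cont i.2.cont hC0 hC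
    refine (int_of_bdd (f := fun x => k (0, x)) _ (by fun_prop) (fun x => hkb _)).congr ?_
    have : ∀ᵐ x ∂m0, x ∈ O := by rw [ae_iff]; exact hm0
    filter_upwards [this] with x hx
    exact hke 0 ⟨le_rfl, hT.le⟩ x (subset_closure hx)
  obtain ⟨S, k, hSk⟩ := dual_abs hQ (Φ := Φ) (Γ := Γ) (c := c)
    (fun i => (continuousOn_const.add (hJc (hLz i))).sub (hμc i.2.cont)) ((hJc hF).add (hμc hG))
    (by
      rintro ⟨μ, P⟩ ⟨hμ, hP⟩ ⟨μ', P'⟩ ⟨hμ', hP'⟩ s t hs ht hst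
      obtain ⟨m, hm, hmi⟩ := hat_decode hT hA (P := (P : Measure (ℝ × ℝ × ℝ))) hP
      obtain ⟨m', hm', hmi'⟩ := hat_decode hT hA (P := (P' : Measure (ℝ × ℝ × ℝ))) hP'
      let l : Bool → ℝ := fun b => if b then s else t
      let ys : Bool → Y := fun b => if b then ((μ : Measure (ℝ × ℝ)), m) else ((μ' : Measure (ℝ × ℝ)), m')
      have hl : ∀ i, 0 ≤ l i := by rintro (_ | _) <;> simp [l, hs, ht]
      have hys : ∀ i, Fl O A (ys i).2 := by rintro (_ | _) <;> simp [ys, hm, hm']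
      have hl1 : ∑ i, l i = 1 := by simp [l, hst]
      have hx := mix_mix (T := T) hl hys
      have hfl := mix_fl hl hl1 hys
      obtain ⟨P'', hP'', hPi⟩ := hat_encode hT hA he hfl
      have hpr : IsProbabilityMeasure (mix l ys).1 := by
        constructor
        simp [mix, l, ys]
        rw [← ENNReal.ofReal_add hs ht, hst]; simp
      have hsu : (mix l ys).1 (Icc 0 T ×ˢ closure O)ᶜ = 0 := by
        have a1 : (μ : Measure (ℝ × ℝ)) (Icc 0 T ×ˢ closure O)ᶜ = 0 := hμ
        have a2 : (μ' : Measure (ℝ × ℝ)) (Icc 0 T ×ˢ closure O)ᶜ = 0 := hμ'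
        simp [mix, l, ys, a1, a2]
      have hJ : ∀ {F}, BM F → J F ⟨P'', hP''.prob⟩ = s * J F P + t * J F P' := by
        intro F hF
        simp only [J]
        rw [← hmi F hF, ← hmi' F hF]
        have := hx.i2 F hF
        rw [hPi F hF] at this
        simpa [l, ys] using this
      have hU : ∀ {u : ℝ → ℝ → ℝ}, ContinuousOn (fun p : ℝ × ℝ => u p.1 p.2) (Icc 0 T ×ˢ closure O) →
          ∫ p, u p.1 p.2 ∂(mix l ys).1 = s * ∫ p, u p.1 p.2 ∂(μ : Measure (ℝ × ℝ)) + t * ∫ p, u p.1 p.2 ∂(μ' : Measure (ℝ × ℝ)) := by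
        intro u hu
        have := hx.int (fun p => u p.1 p.2) (by
          rintro (_ | _)
          · simpa [ys] using hintg hu μ' hμ'
          · simpa [ys] using hintg hu μ hμ)
        simpa [l, ys] using this
      refine ⟨(⟨(mix l ys).1, hpr⟩, ⟨P'', hP''.prob⟩), ⟨hsu, hP''⟩, fun i => ?_, ?_⟩
      · simp only [Φ]
        rw [hJ (hLz i).bm]
        have := hU i.2.cont
        simp only [ProbabilityMeasure.coe_mk]
        rw [this]
        have ht' : t = 1 - s := by linarith
        rw [ht']; ring
      · simp only [Γ]
        rw [hJ hF.bm]
        have := hU hG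
        simp only [ProbabilityMeasure.coe_mk]
        rw [this]
        ring)
    (by
      have hy := M.FP_y0 hT hm0 z
      obtain ⟨P, hP, hPi⟩ := hat_encode hT hA he hy.fl
      refine ⟨(⟨(y0 m0).1, hy.prob⟩, ⟨P, hP.prob⟩), ⟨hy.supp, hP⟩, fun i => ?_⟩
      have := hy.eq _ _ _ _ i.2
      rw [hPi _ (hLz i).bm] at this
      simp only [Φ, J, ProbabilityMeasure.coe_mk]
      rw [this]
      ring)
    (by
      rintro ⟨μ, P⟩ ⟨hμ, hP⟩ hΦ
      obtain ⟨m, hm, hmi⟩ := hat_decode hT hA (P := (P : Measure (ℝ × ℝ × ℝ))) hP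
      have := h ((μ : Measure (ℝ × ℝ)), m) ⟨inferInstance, hμ, hm, fun u ut ux uxx hu => by
        have h1 := hΦ ⟨(u, ut, ux, uxx), hu⟩
        simp only [Φ, J, Lz] at h1
        rw [hmi _ ((M.L_car hu).car hz).bm]
        linarith⟩
      simp only at this
      rw [hmi _ hF.bm] at this
      exact this)
  -- combine
  obtain ⟨i, hi⟩ : ∃ i : I, ∀ q ∈ Qμ ×ˢ QP, ∑ i ∈ S, k i * Φ i q = Φ i q := by
    clear hSk
    induction S using Finset.induction_on with
    | empty =>
      refine ⟨⟨(fun _ _ => 0, fun _ _ => 0, fun _ _ => 0, fun _ _ => 0), cb12_const T O 0⟩, fun q hq => ?_⟩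
      have hz0 : ∀ t p, M.L (fun _ _ => 0) (fun _ _ => 0) (fun _ _ => 0) t p (z t) = 0 := by
        intro t p; simp [Mod.L, cut]
      simp only [Φ, Lz, J]
      simp [hz0]
    | insert j S hj ih =>
      obtain ⟨i, hi⟩ := ih
      let i' : I := ⟨(fun t x => i.1.1 t x + k j * j.1.1 t x, fun t x => i.1.2.1 t x + k j * j.1.2.1 t x,
        fun t x => i.1.2.2.1 t x + k j * j.1.2.2.1 t x, fun t x => i.1.2.2.2 t x + k j * j.1.2.2.2 t x),
        cb12_comb i.2 j.2 (k j)⟩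
      refine ⟨i', fun q hq => ?_⟩
      rw [Finset.sum_insert hj, hi q hq]
      have e1 : Lz i' = fun t p => Lz i t p + k j * Lz j t p := by
        ext t p
        simp only [Lz, Mod.L, cut, i']
        split_ifs <;> ring
      obtain ⟨m, hm, hmi⟩ := hat_decode hT hA (P := (q.2 : Measure (ℝ × ℝ × ℝ))) hq.2
      have e2 : J (fun t p => Lz i t p + k j * Lz j t p) q.2 = J (Lz i) q.2 + k j * J (Lz j) q.2 := by
        simp only [J]
        rw [← hmi _ (hLz i).bm, ← hmi _ (hLz j).bm, ← hmi _ ((hLz i).bm.add ((hLz j).bm.cmul (k j))),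
          hm.I2_add (hLz i).bm ((hLz j).bm.cmul (k j)), I2_cmul]
      have i1 := hintg i.2.cont q.1 hq.1
      have i2 := hintg j.2.cont q.1 hq.1
      simp only [Φ]
      rw [e1, e2]
      simp only [i']
      rw [integral_add i1 (i2.const_mul _), integral_const_mul, integral_add (hu0 i) ((hu0 j).const_mul _), integral_const_mul]
      ring
  have hmain : ∀ m, Fl O A m → ∀ p0 ∈ Icc 0 T ×ˢ closure O,
      I2 T m (fun t p => F t p + Lz i t p) < c - ∫ x, i.1.1 0 x ∂m0 - (G p0.1 p0.2 - i.1.1 p0.1 p0.2) := by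
    intro m hm p0 hp0
    obtain ⟨P, hP, hPi⟩ := hat_encode hT hA he hm
    have hd : (Measure.dirac p0) (Icc 0 T ×ˢ closure O)ᶜ = 0 := by
      rw [Measure.dirac_apply' _ hKc.isClosed.measurableSet.compl]; simp [hp0]
    have hd' : (⟨Measure.dirac p0, inferInstance⟩ : ProbabilityMeasure (ℝ × ℝ)) ∈ Qμ := hd
    have hq : ((⟨Measure.dirac p0, inferInstance⟩ : ProbabilityMeasure (ℝ × ℝ)), (⟨P, hP.prob⟩ : ProbabilityMeasure (ℝ × ℝ × ℝ))) ∈ Qμ ×ˢ QP :=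
      ⟨hd, hP⟩
    have h1 := hSk _ hq
    rw [hi _ hq] at h1
    simp only [Γ, Φ, J, ProbabilityMeasure.coe_mk] at h1
    rw [← hPi _ hF.bm, ← hPi _ (hLz i).bm, integral_dirac, integral_dirac] at h1
    rw [hm.I2_add hF.bm (hLz i).bm]
    linarith
  have hOne : (closure O).Nonempty := by
    by_contra hcon
    rw [not_nonempty_iff_eq_empty, closure_empty_iff] at hcon
    rw [hcon] at hm0
    simp at hm0
  obtain ⟨p0, hp0, hmax⟩ := hKc.exists_isMaxOn (f := fun p : ℝ × ℝ => G p.1 p.2 - i.1.1 p.1 p.2)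
    ((nonempty_Icc.2 hT.le).prod hOne) (hG.sub i.2.cont)
  set κ := G p0.1 p0.2 - i.1.1 p0.1 p0.2 with hκ
  obtain ⟨ψ, hψm, hψb, hψ0, hψ, hψi⟩ := exists_sel (T := T) hA hO (hF.add (hLz i)) (R := c - ∫ x, i.1.1 0 x ∂m0 - κ)
    (fun m hm => (hmain m hm p0 hp0).le)
  have hcb := cb12_comb i.2 (cb12_const T O κ) 1
  refine ⟨_, _, _, _, ψ, hcb, hψm, hψb, hψ0, fun t ht x hx => ?_, fun t p hp => ?_, ?_⟩
  · have := hmax (show (t, x) ∈ Icc 0 T ×ˢ closure O from ⟨ht, hx⟩)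
    simp only [mem_ofPred_eq] at this
    linarith
  · simpa [Lz] using hψ t p hp
  · have : ∫ x, (i.1.1 0 x + 1 * κ) ∂m0 = ∫ x, i.1.1 0 x ∂m0 + κ := by
      rw [integral_add (hu0 i) (integrable_const _)]; simp
    rw [this]
    linarith

end
end LPN
end

noncomputable section

namespace LPN

section

variable {c1 c2 : ℝ}

structure Bi (c1 c2 : ℝ) (f : ℝ → ℝ) : Prop where
  meas : AEStronglyMeasurable f (volume.restrict (Icc c1 c2))
  bdd : ∃ C, ∀ z ∈ Icc c1 c2, |f z| ≤ C

lemma Bi.add {f g : ℝ → ℝ} (hf : Bi c1 c2 f) (hg : Bi c1 c2 g) : Bi c1 c2 (fun z => f z + g z) := by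
  obtain ⟨C, hC⟩ := hf.bdd
  obtain ⟨D, hD⟩ := hg.bdd
  exact ⟨hf.meas.add hg.meas, C + D, fun z hz => (abs_add_le _ _).trans (add_le_add (hC z hz) (hD z hz))⟩

lemma Bi.mul {f g : ℝ → ℝ} (hf : Bi c1 c2 f) (hg : Bi c1 c2 g) : Bi c1 c2 (fun z => f z * g z) := by
  obtain ⟨C, hC⟩ := hf.bdd
  obtain ⟨D, hD⟩ := hg.bdd
  exact ⟨hf.meas.mul hg.meas, C * D, fun z hz => by
    rw [abs_mul]; exact mul_le_mul (hC z hz) (hD z hz) (abs_nonneg _) ((abs_nonneg _).trans (hC z hz))⟩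

lemma Bi.const (k : ℝ) : Bi c1 c2 (fun _ => k) := ⟨aestronglyMeasurable_const, |k|, fun _ _ => le_rfl⟩

lemma Bi.neg {f : ℝ → ℝ} (hf : Bi c1 c2 f) : Bi c1 c2 (fun z => - f z) := by
  simpa using (Bi.const (-1)).mul hf

lemma Bi.sub {f g : ℝ → ℝ} (hf : Bi c1 c2 f) (hg : Bi c1 c2 g) : Bi c1 c2 (fun z => f z - g z) := by
  simpa [sub_eq_add_neg] using hf.add hg.neg

lemma Bi.sq {f : ℝ → ℝ} (hf : Bi c1 c2 f) : Bi c1 c2 (fun z => f z ^ 2) := by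
  simpa [pow_two] using hf.mul hf

lemma Bi.cont {f : ℝ → ℝ} (hf : ContinuousOn f (Icc c1 c2)) : Bi c1 c2 f :=
  ⟨hf.aestronglyMeasurable measurableSet_Icc, isCompact_Icc.exists_bound_of_continuousOn hf⟩

lemma Bi.int {f : ℝ → ℝ} (hf : Bi c1 c2 f) : Integrable f (volume.restrict (Icc c1 c2)) := by
  obtain ⟨C, hC⟩ := hf.bdd
  exact Integrable.of_bound hf.meas C ((ae_restrict_mem measurableSet_Icc).mono hC)

lemma ac_of_c1 {p p' : ℝ → ℝ} (hc : c1 ≤ c2) (hp : ∀ z ∈ Icc c1 c2, HasDerivWithinAt p (p' z) (Icc c1 c2) z)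
    (hp' : ContinuousOn p' (Icc c1 c2)) : AbsolutelyContinuousOnInterval p c1 c2 := by
  obtain ⟨C, hC⟩ := isCompact_Icc.exists_bound_of_continuousOn hp'
  have := (convex_Icc c1 c2).lipschitzOnWith_of_nnnorm_hasDerivWithin_le (C := Real.toNNReal C) hp (fun z hz => by
    rw [← NNReal.coe_le_coe, coe_nnnorm]
    exact (hC z hz).trans (Real.le_coe_toNNReal C))
  rw [← uIcc_of_le hc] at this
  exact this.absolutelyContinuousOnInterval

lemma ftc_ac {B B' p p' : ℝ → ℝ} (hc : c1 ≤ c2) (hB : AbsolutelyContinuousOnInterval B c1 c2)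
    (hB' : ∀ᵐ z, HasDerivAt B (B' z) z)
    (hp : ∀ z ∈ Icc c1 c2, HasDerivWithinAt p (p' z) (Icc c1 c2) z)
    (hp' : ContinuousOn p' (Icc c1 c2)) :
    ∫ z in Icc c1 c2, (B' z * p z + B z * p' z) = B c2 * p c2 - B c1 * p c1 := by
  rw [← hB.integral_deriv_mul_eq_sub (ac_of_c1 hc hp hp'), intervalIntegral.integral_of_le hc,
    ← integral_Icc_eq_integral_Ioc, integral_Icc_eq_integral_Ioo, integral_Icc_eq_integral_Ioo]
  apply integral_congr_ae
  filter_upwards [ae_restrict_of_ae hB', ae_restrict_mem measurableSet_Ioo] with z hz hzI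
  rw [hz.deriv, ((hp z (Ioo_subset_Icc_self hzI)).hasDerivAt (Icc_mem_nhds hzI.1 hzI.2)).deriv]

lemma lip_of {B : ℝ → ℝ} {K : ℝ} (h : ∀ x y, |B x - B y| ≤ K * |x - y|) : LipschitzWith K.toNNReal B := by
  apply LipschitzWith.of_dist_le_mul
  intro x y
  rw [Real.dist_eq, Real.dist_eq]
  exact (h x y).trans (mul_le_mul_of_nonneg_right (Real.le_coe_toNNReal K) (abs_nonneg _))

lemma lip_deriv {B : ℝ → ℝ} {K : ℝ} (hK : 0 ≤ K) (h : ∀ x y, |B x - B y| ≤ K * |x - y|) (z : ℝ) : |deriv B z| ≤ K := by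
  have := norm_deriv_le_of_lipschitz (lip_of h) (x₀ := z)
  rwa [Real.coe_toNNReal _ hK] at this

lemma lip_ae {B : ℝ → ℝ} {K : ℝ} (h : ∀ x y, |B x - B y| ≤ K * |x - y|) : ∀ᵐ z, HasDerivAt B (deriv B z) z := by
  filter_upwards [(lip_of h).ae_differentiableAt] with z hz
  exact hz.hasDerivAt

lemma lip_bi {B : ℝ → ℝ} {K : ℝ} (hK : 0 ≤ K) (h : ∀ x y, |B x - B y| ≤ K * |x - y|) : Bi c1 c2 (deriv B) :=
  ⟨(measurable_deriv B).aestronglyMeasurable, K, fun z _ => lip_deriv hK h z⟩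

lemma lip_ac {B : ℝ → ℝ} {K : ℝ} (h : ∀ x y, |B x - B y| ≤ K * |x - y|) : AbsolutelyContinuousOnInterval B c1 c2 :=
  (lip_of h).lipschitzOnWith.absolutelyContinuousOnInterval

lemma cs_wt {e V : ℝ → ℝ} (he : Bi c1 c2 e) (hV : Bi c1 c2 V) (h0 : ∀ z, 0 < e z)
    (hI : 0 < ∫ z in Icc c1 c2, e z) :
    (∫ z in Icc c1 c2, e z * V z) ^ 2 ≤ (∫ z in Icc c1 c2, e z) * ∫ z in Icc c1 c2, e z * V z ^ 2 := by
  set I := ∫ z in Icc c1 c2, e z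
  set Q := ∫ z in Icc c1 c2, e z * V z
  set S := ∫ z in Icc c1 c2, e z * V z ^ 2
  have h1 : 0 ≤ ∫ z in Icc c1 c2, e z * (I * V z - Q) ^ 2 :=
    integral_nonneg fun z => mul_nonneg (h0 z).le (sq_nonneg _)
  have h2 : ∫ z in Icc c1 c2, e z * (I * V z - Q) ^ 2 = I ^ 2 * S - 2 * I * Q * Q + Q ^ 2 * I := by
    have : (fun z => e z * (I * V z - Q) ^ 2) = fun z => I ^ 2 * (e z * V z ^ 2) - 2 * I * Q * (e z * V z) + Q ^ 2 * e z := by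
      ext z; ring
    rw [this, integral_add, integral_sub, integral_const_mul, integral_const_mul, integral_const_mul]
    · exact ((he.mul hV.sq).int).const_mul _
    · exact ((he.mul hV).int).const_mul _
    · exact (((he.mul hV.sq).int).const_mul _).sub (((he.mul hV).int).const_mul _)
    · exact he.int.const_mul _
  rw [h2] at h1
  by_contra hcon
  push Not at hcon
  nlinarith

lemma int3 {f g h : ℝ → ℝ} (hf : Integrable f (volume.restrict (Icc c1 c2))) (hg : Integrable g (volume.restrict (Icc c1 c2)))
    (hh : Integrable h (volume.restrict (Icc c1 c2))) (a b c : ℝ) :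
    ∫ z in Icc c1 c2, (a * f z + b * g z + c * h z) = a * (∫ z in Icc c1 c2, f z) + b * (∫ z in Icc c1 c2, g z)
      + c * (∫ z in Icc c1 c2, h z) := by
  have h1 : Integrable (fun z => a * f z + b * g z) (volume.restrict (Icc c1 c2)) := (hf.const_mul a).add (hg.const_mul b)
  rw [integral_add h1 (hh.const_mul c), integral_add (hf.const_mul a) (hg.const_mul b), integral_const_mul,
    integral_const_mul, integral_const_mul]

lemma core {κ α α' x s β Fx E K C W R : ℝ} {w w1 w2 wt Ff bt st : ℝ → ℝ} {ψ : ℝ} (hc : c1 < c2) (hκ : 1 ≤ κ) (hα : 0 < α)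
    (hK : 0 ≤ K) (hC : 0 ≤ C)
    (hw : ∀ z ∈ Icc c1 c2, HasDerivWithinAt w (w1 z) (Icc c1 c2) z)
    (hw1 : ∀ z ∈ Icc c1 c2, HasDerivWithinAt w1 (w2 z) (Icc c1 c2) z)
    (hw2 : ContinuousOn w2 (Icc c1 c2)) (hwt : ContinuousOn wt (Icc c1 c2))
    (hW : ∀ z ∈ Icc c1 c2, |w1 z| ≤ W) (hR : ∀ z ∈ Icc c1 c2, |x - z| ≤ R)
    (hbt : ∀ x y, |bt x - bt y| ≤ K * |x - y|) (hst : ∀ x y, |st x - st y| ≤ K * |x - y|)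
    (hbC : ∀ z ∈ Icc c1 c2, |bt z| ≤ C) (hsC : ∀ z ∈ Icc c1 c2, |st z| ≤ C) (hs : |s| ≤ C)
    (hfeas : ∀ z ∈ Icc c1 c2, Ff z + (wt z + (bt z * w1 z + st z ^ 2 / 2 * w2 z)) ≤ ψ)
    (hD : ∀ z ∈ Icc c1 c2, Fx - E ≤ Ff z - ψ - α' * (x - z) ^ 2 - 2 * α * (x - z) * (β - bt z) - α * (s - st z) ^ 2)
    {e : ℝ → ℝ} (he : ∀ z, e z = Real.exp (-κ * (w z + α * (x - z) ^ 2))) :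
    ∃ Q S b2 : ℝ, Q ^ 2 ≤ (∫ z in Icc c1 c2, e z) * S ∧ 0 ≤ S ∧ 
      s * (∫ z in Icc c1 c2, e z * (-κ * (2 * α * (x - z)))) = - κ * Q - b2 ∧
      |b2| ≤ C * (e c1 + e c2) ∧ 0 < (∫ z in Icc c1 c2, e z) ∧
      κ * (Fx - E) * (∫ z in Icc c1 c2, e z) + κ ^ 2 / 2 * S - (K ^ 2 / 2 + K) * (∫ z in Icc c1 c2, e z)
        - κ * (C + C ^ 2 / 2 * (W + 2 * α * R) + C ^ 2 * (2 * α * R)) * (e c1 + e c2)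
      ≤ (∫ z in Icc c1 c2, e z * (-κ * (wt z + α' * (x - z) ^ 2))) + β * (∫ z in Icc c1 c2, e z * (-κ * (2 * α * (x - z))))
        + s ^ 2 / 2 * (∫ z in Icc c1 c2, e z * ((-κ * (2 * α * (x - z))) ^ 2 - κ * (2 * α))) := by
  have hκ0 : 0 < κ := by linarith
  have he0 : ∀ z, 0 < e z := fun z => by rw [he]; exact Real.exp_pos _
  set f1 : ℝ → ℝ := fun z => w1 z - 2 * α * (x - z) with hf1
  have hee : ∀ z ∈ Icc c1 c2, HasDerivWithinAt e (e z * (-κ * f1 z)) (Icc c1 c2) z := by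
    intro z hz
    have h1 : HasDerivWithinAt (fun z => w z + α * (x - z) ^ 2) (f1 z) (Icc c1 c2) z := by
      have h2 : HasDerivWithinAt (fun z : ℝ => α * (x - z) ^ 2) (-(2 * α * (x - z))) (Icc c1 c2) z := by
        have := ((((hasDerivAt_id z).const_sub x).pow 2).const_mul α).hasDerivWithinAt (s := Icc c1 c2)
        exact this.congr_deriv (by simp; ring)
      exact (hw z hz).add h2
    have := (h1.const_mul (-κ)).exp
    have h3 : e = fun z => Real.exp (-κ * (w z + α * (x - z) ^ 2)) := funext he
    rw [h3]
    exact this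
  have hf1d : ∀ z ∈ Icc c1 c2, HasDerivWithinAt f1 (w2 z + 2 * α) (Icc c1 c2) z := by
    intro z hz
    have h2 : HasDerivWithinAt (fun z : ℝ => 2 * α * (x - z)) (-(2 * α)) (Icc c1 c2) z := by
      have := (((hasDerivAt_id z).const_sub x).const_mul (2 * α)).hasDerivWithinAt (s := Icc c1 c2)
      exact this.congr_deriv (by ring)
    have := (hw1 z hz).sub h2
    exact this.congr_deriv (by ring)
  have hrd : ∀ z ∈ Icc c1 c2, HasDerivWithinAt (fun z => 2 * α * (x - z)) (-(2 * α)) (Icc c1 c2) z := by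
    intro z hz
    have := (((hasDerivAt_id z).const_sub x).const_mul (2 * α)).hasDerivWithinAt (s := Icc c1 c2)
    exact this.congr_deriv (by ring)
  have hec : ContinuousOn e (Icc c1 c2) := fun z hz => (hee z hz).continuousWithinAt
  have hf1c : ContinuousOn f1 (Icc c1 c2) := fun z hz => (hf1d z hz).continuousWithinAt
  have hrc : ContinuousOn (fun z => 2 * α * (x - z)) (Icc c1 c2) := by fun_prop
  have hbtc : Continuous bt := (lip_of hbt).continuous
  have hstc : Continuous st := (lip_of hst).continuous
  have be := Bi.cont hec
  have bf := Bi.cont hf1c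
  have br := Bi.cont hrc
  have bb : Bi c1 c2 bt := Bi.cont hbtc.continuousOn
  have bs : Bi c1 c2 st := Bi.cont hstc.continuousOn
  have bb' : Bi c1 c2 (deriv bt) := lip_bi hK hbt
  have bs' : Bi c1 c2 (deriv st) := lip_bi hK hst
  have bw2 := Bi.cont hw2
  have bwt := Bi.cont hwt
  have bw1 : Bi c1 c2 w1 := Bi.cont fun z hz => (hw1 z hz).continuousWithinAt
  have bxz : Bi c1 c2 (fun z => x - z) := Bi.cont (by fun_prop)
  let V : ℝ → ℝ := fun z => s * (2 * α * (x - z)) + st z * f1 z - κ⁻¹ * deriv st z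
  have bV : Bi c1 c2 V := (((Bi.const s).mul br).add (bs.mul bf)).sub ((Bi.const _).mul bs')
  have hI : 0 < ∫ z in Icc c1 c2, e z := by
    rw [setIntegral_pos_iff_support_of_nonneg_ae (Eventually.of_forall fun z => (he0 z).le) be.int]
    have : Function.support e ∩ Icc c1 c2 = Icc c1 c2 := by
      ext z; simp [(he0 z).ne']
    rw [this]; simp [hc]
  -- integration by parts
  have ib := ftc_ac hc.le (lip_ac hbt) (lip_ae hbt) hee (hec.mul (continuousOn_const.mul hf1c))
  have is := ftc_ac hc.le (lip_ac hst) (lip_ae hst) hee (hec.mul (continuousOn_const.mul hf1c))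
  have iss := ftc_ac (B := fun z => st z * st z) (B' := fun z => deriv st z * st z + st z * deriv st z)
    (p := fun z => e z * f1 z) (p' := fun z => e z * (-κ * f1 z) * f1 z + e z * (w2 z + 2 * α)) hc.le
    ((lip_ac hst).mul (lip_ac hst)) ((lip_ae hst).mono fun z hz => hz.mul hz)
    (fun z hz => (hee z hz).mul (hf1d z hz))
    (((hec.mul (continuousOn_const.mul hf1c)).mul hf1c).add (hec.mul (hw2.add continuousOn_const)))
  have isx := ftc_ac (p := fun z => e z * (2 * α * (x - z))) (p' := fun z => e z * (-κ * f1 z) * (2 * α * (x - z)) + e z * (-(2 * α)))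
    hc.le (lip_ac hst) (lip_ae hst)
    (fun z hz => (hee z hz).mul (hrd z hz))
    (((hec.mul (continuousOn_const.mul hf1c)).mul hrc).add (hec.mul continuousOn_const))
  have bk : ∀ k : ℝ, Bi c1 c2 (fun _ => k) := fun k => Bi.const k
  have jb := (bb'.mul be).add (bb.mul (be.mul ((bk (-κ)).mul bf)))
  have js := (bs'.mul be).add (bs.mul (be.mul ((bk (-κ)).mul bf)))
  have jss := (((bs'.mul bs).add (bs.mul bs')).mul (be.mul bf)).add
    ((bs.mul bs).mul (((be.mul ((bk (-κ)).mul bf)).mul bf).add (be.mul (bw2.add (bk (2 * α))))))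
  have jsx := (bs'.mul (be.mul br)).add (bs.mul (((be.mul ((bk (-κ)).mul bf)).mul br).add (be.mul (bk (-(2 * α))))))
  refine ⟨∫ z in Icc c1 c2, e z * V z, ∫ z in Icc c1 c2, e z * V z ^ 2, st c2 * e c2 - st c1 * e c1,
    cs_wt be bV he0 hI, integral_nonneg fun z => mul_nonneg (he0 z).le (sq_nonneg _), ?_, ?_, hI, ?_⟩
  · rw [← is, ← integral_const_mul, ← integral_const_mul, ← integral_sub ((be.mul bV).int.const_mul _) js.int]
    congr 1
    ext z
    simp only [V]
    field_simp
    ring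
  · have h1 := hsC c1 ⟨le_rfl, hc.le⟩
    have h2 := hsC c2 ⟨hc.le, le_rfl⟩
    calc |st c2 * e c2 - st c1 * e c1| ≤ |st c2 * e c2| + |st c1 * e c1| := abs_sub _ _
      _ = |st c2| * e c2 + |st c1| * e c1 := by rw [abs_mul, abs_mul, abs_of_pos (he0 c1), abs_of_pos (he0 c2)]
      _ ≤ C * e c2 + C * e c1 := by
        have := he0 c1; have := he0 c2
        gcongr
      _ = _ := by ring
  · set X : ℝ → ℝ := fun z => e z * (-κ * (wt z + α' * (x - z) ^ 2)) + β * (e z * (-κ * (2 * α * (x - z))))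
        + s ^ 2 / 2 * (e z * ((-κ * (2 * α * (x - z))) ^ 2 - κ * (2 * α))) with hX
    have iX1 : Bi c1 c2 (fun z => e z * (-κ * (wt z + α' * (x - z) ^ 2))) :=
      be.mul ((bk _).mul (bwt.add ((bk _).mul bxz.sq)))
    have iX2 : Bi c1 c2 (fun z => e z * (-κ * (2 * α * (x - z)))) := be.mul ((bk _).mul br)
    have iX3 : Bi c1 c2 (fun z => e z * ((-κ * (2 * α * (x - z))) ^ 2 - κ * (2 * α))) :=
      be.mul (((bk _).mul br).sq.sub (bk _))
    have eX : ∫ z in Icc c1 c2, X z = (∫ z in Icc c1 c2, e z * (-κ * (wt z + α' * (x - z) ^ 2)))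
        + β * (∫ z in Icc c1 c2, e z * (-κ * (2 * α * (x - z))))
        + s ^ 2 / 2 * (∫ z in Icc c1 c2, e z * ((-κ * (2 * α * (x - z))) ^ 2 - κ * (2 * α))) := by
      have := int3 iX1.int iX2.int iX3.int 1 β (s ^ 2 / 2)
      simpa only [one_mul] using this
    have iX : Integrable X (volume.restrict (Icc c1 c2)) := (iX1.int.add (iX2.int.const_mul _)).add (iX3.int.const_mul _)
    rw [← eX]
    set h1 : ℝ → ℝ := fun z => deriv bt z * e z + bt z * (e z * (-κ * f1 z)) with hh1
    set h2 : ℝ → ℝ := fun z => (deriv st z * st z + st z * deriv st z) * (e z * f1 z) +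
      st z * st z * (e z * (-κ * f1 z) * f1 z + e z * (w2 z + 2 * α)) with hh2
    set h3 : ℝ → ℝ := fun z => deriv st z * (e z * (2 * α * (x - z))) +
      st z * (e z * (-κ * f1 z) * (2 * α * (x - z)) + e z * (-(2 * α))) with hh3
    have i1 : Integrable h1 (volume.restrict (Icc c1 c2)) := jb.int
    have i2 : Integrable h2 (volume.restrict (Icc c1 c2)) := jss.int
    have i3 : Integrable h3 (volume.restrict (Icc c1 c2)) := jsx.int
    have iS : Integrable (fun z => e z * V z ^ 2) (volume.restrict (Icc c1 c2)) := (be.mul bV.sq).int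
    have hle : ∫ z in Icc c1 c2, ((κ * (Fx - E) - (K ^ 2 / 2 + K)) * e z + κ ^ 2 / 2 * (e z * V z ^ 2)
        + (-1 * h1 z + κ / 2 * h2 z + κ * s * h3 z)) ≤ ∫ z in Icc c1 c2, X z := by
      refine integral_mono_ae (((be.int.const_mul _).add (iS.const_mul _)).add
        (((i1.const_mul _).add (i2.const_mul _)).add (i3.const_mul _))) iX ?_
      filter_upwards [ae_restrict_mem measurableSet_Icc] with z hz
      have key : X z = e z * κ * ((ψ - (Ff z + (wt z + (bt z * w1 z + st z ^ 2 / 2 * w2 z)))) +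
          ((Ff z - ψ - α' * (x - z) ^ 2 - 2 * α * (x - z) * (β - bt z) - α * (s - st z) ^ 2) - (Fx - E)))
          + (e z * κ * (Fx - E) + κ ^ 2 / 2 * (e z * V z ^ 2) - e z * (deriv st z) ^ 2 / 2 + deriv bt z * e z
            + (-1 * h1 z + κ / 2 * h2 z + κ * s * h3 z)) := by
        simp only [hX, hh1, hh2, hh3, V, hf1]
        field_simp
        ring
      rw [key]
      have a1 := hfeas z hz
      have a2 := hD z hz
      have a3 : 0 ≤ e z * κ * ((ψ - (Ff z + (wt z + (bt z * w1 z + st z ^ 2 / 2 * w2 z)))) +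
          ((Ff z - ψ - α' * (x - z) ^ 2 - 2 * α * (x - z) * (β - bt z) - α * (s - st z) ^ 2) - (Fx - E))) :=
        mul_nonneg (mul_nonneg (he0 z).le hκ0.le) (by linarith)
      have a4 : deriv st z ^ 2 ≤ K ^ 2 := by
        rw [← sq_abs]; exact pow_le_pow_left₀ (abs_nonneg _) (lip_deriv hK hst z) 2
      have a5 := (abs_le.1 (lip_deriv hK hbt z)).1
      have a6 : 0 ≤ e z * (K ^ 2 - deriv st z ^ 2) := mul_nonneg (he0 z).le (by linarith)
      have a7 : 0 ≤ e z * (deriv bt z + K) := mul_nonneg (he0 z).le (by linarith)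
      linarith
    have q1 : Integrable (fun z => (κ * (Fx - E) - (K ^ 2 / 2 + K)) * e z + κ ^ 2 / 2 * (e z * V z ^ 2)) (volume.restrict (Icc c1 c2)) :=
      (be.int.const_mul _).add (iS.const_mul _)
    have q2 : Integrable (fun z => -1 * h1 z + κ / 2 * h2 z + κ * s * h3 z) (volume.restrict (Icc c1 c2)) :=
      ((i1.const_mul _).add (i2.const_mul _)).add (i3.const_mul _)
    rw [integral_add q1 q2, integral_add (be.int.const_mul _) (iS.const_mul _), integral_const_mul, integral_const_mul,
      int3 i1 i2 i3, ib, iss, isx] at hle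
    have hbdry : ∀ c ∈ Icc c1 c2, |-1 * (bt c * e c) + κ / 2 * (st c * st c * (e c * f1 c)) + κ * s * (st c * (e c * (2 * α * (x - c))))|
        ≤ κ * (C + C ^ 2 / 2 * (W + 2 * α * R) + C ^ 2 * (2 * α * R)) * e c := by
      intro c hcc
      have a1 := hbC c hcc
      have a2 := hsC c hcc
      have a3 : |2 * α * (x - c)| ≤ 2 * α * R := by
        rw [abs_mul, abs_of_pos (by linarith : 0 < 2 * α)]
        exact mul_le_mul_of_nonneg_left (hR c hcc) (by linarith)
      have a4 : |f1 c| ≤ W + 2 * α * R := (abs_sub _ _).trans (add_le_add (hW c hcc) a3)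
      have a5 := he0 c
      refine (abs_add_three _ _ _).trans ?_
      have t1 : |-1 * (bt c * e c)| ≤ κ * (C * e c) := by
        rw [abs_mul, abs_mul, abs_neg, abs_one, one_mul, abs_of_pos a5]
        have : |bt c| * e c ≤ C * e c := mul_le_mul_of_nonneg_right a1 a5.le
        nlinarith [mul_nonneg hC a5.le]
      have t2 : |κ / 2 * (st c * st c * (e c * f1 c))| ≤ κ / 2 * (C * C * (e c * (W + 2 * α * R))) := by
        rw [abs_mul, abs_mul, abs_mul, abs_mul, abs_of_pos a5, abs_of_pos (by positivity : 0 < κ / 2)]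
        gcongr
      have t3 : |κ * s * (st c * (e c * (2 * α * (x - c))))| ≤ κ * C * (C * (e c * (2 * α * R))) := by
        rw [abs_mul, abs_mul, abs_mul, abs_mul (e c), abs_of_pos a5, abs_of_pos hκ0]
        gcongr
      calc _ ≤ _ := add_le_add (add_le_add t1 t2) t3
        _ = _ := by ring
    have hd1 := abs_le.1 (hbdry c1 ⟨le_rfl, hc.le⟩)
    have hd2 := abs_le.1 (hbdry c2 ⟨hc.le, le_rfl⟩)
    linarith [hd1.1, hd1.2, hd2.1, hd2.2, hle]

end
end LPN
end

noncomputable section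

namespace LPN

section

variable {T c1 c2 : ℝ} {O : Set ℝ}

lemma cs_alg {I0 S P2 Q v : ℝ} (hI0 : 0 < I0) (hP2 : 0 < P2) (hQ : Q ^ 2 ≤ I0 * S) (hS : 0 ≤ S) :
    (Q + P2 * v) ^ 2 ≤ (I0 + P2) * (S + P2 * v ^ 2) := by
  have a1 : 2 * Q * v ≤ I0 * v ^ 2 + S := by
    have b1 : 0 ≤ (I0 * v - Q) ^ 2 := sq_nonneg _
    have b2 : I0 * (2 * Q * v) ≤ I0 * (I0 * v ^ 2 + S) := by
      have : (I0 * v - Q) ^ 2 = I0 * (I0 * v ^ 2) - I0 * (2 * Q * v) + Q ^ 2 := by ring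
      have h2 : I0 * (I0 * v ^ 2 + S) = I0 * (I0 * v ^ 2) + I0 * S := by ring
      linarith
    exact le_of_mul_le_mul_left b2 hI0
  have a4 : 0 ≤ P2 * (I0 * v ^ 2 + S - 2 * Q * v) := mul_nonneg hP2.le (by linarith)
  have e : (I0 + P2) * (S + P2 * v ^ 2) - (Q + P2 * v) ^ 2
      = (I0 * S - Q ^ 2) + P2 * (I0 * v ^ 2 + S - 2 * Q * v) := by ring
  linarith

lemma core2a {κ Fx E K1 CB γ I0 It Ix Ixx S s β P2 qt qx qxx G : ℝ} (hκ : 0 < κ) (hE : 0 ≤ E)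
    (hCB : 0 ≤ CB) (hγ : 0 ≤ γ) (hI0 : 0 < I0) (hP2 : 0 < P2) (hK1 : 0 ≤ K1)
    (hL : κ * (Fx - E) * I0 + κ ^ 2 / 2 * S - K1 * I0 - κ * CB * G ≤ It + β * Ix + s ^ 2 / 2 * Ixx)
    (hq : qt + β * qx + s ^ 2 / 2 * qxx + Fx ≤ 0) (hG : G ≤ 2 * (P2 * γ)) :
    κ * (Fx - E) * (I0 + P2) + κ ^ 2 / 2 * (S + P2 * (s * qx) ^ 2) - K1 * (I0 + P2) - κ * CB * (2 * ((I0 + P2) * γ)) ≤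
      (It + P2 * (-κ * qt)) + β * (Ix + P2 * (-κ * qx)) + s ^ 2 / 2 * (Ixx + P2 * ((-κ * qx) ^ 2 - κ * qxx)) := by
  have a1 : κ * P2 * (Fx - E) ≤ κ * P2 * (-(qt + β * qx + s ^ 2 / 2 * qxx)) := by
    apply mul_le_mul_of_nonneg_left _ (by positivity)
    linarith
  have hGP : G ≤ 2 * ((I0 + P2) * γ) := hG.trans (by gcongr; linarith)
  have a2 : κ * CB * G ≤ κ * CB * (2 * ((I0 + P2) * γ)) := by gcongr
  have a3 : 0 ≤ K1 * P2 := by positivity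
  have e1 : (It + P2 * (-κ * qt)) + β * (Ix + P2 * (-κ * qx)) + s ^ 2 / 2 * (Ixx + P2 * ((-κ * qx) ^ 2 - κ * qxx))
     = (It + β * Ix + s ^ 2 / 2 * Ixx) + κ * P2 * (-(qt + β * qx + s ^ 2 / 2 * qxx)) + κ ^ 2 / 2 * (P2 * (s * qx) ^ 2) := by
    ring
  have e2 : κ * (Fx - E) * (I0 + P2) + κ ^ 2 / 2 * (S + P2 * (s * qx) ^ 2) - K1 * (I0 + P2)
     = κ * (Fx - E) * I0 + κ * P2 * (Fx - E) + κ ^ 2 / 2 * S + κ ^ 2 / 2 * (P2 * (s * qx) ^ 2) - K1 * I0 - K1 * P2 := by ring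
  rw [e1, e2]
  linarith

lemma core2b {κ C M γ P Px Q b2 s S' : ℝ} (hκ : 0 < κ) (hC : 0 ≤ C) (hM : 0 ≤ M) (hP : 0 < P)
    (hQ : Q ^ 2 ≤ P * S') (h : s * Px = -κ * Q - b2) (hb : |b2| ≤ C * (2 * (P * γ))) (hs : |s| ≤ C)
    (hPx : |Px| ≤ κ * M * P) :
    (s * Px) ^ 2 ≤ κ ^ 2 * (P * S') + 2 * (C * (κ * M * P)) * (C * (2 * (P * γ))) := by
  have hPxb : |s * Px| ≤ C * (κ * M * P) := by
    rw [abs_mul]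
    exact mul_le_mul hs hPx (abs_nonneg _) hC
  have a1 : (s * Px) ^ 2 = κ ^ 2 * Q ^ 2 - 2 * ((s * Px) * b2) - b2 ^ 2 := by
    rw [h]; ring
  have a2 : -((s * Px) * b2) ≤ (C * (κ * M * P)) * (C * (2 * (P * γ))) := by
    refine (neg_le_abs _).trans ?_
    rw [abs_mul]
    exact mul_le_mul hPxb hb (abs_nonneg _) (by positivity)
  have a3 : κ ^ 2 * Q ^ 2 ≤ κ ^ 2 * (P * S') := by gcongr
  have := sq_nonneg b2
  rw [a1]
  linarith

lemma core2c {κ Fx E K1 CB γ C M P Lt Px Pxx β s S' : ℝ} (hκ : 0 < κ) (hP : 0 < P)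
    (h1 : κ * (Fx - E) * P + κ ^ 2 / 2 * S' - K1 * P - κ * CB * (2 * (P * γ)) ≤ Lt + β * Px + s ^ 2 / 2 * Pxx)
    (h2 : (s * Px) ^ 2 ≤ κ ^ 2 * (P * S') + 2 * (C * (κ * M * P)) * (C * (2 * (P * γ)))) :
    Fx + (-Lt / (κ * P) + (β * (-Px / (κ * P)) + s ^ 2 / 2 * (-Pxx / (κ * P) + Px ^ 2 / (κ * P ^ 2))))
      ≤ E + K1 / κ + 2 * (CB + C * M * C) * γ := by
  have h3 : Fx + (-Lt / (κ * P) + (β * (-Px / (κ * P)) + s ^ 2 / 2 * (-Pxx / (κ * P) + Px ^ 2 / (κ * P ^ 2))))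
      = Fx + (-2 * P * (Lt + β * Px + s ^ 2 / 2 * Pxx) + (s * Px) ^ 2) / (2 * κ * P ^ 2) := by
    field_simp
    ring
  rw [h3]
  have h4 : E + K1 / κ + 2 * (CB + C * M * C) * γ - Fx
      = (2 * κ * P ^ 2 * (E - Fx) + 2 * P ^ 2 * K1 + 4 * κ * P ^ 2 * (CB + C * M * C) * γ) / (2 * κ * P ^ 2) := by
    field_simp
    ring
  have h5 : (-2 * P * (Lt + β * Px + s ^ 2 / 2 * Pxx) + (s * Px) ^ 2) / (2 * κ * P ^ 2) ≤
      (2 * κ * P ^ 2 * (E - Fx) + 2 * P ^ 2 * K1 + 4 * κ * P ^ 2 * (CB + C * M * C) * γ) / (2 * κ * P ^ 2) := by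
    apply div_le_div_of_nonneg_right _ (by positivity)
    have := mul_le_mul_of_nonneg_left h1 hP.le
    generalize Lt + β * Px + s ^ 2 / 2 * Pxx = L at *
    generalize (s * Px) ^ 2 = V at *
    have e1 : P * (κ * (Fx - E) * P + κ ^ 2 / 2 * S' - K1 * P - κ * CB * (2 * (P * γ)))
      = κ * P ^ 2 * (Fx - E) + κ ^ 2 * (P * S') / 2 - P ^ 2 * K1 - 2 * (κ * P ^ 2 * CB * γ) := by ring
    have e2 : 2 * (C * (κ * M * P)) * (C * (2 * (P * γ))) = 4 * (κ * P ^ 2 * (C * M * C) * γ) := by ring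
    have e3 : 2 * κ * P ^ 2 * (E - Fx) + 2 * P ^ 2 * K1 + 4 * κ * P ^ 2 * (CB + C * M * C) * γ
      = - 2 * (κ * P ^ 2 * (Fx - E)) + 2 * (P ^ 2 * K1) + 4 * (κ * P ^ 2 * CB * γ) + 4 * (κ * P ^ 2 * (C * M * C) * γ) := by ring
    rw [e1] at this
    rw [e2] at h2
    rw [e3]
    linarith
  linarith

lemma core2 {κ Fx E K1 C M CB γ I0 It Ix Ixx Q S b2 s β P2 qt qx qxx G : ℝ} (hκ : 1 ≤ κ) (hE : 0 ≤ E)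
    (hC : 0 ≤ C) (hCB : 0 ≤ CB) (hγ : 0 ≤ γ)
    (hI0 : 0 < I0) (hP2 : 0 < P2) (hQ : Q ^ 2 ≤ I0 * S) (hS : 0 ≤ S) (hsx : s * Ix = -κ * Q - b2)
    (hb2 : |b2| ≤ C * G) (hK1 : 0 ≤ K1)
    (hL : κ * (Fx - E) * I0 + κ ^ 2 / 2 * S - K1 * I0 - κ * CB * G ≤ It + β * Ix + s ^ 2 / 2 * Ixx)
    (hq : qt + β * qx + s ^ 2 / 2 * qxx + Fx ≤ 0) (hG : G ≤ 2 * (P2 * γ))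
    (hIx : |Ix| ≤ κ * M * I0) (hqx : |qx| ≤ M) (hs : |s| ≤ C) :
    Fx + (-(It + P2 * (-κ * qt)) / (κ * (I0 + P2)) + (β * (-(Ix + P2 * (-κ * qx)) / (κ * (I0 + P2))) +
      s ^ 2 / 2 * (-(Ixx + P2 * ((-κ * qx) ^ 2 - κ * qxx)) / (κ * (I0 + P2)) +
        (Ix + P2 * (-κ * qx)) ^ 2 / (κ * (I0 + P2) ^ 2))))
      ≤ E + K1 / κ + 2 * (CB + C * M * C) * γ := by
  have hκ0 : 0 < κ := by linarith
  have hM : 0 ≤ M := (abs_nonneg _).trans hqx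
  have hP0 : 0 < I0 + P2 := by positivity
  have hGP : G ≤ 2 * ((I0 + P2) * γ) := hG.trans (by gcongr; linarith)
  refine core2c hκ0 hP0 (core2a hκ0 hE hCB hγ hI0 hP2 hK1 hL hq hG)
    (core2b hκ0 hC hM hP0 (cs_alg hI0 hP2 hQ hS) (b2 := b2) ?_ (hb2.trans (by gcongr)) hs ?_)
  · rw [mul_add, hsx]; ring
  · calc |Ix + P2 * (-κ * qx)| ≤ |Ix| + |P2 * (-κ * qx)| := abs_add_le _ _
      _ ≤ κ * M * I0 + P2 * (κ * M) := by
        apply add_le_add hIx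
        rw [abs_mul, abs_mul, abs_neg, abs_of_pos hP2, abs_of_pos hκ0]
        gcongr
      _ = _ := by ring

lemma param_cont {S : Set (ℝ × ℝ)} (hS : IsCompact S) {k : ℝ → ℝ → ℝ → ℝ}
    (hk : ContinuousOn (fun p : (ℝ × ℝ) × ℝ => k p.1.1 p.1.2 p.2) (S ×ˢ Icc c1 c2)) :
    ContinuousOn (fun p : ℝ × ℝ => ∫ z in Icc c1 c2, k p.1 p.2 z) S := by
  have hc : IsCompact (S ×ˢ Icc c1 c2) := hS.prod isCompact_Icc
  obtain ⟨C, hC⟩ := hc.exists_bound_of_continuousOn hk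
  obtain ⟨g, hg, -, hge⟩ := tietze_bdd hc.isClosed _ hk |C| (abs_nonneg _)
    (fun p hp => (hC p hp).trans (le_abs_self C))
  have h1 : Continuous (fun p : ℝ × ℝ => ∫ z in Icc c1 c2, g (p, z)) :=
    continuous_parametric_integral_of_continuous (by simpa [Function.uncurry_def] using hg) isCompact_Icc
  refine h1.continuousOn.congr fun p hp => setIntegral_congr_fun measurableSet_Icc fun z hz => ?_
  exact (hge (p, z) ⟨hp, hz⟩).symm

lemma param_deriv {I : Set ℝ} (hI : IsCompact I) (hIc : Convex ℝ I) (hc : c1 ≤ c2) {k kt : ℝ → ℝ → ℝ}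
    (hk : ∀ t ∈ I, ContinuousOn (k t) (Icc c1 c2))
    (hkt : ContinuousOn (fun p : ℝ × ℝ => kt p.1 p.2) (I ×ˢ Icc c1 c2))
    (hd : ∀ t ∈ I, ∀ z ∈ Icc c1 c2, HasDerivWithinAt (fun t => k t z) (kt t z) I t) {t : ℝ} (ht : t ∈ I) :
    HasDerivWithinAt (fun t => ∫ z in Icc c1 c2, k t z) (∫ z in Icc c1 c2, kt t z) I t := by
  rw [hasDerivWithinAt_iff_isLittleO, Asymptotics.isLittleO_iff]
  intro ε hε
  have huc := (hI.prod isCompact_Icc).uniformContinuousOn_of_continuous hkt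
  rw [Metric.uniformContinuousOn_iff] at huc
  obtain ⟨δ, hδ, hu⟩ := huc (ε / (c2 - c1 + 1)) (by have := sub_nonneg.2 hc; positivity)
  filter_upwards [inter_mem_nhdsWithin I (Metric.ball_mem_nhds t hδ)] with t' ht'
  have hkt0 : ContinuousOn (kt t) (Icc c1 c2) := by
    have : ContinuousOn ((fun p : ℝ × ℝ => kt p.1 p.2) ∘ fun z => (t, z)) (Icc c1 c2) :=
      hkt.comp (by fun_prop) (fun z hz => ⟨ht, hz⟩)
    exact this
  have i1 := (Bi.cont (hk t' ht'.1)).int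
  have i2 := (Bi.cont (hk t ht)).int
  have i3 := (Bi.cont hkt0).int
  have i4 : Integrable (fun z => k t' z - k t z) (volume.restrict (Icc c1 c2)) := i1.sub i2
  have i5 : Integrable (fun z => (t' - t) • kt t z) (volume.restrict (Icc c1 c2)) := i3.const_mul (t' - t)
  rw [← integral_sub i1 i2, ← integral_smul, ← integral_sub i4 i5]
  have hpt : ∀ z ∈ Icc c1 c2, ‖k t' z - k t z - (t' - t) • kt t z‖ ≤ ε / (c2 - c1 + 1) * ‖t' - t‖ := by
    intro z hz
    have hs : Convex ℝ (I ∩ Metric.ball t δ) := hIc.inter (convex_ball _ _)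
    have := hs.norm_image_sub_le_of_norm_hasDerivWithin_le (f := fun r => k r z - r • kt t z)
      (f' := fun r => kt r z - (1:ℝ) • kt t z) (C := ε / (c2 - c1 + 1))
      (fun r hr => (((hd r hr.1 z hz).mono inter_subset_left)).sub ((hasDerivAt_id r).smul_const _).hasDerivWithinAt)
      (fun r hr => by
        have := hu (r, z) ⟨hr.1, hz⟩ (t, z) ⟨ht, hz⟩ (by
          rw [Prod.dist_eq]; simp; exact hr.2)
        rw [Real.dist_eq] at this
        simpa using this.le) ⟨ht, Metric.mem_ball_self hδ⟩ ht'
    have e : k t' z - k t z - (t' - t) • kt t z = (k t' z - t' • kt t z) - (k t z - t • kt t z) := by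
      simp only [smul_eq_mul]; ring
    rw [e]; exact this
  calc ‖∫ z in Icc c1 c2, (k t' z - k t z - (t' - t) • kt t z)‖
      ≤ ε / (c2 - c1 + 1) * ‖t' - t‖ * (volume.real (Icc c1 c2)) :=
        norm_setIntegral_le_of_norm_le_const (by simp) (fun z hz => hpt z hz)
    _ = ε / (c2 - c1 + 1) * (c2 - c1) * ‖t' - t‖ := by
        rw [Real.volume_real_Icc_of_le hc]; ring
    _ ≤ ε * ‖t' - t‖ := by
        gcongr
        have := sub_nonneg.2 hc
        rw [div_mul_eq_mul_div, div_le_iff₀ (by positivity)]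
        nlinarith

lemma cb12_bdd {u ut ux uxx : ℝ → ℝ → ℝ} (hO : IsCompact (closure O))
    (h0 : ContinuousOn (fun p : ℝ × ℝ => u p.1 p.2) (Icc 0 T ×ˢ closure O))
    (ht : ContinuousOn (fun p : ℝ × ℝ => ut p.1 p.2) (Icc 0 T ×ˢ closure O))
    (hx : ContinuousOn (fun p : ℝ × ℝ => ux p.1 p.2) (Icc 0 T ×ˢ closure O))
    (hxx : ContinuousOn (fun p : ℝ × ℝ => uxx p.1 p.2) (Icc 0 T ×ˢ closure O)) :
    ∃ C : ℝ, ∀ t ∈ Set.Icc (0:ℝ) T, ∀ x ∈ closure O,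
    |u t x| ≤ C ∧ |ut t x| ≤ C ∧ |ux t x| ≤ C ∧ |uxx t x| ≤ C := by
  have hK : IsCompact (Icc 0 T ×ˢ closure O) := isCompact_Icc.prod hO
  obtain ⟨C0, h0⟩ := hK.exists_bound_of_continuousOn h0
  obtain ⟨C1, h1⟩ := hK.exists_bound_of_continuousOn ht
  obtain ⟨C2, h2⟩ := hK.exists_bound_of_continuousOn hx
  obtain ⟨C3, h3⟩ := hK.exists_bound_of_continuousOn hxx
  refine ⟨max (max C0 C1) (max C2 C3), fun t ht x hx => ⟨?_, ?_, ?_, ?_⟩⟩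
  · exact (h0 (t, x) ⟨ht, hx⟩).trans ((le_max_left _ _).trans (le_max_left _ _))
  · exact (h1 (t, x) ⟨ht, hx⟩).trans ((le_max_right _ _).trans (le_max_left _ _))
  · exact (h2 (t, x) ⟨ht, hx⟩).trans ((le_max_left _ _).trans (le_max_right _ _))
  · exact (h3 (t, x) ⟨ht, hx⟩).trans ((le_max_right _ _).trans (le_max_right _ _))

lemma cb12_log {u ut ux uxx : ℝ → ℝ → ℝ} (hO : IsCompact (closure O)) (hu : IsCb12 T O u ut ux uxx)
    (h0 : ∀ t x, 0 < u t x) {κ : ℝ} (hκ : 0 < κ) :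
    IsCb12 T O (fun t x => -Real.log (u t x) / κ) (fun t x => -ut t x / (κ * u t x)) (fun t x => -ux t x / (κ * u t x))
      (fun t x => -uxx t x / (κ * u t x) + ux t x ^ 2 / (κ * u t x ^ 2)) := by
  have hn : ∀ t x, κ * u t x ≠ 0 := fun t x => (mul_pos hκ (h0 t x)).ne'
  have hn2 : ∀ t x, κ * u t x ^ 2 ≠ 0 := fun t x => (mul_pos hκ (pow_pos (h0 t x) 2)).ne'
  have k0 : ContinuousOn (fun p : ℝ × ℝ => -Real.log (u p.1 p.2) / κ) (Icc 0 T ×ˢ closure O) :=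
    ((hu.cont.log fun p _ => (h0 _ _).ne').neg).div_const _
  have kt : ContinuousOn (fun p : ℝ × ℝ => -ut p.1 p.2 / (κ * u p.1 p.2)) (Icc 0 T ×ˢ closure O) :=
    hu.cont_t.neg.div (continuousOn_const.mul hu.cont) fun p _ => hn _ _
  have kx : ContinuousOn (fun p : ℝ × ℝ => -ux p.1 p.2 / (κ * u p.1 p.2)) (Icc 0 T ×ˢ closure O) :=
    hu.cont_x.neg.div (continuousOn_const.mul hu.cont) fun p _ => hn _ _
  have kxx : ContinuousOn (fun p : ℝ × ℝ => -uxx p.1 p.2 / (κ * u p.1 p.2) + ux p.1 p.2 ^ 2 / (κ * u p.1 p.2 ^ 2)) (Icc 0 T ×ˢ closure O) :=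
    (hu.cont_xx.neg.div (continuousOn_const.mul hu.cont) fun p _ => hn _ _).add
      ((hu.cont_x.pow 2).div (continuousOn_const.mul (hu.cont.pow 2)) fun p _ => hn2 _ _)
  refine ⟨k0, kt, kx, kxx, fun t ht x hx => ?_, fun t ht x hx => ?_, fun t ht x hx => ?_, cb12_bdd hO k0 kt kx kxx⟩
  · refine ((((hu.deriv_t t ht x hx).log (h0 t x).ne').neg).div_const κ).congr_deriv ?_
    have := h0 t x
    field_simp
  · refine ((((hu.deriv_x t ht x hx).log (h0 t x).ne').neg).div_const κ).congr_deriv ?_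
    have := h0 t x
    field_simp
  · refine (((hu.deriv_xx t ht x hx).neg).div ((hu.deriv_x t ht x hx).const_mul κ) (hn t x)).congr_deriv ?_
    have := h0 t x
    simp only [Pi.neg_apply]
    field_simp
    ring

lemma cb12_exp {u ut ux uxx : ℝ → ℝ → ℝ} (hO : IsCompact (closure O)) (hu : IsCb12 T O u ut ux uxx) (κ : ℝ) :
    IsCb12 T O (fun t x => Real.exp (-κ * u t x)) (fun t x => Real.exp (-κ * u t x) * (-κ * ut t x))
      (fun t x => Real.exp (-κ * u t x) * (-κ * ux t x))
      (fun t x => Real.exp (-κ * u t x) * ((-κ * ux t x) ^ 2 - κ * uxx t x)) := by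
  have k0 : ContinuousOn (fun p : ℝ × ℝ => Real.exp (-κ * u p.1 p.2)) (Icc 0 T ×ˢ closure O) :=
    (continuousOn_const.mul hu.cont).rexp
  have kt := k0.mul ((continuousOn_const (c := -κ)).mul hu.cont_t)
  have kx := k0.mul ((continuousOn_const (c := -κ)).mul hu.cont_x)
  have kxx := k0.mul ((((continuousOn_const (c := -κ)).mul hu.cont_x).pow 2).sub ((continuousOn_const (c := κ)).mul hu.cont_xx))
  refine ⟨k0, kt, kx, kxx, fun t ht x hx => ?_, fun t ht x hx => ?_, fun t ht x hx => ?_, cb12_bdd hO k0 kt kx kxx⟩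
  · exact ((hu.deriv_t t ht x hx).const_mul (-κ)).exp
  · exact ((hu.deriv_x t ht x hx).const_mul (-κ)).exp
  · refine ((((hu.deriv_x t ht x hx).const_mul (-κ)).exp).mul ((hu.deriv_xx t ht x hx).const_mul (-κ))).congr_deriv ?_
    ring

end
end LPN
end

noncomputable section

namespace LPN

section

variable {T c1 c2 κ : ℝ} {O : Set ℝ} {u ut ux uxx : ℝ → ℝ → ℝ} {a a' : ℝ → ℝ}

def ee (κ : ℝ) (u : ℝ → ℝ → ℝ) (a : ℝ → ℝ) (t x z : ℝ) : ℝ := Real.exp (-κ * (u t z + a t * (x - z) ^ 2))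

lemma soft_cb (hc : c1 < c2) (hcl : closure O = Icc c1 c2) (hu : IsCb12 T O u ut ux uxx)
    (ha : ∀ t, HasDerivAt a (a' t) t) (ha' : Continuous a') :
    IsCb12 T O (fun t x => ∫ z in Icc c1 c2, ee κ u a t x z)
      (fun t x => ∫ z in Icc c1 c2, ee κ u a t x z * (-κ * (ut t z + a' t * (x - z) ^ 2)))
      (fun t x => ∫ z in Icc c1 c2, ee κ u a t x z * (-κ * (2 * a t * (x - z))))
      (fun t x => ∫ z in Icc c1 c2, ee κ u a t x z * ((-κ * (2 * a t * (x - z))) ^ 2 - κ * (2 * a t))) := by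
  have hac : Continuous a := continuous_iff_continuousAt.2 fun t => (ha t).continuousAt
  have hcK : IsCompact (closure O) := hcl ▸ isCompact_Icc
  have hSK : IsCompact (Icc 0 T ×ˢ closure O) := isCompact_Icc.prod hcK
  have cu : ContinuousOn (fun p : (ℝ × ℝ) × ℝ => u p.1.1 p.2) ((Icc 0 T ×ˢ closure O) ×ˢ Icc c1 c2) := by
    have : ContinuousOn ((fun p : ℝ × ℝ => u p.1 p.2) ∘ fun p : (ℝ × ℝ) × ℝ => (p.1.1, p.2)) ((Icc 0 T ×ˢ closure O) ×ˢ Icc c1 c2) :=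
      hu.cont.comp (by fun_prop) (fun p hp => ⟨hp.1.1, hcl ▸ hp.2⟩)
    exact this
  have cut' : ContinuousOn (fun p : (ℝ × ℝ) × ℝ => ut p.1.1 p.2) ((Icc 0 T ×ˢ closure O) ×ˢ Icc c1 c2) := by
    have : ContinuousOn ((fun p : ℝ × ℝ => ut p.1 p.2) ∘ fun p : (ℝ × ℝ) × ℝ => (p.1.1, p.2)) ((Icc 0 T ×ˢ closure O) ×ˢ Icc c1 c2) :=
      hu.cont_t.comp (by fun_prop) (fun p hp => ⟨hp.1.1, hcl ▸ hp.2⟩)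
    exact this
  have k0 : ContinuousOn (fun p : (ℝ × ℝ) × ℝ => ee κ u a p.1.1 p.1.2 p.2) ((Icc 0 T ×ˢ closure O) ×ˢ Icc c1 c2) := by
    have q0 : Continuous (fun p : (ℝ × ℝ) × ℝ => a p.1.1 * (p.1.2 - p.2) ^ 2) := by fun_prop
    exact (continuousOn_const.mul (cu.add q0.continuousOn)).rexp
  have kt : ContinuousOn (fun p : (ℝ × ℝ) × ℝ => ee κ u a p.1.1 p.1.2 p.2 * (-κ * (ut p.1.1 p.2 + a' p.1.1 * (p.1.2 - p.2) ^ 2)))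
      ((Icc 0 T ×ˢ closure O) ×ˢ Icc c1 c2) := by
    have q0 : Continuous (fun p : (ℝ × ℝ) × ℝ => a' p.1.1 * (p.1.2 - p.2) ^ 2) := by fun_prop
    exact k0.mul (continuousOn_const.mul (cut'.add q0.continuousOn))
  have kx : ContinuousOn (fun p : (ℝ × ℝ) × ℝ => ee κ u a p.1.1 p.1.2 p.2 * (-κ * (2 * a p.1.1 * (p.1.2 - p.2))))
      ((Icc 0 T ×ˢ closure O) ×ˢ Icc c1 c2) := by fun_prop
  have kxx : ContinuousOn (fun p : (ℝ × ℝ) × ℝ => ee κ u a p.1.1 p.1.2 p.2 * ((-κ * (2 * a p.1.1 * (p.1.2 - p.2))) ^ 2 - κ * (2 * a p.1.1)))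
      ((Icc 0 T ×ˢ closure O) ×ˢ Icc c1 c2) := by fun_prop
  have slice : ∀ {k : ℝ → ℝ → ℝ → ℝ}, ContinuousOn (fun p : (ℝ × ℝ) × ℝ => k p.1.1 p.1.2 p.2) ((Icc 0 T ×ˢ closure O) ×ˢ Icc c1 c2) →
      ∀ t ∈ Icc 0 T, ∀ x ∈ closure O, ContinuousOn (k t x) (Icc c1 c2) := by
    intro k hk t ht x hx
    have : ContinuousOn ((fun p : (ℝ × ℝ) × ℝ => k p.1.1 p.1.2 p.2) ∘ fun z => ((t, x), z)) (Icc c1 c2) :=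
      hk.comp (by fun_prop) (fun z hz => ⟨⟨ht, hx⟩, hz⟩)
    exact this
  have slt : ∀ {k : ℝ → ℝ → ℝ → ℝ}, ContinuousOn (fun p : (ℝ × ℝ) × ℝ => k p.1.1 p.1.2 p.2) ((Icc 0 T ×ˢ closure O) ×ˢ Icc c1 c2) →
      ∀ x ∈ closure O, ContinuousOn (fun p : ℝ × ℝ => k p.1 x p.2) (Icc 0 T ×ˢ Icc c1 c2) := by
    intro k hk x hx
    have : ContinuousOn ((fun p : (ℝ × ℝ) × ℝ => k p.1.1 p.1.2 p.2) ∘ fun p : ℝ × ℝ => ((p.1, x), p.2)) (Icc 0 T ×ˢ Icc c1 c2) :=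
      hk.comp (by fun_prop) (fun p hp => ⟨⟨hp.1, hx⟩, hp.2⟩)
    exact this
  have slx : ∀ {k : ℝ → ℝ → ℝ → ℝ}, ContinuousOn (fun p : (ℝ × ℝ) × ℝ => k p.1.1 p.1.2 p.2) ((Icc 0 T ×ˢ closure O) ×ˢ Icc c1 c2) →
      ∀ t ∈ Icc 0 T, ContinuousOn (fun p : ℝ × ℝ => k t p.1 p.2) (closure O ×ˢ Icc c1 c2) := by
    intro k hk t ht
    have : ContinuousOn ((fun p : (ℝ × ℝ) × ℝ => k p.1.1 p.1.2 p.2) ∘ fun p : ℝ × ℝ => ((t, p.1), p.2)) (closure O ×ˢ Icc c1 c2) :=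
      hk.comp (by fun_prop) (fun p hp => ⟨⟨ht, hp.1⟩, hp.2⟩)
    exact this
  have hconv : Convex ℝ (closure O) := hcl ▸ convex_Icc _ _
  have dx : ∀ t x z, HasDerivAt (fun x => ee κ u a t x z) (ee κ u a t x z * (-κ * (2 * a t * (x - z)))) x := by
    intro t x z
    have h1 : HasDerivAt (fun x => -κ * (u t z + a t * (x - z) ^ 2)) (-κ * (2 * a t * (x - z))) x := by
      have := (((((hasDerivAt_id x).sub_const z).pow 2).const_mul (a t)).const_add (u t z)).const_mul (-κ)
      refine this.congr_deriv ?_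
      simp only [id]; push_cast; ring
    exact h1.exp
  have m0 := param_cont hSK (k := fun t x z => ee κ u a t x z) k0
  have mt := param_cont hSK (k := fun t x z => ee κ u a t x z * (-κ * (ut t z + a' t * (x - z) ^ 2))) kt
  have mx := param_cont hSK (k := fun t x z => ee κ u a t x z * (-κ * (2 * a t * (x - z)))) kx
  have mxx := param_cont hSK (k := fun t x z => ee κ u a t x z * ((-κ * (2 * a t * (x - z))) ^ 2 - κ * (2 * a t))) kxx
  refine ⟨m0, mt, mx, mxx, fun t ht x hx => ?_, fun t ht x hx => ?_, fun t ht x hx => ?_, cb12_bdd hcK m0 mt mx mxx⟩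
  · refine param_deriv (k := fun t z => ee κ u a t x z) (kt := fun t z => ee κ u a t x z * (-κ * (ut t z + a' t * (x - z) ^ 2)))
      isCompact_Icc (convex_Icc _ _) hc.le (fun t ht => slice (k := fun t x z => ee κ u a t x z) k0 t ht x hx)
      (slt (k := fun t x z => ee κ u a t x z * (-κ * (ut t z + a' t * (x - z) ^ 2))) kt x hx) (fun t ht z hz => ?_) ht
    exact (((hu.deriv_t t ht z (hcl ▸ hz)).add ((ha t).hasDerivWithinAt.mul_const _)).const_mul (-κ)).exp
  · exact param_deriv (k := fun x z => ee κ u a t x z) (kt := fun x z => ee κ u a t x z * (-κ * (2 * a t * (x - z))))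
      hcK hconv hc.le (fun x hx => slice (k := fun t x z => ee κ u a t x z) k0 t ht x hx)
      (slx (k := fun t x z => ee κ u a t x z * (-κ * (2 * a t * (x - z)))) kx t ht) (fun x hx z hz => (dx t x z).hasDerivWithinAt) hx
  · refine param_deriv (k := fun x z => ee κ u a t x z * (-κ * (2 * a t * (x - z))))
      (kt := fun x z => ee κ u a t x z * ((-κ * (2 * a t * (x - z))) ^ 2 - κ * (2 * a t)))
      hcK hconv hc.le (fun x hx => slice (k := fun t x z => ee κ u a t x z * (-κ * (2 * a t * (x - z)))) kx t ht x hx)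
      (slx (k := fun t x z => ee κ u a t x z * ((-κ * (2 * a t * (x - z))) ^ 2 - κ * (2 * a t))) kxx t ht) (fun x hx z hz => ?_) hx
    have h2 : HasDerivAt (fun x => -κ * (2 * a t * (x - z))) (-κ * (2 * a t)) x :=
      ((((hasDerivAt_id x).sub_const z).const_mul (2 * a t)).const_mul (-κ)).congr_deriv (by simp)
    refine ((dx t x z).mul h2).hasDerivWithinAt.congr_deriv ?_
    ring

end
end LPN
end

noncomputable section

namespace LPN

section

variable {T c1 c2 κ : ℝ} {O : Set ℝ} {u ut ux uxx : ℝ → ℝ → ℝ} {a a' : ℝ → ℝ}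

lemma young {α L r : ℝ} (hα : 0 < α) : L * r ≤ α * r ^ 2 + L ^ 2 / (4 * α) := by
  have h : α * r ^ 2 + L ^ 2 / (4 * α) - L * r = α * (r - L / (2 * α)) ^ 2 := by
    field_simp; ring
  have : 0 ≤ α * (r - L / (2 * α)) ^ 2 := by positivity
  linarith

lemma D_bd {α K η LF Fx Fz ψ β bx bz s sx sz r : ℝ} (hα : 0 < α) (hK : 0 ≤ K) (hη : 0 ≤ η)
    (hF : Fx - Fz ≤ LF * |r|) (h1 : |β - bx| ≤ η) (h2 : |bx - bz| ≤ K * |r|) (h3 : |s - sx| ≤ η)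
    (h4 : |sx - sz| ≤ K * |r|) :
    Fx - (ψ + 3 * α * η ^ 2 + LF ^ 2 / (4 * α)) ≤
      Fz - ψ - (-(2 + 2 * K + 2 * K ^ 2) * α) * r ^ 2 - 2 * α * r * (β - bz) - α * (s - sz) ^ 2 := by
  have y1 := young (L := LF) (r := |r|) hα
  have hr := abs_nonneg r
  have hr2 : |r| ^ 2 = r ^ 2 := sq_abs r
  have b1 : |β - bz| ≤ η + K * |r| := (abs_sub_le β bx bz).trans (add_le_add h1 h2)
  have b2 : |s - sz| ≤ η + K * |r| := (abs_sub_le s sx sz).trans (add_le_add h3 h4)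
  have c1 : r * (β - bz) ≤ |r| * (η + K * |r|) := by
    refine (le_abs_self _).trans ?_
    rw [abs_mul]
    gcongr
  have c2 : (s - sz) ^ 2 ≤ (η + K * |r|) ^ 2 := by
    rw [← sq_abs]; gcongr
  have d1 : α * (2 * (r * (β - bz))) ≤ α * (η ^ 2 + r ^ 2 + 2 * K * r ^ 2) := by
    apply mul_le_mul_of_nonneg_left _ hα.le
    have := sq_nonneg (η - |r|)
    have e : (η - |r|) ^ 2 = η ^ 2 - 2 * (|r| * η) + |r| ^ 2 := by ring
    have e2 : |r| * (η + K * |r|) = |r| * η + K * |r| ^ 2 := by ring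
    rw [hr2] at e e2
    linarith
  have d2 : α * (s - sz) ^ 2 ≤ α * (2 * η ^ 2 + 2 * K ^ 2 * r ^ 2) := by
    apply mul_le_mul_of_nonneg_left _ hα.le
    refine c2.trans ?_
    have := sq_nonneg (η - K * |r|)
    have e : (η + K * |r|) ^ 2 = 2 * η ^ 2 + 2 * K ^ 2 * |r| ^ 2 - (η - K * |r|) ^ 2 := by ring
    rw [hr2] at e
    linarith
  rw [hr2] at y1
  linarith

lemma pt {w wt wx wxx : ℝ → ℝ → ℝ} {t x K C W α0 β s η LF Fx ψ M q0 qt qx qxx : ℝ} {Ff bt st : ℝ → ℝ}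
    (hc : c1 < c2) (hcl : closure O = Icc c1 c2) (hw : IsCb12 T O w wt wx wxx)
    (hW : ∀ t ∈ Icc 0 T, ∀ x ∈ closure O, |wx t x| ≤ W) (hκ : 1 ≤ κ) (hK : 0 ≤ K) (hC : 0 ≤ C)
    (ht : t ∈ Icc 0 T) (hx : x ∈ Icc c1 c2) (hα0 : 0 < α0) (ha : α0 ≤ a t)
    (ha' : a' t = -(2 + 2 * K + 2 * K ^ 2) * a t)
    (hbt : ∀ x y, |bt x - bt y| ≤ K * |x - y|) (hst : ∀ x y, |st x - st y| ≤ K * |x - y|)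
    (hbC : ∀ z ∈ Icc c1 c2, |bt z| ≤ C) (hsC : ∀ z ∈ Icc c1 c2, |st z| ≤ C) (hs : |s| ≤ C)
    (hfeas : ∀ z ∈ Icc c1 c2, Ff z + (wt t z + (bt z * wx t z + st z ^ 2 / 2 * wxx t z)) ≤ ψ)
    (hψ : 0 ≤ ψ) (hη : 0 ≤ η) (hβη : |β - bt x| ≤ η) (hsη : |s - st x| ≤ η)
    (hF : ∀ z ∈ Icc c1 c2, Fx - Ff z ≤ LF * |x - z|)
    (hq : qt + β * qx + s ^ 2 / 2 * qxx + Fx ≤ 0) (hqx : |qx| ≤ M) (hM : 2 * a t * (c2 - c1) ≤ M)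
    (hb1 : q0 + 1 / α0 ≤ w t c1 + a t * (x - c1) ^ 2) (hb2 : q0 + 1 / α0 ≤ w t c2 + a t * (x - c2) ^ 2)
    {I0 It Ix Ixx P2 : ℝ} (hI0 : I0 = ∫ z in Icc c1 c2, ee κ w a t x z)
    (hIt : It = ∫ z in Icc c1 c2, ee κ w a t x z * (-κ * (wt t z + a' t * (x - z) ^ 2)))
    (hIx : Ix = ∫ z in Icc c1 c2, ee κ w a t x z * (-κ * (2 * a t * (x - z))))
    (hIxx : Ixx = ∫ z in Icc c1 c2, ee κ w a t x z * ((-κ * (2 * a t * (x - z))) ^ 2 - κ * (2 * a t)))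
    (hP2 : P2 = Real.exp (-κ * q0)) :
    0 < I0 ∧ Fx + (-(It + P2 * (-κ * qt)) / (κ * (I0 + P2)) + (β * (-(Ix + P2 * (-κ * qx)) / (κ * (I0 + P2))) +
      s ^ 2 / 2 * (-(Ixx + P2 * ((-κ * qx) ^ 2 - κ * qxx)) / (κ * (I0 + P2)) +
        (Ix + P2 * (-κ * qx)) ^ 2 / (κ * (I0 + P2) ^ 2))))
      ≤ (ψ + 3 * a t * η ^ 2 + LF ^ 2 / (4 * a t)) + (K ^ 2 / 2 + K) / κ +
        2 * ((C + C ^ 2 / 2 * (W + M) + C ^ 2 * M) + C * M * C) * Real.exp (-κ * (1 / α0)) := by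
  have hα : 0 < a t := hα0.trans_le ha
  have hκ0 : 0 < κ := by linarith
  have hR : ∀ z ∈ Icc c1 c2, |x - z| ≤ c2 - c1 := by
    intro z hz
    rw [abs_le]; constructor <;> linarith [hz.1, hz.2, hx.1, hx.2]
  have hsl : ∀ {k : ℝ → ℝ → ℝ}, ContinuousOn (fun p : ℝ × ℝ => k p.1 p.2) (Icc 0 T ×ˢ closure O) → ContinuousOn (k t) (Icc c1 c2) := by
    intro k hk
    have : ContinuousOn ((fun p : ℝ × ℝ => k p.1 p.2) ∘ fun z => (t, z)) (Icc c1 c2) :=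
      hk.comp (by fun_prop) (fun z hz => ⟨ht, hcl ▸ hz⟩)
    exact this
  have hW0 : 0 ≤ W := (abs_nonneg _).trans (hW t ht c1 (hcl ▸ left_mem_Icc.2 hc.le))
  obtain ⟨Q, S, b2, h1, h2, h3, h4, h5, h6⟩ := core (x := x) (Fx := Fx) (s := s) (β := β) (w := w t) (w1 := wx t) (w2 := wxx t) (wt := wt t) (α := a t)
    (α' := a' t) (E := ψ + 3 * a t * η ^ 2 + LF ^ 2 / (4 * a t)) (Ff := Ff) (bt := bt) (st := st) (e := ee κ w a t x)
    (R := c2 - c1) hc hκ hα hK hC (fun z hz => by rw [← hcl]; exact hw.deriv_x t ht z (hcl ▸ hz))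
    (fun z hz => by rw [← hcl]; exact hw.deriv_xx t ht z (hcl ▸ hz))
    (hsl hw.cont_xx) (hsl hw.cont_t) (fun z hz => hW t ht z (hcl ▸ hz)) hR hbt hst hbC hsC hs hfeas
    (fun z hz => by rw [ha']; exact D_bd hα hK hη (hF z hz) hβη (hbt _ _) hsη (hst _ _)) (fun z => rfl)
  rw [← hI0] at h1 h5 h6
  rw [← hIx] at h3 h6
  rw [← hIt, ← hIxx] at h6
  have hP20 : 0 < P2 := by rw [hP2]; exact Real.exp_pos _
  have hee : ∀ z, q0 + 1 / α0 ≤ w t z + a t * (x - z) ^ 2 → ee κ w a t x z ≤ P2 * Real.exp (-κ * (1 / α0)) := by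
    intro z hz
    rw [hP2, ← Real.exp_add]
    apply Real.exp_le_exp.2
    have := mul_le_mul_of_nonneg_left hz hκ0.le
    linarith
  have he0 : ∀ z, 0 < ee κ w a t x z := fun z => Real.exp_pos _
  have hG0 : 0 ≤ ee κ w a t x c1 + ee κ w a t x c2 := (add_pos (he0 _) (he0 _)).le
  have hM0 : 0 ≤ M := (abs_nonneg _).trans hqx
  refine ⟨h5, core2 (Q := Q) (S := S) (b2 := b2) (G := ee κ w a t x c1 + ee κ w a t x c2) hκ ?_ hC ?_ (Real.exp_pos _).le h5 hP20 h1 h2 h3 h4 (by positivity) ?_ hq ?_ ?_ hqx hs⟩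
  · positivity
  · positivity
  · refine le_trans ?_ h6
    have : κ * (C + C ^ 2 / 2 * (W + 2 * a t * (c2 - c1)) + C ^ 2 * (2 * a t * (c2 - c1))) * (ee κ w a t x c1 + ee κ w a t x c2)
      ≤ κ * (C + C ^ 2 / 2 * (W + M) + C ^ 2 * M) * (ee κ w a t x c1 + ee κ w a t x c2) := by gcongr
    linarith
  · have := hee c1 hb1
    have := hee c2 hb2
    linarith
  · have hce : ContinuousOn (ee κ w a t x) (Icc c1 c2) := by
      have q0 : Continuous (fun z : ℝ => a t * (x - z) ^ 2) := by fun_prop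
      exact (continuousOn_const.mul ((hsl hw.cont).add q0.continuousOn)).rexp
    rw [hIx, hI0, ← integral_const_mul, ← Real.norm_eq_abs]
    apply norm_integral_le_of_norm_le ((Bi.cont hce).int.const_mul _)
    filter_upwards [ae_restrict_mem measurableSet_Icc] with z hz
    rw [Real.norm_eq_abs, abs_mul, abs_mul, abs_mul, abs_neg, abs_of_pos (he0 z), abs_of_pos hκ0, abs_of_pos (by positivity : 0 < 2 * a t), mul_comm]
    apply mul_le_mul_of_nonneg_right _ (he0 z).le
    apply mul_le_mul_of_nonneg_left _ hκ0.le
    exact (mul_le_mul_of_nonneg_left (hR z hz) (by positivity)).trans hM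

end
end LPN
end

noncomputable section

namespace LPN

section

variable {T c1 c2 κ : ℝ} {O A : Set ℝ} {a a' : ℝ → ℝ}

lemma soft_lower {w : ℝ → ℝ → ℝ} {t x g q0 : ℝ} (hc : c1 < c2) (hκ : 0 < κ) (hw : ContinuousOn (w t) (Icc c1 c2))
    (h : ∀ z ∈ Icc c1 c2, g ≤ w t z + a t * (x - z) ^ 2) (hq : g ≤ q0) :
    g - Real.log (c2 - c1 + 1) / κ ≤ -Real.log ((∫ z in Icc c1 c2, ee κ w a t x z) + Real.exp (-κ * q0)) / κ := by
  have he0 : ∀ z, 0 < ee κ w a t x z := fun z => Real.exp_pos _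
  have hI0 : 0 ≤ ∫ z in Icc c1 c2, ee κ w a t x z := setIntegral_nonneg measurableSet_Icc fun z _ => (he0 z).le
  have hI : ∫ z in Icc c1 c2, ee κ w a t x z ≤ (c2 - c1) * Real.exp (-κ * g) := by
    have hce : ContinuousOn (ee κ w a t x) (Icc c1 c2) := by
      have q0 : Continuous (fun z : ℝ => a t * (x - z) ^ 2) := by fun_prop
      exact (continuousOn_const.mul (hw.add q0.continuousOn)).rexp
    have h2 : ∫ z in Icc c1 c2, ee κ w a t x z ≤ ∫ z in Icc c1 c2, Real.exp (-κ * g) := by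
      apply setIntegral_mono_on (Bi.cont hce).int (Bi.cont continuousOn_const).int measurableSet_Icc
      intro z hz
      apply Real.exp_le_exp.2
      have := mul_le_mul_of_nonneg_left (h z hz) hκ.le
      linarith
    refine h2.trans_eq ?_
    rw [setIntegral_const, Real.volume_real_Icc_of_le hc.le, smul_eq_mul]
  have hP : (∫ z in Icc c1 c2, ee κ w a t x z) + Real.exp (-κ * q0) ≤ (c2 - c1 + 1) * Real.exp (-κ * g) := by
    have : Real.exp (-κ * q0) ≤ Real.exp (-κ * g) := by
      apply Real.exp_le_exp.2
      have := mul_le_mul_of_nonneg_left hq hκ.le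
      linarith
    linarith
  have hl := Real.log_le_log (by have := Real.exp_pos (-κ * q0); linarith) hP
  rw [Real.log_mul (by linarith) (Real.exp_pos _).ne', Real.log_exp] at hl
  rw [le_div_iff₀ hκ, sub_mul, div_mul_cancel₀ _ hκ.ne']
  linarith

lemma soft_upper {w wt wx wxx : ℝ → ℝ → ℝ} {t x q0 W A0 θ : ℝ} (hc : c1 < c2) (hcl : closure O = Icc c1 c2) (hκ : 0 < κ)
    (hw : IsCb12 T O w wt wx wxx) (hW : ∀ t ∈ Icc 0 T, ∀ x ∈ closure O, |wx t x| ≤ W) (ht : t ∈ Icc 0 T) (hx : x ∈ Icc c1 c2)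
    (hA0 : a t ≤ A0) (ha : 0 ≤ a t) (hθ : 0 < θ) (hθ1 : θ ≤ 1) :
    -Real.log ((∫ z in Icc c1 c2, ee κ w a t x z) + Real.exp (-κ * q0)) / κ ≤
      w t x + W * (θ * (c2 - c1)) + A0 * (θ * (c2 - c1)) ^ 2 - Real.log (θ * (c2 - c1)) / κ := by
  have he0 : ∀ z, 0 < ee κ w a t x z := fun z => Real.exp_pos _
  have hwc : ContinuousOn (w t) (Icc c1 c2) := by
    have : ContinuousOn ((fun p : ℝ × ℝ => w p.1 p.2) ∘ fun z => (t, z)) (Icc c1 c2) :=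
      hw.cont.comp (by fun_prop) (fun z hz => ⟨ht, hcl ▸ hz⟩)
    exact this
  have hce : ContinuousOn (ee κ w a t x) (Icc c1 c2) := by
    have q0 : Continuous (fun z : ℝ => a t * (x - z) ^ 2) := by fun_prop
    exact (continuousOn_const.mul (hwc.add q0.continuousOn)).rexp
  set δ := θ * (c2 - c1) with hδ
  have hδ0 : 0 < δ := mul_pos hθ (by linarith)
  set B := w t x + W * δ + A0 * δ ^ 2 with hB
  set J := Icc (x - θ * (x - c1)) (x + θ * (c2 - x)) with hJ
  have p1 : 0 ≤ θ * (x - c1) := mul_nonneg hθ.le (by linarith [hx.1])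
  have p2 : 0 ≤ θ * (c2 - x) := mul_nonneg hθ.le (by linarith [hx.2])
  have p3 : θ * (x - c1) ≤ x - c1 := mul_le_of_le_one_left (by linarith [hx.1]) hθ1
  have p4 : θ * (c2 - x) ≤ c2 - x := mul_le_of_le_one_left (by linarith [hx.2]) hθ1
  have hJs : J ⊆ Icc c1 c2 := Icc_subset_Icc (by linarith) (by linarith)
  have hWL : ∀ z ∈ Icc c1 c2, w t z - w t x ≤ W * |x - z| := by
    intro z hz
    have := (convex_Icc c1 c2).norm_image_sub_le_of_norm_hasDerivWithin_le (f := w t) (f' := wx t) (C := W)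
      (fun r hr => by rw [← hcl]; exact hw.deriv_x t ht r (hcl ▸ hr)) (fun r hr => hW t ht r (hcl ▸ hr)) hx hz
    rw [Real.norm_eq_abs, Real.norm_eq_abs, abs_sub_comm z x] at this
    exact (le_abs_self _).trans this
  have hW0 : 0 ≤ W := (abs_nonneg _).trans (hW t ht c1 (hcl ▸ left_mem_Icc.2 hc.le))
  have hI : δ * Real.exp (-κ * B) ≤ ∫ z in Icc c1 c2, ee κ w a t x z := by
    calc δ * Real.exp (-κ * B) = ∫ z in J, Real.exp (-κ * B) := by
          rw [setIntegral_const, Real.volume_real_Icc_of_le (by linarith), smul_eq_mul]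
          congr 1
          rw [hδ]; ring
      _ ≤ ∫ z in J, ee κ w a t x z := by
          apply setIntegral_mono_on (Bi.cont continuousOn_const).int (Bi.cont (hce.mono hJs)).int measurableSet_Icc
          intro z hz
          apply Real.exp_le_exp.2
          have hr : |x - z| ≤ δ := by
            have e : δ = θ * (x - c1) + θ * (c2 - x) := by rw [hδ]; ring
            rw [abs_le]; constructor <;> linarith [hz.1, hz.2]
          have h1 := (hWL z (hJs hz)).trans (mul_le_mul_of_nonneg_left hr hW0)
          have h2 : a t * (x - z) ^ 2 ≤ A0 * δ ^ 2 := by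
            apply mul_le_mul hA0 _ (sq_nonneg _) (ha.trans hA0)
            rw [← sq_abs]; gcongr
          have := mul_le_mul_of_nonneg_left (by linarith : w t z + a t * (x - z) ^ 2 ≤ B) hκ.le
          linarith
      _ ≤ _ := setIntegral_mono_set (Bi.cont hce).int (Eventually.of_forall fun z => (he0 z).le) (HasSubset.Subset.eventuallyLE hJs)
  have hP : δ * Real.exp (-κ * B) ≤ (∫ z in Icc c1 c2, ee κ w a t x z) + Real.exp (-κ * q0) := by
    have := Real.exp_pos (-κ * q0); linarith
  have hl := Real.log_le_log (mul_pos hδ0 (Real.exp_pos _)) hP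
  rw [Real.log_mul hδ0.ne' (Real.exp_pos _).ne', Real.log_exp] at hl
  rw [div_le_iff₀ hκ, sub_mul, div_mul_cancel₀ _ hκ.ne']
  linarith

lemma int_m0 {m0 : Measure ℝ} [IsProbabilityMeasure m0] (hm0 : m0 Oᶜ = 0) (hT : 0 ≤ T) {u ut ux uxx : ℝ → ℝ → ℝ}
    (hu : IsCb12 T O u ut ux uxx) : Integrable (fun x => u 0 x) m0 := by
  obtain ⟨C, hC⟩ := hu.bdd
  have hO : O.Nonempty := by
    by_contra h
    rw [not_nonempty_iff_eq_empty] at h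
    subst h
    simp at hm0
  obtain ⟨x0, hx0⟩ := hO
  have h0 : (0:ℝ) ∈ Icc 0 T := ⟨le_rfl, hT⟩
  obtain ⟨k, kc, kb, hk⟩ := ext_cont hu.cont ((abs_nonneg _).trans (hC 0 h0 x0 (subset_closure hx0)).1) (fun t ht x hx => (hC t ht x hx).1)
  have : Integrable (fun x => k (0, x)) m0 := Integrable.of_bound (by fun_prop) C (Eventually.of_forall fun x => kb _)
  refine this.congr ?_
  have hae : ∀ᵐ x ∂m0, x ∈ O := by
    rw [ae_iff]; exact hm0
  filter_upwards [hae] with x hx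
  exact hk 0 h0 x (subset_closure hx)

end
end LPN
end

noncomputable section

namespace LPN

section

variable {T c1 c2 : ℝ} {O A : Set ℝ} {m0 : Measure ℝ} {ι : Type} [Fintype ι] (M : Mod ι T O A)

/-- Barrier data. -/
structure Mod.Bar (c1 c2 : ℝ) (z : ℝ → ι → ℝ) (F : ℝ → ℝ × ℝ → ℝ) (G : ℝ → ℝ → ℝ) (L1 Cq : ℝ)
    (q qt qx qxx : ℝ → ℝ → ℝ) : Prop where
  cb : IsCb12 T O q qt qx qxx
  ge : ∀ t ∈ Icc 0 T, ∀ x ∈ closure O, G t x ≤ q t x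
  e1 : ∀ t ∈ Icc 0 T, q t c1 = G t c1
  e2 : ∀ t ∈ Icc 0 T, q t c2 = G t c2
  lip : ∀ t ∈ Icc 0 T, ∀ x ∈ closure O, ∀ y ∈ closure O, q t x - q t y ≤ L1 * |x - y|
  lipG : ∀ t ∈ Icc 0 T, ∀ x ∈ closure O, ∀ y ∈ closure O, G t x - G t y ≤ L1 * |x - y|
  sup : ∀ t ∈ Icc 0 T, ∀ p ∈ closure O ×ˢ A, F t p + M.L qt qx qxx t p (z t) ≤ 0
  bx : ∀ t ∈ Icc 0 T, ∀ x ∈ closure O, |qx t x| ≤ Cq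

lemma Mod.s_abs (t : ℝ) (p : ℝ × ℝ) (z : ι → ℝ) : |M.s t p z| ≤ M.Cb + 1 := by
  have h := (abs_le.1 (M.s_bd t p z)).2
  have h2 := sq_nonneg (|M.s t p z| - 1)
  have h3 : (|M.s t p z| - 1) ^ 2 = |M.s t p z| ^ 2 - 2 * |M.s t p z| + 1 := by ring
  rw [sq_abs] at h3
  linarith

lemma Mod.comp1 (hT : 0 < T) [IsProbabilityMeasure m0] (hm0 : m0 Oᶜ = 0) (hc : c1 < c2) (hcl : closure O = Icc c1 c2)
    {K : ℝ} (hK : 0 ≤ K) {z z' : ℝ → ι → ℝ} (hz : Measurable z)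
    (lb : ∀ t ∈ Icc 0 T, ∀ x y a, |M.b t (x, a) (z' t) - M.b t (y, a) (z' t)| ≤ K * |x - y|)
    (ls : ∀ t ∈ Icc 0 T, ∀ x y a, |M.s t (x, a) (z' t) - M.s t (y, a) (z' t)| ≤ K * |x - y|)
    {F : ℝ → ℝ × ℝ → ℝ} (hF : Car (closure O ×ˢ A) F) {LF : ℝ}
    (lF : ∀ t ∈ Icc 0 T, ∀ x ∈ closure O, ∀ y ∈ closure O, ∀ a ∈ A, F t (x, a) - F t (y, a) ≤ LF * |x - y|)
    {G Gt Gx Gxx : ℝ → ℝ → ℝ} (hG : IsCb12 T O G Gt Gx Gxx) {q qt qx qxx : ℝ → ℝ → ℝ} {L1 Cq : ℝ}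
    (hq : M.Bar c1 c2 z F G L1 Cq q qt qx qxx) {α0 : ℝ} (hα0 : 0 < α0)
    {u ut ux uxx : ℝ → ℝ → ℝ} {ψ : ℝ → ℝ} (hu : IsCb12 T O u ut ux uxx) (hψm : Measurable ψ) (hψb : ∃ C, ∀ t, |ψ t| ≤ C)
    (hψ0 : ∀ t, 0 ≤ ψ t) (hGu : ∀ t ∈ Icc 0 T, ∀ x ∈ closure O, G t x ≤ u t x)
    (hfeas : ∀ t, ∀ p ∈ closure O ×ˢ A, F t p + M.L ut ux uxx t p (z' t) ≤ ψ t)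
    {W : ℝ} (hW : ∀ t ∈ Icc 0 T, ∀ x ∈ closure O, |ux t x| ≤ W)
    {η : ℝ → ℝ} (hηm : Measurable η) {Cη : ℝ} (hηb : ∀ t, η t ≤ Cη) (hη0 : ∀ t, 0 ≤ η t)
    (hηbd : ∀ t ∈ Icc 0 T, ∀ p ∈ closure O ×ˢ A, |M.b t p (z t) - M.b t p (z' t)| ≤ η t)
    (hηsd : ∀ t ∈ Icc 0 T, ∀ p ∈ closure O ×ˢ A, |M.s t p (z t) - M.s t p (z' t)| ≤ η t)
    {y : Y} (hy : M.FP m0 z y) {A0 C Mx : ℝ} (hA0 : A0 = α0 * Real.exp ((2 + 2 * K + 2 * K ^ 2) * T)) (hC : C = M.Cb + 1)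
    (hMx : Mx = Cq + 2 * A0 * (c2 - c1)) {κ : ℝ} (hκ : 1 ≤ κ) :
    I2 T y.2 F + ∫ p, G p.1 p.2 ∂y.1 ≤ ∫ x, u 0 x ∂m0 + (∫ t in Icc 0 T, ψ t) + (L1 ^ 2 / 4 + 1) / α0 + T * (LF ^ 2 / (4 * α0)) +
      3 * A0 * (∫ t in Icc 0 T, η t ^ 2) +
      (T * ((K ^ 2 / 2 + K) / κ + 2 * ((C + C ^ 2 / 2 * (W + Mx) + C ^ 2 * Mx) + C * Mx * C) * Real.exp (-κ * (1 / α0)))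
        + Real.log (c2 - c1 + 1) / κ + (W * (1 / κ * (c2 - c1)) + A0 * (1 / κ * (c2 - c1)) ^ 2 - Real.log (1 / κ * (c2 - c1)) / κ)) := by
  have hκ0 : 0 < κ := by linarith
  set lam := 2 + 2 * K + 2 * K ^ 2 with hlam
  have hlam0 : 0 ≤ lam := by positivity
  have hC0 : 0 ≤ C := by have := M.Cb0; linarith
  set a : ℝ → ℝ := fun t => α0 * Real.exp (lam * (T - t)) with ha
  set a' : ℝ → ℝ := fun t => -lam * a t with ha'
  have had : ∀ t, HasDerivAt a (a' t) t := by
    intro t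
    have := (((hasDerivAt_id t).const_sub T).const_mul lam).exp.const_mul α0
    refine this.congr_deriv ?_
    simp only [ha', ha, id]; ring
  have hac : Continuous a' := by simp only [ha', ha]; fun_prop
  have hage : ∀ t ∈ Icc 0 T, α0 ≤ a t := by
    intro t ht
    have : 1 ≤ Real.exp (lam * (T - t)) := Real.one_le_exp (mul_nonneg hlam0 (by linarith [ht.2]))
    exact le_mul_of_one_le_right hα0.le this
  have hale : ∀ t ∈ Icc 0 T, a t ≤ A0 := by
    intro t ht
    rw [hA0]
    apply mul_le_mul_of_nonneg_left _ hα0.le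
    apply Real.exp_le_exp.2
    exact mul_le_mul_of_nonneg_left (by linarith [ht.1]) hlam0
  have hA00 : 0 < A0 := by rw [hA0]; positivity
  have h0T : (0:ℝ) ∈ Icc 0 T := ⟨le_rfl, hT.le⟩
  have hc1m : c1 ∈ closure O := hcl ▸ left_mem_Icc.2 hc.le
  have hc2m : c2 ∈ closure O := hcl ▸ right_mem_Icc.2 hc.le
  have hW0 : 0 ≤ W := (abs_nonneg _).trans (hW 0 h0T c1 hc1m)
  have hCq0 : 0 ≤ Cq := (abs_nonneg _).trans (hq.bx 0 h0T c1 hc1m)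
  have hMx0 : 0 ≤ Mx := by rw [hMx]; have : 0 < c2 - c1 := by linarith
                           positivity
  set β0 := (L1 ^ 2 / 4 + 1) / α0 with hβ0
  set w : ℝ → ℝ → ℝ := fun t x => u t x + β0 with hw
  have hwcb : IsCb12 T O w ut ux uxx := by
    have := cb12_comb hu (cb12_const T O β0) 1
    simpa only [one_mul, add_zero, mul_zero] using this
  have hcK : IsCompact (closure O) := hcl ▸ isCompact_Icc
  have hS := soft_cb (κ := κ) hc hcl hwcb had hac
  have hE := cb12_exp hcK hq.cb κ
  have hP := cb12_comb hS hE 1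
  simp only [one_mul] at hP
  have hP0 : ∀ t x, 0 < (∫ z in Icc c1 c2, ee κ w a t x z) + Real.exp (-κ * q t x) := fun t x =>
    add_pos_of_nonneg_of_pos (setIntegral_nonneg measurableSet_Icc fun z _ => (Real.exp_pos _).le) (Real.exp_pos _)
  obtain ⟨Ut, Ux, Uxx, hUt, hUx, hUxx, hU⟩ : ∃ Ut Ux Uxx : ℝ → ℝ → ℝ,
      (∀ t x, Ut t x = -((∫ z in Icc c1 c2, ee κ w a t x z * (-κ * (ut t z + a' t * (x - z) ^ 2))) +
            Real.exp (-κ * q t x) * (-κ * qt t x)) /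
        (κ * ((∫ z in Icc c1 c2, ee κ w a t x z) + Real.exp (-κ * q t x)))) ∧
      (∀ t x, Ux t x = -((∫ z in Icc c1 c2, ee κ w a t x z * (-κ * (2 * a t * (x - z)))) +
            Real.exp (-κ * q t x) * (-κ * qx t x)) /
        (κ * ((∫ z in Icc c1 c2, ee κ w a t x z) + Real.exp (-κ * q t x)))) ∧
      (∀ t x, Uxx t x = -((∫ z in Icc c1 c2, ee κ w a t x z * ((-κ * (2 * a t * (x - z))) ^ 2 - κ * (2 * a t))) +
            Real.exp (-κ * q t x) * ((-κ * qx t x) ^ 2 - κ * qxx t x)) /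
        (κ * ((∫ z in Icc c1 c2, ee κ w a t x z) + Real.exp (-κ * q t x))) +
        ((∫ z in Icc c1 c2, ee κ w a t x z * (-κ * (2 * a t * (x - z)))) + Real.exp (-κ * q t x) * (-κ * qx t x)) ^ 2 /
        (κ * ((∫ z in Icc c1 c2, ee κ w a t x z) + Real.exp (-κ * q t x)) ^ 2)) ∧
      IsCb12 T O (fun t x => -Real.log ((∫ z in Icc c1 c2, ee κ w a t x z) + Real.exp (-κ * q t x)) / κ) Ut Ux Uxx :=
    ⟨_, _, _, fun _ _ => rfl, fun _ _ => rfl, fun _ _ => rfl, cb12_log hcK hP hP0 hκ0⟩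
  -- Young at the shift
  have hsh : ∀ t ∈ Icc 0 T, ∀ r : ℝ, L1 * |r| + 1 / α0 ≤ β0 + a t * r ^ 2 := by
    intro t ht r
    have h1 := young (L := L1) (r := |r|) hα0
    rw [sq_abs] at h1
    have h2 : α0 * r ^ 2 ≤ a t * r ^ 2 := mul_le_mul_of_nonneg_right (hage t ht) (sq_nonneg _)
    have h3 : β0 = L1 ^ 2 / (4 * α0) + 1 / α0 := by rw [hβ0]; field_simp
    linarith
  have hpos : 0 < 1 / α0 := by positivity
  set err := (K ^ 2 / 2 + K) / κ + 2 * ((C + C ^ 2 / 2 * (W + Mx) + C ^ 2 * Mx) + C * Mx * C) * Real.exp (-κ * (1 / α0)) with herr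
  have herr0 : 0 ≤ err := by positivity
  have hpt : ∀ t ∈ Icc 0 T, ∀ p ∈ closure O ×ˢ A, F t p + M.L Ut Ux Uxx t p (z t) ≤
      ψ t + 3 * A0 * η t ^ 2 + (LF ^ 2 / (4 * α0) + err) := by
    intro t ht p hp
    obtain ⟨x, v⟩ := p
    have hx : x ∈ Icc c1 c2 := hcl ▸ hp.1
    have hbq := hq.sup t ht (x, v) hp
    simp only [Mod.L] at hbq ⊢
    rw [cut_eq ht hp.1, cut_eq ht hp.1, cut_eq ht hp.1] at hbq ⊢
    rw [hUt, hUx, hUxx]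
    have := (pt (κ := κ) (a := a) (a' := a') (t := t) (x := x) (α0 := α0) (β := M.b t (x, v) (z t)) (s := M.s t (x, v) (z t)) (η := η t) (LF := LF)
      (Fx := F t (x, v)) (ψ := ψ t) (M := Mx) (q0 := q t x) (qt := qt t x) (qx := qx t x) (qxx := qxx t x)
      (Ff := fun x => F t (x, v)) (bt := fun x => M.b t (x, v) (z' t)) (st := fun x => M.s t (x, v) (z' t)) (C := C) (K := K)
      hc hcl hwcb hW hκ hK hC0 ht hx hα0 (hage t ht) rfl (fun x y => lb t ht x y v) (fun x y => ls t ht x y v)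
      (fun x _ => by have := M.b_bd t (x, v) (z' t); linarith) (fun x _ => by rw [hC]; exact M.s_abs _ _ _)
      (by rw [hC]; exact M.s_abs _ _ _) (fun x' hx' => by
        have hp' : ((x', v) : ℝ × ℝ) ∈ closure O ×ˢ A := ⟨hcl ▸ hx', hp.2⟩
        have := hfeas t (x', v) hp'
        simp only [Mod.L] at this
        rw [cut_eq ht hp'.1, cut_eq ht hp'.1, cut_eq ht hp'.1] at this
        exact this)
      (hψ0 t) (hη0 t) (hηbd t ht _ hp) (hηsd t ht _ hp) (fun y hy => lF t ht x hp.1 y (hcl ▸ hy) v hp.2)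
      (by linarith) ((hq.bx t ht x hp.1).trans (by rw [hMx]; have : 0 < c2 - c1 := by linarith
                                                   have : 0 ≤ 2 * A0 * (c2 - c1) := by positivity
                                                   linarith))
      (by rw [hMx]
          have : 2 * a t * (c2 - c1) ≤ 2 * A0 * (c2 - c1) := by
            apply mul_le_mul_of_nonneg_right _ (by linarith)
            linarith [hale t ht]
          linarith)
      (by have h1 := hsh t ht (x - c1)
          have h2 := hq.lip t ht x hp.1 c1 hc1m
          have h3 := hGu t ht c1 hc1m
          rw [← hq.e1 t ht] at h3
          simp only [hw]; linarith)
      (by have h1 := hsh t ht (x - c2)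
          have h2 := hq.lip t ht x hp.1 c2 hc2m
          have h3 := hGu t ht c2 hc2m
          rw [← hq.e2 t ht] at h3
          simp only [hw]; linarith) rfl rfl rfl rfl rfl).2
    refine this.trans ?_
    have k1 : 3 * a t * η t ^ 2 ≤ 3 * A0 * η t ^ 2 := by
      apply mul_le_mul_of_nonneg_right _ (sq_nonneg _)
      linarith [hale t ht]
    have k2 : LF ^ 2 / (4 * a t) ≤ LF ^ 2 / (4 * α0) := by
      apply div_le_div_of_nonneg_left (sq_nonneg _) (by positivity)
      linarith [hage t ht]
    rw [herr]
    linarith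
  have hfl := hy.fl
  have hLbm := ((M.L_car hU).car hz).bm
  have iψ : IntegrableOn ψ (Icc 0 T) := by
    obtain ⟨D, hD⟩ := hψb
    exact int_of_bdd _ hψm hD
  have iη : IntegrableOn (fun t => 3 * A0 * η t ^ 2) (Icc 0 T) := by
    have : Integrable (fun t => η t ^ 2) (volume.restrict (Icc 0 T)) := by
      apply int_of_bdd _ (hηm.pow_const 2) (C := Cη ^ 2)
      intro t
      rw [abs_of_nonneg (sq_nonneg _)]
      have := hη0 t
      gcongr
      exact hηb t
    exact this.const_mul _
  have iψη : IntegrableOn (fun t => ψ t + 3 * A0 * η t ^ 2) (Icc 0 T) := iψ.add iη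
  have ic : IntegrableOn (fun _ : ℝ => LF ^ 2 / (4 * α0) + err) (Icc 0 T) := integrableOn_const (by simp)
  have hI := hfl.I2_le_time (ψ := fun t => ψ t + 3 * A0 * η t ^ 2 + (LF ^ 2 / (4 * α0) + err)) (iψη.add ic)
    (hF.bm.add hLbm) (fun t ht => by have := hψ0 t; positivity) hpt
  rw [hfl.I2_add hF.bm hLbm, integral_add iψη ic, integral_add iψ iη, integral_const_mul, setIntegral_const,
    Real.volume_real_Icc_of_le hT.le, smul_eq_mul] at hI
  have hmain := hy.eq _ _ _ _ hU
  have hreg := hy.reg M hT hz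
  have hprob := hy.prob
  -- lower bound
  have hlow : ∫ p, G p.1 p.2 ∂y.1 ≤ (∫ p, -Real.log ((∫ z in Icc c1 c2, ee κ w a p.1 p.2 z) + Real.exp (-κ * q p.1 p.2)) / κ ∂y.1)
      + Real.log (c2 - c1 + 1) / κ := by
    have h1 : ∫ p, G p.1 p.2 ∂y.1 ≤ ∫ p, (-Real.log ((∫ z in Icc c1 c2, ee κ w a p.1 p.2 z) + Real.exp (-κ * q p.1 p.2)) / κ
      + Real.log (c2 - c1 + 1) / κ) ∂y.1 := by
      apply integral_mono_ae (int_u hreg hG) ((int_u hreg hU).add (integrable_const _))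
      filter_upwards [hreg.ae] with p hp
      have hwc : ContinuousOn (w p.1) (Icc c1 c2) := by
        have : ContinuousOn ((fun p : ℝ × ℝ => w p.1 p.2) ∘ fun z => (p.1, z)) (Icc c1 c2) :=
          hwcb.cont.comp (by fun_prop) (fun z hz => ⟨hp.1, hcl ▸ hz⟩)
        exact this
      have := soft_lower (w := w) (a := a) (t := p.1) (x := p.2) (g := G p.1 p.2) hc hκ0 hwc (fun r hr => by
        have h1 := hsh p.1 hp.1 (p.2 - r)
        have h2 := hq.lipG p.1 hp.1 p.2 hp.2 r (hcl ▸ hr)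
        have h3 := hGu p.1 hp.1 r (hcl ▸ hr)
        simp only [hw]; linarith) (hq.ge p.1 hp.1 p.2 hp.2)
      simp only [Pi.add_apply]
      linarith
    rw [integral_add (int_u hreg hU) (integrable_const _)] at h1
    simpa using h1
  have hup : ∫ x, -Real.log ((∫ z in Icc c1 c2, ee κ w a 0 x z) + Real.exp (-κ * q 0 x)) / κ ∂m0 ≤ ∫ x, u 0 x ∂m0 +
      (β0 + (W * (1 / κ * (c2 - c1)) + A0 * (1 / κ * (c2 - c1)) ^ 2 - Real.log (1 / κ * (c2 - c1)) / κ)) := by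
    have h1 : ∫ x, -Real.log ((∫ z in Icc c1 c2, ee κ w a 0 x z) + Real.exp (-κ * q 0 x)) / κ ∂m0 ≤ ∫ x, (u 0 x +
      (β0 + (W * (1 / κ * (c2 - c1)) + A0 * (1 / κ * (c2 - c1)) ^ 2 - Real.log (1 / κ * (c2 - c1)) / κ))) ∂m0 := by
      apply integral_mono_ae (int_m0 hm0 hT.le hU) ((int_m0 hm0 hT.le hu).add (integrable_const _))
      have hae : ∀ᵐ x ∂m0, x ∈ O := by
        rw [ae_iff]; exact hm0
      filter_upwards [hae] with x hx
      have := soft_upper (w := w) (a := a) (q0 := q 0 x) hc hcl hκ0 hwcb hW h0T (hcl ▸ subset_closure hx) (hale 0 h0T) (hα0.le.trans (hage 0 h0T))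
        (θ := 1 / κ) (by positivity) (by rw [div_le_one hκ0]; exact hκ)
      refine this.trans ?_
      simp only [hw, Pi.add_apply]
      linarith
    rw [integral_add (int_m0 hm0 hT.le hu) (integrable_const _)] at h1
    simpa using h1
  have e : (T - 0) * (LF ^ 2 / (4 * α0) + err) = T * (LF ^ 2 / (4 * α0)) + T * err := by ring
  rw [e] at hI
  linarith

end
end LPN
end

noncomputable section

namespace LPN

section

variable {T c1 c2 : ℝ} {O A : Set ℝ} {m0 : Measure ℝ} {ι : Type} [Fintype ι] (M : Mod ι T O A)

lemma err_tendsto {B1 B2 B3 W A0 T c α0 : ℝ} (hα : 0 < α0) (hc : 0 < c) :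
    Tendsto (fun κ : ℝ => T * (B1 / κ + B2 * Real.exp (-κ * (1 / α0))) + B3 / κ +
      (W * (1 / κ * c) + A0 * (1 / κ * c) ^ 2 - Real.log (1 / κ * c) / κ)) atTop (𝓝 0) := by
  have h1 : Tendsto (fun κ : ℝ => 1 / κ) atTop (𝓝 0) := by
    simpa using tendsto_inv_atTop_zero (𝕜 := ℝ)
  have hd : ∀ B : ℝ, Tendsto (fun κ : ℝ => B / κ) atTop (𝓝 0) := fun B => tendsto_const_nhds.div_atTop tendsto_id
  have he : Tendsto (fun κ : ℝ => Real.exp (-κ * (1 / α0))) atTop (𝓝 0) := by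
    have : Tendsto (fun κ : ℝ => κ * (1 / α0)) atTop atTop := tendsto_id.atTop_mul_const (by positivity)
    have := Real.tendsto_exp_neg_atTop_nhds_zero.comp this
    refine this.congr fun κ => ?_
    simp only [Function.comp]; ring_nf
  have hl : Tendsto (fun κ : ℝ => Real.log (1 / κ * c) / κ) atTop (𝓝 0) := by
    have h2 : Tendsto (fun κ : ℝ => Real.log κ / κ) atTop (𝓝 0) := by
      have := Real.isLittleO_log_id_atTop.tendsto_div_nhds_zero
      simpa using this
    have h3 := (hd (Real.log c)).sub h2
    rw [sub_zero] at h3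
    refine h3.congr' ?_
    filter_upwards [eventually_gt_atTop 0] with κ hκ
    rw [Real.log_mul (by positivity) hc.ne', one_div, Real.log_inv]
    ring
  have h4 := (((((hd B1).add (he.const_mul B2)).const_mul T).add (hd B3)).add
    ((((h1.mul_const c).const_mul W).add (((h1.mul_const c).pow 2).const_mul A0)).sub hl))
  simpa using h4

lemma Mod.comp (hT : 0 < T) [IsProbabilityMeasure m0] (hm0 : m0 Oᶜ = 0) (hc : c1 < c2) (hcl : closure O = Icc c1 c2)
    {K : ℝ} (hK : 0 ≤ K) {z z' : ℝ → ι → ℝ} (hz : Measurable z)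
    (lb : ∀ t ∈ Icc 0 T, ∀ x y a, |M.b t (x, a) (z' t) - M.b t (y, a) (z' t)| ≤ K * |x - y|)
    (ls : ∀ t ∈ Icc 0 T, ∀ x y a, |M.s t (x, a) (z' t) - M.s t (y, a) (z' t)| ≤ K * |x - y|)
    {F : ℝ → ℝ × ℝ → ℝ} (hF : Car (closure O ×ˢ A) F) {LF : ℝ}
    (lF : ∀ t ∈ Icc 0 T, ∀ x ∈ closure O, ∀ y ∈ closure O, ∀ a ∈ A, F t (x, a) - F t (y, a) ≤ LF * |x - y|)
    {G Gt Gx Gxx : ℝ → ℝ → ℝ} (hG : IsCb12 T O G Gt Gx Gxx) {q qt qx qxx : ℝ → ℝ → ℝ} {L1 Cq : ℝ}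
    (hq : M.Bar c1 c2 z F G L1 Cq q qt qx qxx) {α0 : ℝ} (hα0 : 0 < α0)
    {u ut ux uxx : ℝ → ℝ → ℝ} {ψ : ℝ → ℝ} (hu : IsCb12 T O u ut ux uxx) (hψm : Measurable ψ) (hψb : ∃ C, ∀ t, |ψ t| ≤ C)
    (hψ0 : ∀ t, 0 ≤ ψ t) (hGu : ∀ t ∈ Icc 0 T, ∀ x ∈ closure O, G t x ≤ u t x)
    (hfeas : ∀ t, ∀ p ∈ closure O ×ˢ A, F t p + M.L ut ux uxx t p (z' t) ≤ ψ t)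
    {η : ℝ → ℝ} (hηm : Measurable η) {Cη : ℝ} (hηb : ∀ t, η t ≤ Cη) (hη0 : ∀ t, 0 ≤ η t)
    (hηbd : ∀ t ∈ Icc 0 T, ∀ p ∈ closure O ×ˢ A, |M.b t p (z t) - M.b t p (z' t)| ≤ η t)
    (hηsd : ∀ t ∈ Icc 0 T, ∀ p ∈ closure O ×ˢ A, |M.s t p (z t) - M.s t p (z' t)| ≤ η t)
    {y : Y} (hy : M.FP m0 z y) :
    I2 T y.2 F + ∫ p, G p.1 p.2 ∂y.1 ≤ ∫ x, u 0 x ∂m0 + (∫ t in Icc 0 T, ψ t) + (L1 ^ 2 / 4 + 1) / α0 + T * (LF ^ 2 / (4 * α0)) +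
      3 * (α0 * Real.exp ((2 + 2 * K + 2 * K ^ 2) * T)) * (∫ t in Icc 0 T, η t ^ 2) := by
  obtain ⟨W, hW⟩ := hu.bdd
  have h1 := (err_tendsto (T := T) (B1 := K ^ 2 / 2 + K) (B3 := Real.log (c2 - c1 + 1)) (W := W) (c := c2 - c1)
    (A0 := α0 * Real.exp ((2 + 2 * K + 2 * K ^ 2) * T))
    (B2 := 2 * (((M.Cb + 1) + (M.Cb + 1) ^ 2 / 2 * (W + (Cq + 2 * (α0 * Real.exp ((2 + 2 * K + 2 * K ^ 2) * T)) * (c2 - c1))) +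
       (M.Cb + 1) ^ 2 * (Cq + 2 * (α0 * Real.exp ((2 + 2 * K + 2 * K ^ 2) * T)) * (c2 - c1))) +
       (M.Cb + 1) * (Cq + 2 * (α0 * Real.exp ((2 + 2 * K + 2 * K ^ 2) * T)) * (c2 - c1)) * (M.Cb + 1))) hα0 (by linarith)).const_add
       (∫ x, u 0 x ∂m0 + (∫ t in Icc 0 T, ψ t) + (L1 ^ 2 / 4 + 1) / α0 + T * (LF ^ 2 / (4 * α0)) +
      3 * (α0 * Real.exp ((2 + 2 * K + 2 * K ^ 2) * T)) * (∫ t in Icc 0 T, η t ^ 2))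
  rw [add_zero] at h1
  refine ge_of_tendsto h1 ?_
  filter_upwards [eventually_ge_atTop 1] with κ hκ
  exact M.comp1 hT hm0 hc hcl hK hz lb ls hF lF hG hq hα0 hu hψm hψb hψ0 hGu hfeas (fun t ht x hx => (hW t ht x hx).2.2.1)
    hηm hηb hη0 hηbd hηsd hy rfl rfl rfl hκ

lemma cb12_lip (hcl : closure O = Icc c1 c2) {u ut ux uxx : ℝ → ℝ → ℝ} (hu : IsCb12 T O u ut ux uxx) {C : ℝ}
    (hC : ∀ t ∈ Icc 0 T, ∀ x ∈ closure O, |ux t x| ≤ C) :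
    ∀ t ∈ Icc 0 T, ∀ x ∈ closure O, ∀ y ∈ closure O, u t x - u t y ≤ C * |x - y| := by
  intro t ht x hx y hy
  have hcv : Convex ℝ (closure O) := hcl ▸ convex_Icc _ _
  have := hcv.norm_image_sub_le_of_norm_hasDerivWithin_le (fun r hr => hu.deriv_x t ht r hr) (fun r hr => hC t ht r hr) hy hx
  exact (le_abs_self _).trans this

lemma Mod.bar_ex (hc : c1 < c2) (hcl : closure O = Icc c1 c2) {z : ℝ → ι → ℝ} {cs : ℝ} (hcs : 0 < cs)
    (hs : ∀ t ∈ Icc 0 T, ∀ x a, cs ≤ M.s t (x, a) (z t))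
    {F : ℝ → ℝ × ℝ → ℝ} (hF : ∃ C, ∀ t p, |F t p| ≤ C) {G Gt Gx Gxx : ℝ → ℝ → ℝ} (hG : IsCb12 T O G Gt Gx Gxx) :
    ∃ q qt qx qxx L1 Cq, M.Bar c1 c2 z F G L1 Cq q qt qx qxx := by
  obtain ⟨CF, hCF⟩ := hF
  obtain ⟨CG, hCG⟩ := hG.bdd
  have hCF0 : 0 ≤ CF := (abs_nonneg _).trans (hCF 0 0)
  have hCb := M.Cb0
  set k := 2 * (M.Cb + 1) / cs ^ 2 with hk
  have hk0 : 0 < k := by positivity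
  set Cc := (|CG| * (1 + 2 * M.Cb) + CF) / k with hCc
  have hCc0 : 0 ≤ Cc := by positivity
  set mid := (c1 + c2) / 2
  set Ψ : ℝ → ℝ := fun x => Cc * (Real.cosh (k * ((c2 - c1) / 2)) - Real.cosh (k * (x - mid))) with hΨ
  set Ψ1 : ℝ → ℝ := fun x => -(Cc * (k * Real.sinh (k * (x - mid)))) with hΨ1
  set Ψ2 : ℝ → ℝ := fun x => -(Cc * (k * (k * Real.cosh (k * (x - mid))))) with hΨ2
  have d0 : ∀ x, HasDerivAt (fun x => k * (x - mid)) k x := fun x => by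
    simpa using ((hasDerivAt_id x).sub_const mid).const_mul k
  have d1 : ∀ x, HasDerivAt Ψ (Ψ1 x) x := fun x => by
    have := (((d0 x).cosh).const_sub (Real.cosh (k * ((c2 - c1) / 2)))).const_mul Cc
    exact this.congr_deriv (by simp only [hΨ1]; ring)
  have d2 : ∀ x, HasDerivAt Ψ1 (Ψ2 x) x := fun x => by
    have := ((((d0 x).sinh).const_mul k).const_mul Cc).neg
    exact this.congr_deriv (by simp only [hΨ2]; ring)
  have c0 : Continuous Ψ := continuous_iff_continuousAt.2 fun x => (d1 x).continuousAt
  have c1' : Continuous Ψ1 := continuous_iff_continuousAt.2 fun x => (d2 x).continuousAt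
  have c2' : Continuous Ψ2 := by
    have : Continuous fun x => Real.cosh (k * (x - mid)) := Real.continuous_cosh.comp (by fun_prop)
    exact (((this.const_mul k).const_mul k).const_mul Cc).neg
  have hcK : IsCompact (closure O) := hcl ▸ isCompact_Icc
  have cb : IsCb12 T O (fun _ x => Ψ x) (fun _ _ => 0) (fun _ x => Ψ1 x) (fun _ x => Ψ2 x) := by
    obtain ⟨B0, hB0⟩ := hcK.exists_bound_of_continuousOn c0.continuousOn
    obtain ⟨B1, hB1⟩ := hcK.exists_bound_of_continuousOn c1'.continuousOn
    obtain ⟨B2, hB2⟩ := hcK.exists_bound_of_continuousOn c2'.continuousOn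
    refine ⟨(c0.comp continuous_snd).continuousOn, continuousOn_const, (c1'.comp continuous_snd).continuousOn,
      (c2'.comp continuous_snd).continuousOn, fun t _ x _ => hasDerivWithinAt_const _ _ _, fun t _ x _ => (d1 x).hasDerivWithinAt,
      fun t _ x _ => (d2 x).hasDerivWithinAt, max B0 (max B1 B2), fun t _ x hx => ⟨?_, ?_, ?_, ?_⟩⟩
    · exact (hB0 x hx).trans (le_max_left _ _)
    · rw [abs_zero]
      exact (norm_nonneg _).trans ((hB0 x hx).trans (le_max_left _ _))
    · exact (hB1 x hx).trans ((le_max_left _ _).trans (le_max_right _ _))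
    · exact (hB2 x hx).trans ((le_max_right _ _).trans (le_max_right _ _))
  have hq := cb12_comb hG cb 1
  simp only [one_mul, add_zero] at hq
  obtain ⟨Cq, hCq⟩ := hq.bdd
  have lG := cb12_lip hcl hG (fun t ht x hx => (hCG t ht x hx).2.2.1)
  have lq := cb12_lip hcl hq (fun t ht x hx => (hCq t ht x hx).2.2.1)
  refine ⟨_, _, _, _, max CG Cq, Cq, hq, ?_, ?_, ?_, ?_, ?_, ?_, fun t ht x hx => (hCq t ht x hx).2.2.1⟩
  · intro t ht x hx
    have hx' : x ∈ Icc c1 c2 := hcl ▸ hx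
    have : Real.cosh (k * (x - mid)) ≤ Real.cosh (k * ((c2 - c1) / 2)) := by
      rw [Real.cosh_le_cosh, abs_mul, abs_mul]
      apply mul_le_mul_of_nonneg_left _ (abs_nonneg _)
      rw [abs_of_pos (show 0 < (c2 - c1) / 2 by linarith), abs_le]
      simp only [mid]
      constructor <;> linarith [hx'.1, hx'.2]
    have : 0 ≤ Ψ x := mul_nonneg hCc0 (by linarith)
    linarith
  · intro t ht
    have e : k * (c1 - mid) = -(k * ((c2 - c1) / 2)) := by simp only [mid]; ring
    have : Ψ c1 = 0 := by simp only [hΨ]; rw [e, Real.cosh_neg, sub_self, mul_zero]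
    rw [this, add_zero]
  · intro t ht
    have e : k * (c2 - mid) = (k * ((c2 - c1) / 2)) := by simp only [mid]; ring
    have : Ψ c2 = 0 := by simp only [hΨ]; rw [e, sub_self, mul_zero]
    rw [this, add_zero]
  · intro t ht x hx y hy
    exact (lq t ht x hx y hy).trans (mul_le_mul_of_nonneg_right (le_max_right _ _) (abs_nonneg _))
  · intro t ht x hx y hy
    exact (lG t ht x hx y hy).trans (mul_le_mul_of_nonneg_right (le_max_left _ _) (abs_nonneg _))
  · intro t ht p hp
    obtain ⟨x, v⟩ := p
    have hx : x ∈ closure O := hp.1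
    simp only [Mod.L]
    rw [cut_eq ht hx, cut_eq ht hx, cut_eq ht hx]
    obtain ⟨-, g1, g2, g3⟩ := hCG t ht x hx
    have hCG0 : CG ≤ |CG| := le_abs_self _
    have hb := M.b_bd t (x, v) (z t)
    have hs2 := M.s_bd t (x, v) (z t)
    have hsl : cs ^ 2 ≤ M.s t (x, v) (z t) ^ 2 := by
      have := hs t ht x v
      gcongr
    set β := M.b t (x, v) (z t)
    set s := M.s t (x, v) (z t)
    have k1 : F t (x, v) ≤ CF := (abs_le.1 (hCF t (x, v))).2
    have k2 : Gt t x ≤ |CG| := (le_abs_self _).trans (g1.trans hCG0)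
    have k3 : β * Gx t x ≤ M.Cb * |CG| := by
      refine (le_abs_self _).trans ?_
      rw [abs_mul]
      exact mul_le_mul hb (g2.trans hCG0) (abs_nonneg _) hCb
    have k4 : s ^ 2 / 2 * Gxx t x ≤ M.Cb * |CG| := by
      refine (le_abs_self _).trans ?_
      rw [abs_mul]
      exact mul_le_mul hs2 (g3.trans hCG0) (abs_nonneg _) hCb
    set ch := Real.cosh (k * (x - mid))
    set sh := Real.sinh (k * (x - mid))
    have hch : 1 ≤ ch := Real.one_le_cosh _
    have hsh : |sh| ≤ ch := by
      rw [abs_le]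
      have e1 := Real.cosh_add_sinh (k * (x - mid))
      have e2 := Real.cosh_sub_sinh (k * (x - mid))
      have e3 := Real.exp_pos (k * (x - mid))
      have e4 := Real.exp_pos (-(k * (x - mid)))
      constructor <;> simp only [ch, sh] <;> linarith
    have k5 : β * -(Cc * (k * sh)) ≤ Cc * k * (M.Cb * ch) := by
      have : -(β * sh) ≤ M.Cb * ch := by
        refine (neg_le_abs _).trans ?_
        rw [abs_mul]
        exact mul_le_mul hb hsh (abs_nonneg _) hCb
      have := mul_le_mul_of_nonneg_left this (mul_nonneg hCc0 hk0.le)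
      linarith
    have k6 : s ^ 2 / 2 * -(Cc * (k * (k * ch))) ≤ -(Cc * k * ((M.Cb + 1) * ch)) := by
      have h1 : M.Cb + 1 ≤ s ^ 2 / 2 * k := by
        have : cs ^ 2 / 2 * k = M.Cb + 1 := by rw [hk]; field_simp
        have := mul_le_mul_of_nonneg_right hsl hk0.le
        linarith
      have h2 := mul_le_mul_of_nonneg_right h1 (by linarith : (0:ℝ) ≤ ch)
      have := mul_le_mul_of_nonneg_left h2 (mul_nonneg hCc0 hk0.le)
      linarith
    have k7 : Cc * k = |CG| * (1 + 2 * M.Cb) + CF := by rw [hCc]; field_simp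
    have k8 : Cc * k * 1 ≤ Cc * k * ch := mul_le_mul_of_nonneg_left hch (mul_nonneg hCc0 hk0.le)
    have e : F t (x, v) + (Gt t x + (β * (Gx t x + Ψ1 x) + s ^ 2 / 2 * (Gxx t x + Ψ2 x))) =
      F t (x, v) + Gt t x + β * Gx t x + s ^ 2 / 2 * Gxx t x + β * -(Cc * (k * sh)) + s ^ 2 / 2 * -(Cc * (k * (k * ch))) := by
      simp only [hΨ1, hΨ2, ch, sh]; ring
    rw [e]
    linarith

end
end LPN
end

noncomputable section

namespace LPN

section

variable {T c1 c2 : ℝ} {O A : Set ℝ} {m0 : Measure ℝ} {ι : Type} [Fintype ι] (M : Mod ι T O A)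

lemma F_lip_approx (hT : 0 < T) (hA : IsCompact A) (hcO : IsCompact (closure O)) {F : ℝ → ℝ × ℝ → ℝ}
    (hF : Car (closure O ×ˢ A) F) (ε : ℝ) (hε : 0 < ε) :
    ∃ (F' : ℝ → ℝ × ℝ → ℝ) (LF : ℝ), Car (closure O ×ˢ A) F' ∧
      (∀ t ∈ Icc 0 T, ∀ x ∈ closure O, ∀ y ∈ closure O, ∀ a ∈ A, F' t (x, a) - F' t (y, a) ≤ LF * |x - y|) ∧
      ∀ m, Fl O A m → |I2 T m F - I2 T m F'| ≤ ε := by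
  have hS : IsCompact (closure O ×ˢ A) := hcO.prod hA
  obtain ⟨C, hC⟩ := hF.bdd
  have hC0 : 0 ≤ C := (abs_nonneg _).trans (hC 0 0)
  obtain ⟨H, ψ, D, Hc, HD, Hψ, ψm, ψb, ψi⟩ := car_approx hS hF T (ε / 2) (by positivity) hC hC0
  have he1 : 0 < ε / 2 / T := by positivity
  obtain ⟨g, hg, hgd, -⟩ := Hc.exists_contDiff_approx 2 (ε := fun _ => ε / 2 / T) continuous_const (fun _ => he1)
  have hgd' : ∀ q, |g q - H q| ≤ ε / 2 / T := fun q => (hgd q).le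
  have hgl : LocallyLipschitz g := (hg.of_le (by norm_num)).locallyLipschitz
  obtain ⟨L, hL⟩ := (hgl.locallyLipschitzOn (s := Icc 0 T ×ˢ (closure O ×ˢ A))).exists_lipschitzOnWith_of_compact
    (isCompact_Icc.prod hS)
  have hcar : Car (closure O ×ˢ A) (fun t p => g (t, p)) := by
    refine ⟨hg.continuous.measurable, fun t => (hg.continuous.comp (by fun_prop : Continuous fun p : ℝ × ℝ => (t, p))).continuousOn,
      D + ε / 2 / T, fun t p => ?_⟩
    have h1 := abs_le.1 (hgd' (t, p))
    have h2 := abs_le.1 (HD (t, p))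
    rw [abs_le]; constructor <;> linarith [h1.1, h1.2, h2.1, h2.2]
  refine ⟨fun t p => g (t, p), L, hcar, ?_, ?_⟩
  · intro t ht x hx y hy a ha
    have := hL.dist_le_mul (t, (x, a)) ⟨ht, hx, ha⟩ (t, (y, a)) ⟨ht, hy, ha⟩
    have e : dist ((t, (x, a)) : ℝ × ℝ × ℝ) (t, (y, a)) = |x - y| := by
      simp [Prod.dist_eq, Real.dist_eq]
    rw [e, Real.dist_eq] at this
    exact (le_abs_self _).trans this
  · intro m hm
    rw [← hm.I2_sub hF.bm hcar.bm]
    have iψ : IntegrableOn ψ (Icc 0 T) := int_of_bdd _ ψm (C := C + D) (fun t => by rw [abs_of_nonneg (ψb t).1]; exact (ψb t).2)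
    have ic : IntegrableOn (fun _ : ℝ => ε / 2 / T) (Icc 0 T) := integrableOn_const (by simp)
    have iψc : IntegrableOn (fun t => ψ t + ε / 2 / T) (Icc 0 T) := iψ.add ic
    have := hm.I2_abs_time iψc (hF.bm.sub hcar.bm) (fun t _ => add_nonneg (ψb t).1 he1.le) (fun t ht p hp => by
      have h1 := abs_le.1 (hgd' (t, p))
      have h2 := abs_le.1 (Hψ t p hp)
      rw [abs_le]; constructor <;> linarith [h1.1, h1.2, h2.1, h2.2])
    rw [integral_add iψ ic, setIntegral_const, Real.volume_real_Icc_of_le hT.le, smul_eq_mul] at this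
    have e : (T - 0) * (ε / 2 / T) = ε / 2 := by field_simp; ring
    linarith

lemma G_smooth_approx (hcl : closure O = Icc c1 c2) (B : ℝ) (w : ι → ℝ) (ε : ℝ) (hε : 0 < ε) :
    ∃ G Gt Gx Gxx : ℝ → ℝ → ℝ, IsCb12 T O G Gt Gx Gxx ∧
      ∀ y : Y, M.RegP m0 y → |∫ p, M.g p.1 p.2 w ∂y.1 - ∫ p, G p.1 p.2 ∂y.1| ≤ ε := by
  have hc : ContinuousOn (fun p : ℝ × ℝ => M.g p.1 p.2 w) (Icc 0 T ×ˢ closure O) :=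
    M.g_cont.comp (f := fun p : ℝ × ℝ => (p, w)) (by fun_prop) (fun p hp => ⟨hp, mem_univ _⟩)
  set R := max 1 (|c1| + |c2|)
  have hR1 : 1 ≤ R := le_max_left _ _
  obtain ⟨g, hg, ⟨gt, gx, gxx, hcb⟩, -, hga⟩ := smooth_approx hc ((abs_nonneg _).trans (M.g_bd 0 0 w))
    (fun t _ x _ => M.g_bd t x w) (R := R) hR1 hε
  refine ⟨_, gt, gx, gxx, hcb, fun y hy => ?_⟩
  have hpr := hy.prob
  rw [← integral_sub (M.g_int hy w) (int_u hy hcb)]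
  have : ‖∫ p, (M.g p.1 p.2 w - g (p.1, p.2)) ∂y.1‖ ≤ ε * y.1.real univ := by
    apply norm_integral_le_of_norm_le_const
    filter_upwards [hy.ae] with p hp
    have h1 := hga p.1 hp.1 p.2 hp.2
    have hx : p.2 ∈ Icc c1 c2 := hcl ▸ hp.2
    have h2 : chi R p.2 = 0 := by
      apply Real.smoothTransition.zero_of_nonpos
      have h3 : |p.2 / R| ≤ 1 := by
        rw [abs_div, abs_of_pos (by linarith : 0 < R), div_le_one (by linarith)]
        refine le_trans ?_ (le_max_right _ _)
        rw [abs_le]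
        constructor
        · have := neg_abs_le c1; have := abs_nonneg c2; linarith [hx.1]
        · have := le_abs_self c2; have := abs_nonneg c1; linarith [hx.2]
      have := (sq_le_one_iff_abs_le_one _).2 h3
      linarith
    rw [h2, mul_zero, add_zero] at h1
    exact h1
  simpa using this

lemma Mod.LSC_c (hT : 0 < T) (hA : IsCompact A) [IsProbabilityMeasure m0] (hm0 : m0 Oᶜ = 0) {K cs : ℝ}
    (h : M.HypC c1 c2 K cs) : M.LSC m0 := by
  intro x hx y hy ε hε
  have hc := h.c12
  have hcl : closure O = Icc c1 c2 := by rw [h.hO, closure_Ioo hc.ne]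
  have hbO : Bornology.IsBounded O := by rw [h.hO]; exact Metric.isBounded_Ioo _ _
  have hcO : IsCompact (closure O) := hcl ▸ isCompact_Icc
  have hS : IsCompact (closure O ×ˢ A) := hcO.prod hA
  have hSc : CompactSpace (closure O ×ˢ A : Set (ℝ × ℝ)) := isCompact_iff_compactSpace.1 hS
  have hz := M.zf_meas hx.fl
  have hK : 0 ≤ K := by
    have := (abs_nonneg _).trans (h.lb _ hx.fl 0 ⟨le_rfl, hT.le⟩ 1 0 0)
    simpa using this
  have hCb := M.Cb0
  obtain ⟨F, LF, hF, lF, hFF⟩ := F_lip_approx hT hA hcO (M.f_car.car hz) (ε / 16) (by positivity)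
  obtain ⟨G, Gt, Gx, Gxx, hG, hGG⟩ := G_smooth_approx (m0 := m0) M hcl 0 (M.wf x.1) (ε / 16) (by positivity)
  have hΓ : ∀ y : Y, M.RegP m0 y → |M.GamY x y - (I2 T y.2 F + ∫ p, G p.1 p.2 ∂y.1)| ≤ ε / 8 := by
    intro y hy
    have h1 := abs_le.1 (hFF _ hy.fl)
    have h2 := abs_le.1 (hGG _ hy)
    unfold Mod.GamY Mod.Gam
    rw [abs_le]; constructor <;> linarith [h1.1, h1.2, h2.1, h2.2]
  obtain ⟨q, qt, qx, qxx, L1, Cq, hq⟩ := M.bar_ex hc hcl h.cs0 (h.sc _ hx.fl) hF.bdd hG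
  set α0 := ((L1 ^ 2 / 4 + 1) + T * (LF ^ 2 / 4)) / (ε / 4) with hα
  have hα0 : 0 < α0 := by positivity
  set A0 := α0 * Real.exp ((2 + 2 * K + 2 * K ^ 2) * T) with hA0
  have hA00 : 0 < A0 := by positivity
  set Cη := 4 * (M.Cb + 1) with hCη
  have hCη0 : 0 < Cη := by positivity
  set δ' := ε / (24 * A0 * Cη) with hδ'
  have hδ'0 : 0 < δ' := by positivity
  obtain ⟨δ1, hδ1, H1⟩ := nem_unif hS M.b_car T hz (M.zf_bd hx.fl) δ' hδ'0
  obtain ⟨δ2, hδ2, H2⟩ := nem_unif hS M.s_car T hz (M.zf_bd hx.fl) δ' hδ'0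
  obtain ⟨δ3, hδ3, H3⟩ := M.Gam_unif hT hA hx (ε / 8) (by positivity)
  refine ⟨min (min δ1 δ2) δ3, lt_min (lt_min hδ1 hδ2) hδ3, fun x' hx' d1 d2 => ?_⟩
  by_contra hcon
  push Not at hcon
  have hz' := M.zf_meas hx'.fl
  have D1 := H1 _ hz' (M.zf_bd hx'.fl) (d1.trans ((min_le_left _ _).trans (min_le_left _ _)))
  have D2 := H2 _ hz' (M.zf_bd hx'.fl) (d1.trans ((min_le_left _ _).trans (min_le_right _ _)))
  have D3 := H3 x' hx' (d1.trans (min_le_right _ _)) (d2.trans (min_le_right _ _))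
  obtain ⟨u, ut, ux, uxx, ψ, hu, hψm, hψb, hψ0, hGu, hfeas, hval⟩ := M.dual (c := M.GamY x y - 6 * ε / 8) hT hA hbO hm0 hz' hF hG.cont
    (fun y' hy' => by
      have r := hy'.reg M hT hz'
      have h1 := hcon y' hy'
      have h2 := abs_le.1 (D3 y' r)
      have h3 := abs_le.1 (hΓ y' r)
      linarith [h2.1, h3.1])
  have cb := M.b_car.car hz
  have cb' := M.b_car.car hz'
  have cs0 := M.s_car.car hz
  have cs' := M.s_car.car hz'
  set η1 : ℝ → ℝ := fun t => ‖cm (closure O ×ˢ A) (fun t p => M.b t p (M.zf x'.2 t)) t - cm (closure O ×ˢ A) (fun t p => M.b t p (M.zf x.2 t)) t‖ with hη1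
  set η2 : ℝ → ℝ := fun t => ‖cm (closure O ×ˢ A) (fun t p => M.s t p (M.zf x'.2 t)) t - cm (closure O ×ˢ A) (fun t p => M.s t p (M.zf x.2 t)) t‖ with hη2
  have m1 : Measurable η1 := ((cm_meas hS cb').sub (cm_meas hS cb)).norm.measurable
  have m2 : Measurable η2 := ((cm_meas hS cs').sub (cm_meas hS cs0)).norm.measurable
  have b1 : ∀ t, η1 t ≤ 2 * M.Cb := fun t => by
    have := norm_sub_le (cm (closure O ×ˢ A) (fun t p => M.b t p (M.zf x'.2 t)) t) (cm (closure O ×ˢ A) (fun t p => M.b t p (M.zf x.2 t)) t)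
    have k1 := cm_bdd hS cb' (C := M.Cb) (fun t p => M.b_bd _ _ _) hCb t
    have k2 := cm_bdd hS cb (C := M.Cb) (fun t p => M.b_bd _ _ _) hCb t
    simp only [hη1]
    linarith
  have b2 : ∀ t, η2 t ≤ 2 * (M.Cb + 1) := fun t => by
    have := norm_sub_le (cm (closure O ×ˢ A) (fun t p => M.s t p (M.zf x'.2 t)) t) (cm (closure O ×ˢ A) (fun t p => M.s t p (M.zf x.2 t)) t)
    have k1 := cm_bdd hS cs' (C := M.Cb + 1) (fun t p => M.s_abs _ _ _) (by linarith) t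
    have k2 := cm_bdd hS cs0 (C := M.Cb + 1) (fun t p => M.s_abs _ _ _) (by linarith) t
    simp only [hη2]
    linarith
  have n1 : ∀ t, 0 ≤ η1 t := fun t => norm_nonneg _
  have n2 : ∀ t, 0 ≤ η2 t := fun t => norm_nonneg _
  have i1 : IntegrableOn η1 (Icc 0 T) := int_of_bdd _ m1 (C := 2 * M.Cb) (fun t => by rw [abs_of_nonneg (n1 t)]; exact b1 t)
  have i2 : IntegrableOn η2 (Icc 0 T) := int_of_bdd _ m2 (C := 2 * (M.Cb + 1)) (fun t => by rw [abs_of_nonneg (n2 t)]; exact b2 t)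
  have bη : ∀ t, η1 t + η2 t ≤ Cη := fun t => by have := b1 t; have := b2 t; linarith
  have hsq : ∫ t in Icc 0 T, (η1 t + η2 t) ^ 2 ≤ Cη * (2 * δ') := by
    have : ∫ t in Icc 0 T, (η1 t + η2 t) ^ 2 ≤ ∫ t in Icc 0 T, Cη * (η1 t + η2 t) := by
      apply integral_mono_of_nonneg (Eventually.of_forall fun t => sq_nonneg _) ((i1.add i2).const_mul _)
      refine Eventually.of_forall fun t => ?_
      have := mul_le_mul_of_nonneg_right (bη t) (add_nonneg (n1 t) (n2 t))
      show (η1 t + η2 t) ^ 2 ≤ Cη * (η1 t + η2 t)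
      rw [sq]
      exact this
    rw [integral_const_mul, integral_add i1 i2] at this
    refine this.trans (mul_le_mul_of_nonneg_left ?_ hCη0.le)
    linarith
  have hcomp := M.comp (z := M.zf x.2) (z' := M.zf x'.2) (η := fun t => η1 t + η2 t) hT hm0 hc hcl hK hz (h.lb _ hx'.fl) (h.ls _ hx'.fl) hF lF hG hq hα0
    hu hψm hψb hψ0 hGu hfeas (m1.add m2) bη (fun t => add_nonneg (n1 t) (n2 t))
    (fun t ht p hp => by
      have := (cm (closure O ×ˢ A) (fun t p => M.b t p (M.zf x'.2 t)) t - cm (closure O ×ˢ A) (fun t p => M.b t p (M.zf x.2 t)) t).norm_coe_le_norm ⟨p, hp⟩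
      rw [ContinuousMap.sub_apply, cm_apply cb', cm_apply cb, Real.norm_eq_abs, abs_sub_comm] at this
      exact this.trans (le_add_of_nonneg_right (n2 t)))
    (fun t ht p hp => by
      have := (cm (closure O ×ˢ A) (fun t p => M.s t p (M.zf x'.2 t)) t - cm (closure O ×ˢ A) (fun t p => M.s t p (M.zf x.2 t)) t).norm_coe_le_norm ⟨p, hp⟩
      rw [ContinuousMap.sub_apply, cm_apply cs', cm_apply cs0, Real.norm_eq_abs, abs_sub_comm] at this
      exact this.trans (le_add_of_nonneg_left (n1 t))) hy
  have e1 : (L1 ^ 2 / 4 + 1) / α0 + T * (LF ^ 2 / (4 * α0)) = ε / 4 := by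
    have : (L1 ^ 2 / 4 + 1) / α0 + T * (LF ^ 2 / (4 * α0)) = ((L1 ^ 2 / 4 + 1) + T * (LF ^ 2 / 4)) / α0 := by field_simp
    rw [this, hα, div_div_cancel₀ (by positivity)]
  have e2 : 3 * A0 * (∫ t in Icc 0 T, (η1 t + η2 t) ^ 2) ≤ ε / 4 := by
    have := mul_le_mul_of_nonneg_left hsq (by positivity : 0 ≤ 3 * A0)
    refine this.trans (le_of_eq ?_)
    rw [hδ']; field_simp; ring
  have h3 := (abs_le.1 (hΓ y (hy.reg M hT hz))).2
  linarith

end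
end LPN
end

/-- Existence of a maximal Nash value: under the mean-field
assumptions and the additional assumption (a) or (c), there exists an LP MFG Nash
equilibrium `(μ⋆, m⋆)` whose Nash value dominates the Nash value of every other
LP MFG Nash equilibrium. -/
theorem exists_maximal_nash_value
    (T : ℝ) (hT : 0 < T) (O A : Set ℝ) (hO : IsOpen O) (hA : IsCompact A)
    (d : ℕ) (hd : 0 < d)
    (b σ f : ℝ → ℝ → Measure (ℝ × ℝ) → ℝ → ℝ) (g : ℝ → ℝ → Measure (ℝ × ℝ) → ℝ)
    (bbar σbar fbar : ℝ → ℝ → (Fin d → ℝ) → ℝ → ℝ)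
    (bhat σhat fhat ghat : ℝ → ℝ → Fin d → ℝ)
    (gbar : ℝ → ℝ → (Fin d → ℝ) → ℝ)
    (hb : MFCoeff T O A d b bbar bhat) (hσ : MFCoeff T O A d σ σbar σhat)
    (hσpos : ∀ t x ν a, 0 ≤ σ t x ν a)
    (hf : MFRunning T O A d f fbar fhat) (hg : MFTerminal T O d g gbar ghat)
    (halt : MeasIndepOrInterval O b σ)
    (m0 : Measure ℝ) (hm0 : InitAssumption2 O m0) :
    ∃ (μs : Measure (ℝ × ℝ)) (ms : ℝ → Measure (ℝ × ℝ)),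
      IsLPNash T O A b σ f g m0 μs ms ∧
      ∀ (μ : Measure (ℝ × ℝ)) (m : ℝ → Measure (ℝ × ℝ)),
        IsLPNash T O A b σ f g m0 μ m →
        GammaMF T f g μ m μ m ≤ GammaMF T f g μs ms μs ms := by
  have := hm0.1
  exact LPN.final (fun M c1 c2 K cs h => M.LSC_c hT hA hm0.2.1 h) hT hA hb hσ hf hg halt hm0
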